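/- Let f be an orientation-preserving C^∞ diffeomorphism of the circle ℝ/ℤ, with lift F, which has a periodic orbit (equivalently, rational rotation number: there exist x₀ ∈ ℝ and integers p, q with q ≥ 1 such that F^q(x₀) = x₀ + p) and whose asymptotic variation vanishes: Var_{[0,1]}(log DFⁿ)/n → 0 as n → ∞. Then f is almost reducible: for every r ∈ ℕ and every ε > 0 there exist a lift H of an orientation-preserving C^∞ circle diffeomorphism and a real number α such that d_r(H∘F∘H⁻¹, x ↦ x + α) < ε. -/

import Mathlib

open Filter Set

noncomputable section

/-- A lift of an orientation-preserving `C^∞` diffeomorphism of the circle `ℝ/ℤ`: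
a `C^∞` increasing bijection of `ℝ` with `C^∞` inverse commuting with the unit
translation. -/
structure CircleLift where
  toFun : ℝ → ℝ
  invFun : ℝ → ℝ
  smooth : ContDiff ℝ (⊤ : ℕ∞) toFun
  smooth_inv : ContDiff ℝ (⊤ : ℕ∞) invFun
  left_inv : Function.LeftInverse invFun toFun
  right_inv : Function.RightInverse invFun toFun
  mono : StrictMono toFun
  lift : ∀ x : ℝ, toFun (x + 1) = toFun x + 1

open Real RelIso
open scoped ContDiff Topology

/-- Order automorphisms of the line. -/
local notation "𝓐" => ℝ ≃o ℝ

section JetCalculus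

variable {ι : Type*}

lemma abs_sub_le_of_deriv_le {φ : ℝ → ℝ} {x y C : ℝ}
    (hd : ∀ v ∈ uIcc x y, DifferentiableAt ℝ φ v) (h : ∀ v ∈ uIcc x y, |deriv φ v| ≤ C) :
    |φ y - φ x| ≤ C * |y - x| :=
  Convex.norm_image_sub_le_of_norm_deriv_le hd h (convex_uIcc x y) left_mem_uIcc right_mem_uIcc

lemma tendstoUniformly_iff_abs {ι X : Type*} {l : Filter ι} {u : ι → X → ℝ} {f : X → ℝ} :
    TendstoUniformly u f l ↔ ∀ ε > 0, ∀ᶠ n in l, ∀ x, |u n x - f x| < ε := by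
  simp only [Metric.tendstoUniformly_iff, dist_comm (f _), dist_eq]

lemma contDiffAt_deriv {f : ℝ → ℝ} {x : ℝ} (hf : ContDiffAt ℝ ∞ f x) :
    ContDiffAt ℝ ∞ (deriv f) x := by
  have h : ContDiffAt ℝ ∞ (fderiv ℝ f) x := hf.fderiv_right (by simp)
  exact h.clm_apply contDiffAt_const

lemma eventually_differentiableAt {f : ℝ → ℝ} {x : ℝ} (hf : ContDiffAt ℝ ∞ f x) :
    ∀ᶠ y in 𝓝 x, DifferentiableAt ℝ f y := by
  have h1 : ContDiffAt ℝ 1 f x := hf.of_le (by exact_mod_cast le_top)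
  filter_upwards [h1.eventually (by simp)] with y hy
  exact hy.differentiableAt (by simp)

/-- The derivatives of order at most `n` of the family `f` at the points `x` are sequences
belonging to the group `A`. -/
def Jet (A : AddSubgroup (ι → ℝ)) (n : ℕ) (f : ι → ℝ → ℝ) (x : ι → ℝ) : Prop :=
  ∀ j ≤ n, (fun i => iteratedDeriv j (f i) (x i)) ∈ A

/-- Every member of the family is smooth near the corresponding point. -/
def SmoothAt (f : ι → ℝ → ℝ) (x : ι → ℝ) : Prop := ∀ i, ContDiffAt ℝ ∞ (f i) (x i)

variable {A B D T : AddSubgroup (ι → ℝ)} {n m : ℕ} {f g : ι → ℝ → ℝ} {x : ι → ℝ}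

lemma SmoothAt.deriv (hf : SmoothAt f x) : SmoothAt (fun i => deriv (f i)) x :=
  fun i => contDiffAt_deriv (hf i)

lemma SmoothAt.mul (hf : SmoothAt f x) (hg : SmoothAt g x) :
    SmoothAt (fun i y => f i y * g i y) x := fun i => (hf i).mul (hg i)

lemma SmoothAt.add (hf : SmoothAt f x) (hg : SmoothAt g x) :
    SmoothAt (fun i y => f i y + g i y) x := fun i => (hf i).add (hg i)

lemma SmoothAt.sub (hf : SmoothAt f x) (hg : SmoothAt g x) :
    SmoothAt (fun i y => f i y - g i y) x := fun i => (hf i).sub (hg i)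

lemma SmoothAt.neg (hf : SmoothAt f x) : SmoothAt (fun i y => -f i y) x := fun i => (hf i).neg

lemma SmoothAt.exp (hf : SmoothAt f x) : SmoothAt (fun i y => exp (f i y)) x :=
  fun i => (hf i).exp

lemma SmoothAt.comp (hf : SmoothAt f (fun i => g i (x i))) (hg : SmoothAt g x) :
    SmoothAt (fun i y => f i (g i y)) x := fun i => ContDiffAt.comp (x i) (hf i) (hg i)

lemma Jet.mono (h : Jet A n f x) (hm : m ≤ n) : Jet A m f x := fun j hj => h j (hj.trans hm)

lemma Jet.mono_group (h : Jet A n f x) (hA : A ≤ B) : Jet B n f x := fun j hj => hA (h j hj)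

lemma jet_zero : Jet A 0 f x ↔ (fun i => f i (x i)) ∈ A := by
  simp [Jet]

lemma Jet.val (h : Jet A n f x) : (fun i => f i (x i)) ∈ A := by
  simpa using h 0 (Nat.zero_le _)

lemma jet_succ : Jet A (n + 1) f x ↔
    (fun i => f i (x i)) ∈ A ∧ Jet A n (fun i => deriv (f i)) x := by
  constructor
  · intro h
    refine ⟨h.val, fun j hj => ?_⟩
    have := h (j + 1) (by omega)
    simpa [iteratedDeriv_succ'] using this
  · rintro ⟨h0, h1⟩ j hj
    cases j with
    | zero => simpa using h0
    | succ j =>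
      have := h1 j (by omega)
      simpa [iteratedDeriv_succ'] using this

lemma Jet.congr (h : Jet A n f x) (hfg : ∀ i, g i =ᶠ[𝓝 (x i)] f i) : Jet A n g x := by
  intro j hj
  have : (fun i => iteratedDeriv j (g i) (x i)) = fun i => iteratedDeriv j (f i) (x i) := by
    funext i
    exact (hfg i).iteratedDeriv_eq j
  rw [this]
  exact h j hj

lemma Jet.add (hf : Jet A n f x) (hg : Jet A n g x) (hfs : SmoothAt f x) (hgs : SmoothAt g x) :
    Jet A n (fun i y => f i y + g i y) x := by
  intro j hj
  have : (fun i => iteratedDeriv j (fun y => f i y + g i y) (x i)) =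
      (fun i => iteratedDeriv j (f i) (x i)) + fun i => iteratedDeriv j (g i) (x i) := by
    funext i
    exact iteratedDeriv_add ((hfs i).of_le (by exact_mod_cast le_top))
      ((hgs i).of_le (by exact_mod_cast le_top))
  rw [this]
  exact A.add_mem (hf j hj) (hg j hj)

lemma Jet.neg (hf : Jet A n f x) : Jet A n (fun i y => -f i y) x := by
  intro j hj
  have : (fun i => iteratedDeriv j (fun y => -f i y) (x i)) =
      -(fun i => iteratedDeriv j (f i) (x i)) := by
    funext i
    exact iteratedDeriv_fun_neg j (f i) (x i)
  aesop

lemma Jet.sub (hf : Jet A n f x) (hg : Jet A n g x) (hfs : SmoothAt f x) (hgs : SmoothAt g x) :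
    Jet A n (fun i y => f i y - g i y) x := by
  have := hf.add hg.neg hfs hgs.neg
  simpa [sub_eq_add_neg] using this

lemma jet_const {c : ι → ℝ} (hc : c ∈ A) : Jet A n (fun i _ => c i) x := by
  intro j _
  cases j with
  | zero => simpa using hc
  | succ j =>
    have : (fun i => iteratedDeriv (j + 1) (fun _ : ℝ => c i) (x i)) = 0 := by
      funext i
      simp [iteratedDeriv_const]
    simp_all

lemma Jet.mul (hAB : ∀ a ∈ A, ∀ b ∈ B, a * b ∈ D) (hf : Jet A n f x) (hg : Jet B n g x)
    (hfs : SmoothAt f x) (hgs : SmoothAt g x) : Jet D n (fun i y => f i y * g i y) x := by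
  induction n generalizing f g with
  | zero => exact jet_zero.2 (hAB _ hf.val _ hg.val)
  | succ n ih =>
    refine jet_succ.2 ⟨hAB _ hf.val _ hg.val, ?_⟩
    have h1 := ih (jet_succ.1 hf).2 (hg.mono (Nat.le_succ n)) hfs.deriv hgs
    have h2 := ih (hf.mono (Nat.le_succ n)) (jet_succ.1 hg).2 hfs hgs.deriv
    refine (h1.add h2 (hfs.deriv.mul hgs) (hfs.mul hgs.deriv)).congr fun i => ?_
    filter_upwards [eventually_differentiableAt (hfs i), eventually_differentiableAt (hgs i)]
      with y h1 h2
    exact deriv_fun_mul h1 h2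

lemma Jet.comp (hAT : ∀ a ∈ A, ∀ b ∈ T, a * b ∈ A) (hf : Jet A (n + 1) f (fun i => g i (x i)))
    (hg : Jet T n (fun i => deriv (g i)) x) (hfs : SmoothAt f (fun i => g i (x i)))
    (hgs : SmoothAt g x) : Jet A (n + 1) (fun i y => f i (g i y)) x := by
  induction n generalizing f with
  | zero =>
    refine jet_succ.2 ⟨hf.val, ?_⟩
    have hf' := (jet_succ.1 hf).2
    have h1 : Jet A 0 (fun i y => deriv (f i) (g i y) * deriv (g i) y) x :=
      jet_zero.2 (hAT _ hf'.val _ hg.val)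
    refine h1.congr fun i => ?_
    filter_upwards [(hgs i).continuousAt.eventually (eventually_differentiableAt (hfs i)),
      eventually_differentiableAt (hgs i)] with y h1 h2
    exact deriv_comp y h1 h2
  | succ n ih =>
    refine jet_succ.2 ⟨hf.val, ?_⟩
    have hf' := (jet_succ.1 hf).2
    refine (Jet.mul hAT (ih hf' (hg.mono (Nat.le_succ n)) hfs.deriv) hg
      (SmoothAt.comp hfs.deriv hgs) hgs.deriv).congr fun i => ?_
    filter_upwards [(hgs i).continuousAt.eventually (eventually_differentiableAt (hfs i)),
      eventually_differentiableAt (hgs i)] with y h1 h2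
    exact deriv_comp y h1 h2

/-- The variant of `Jet.comp` without loss in the order. -/
lemma Jet.comp' (hAT : ∀ a ∈ A, ∀ b ∈ T, a * b ∈ A) (hf : Jet A n f (fun i => g i (x i)))
    (hg : Jet T n (fun i => deriv (g i)) x) (hfs : SmoothAt f (fun i => g i (x i)))
    (hgs : SmoothAt g x) : Jet A n (fun i y => f i (g i y)) x := by
  cases n with
  | zero => exact jet_zero.2 hf.val
  | succ n => exact Jet.comp hAT hf (hg.mono (Nat.le_succ n)) hfs hgs

lemma jet_of_deriv_eq_mul (hAT : ∀ a ∈ A, ∀ b ∈ T, a * b ∈ A) (h0 : (fun i => f i (x i)) ∈ A)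
    (hg : Jet T n g x) (hfs : SmoothAt f x) (hgs : SmoothAt g x)
    (hd : ∀ i, deriv (f i) =ᶠ[𝓝 (x i)] fun y => f i y * g i y) : Jet A (n + 1) f x := by
  induction n with
  | zero =>
    refine jet_succ.2 ⟨h0, ?_⟩
    have h1 : Jet A 0 (fun i y => f i y * g i y) x := jet_zero.2 (hAT _ h0 _ hg.val)
    exact h1.congr hd
  | succ n ih =>
    refine jet_succ.2 ⟨h0, ?_⟩
    exact (Jet.mul hAT (ih (hg.mono (Nat.le_succ n))) hg hfs hgs).congr hd

lemma Jet.exp (hAT : ∀ a ∈ A, ∀ b ∈ T, a * b ∈ A) (h0 : (fun i => exp (f i (x i))) ∈ A)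
    (hf : Jet T n (fun i => deriv (f i)) x) (hfs : SmoothAt f x) :
    Jet A (n + 1) (fun i y => exp (f i y)) x := by
  refine jet_of_deriv_eq_mul hAT h0 hf hfs.exp hfs.deriv fun i => ?_
  filter_upwards [eventually_differentiableAt (hfs i)] with y h1
  exact deriv_exp h1

lemma Jet.inv (hT : ∀ a ∈ T, ∀ b ∈ T, a * b ∈ T) (h0 : (fun i => (f i (x i))⁻¹) ∈ T)
    (hf : Jet T n (fun i => deriv (f i)) x) (hfs : SmoothAt f x) (hne : ∀ i, f i (x i) ≠ 0) :
    Jet T (n + 1) (fun i y => (f i y)⁻¹) x := by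
  have hi : SmoothAt (fun i y => (f i y)⁻¹) x := fun i => (hfs i).inv (hne i)
  have hd : ∀ i, deriv (fun y => (f i y)⁻¹) =ᶠ[𝓝 (x i)]
      fun y => -deriv (f i) y * ((f i y)⁻¹ * (f i y)⁻¹) := by
    intro i
    filter_upwards [eventually_differentiableAt (hfs i),
      (hfs i).continuousAt.eventually_ne (hne i)] with y h1 h2
    rw [deriv_fun_inv'' h1 h2]
    field_simp
  induction n with
  | zero =>
    refine jet_succ.2 ⟨h0, ?_⟩
    have hz : Jet T 0 (fun i y => (f i y)⁻¹) x := jet_zero.2 h0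
    exact (Jet.mul hT hf.neg (Jet.mul hT hz hz hi hi) hfs.deriv.neg (hi.mul hi)).congr hd
  | succ n ih =>
    refine jet_succ.2 ⟨h0, ?_⟩
    have hz := ih (hf.mono (Nat.le_succ n))
    exact (Jet.mul hT hf.neg (Jet.mul hT hz hz hi hi) hfs.deriv.neg (hi.mul hi)).congr hd

/-- Bounded sequences. -/
def bddSeq (ι : Type*) : AddSubgroup (ι → ℝ) where
  carrier := {a | ∃ C, ∀ i, |a i| ≤ C}
  zero_mem' := ⟨0, by simp⟩
  add_mem' := by
    rintro a b ⟨C, hC⟩ ⟨C', hC'⟩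
    exact ⟨C + C', fun i => (abs_add_le _ _).trans (add_le_add (hC i) (hC' i))⟩
  neg_mem' := by simp

lemma mul_mem_bddSeq : ∀ a ∈ bddSeq ι, ∀ b ∈ bddSeq ι, a * b ∈ bddSeq ι := by
  rintro a ⟨C, hC⟩ b ⟨C', hC'⟩
  refine ⟨C * C', fun i => ?_⟩
  rw [Pi.mul_apply, abs_mul]
  exact mul_le_mul (hC i) (hC' i) (abs_nonneg _) ((abs_nonneg _).trans (hC i))

/-- Families whose derivatives of all orders are bounded at the given points. -/
def BddJet (f : ι → ℝ → ℝ) (x : ι → ℝ) : Prop := ∀ n, Jet (bddSeq ι) n f x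

lemma BddJet.mul (hf : BddJet f x) (hg : BddJet g x) (hfs : SmoothAt f x) (hgs : SmoothAt g x) :
    BddJet (fun i y => f i y * g i y) x := fun n => (hf n).mul mul_mem_bddSeq (hg n) hfs hgs

lemma BddJet.add (hf : BddJet f x) (hg : BddJet g x) (hfs : SmoothAt f x) (hgs : SmoothAt g x) :
    BddJet (fun i y => f i y + g i y) x := fun n => (hf n).add (hg n) hfs hgs

lemma BddJet.sub (hf : BddJet f x) (hg : BddJet g x) (hfs : SmoothAt f x) (hgs : SmoothAt g x) :
    BddJet (fun i y => f i y - g i y) x := fun n => (hf n).sub (hg n) hfs hgs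

lemma BddJet.deriv (hf : BddJet f x) : BddJet (fun i => deriv (f i)) x :=
  fun n => (jet_succ.1 (hf (n + 1))).2

lemma bddJet_of_deriv (h0 : ∃ C, ∀ i, |f i (x i)| ≤ C) (hf : BddJet (fun i => _root_.deriv (f i)) x) :
    BddJet f x := fun n => (jet_succ.2 ⟨h0, hf n⟩).mono (Nat.le_succ n)

lemma BddJet.comp (hf : BddJet f (fun i => g i (x i))) (hg : BddJet (fun i => _root_.deriv (g i)) x)
    (hfs : SmoothAt f (fun i => g i (x i))) (hgs : SmoothAt g x) :
    BddJet (fun i y => f i (g i y)) x :=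
  fun n => (hf n).comp' mul_mem_bddSeq (hg n) hfs hgs

lemma BddJet.congr (h : BddJet f x) (hfg : ∀ i, g i =ᶠ[𝓝 (x i)] f i) : BddJet g x :=
  fun n => (h n).congr hfg

lemma BddJet.reindex {κ : Type*} (h : BddJet f x) (s : κ → ι) :
    BddJet (fun k => f (s k)) (fun k => x (s k)) := by
  intro n j hj
  obtain ⟨C, hC⟩ := h n j hj
  exact ⟨C, fun k => hC (s k)⟩

lemma bddJet_const (c : ℝ) : BddJet (fun (_ : ι) _ => c) x :=
  fun _ => jet_const (c := fun _ => c) ⟨|c|, fun _ => le_rfl⟩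

lemma BddJet.bound (h : BddJet f x) (j : ℕ) : ∃ C, 0 < C ∧ ∀ i, |iteratedDeriv j (f i) (x i)| ≤ C := by
  obtain ⟨C, hC⟩ := h j j le_rfl
  exact ⟨max C 1, by positivity, fun i => (hC i).trans (le_max_left _ _)⟩

lemma bddJet_iff : BddJet f x ↔ ∀ j, ∃ C, ∀ i, |iteratedDeriv j (f i) (x i)| ≤ C :=
  ⟨fun h j => h j j le_rfl, fun h _ j _ => h j⟩

end JetCalculus

section LogDerivative

/-- Increasing homeomorphisms of the line that are smooth with positive derivative. -/
def IsDiffeo (f : 𝓐) : Prop := ContDiff ℝ ∞ f ∧ ∀ x, 0 < deriv f x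

/-- The logarithm of the derivative. -/
def ld (f : 𝓐) (x : ℝ) : ℝ := log (deriv f x)

variable {f g h : 𝓐}

lemma IsDiffeo.differentiable (hf : IsDiffeo f) : Differentiable ℝ f :=
  hf.1.differentiable (by simp)

lemma IsDiffeo.contDiff_deriv (hf : IsDiffeo f) : ContDiff ℝ ∞ (deriv f) :=
  (contDiff_infty_iff_deriv.1 hf.1).2

lemma IsDiffeo.contDiff_ld (hf : IsDiffeo f) : ContDiff ℝ ∞ (ld f) :=
  hf.contDiff_deriv.log fun x => (hf.2 x).ne'

lemma IsDiffeo.exp_ld (hf : IsDiffeo f) (x : ℝ) : exp (ld f x) = deriv f x :=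
  exp_log (hf.2 x)

lemma isDiffeo_one : IsDiffeo 1 := by
  have h : ((1 : 𝓐) : ℝ → ℝ) = fun x => x := rfl
  refine ⟨h ▸ contDiff_id, fun x => ?_⟩
  simp

lemma coe_mul_eq_comp (f g : 𝓐) : ((f * g : 𝓐) : ℝ → ℝ) = f ∘ g := rfl

lemma IsDiffeo.deriv_mul (hf : IsDiffeo f) (hg : IsDiffeo g) (x : ℝ) :
    deriv (f * g : 𝓐) x = deriv f (g x) * deriv g x := by
  rw [coe_mul_eq_comp]
  exact deriv_comp x (hf.differentiable _) (hg.differentiable _)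

lemma IsDiffeo.mul (hf : IsDiffeo f) (hg : IsDiffeo g) : IsDiffeo (f * g) := by
  refine ⟨?_, fun x => ?_⟩
  · rw [coe_mul_eq_comp]
    exact hf.1.comp hg.1
  · rw [hf.deriv_mul hg]
    exact mul_pos (hf.2 _) (hg.2 _)

lemma IsDiffeo.inv (hf : IsDiffeo f) : IsDiffeo f⁻¹ := by
  have h1 : ∀ x, HasDerivAt f.toHomeomorph (deriv f x) x := fun x =>
    (hf.differentiable x).hasDerivAt
  have h2 : ContDiff ℝ ∞ (f⁻¹ : 𝓐) :=
    f.toHomeomorph.contDiff_symm_deriv (fun x => (hf.2 x).ne') h1 hf.1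
  refine ⟨h2, fun x => ?_⟩
  have h3 : deriv ((f : ℝ → ℝ) ∘ (f⁻¹ : 𝓐)) x = 1 := by
    have : ((f : ℝ → ℝ) ∘ (f⁻¹ : 𝓐)) = fun x => x := by aesop
    rw [this, deriv_id'']
  rw [deriv_comp x (hf.differentiable _) (h2.differentiable (by simp) _)] at h3
  exact (mul_pos_iff_of_pos_left (hf.2 _)).1 (h3 ▸ one_pos)

lemma IsDiffeo.conj (hf : IsDiffeo f) (hh : IsDiffeo h) : IsDiffeo (h * f * h⁻¹) :=
  (hh.mul hf).mul hh.inv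

lemma IsDiffeo.pow (hf : IsDiffeo f) (n : ℕ) : IsDiffeo (f ^ n) := by
  induction n with
  | zero => simpa using isDiffeo_one
  | succ n ih => rw [pow_succ]; exact ih.mul hf

lemma ld_mul (hf : IsDiffeo f) (hg : IsDiffeo g) (x : ℝ) : ld (f * g) x = ld f (g x) + ld g x := by
  rw [ld, hf.deriv_mul hg, log_mul (hf.2 _).ne' (hg.2 _).ne']
  rfl

lemma ld_one (x : ℝ) : ld 1 x = 0 := by
  have h : ((1 : 𝓐) : ℝ → ℝ) = fun x => x := rfl
  rw [ld, h, deriv_id'', log_one]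

lemma ld_inv_apply (hf : IsDiffeo f) (x : ℝ) : ld f⁻¹ (f x) = -ld f x := by
  have h := ld_mul hf.inv hf x
  rw [inv_mul_cancel, ld_one] at h
  linarith

lemma ld_inv (hf : IsDiffeo f) (y : ℝ) : ld f⁻¹ y = -ld f (f⁻¹ y) := by
  have h := ld_inv_apply hf (f⁻¹ y)
  simp_all

lemma IsDiffeo.deriv_ld (hf : IsDiffeo f) (x : ℝ) :
    deriv (ld f) x = deriv (deriv f) x * (deriv f x)⁻¹ := by
  have h := (hf.contDiff_deriv.differentiable (by simp) x).hasDerivAt.log (hf.2 x).ne'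
  rw [show ld f = fun y => log (deriv f y) from rfl, h.deriv, div_eq_mul_inv]

variable {ι : Type*} {F G : ι → 𝓐} {x : ι → ℝ}

/-- The logarithms of the derivatives of the family are bounded at the given points, together
with all their derivatives. -/
def LogBdd (F : ι → 𝓐) (x : ι → ℝ) : Prop := BddJet (fun i => ld (F i)) x

lemma smoothAt_coe (hF : ∀ i, IsDiffeo (F i)) : SmoothAt (fun i => (F i : ℝ → ℝ)) x :=
  fun i => (hF i).1.contDiffAt

lemma smoothAt_deriv (hF : ∀ i, IsDiffeo (F i)) : SmoothAt (fun i => deriv (F i)) x :=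
  fun i => (hF i).contDiff_deriv.contDiffAt

lemma smoothAt_ld (hF : ∀ i, IsDiffeo (F i)) : SmoothAt (fun i => ld (F i)) x :=
  fun i => (hF i).contDiff_ld.contDiffAt

lemma exp_bounded {a : ι → ℝ} (h : ∃ C, ∀ i, |a i| ≤ C) : ∃ C, ∀ i, |exp (a i)| ≤ C := by
  obtain ⟨C, hC⟩ := h
  refine ⟨exp C, fun i => ?_⟩
  rw [abs_of_pos (exp_pos _)]
  exact exp_le_exp.2 ((le_abs_self _).trans (hC i))

lemma jet_deriv_of_jet_ld (hF : ∀ i, IsDiffeo (F i)) {n : ℕ}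
    (h : Jet (bddSeq ι) n (fun i => ld (F i)) x) : Jet (bddSeq ι) n (fun i => deriv (F i)) x := by
  have he : (fun i => deriv (F i)) = fun i y => exp (ld (F i) y) := by
    funext i y
    rw [(hF i).exp_ld]
  rw [he]
  have h0 : (fun i => exp (ld (F i) (x i))) ∈ bddSeq ι := exp_bounded h.val
  cases n with
  | zero => exact jet_zero.2 h0
  | succ n => exact Jet.exp mul_mem_bddSeq h0 (jet_succ.1 h).2 (smoothAt_ld hF)

lemma LogBdd.bddJet_deriv (hF : ∀ i, IsDiffeo (F i)) (h : LogBdd F x) :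
    BddJet (fun i => deriv (F i)) x := fun n => jet_deriv_of_jet_ld hF (h n)

lemma logBdd_of_bddJet (hF : ∀ i, IsDiffeo (F i)) (h0 : ∃ C, ∀ i, |ld (F i) (x i)| ≤ C)
    (h : BddJet (fun i => deriv (F i)) x) : LogBdd F x := by
  refine bddJet_of_deriv h0 ?_
  have he : (fun i => deriv (ld (F i))) =
      fun i y => deriv (deriv (F i)) y * (deriv (F i) y)⁻¹ := by
    funext i y
    exact (hF i).deriv_ld y
  have hi : (fun i => (deriv (F i) (x i))⁻¹) ∈ bddSeq ι := by
    have : (fun i => (deriv (F i) (x i))⁻¹) = fun i => exp (-ld (F i) (x i)) := by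
      funext i
      rw [exp_neg, (hF i).exp_ld]
    rw [this]
    obtain ⟨C, hC⟩ := h0
    exact exp_bounded ⟨C, by simpa using hC⟩
  have hinv : BddJet (fun i y => (deriv (F i) y)⁻¹) x := fun n =>
    (Jet.inv mul_mem_bddSeq hi (h.deriv n) (smoothAt_deriv hF)
      fun i => ((hF i).2 _).ne').mono (Nat.le_succ n)
  rw [he]
  exact h.deriv.mul hinv (smoothAt_deriv hF).deriv fun i =>
    (smoothAt_deriv hF i).inv ((hF i).2 _).ne'

lemma LogBdd.mul (hF : ∀ i, IsDiffeo (F i)) (hG : ∀ i, IsDiffeo (G i))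
    (h1 : LogBdd F fun i => G i (x i)) (h2 : LogBdd G x) : LogBdd (fun i => F i * G i) x := by
  have he : (fun i => ld (F i * G i)) = fun i y => ld (F i) (G i y) + ld (G i) y := by
    funext i y
    exact ld_mul (hF i) (hG i) y
  unfold LogBdd
  rw [he]
  exact (BddJet.comp h1 (h2.bddJet_deriv hG) (smoothAt_ld hF) (smoothAt_coe hG)).add h2
    ((smoothAt_ld hF).comp (smoothAt_coe hG)) (smoothAt_ld hG)

/-- If `log F' = a - b ∘ F` near the given points, then bounds on the derivatives of `a` and `b`
yield bounds on those of `F`. -/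
lemma logBdd_of_ld_eq_sub (hF : ∀ i, IsDiffeo (F i)) {a b : ι → ℝ → ℝ}
    (h0 : ∃ C, ∀ i, |ld (F i) (x i)| ≤ C) (ha : BddJet (fun i => deriv (a i)) x)
    (hb : BddJet (fun i => deriv (b i)) fun i => F i (x i)) (has : SmoothAt a x)
    (hbs : SmoothAt b fun i => F i (x i))
    (he : ∀ i, ld (F i) =ᶠ[𝓝 (x i)] fun y => a i y - b i (F i y)) : LogBdd F x := by
  intro n
  induction n with
  | zero => exact jet_zero.2 h0
  | succ n ih =>
    refine jet_succ.2 ⟨h0, ?_⟩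
    have hd := jet_deriv_of_jet_ld hF ih
    have hF' := smoothAt_coe (x := x) hF
    have hc := Jet.comp' mul_mem_bddSeq (hb n) hd hbs.deriv hF'
    have hm := Jet.mul mul_mem_bddSeq hc hd (hbs.deriv.comp hF') hF'.deriv
    refine ((ha n).sub hm has.deriv ((hbs.deriv.comp hF').mul hF'.deriv)).congr fun i => ?_
    refine (he i).deriv.trans ?_
    filter_upwards [eventually_differentiableAt (has i),
      (hF' i).continuousAt.eventually (eventually_differentiableAt (hbs i)),
      eventually_differentiableAt (hF' i)] with y h1 h2 h3
    have h4 := (h1.hasDerivAt.sub (h2.hasDerivAt.comp y h3.hasDerivAt)).deriv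
    exact h4

lemma LogBdd.inv (hF : ∀ i, IsDiffeo (F i)) (h : LogBdd F x) :
    LogBdd (fun i => (F i)⁻¹) fun i => F i (x i) := by
  have hx : (fun i => (F i)⁻¹ (F i (x i))) = x := by simp
  have hF' : ∀ i, IsDiffeo (F i)⁻¹ := fun i => (hF i).inv
  refine logBdd_of_ld_eq_sub (a := fun _ _ => 0) (b := fun i => ld (F i)) hF' ?_ ?_ ?_
    (fun i => contDiffAt_const) (smoothAt_ld hF) ?_
  · obtain ⟨C, hC⟩ := (h 0).val
    refine ⟨C, fun i => ?_⟩
    rw [ld_inv_apply (hF i), abs_neg]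
    exact hC i
  · simpa using bddJet_const 0
  · rw [hx]
    exact BddJet.deriv h
  · intro i
    refine Eventually.of_forall fun y => ?_
    rw [ld_inv (hF i)]
    ring

lemma LogBdd.inv' (hF : ∀ i, IsDiffeo (F i)) (h : LogBdd F fun i => (F i)⁻¹ (x i)) :
    LogBdd (fun i => (F i)⁻¹) x := by
  have := h.inv hF
  simpa using this

lemma LogBdd.reindex {κ : Type*} (h : LogBdd F x) (s : κ → ι) :
    LogBdd (fun k => F (s k)) (fun k => x (s k)) := BddJet.reindex h s

lemma LogBdd.congr (h : LogBdd F x) (he : ∀ i, (G i : ℝ → ℝ) =ᶠ[𝓝 (x i)] F i) : LogBdd G x := by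
  refine BddJet.congr h fun i => ?_
  filter_upwards [(he i).deriv] with y hy
  rw [ld, hy, ld]

end LogDerivative

section UniformLimits

lemma natCast_le_infty (n : ℕ) : (n : WithTop ℕ∞) ≤ ∞ := by
  exact_mod_cast (le_top : (n : ℕ∞) ≤ ⊤)

lemma abs_deriv_le_of_bounds {g : ℝ → ℝ} {δ M t : ℝ} (hg : ContDiff ℝ ∞ g) (ht : 0 < t)
    (h0 : ∀ x, |g x| ≤ δ) (h2 : ∀ x, |deriv (deriv g) x| ≤ M) (x : ℝ) :
    |deriv g x| ≤ 2 * δ / t + M * t := by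
  have hd : Differentiable ℝ g := hg.differentiable (by simp)
  have hd' : Differentiable ℝ (deriv g) :=
    (contDiff_infty_iff_deriv.1 hg).2.differentiable (by simp)
  obtain ⟨ξ, hξ, he⟩ := exists_deriv_eq_slope g (lt_add_of_pos_right x ht) hd.continuous.continuousOn
    hd.differentiableOn
  have h3 : |deriv g x - deriv g ξ| ≤ M * |x - ξ| :=
    abs_sub_le_of_deriv_le (fun y _ => hd' y) fun y _ => h2 y
  have hM : 0 ≤ M := (abs_nonneg _).trans (h2 0)
  have h4 : |x - ξ| ≤ t := by grind
  have h5 : |deriv g ξ| ≤ 2 * δ / t := by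
    rw [he, abs_div, add_sub_cancel_left, abs_of_pos ht]
    gcongr
    grind
  calc |deriv g x| = |deriv g ξ + (deriv g x - deriv g ξ)| := by ring_nf
    _ ≤ |deriv g ξ| + |deriv g x - deriv g ξ| := abs_add_le _ _
    _ ≤ 2 * δ / t + M * t := add_le_add h5 (h3.trans (by gcongr))

lemma eventually_deriv_small {κ : Type*} {l : Filter κ} {w : κ → ℝ → ℝ}
    (hw : ∀ i, ContDiff ℝ ∞ (w i)) (hb : ∃ C, ∀ i x, |deriv (deriv (w i)) x| ≤ C)
    (h0 : ∀ ε > 0, ∀ᶠ i in l, ∀ x, |w i x| ≤ ε) : ∀ ε > 0, ∀ᶠ i in l, ∀ x, |deriv (w i) x| ≤ ε := by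
  intro ε hε
  obtain ⟨C, hC⟩ := hb
  set M := max C 1 with hM
  have hMpos : 0 < M := by positivity
  set t := ε / (2 * M) with ht
  have htpos : 0 < t := by positivity
  filter_upwards [h0 (ε * t / 4) (by positivity)] with i hi x
  have := abs_deriv_le_of_bounds (hw i) htpos hi (M := M) (fun y => (hC i y).trans (le_max_left _ _)) x
  refine this.trans (le_of_eq ?_)
  rw [ht]
  field_simp
  ring

lemma eventually_iteratedDeriv_small {κ : Type*} {l : Filter κ} {w : κ → ℝ → ℝ}
    (hw : ∀ i, ContDiff ℝ ∞ (w i)) (hb : ∀ j, ∃ C, ∀ i x, |iteratedDeriv (j + 2) (w i) x| ≤ C)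
    (h0 : ∀ ε > 0, ∀ᶠ i in l, ∀ x, |w i x| ≤ ε) (j : ℕ) :
    ∀ ε > 0, ∀ᶠ i in l, ∀ x, |iteratedDeriv j (w i) x| ≤ ε := by
  induction j generalizing w with
  | zero => simpa using h0
  | succ j ih =>
    have h1 := eventually_deriv_small hw (by simpa [iteratedDeriv_succ'] using hb 0) h0
    have := ih (w := fun i => deriv (w i)) (fun i => (contDiff_infty_iff_deriv.1 (hw i)).2)
      (fun j => by simpa [iteratedDeriv_succ'] using hb (j + 1)) h1
    simpa [iteratedDeriv_succ'] using this

lemma contDiff_of_hasDerivAt_seq {G : ℕ → ℝ → ℝ} (h : ∀ j x, HasDerivAt (G j) (G (j + 1) x) x) :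
    ContDiff ℝ ∞ (G 0) := by
  rw [contDiff_infty]
  intro n
  suffices H : ∀ n : ℕ, ∀ j, ContDiff ℝ n (G j) from H n 0
  intro n
  induction n with
  | zero =>
    intro j
    exact contDiff_zero.2 (continuous_iff_continuousAt.2 fun x => (h j x).continuousAt)
  | succ n ih =>
    intro j
    have hd : deriv (G j) = G (j + 1) := funext fun x => (h j x).deriv
    push_cast
    rw [contDiff_succ_iff_deriv]
    refine ⟨fun x => (h j x).differentiableAt, by simp, ?_⟩
    simp_all

lemma contDiff_of_tendstoUniformly {u : ℕ → ℝ → ℝ} {v : ℝ → ℝ} (hu : ∀ n, ContDiff ℝ ∞ (u n))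
    (hb : ∀ j, ∃ C, ∀ n x, |iteratedDeriv (j + 1) (u n) x| ≤ C)
    (hv : TendstoUniformly u v atTop) :
    ContDiff ℝ ∞ v ∧ ∀ j, TendstoUniformly (fun n => iteratedDeriv j (u n)) (iteratedDeriv j v)
      atTop := by
  have hcauchy : ∀ j, ∀ ε > 0, ∀ᶠ p : ℕ × ℕ in atTop ×ˢ atTop, ∀ x,
      |iteratedDeriv j (u p.1) x - iteratedDeriv j (u p.2) x| ≤ ε := by
    intro j
    have h1 := eventually_iteratedDeriv_small (κ := ℕ × ℕ) (l := atTop ×ˢ atTop)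
      (w := fun p x => u p.1 x - u p.2 x) (fun p => (hu p.1).sub (hu p.2)) ?_ ?_ j
    · intro ε hε
      filter_upwards [h1 ε hε] with p hp x
      have := hp x
      rwa [show (fun x => u p.1 x - u p.2 x) = u p.1 - u p.2 from rfl,
        iteratedDeriv_sub ((hu p.1).contDiffAt.of_le (natCast_le_infty _))
        ((hu p.2).contDiffAt.of_le (natCast_le_infty _))] at this
    · intro j
      obtain ⟨C, hC⟩ := hb (j + 1)
      refine ⟨C + C, fun p x => ?_⟩
      rw [show (fun x => u p.1 x - u p.2 x) = u p.1 - u p.2 from rfl,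
        iteratedDeriv_sub ((hu p.1).contDiffAt.of_le (natCast_le_infty _))
        ((hu p.2).contDiffAt.of_le (natCast_le_infty _))]
      grind
    · intro ε hε
      have h2 := tendstoUniformly_iff_abs.1 hv (ε / 2) (half_pos hε)
      filter_upwards [h2.prod_mk h2] with p hp x
      have h3 := abs_lt.1 (hp.1 x)
      have h4 := abs_lt.1 (hp.2 x)
      rw [abs_le]
      constructor <;> linarith
  have hlim : ∀ j, ∃ G : ℝ → ℝ, TendstoUniformly (fun n => iteratedDeriv j (u n)) G atTop := by
    intro j
    have hU : UniformCauchySeqOn (fun n => iteratedDeriv j (u n)) atTop univ := by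
      rw [uniformCauchySeqOn_iff_uniformCauchySeqOnFilter]
      intro U hU
      obtain ⟨ε, hε, hεU⟩ := Metric.mem_uniformity_dist.1 hU
      have h1 := hcauchy j (ε / 2) (half_pos hε)
      have h2 : ∀ᶠ p : (ℕ × ℕ) × ℝ in (atTop ×ˢ atTop) ×ˢ 𝓟 univ,
          ∀ x, |iteratedDeriv j (u p.1.1) x - iteratedDeriv j (u p.1.2) x| ≤ ε / 2 :=
        h1.prod_inl _
      filter_upwards [h2] with p hp
      refine hεU ?_
      rw [dist_eq]
      grind
    have hc : ∀ x, ∃ y, Tendsto (fun n => iteratedDeriv j (u n) x) atTop (𝓝 y) := fun x =>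
      cauchySeq_tendsto_of_complete (hU.cauchySeq (mem_univ x))
    choose G hG using hc
    exact ⟨G, tendstoUniformlyOn_univ.1 (hU.tendstoUniformlyOn_of_tendsto fun x _ => hG x)⟩
  choose G hG using hlim
  have hG0 : G 0 = v := by
    funext x
    have h1 := (hG 0).tendsto_at x
    simp only [iteratedDeriv_zero] at h1
    exact tendsto_nhds_unique h1 (hv.tendsto_at x)
  have hder : ∀ j x, HasDerivAt (G j) (G (j + 1) x) x := by
    intro j x
    refine hasDerivAt_of_tendstoUniformly (hG (j + 1)) (Eventually.of_forall fun n y => ?_)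
      (fun y => (hG j).tendsto_at y) x
    rw [iteratedDeriv_succ]
    exact ((hu n).differentiable_iteratedDeriv j (by exact_mod_cast WithTop.coe_lt_top _) y).hasDerivAt
  have hit : ∀ j, iteratedDeriv j v = G j := by
    intro j
    induction j with
    | zero => rw [iteratedDeriv_zero, hG0]
    | succ j ih =>
      rw [iteratedDeriv_succ, ih]
      exact funext fun x => (hder j x).deriv
  refine ⟨hG0 ▸ contDiff_of_hasDerivAt_seq hder, fun j => ?_⟩
  rw [hit]
  exact hG j

end UniformLimits

section UniformDiffeos

/-- The group of diffeomorphisms whose logarithmic derivative has bounded derivatives of all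
orders. -/
def unifDiffeo : Subgroup 𝓐 where
  carrier := {f | IsDiffeo f ∧ LogBdd (fun _ : ℝ => f) id}
  mul_mem' := by
    rintro f g ⟨hf, hf'⟩ ⟨hg, hg'⟩
    exact ⟨hf.mul hg, LogBdd.mul (fun _ => hf) (fun _ => hg) (hf'.reindex g) hg'⟩
  one_mem' := by
    refine ⟨isDiffeo_one, ?_⟩
    have : (fun _ : ℝ => ld 1) = fun _ _ => 0 := by
      funext x y
      exact ld_one y
    unfold LogBdd
    rw [this]
    exact bddJet_const 0
  inv_mem' := by
    rintro f ⟨hf, hf'⟩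
    exact ⟨hf.inv, LogBdd.inv' (fun _ => hf) (hf'.reindex (f⁻¹ : 𝓐))⟩

lemma mem_unifDiffeo {f : 𝓐} : f ∈ unifDiffeo ↔ IsDiffeo f ∧ LogBdd (fun _ : ℝ => f) id :=
  Iff.rfl

/-- Uniform bounds for the logarithmic derivatives of a sequence of diffeomorphisms. -/
def UnifLogBdd (u : ℕ → 𝓐) : Prop := LogBdd (fun p : ℕ × ℝ => u p.1) fun p => p.2

lemma UnifLogBdd.iteratedDeriv_le {u : ℕ → 𝓐} (h : UnifLogBdd u) (hu : ∀ n, IsDiffeo (u n))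
    (j : ℕ) : ∃ C, ∀ n x, |iteratedDeriv (j + 1) (u n) x| ≤ C := by
  obtain ⟨C, hC⟩ := (LogBdd.bddJet_deriv (fun p : ℕ × ℝ => hu p.1) h) j j le_rfl
  refine ⟨C, fun n x => ?_⟩
  simpa [iteratedDeriv_succ'] using hC (n, x)

lemma tendstoUniformly_iteratedDeriv {u : ℕ → 𝓐} {v : 𝓐} (hu : ∀ n, IsDiffeo (u n))
    (hb : UnifLogBdd u) (hv : TendstoUniformly (fun n => (u n : ℝ → ℝ)) v atTop) (j : ℕ) :
    TendstoUniformly (fun n => iteratedDeriv j (u n)) (iteratedDeriv j v) atTop :=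
  (contDiff_of_tendstoUniformly (fun n => (hu n).1) (hb.iteratedDeriv_le hu) hv).2 j

lemma mem_unifDiffeo_of_tendsto {u : ℕ → 𝓐} {v : 𝓐} (hu : ∀ n, IsDiffeo (u n))
    (hb : UnifLogBdd u) (hv : TendstoUniformly (fun n => (u n : ℝ → ℝ)) v atTop) :
    v ∈ unifDiffeo := by
  have h1 := contDiff_of_tendstoUniformly (fun n => (hu n).1) (hb.iteratedDeriv_le hu) hv
  obtain ⟨C, hC⟩ := (hb 0).val
  have hlow : ∀ x, exp (-C) ≤ deriv v x := by
    intro x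
    have h2 := (h1.2 1).tendsto_at x
    simp only [iteratedDeriv_one] at h2
    refine ge_of_tendsto' h2 fun n => ?_
    rw [← (hu n).exp_ld]
    exact exp_le_exp.2 (abs_le.1 (hC (n, x))).1
  have hv' : IsDiffeo v := ⟨h1.1, fun x => (exp_pos _).trans_le (hlow x)⟩
  refine ⟨hv', logBdd_of_bddJet (fun _ => hv') ?_ ?_⟩
  · refine ⟨C, fun x => ?_⟩
    have h2 := (h1.2 1).tendsto_at x
    simp only [iteratedDeriv_one] at h2
    have h3 : Tendsto (fun n => |ld (u n) x|) atTop (𝓝 |ld v x|) :=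
      (h2.log (hv'.2 x).ne').abs
    exact le_of_tendsto' h3 fun n => hC (n, x)
  · rw [bddJet_iff]
    intro j
    obtain ⟨C', hC'⟩ := hb.iteratedDeriv_le hu j
    refine ⟨C', fun x => ?_⟩
    have h2 := ((h1.2 (j + 1)).tendsto_at x).abs
    rw [iteratedDeriv_succ'] at h2
    exact le_of_tendsto' h2 fun n => hC' n x

/-- `F₂` is a smooth limit of conjugates of `F` by elements of `𝓗`. -/
def Degenerates (𝓗 : Subgroup 𝓐) (F F₂ : 𝓐) : Prop :=
  ∃ H : ℕ → 𝓐, (∀ n, H n ∈ 𝓗) ∧ UnifLogBdd (fun n => H n * F * (H n)⁻¹) ∧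
    TendstoUniformly (fun n => ((H n * F * (H n)⁻¹ : 𝓐) : ℝ → ℝ)) F₂ atTop

/-- Some conjugate of `F` by an element of `𝓗` is at distance less than `ε` from `R` in the
`C^r` topology. -/
def Reducible (𝓗 : Subgroup 𝓐) (R : ℝ → ℝ) (r : ℕ) (ε : ℝ) (F : 𝓐) : Prop :=
  ∃ h ∈ 𝓗, ∃ ε' < ε, ∀ k ≤ r, ∀ x,
    |iteratedDeriv k (h * F * h⁻¹ : 𝓐) x - iteratedDeriv k R x| ≤ ε'

variable {𝓗 : Subgroup 𝓐} {F F₂ : 𝓐} {R : ℝ → ℝ} {r : ℕ} {ε : ℝ}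

lemma Degenerates.mem_unifDiffeo (h : Degenerates 𝓗 F F₂) (hH : 𝓗 ≤ unifDiffeo)
    (hF : IsDiffeo F) : F₂ ∈ unifDiffeo := by
  obtain ⟨H, h1, h2, h3⟩ := h
  exact mem_unifDiffeo_of_tendsto (fun n => hF.conj (hH (h1 n)).1) h2 h3

lemma lipschitz_of_mem_unifDiffeo {h : 𝓐} (hh : h ∈ unifDiffeo) :
    ∃ L > 0, ∀ x y, |h x - h y| ≤ L * |x - y| := by
  obtain ⟨C, hC⟩ := ((LogBdd.bddJet_deriv (fun _ : ℝ => hh.1) hh.2) 0).val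
  exact ⟨max C 1, by positivity, fun x y => abs_sub_le_of_deriv_le
    (fun y _ => hh.1.differentiable y) fun y _ => (hC y).trans (le_max_left _ _)⟩

lemma Degenerates.conj {h : 𝓐} (hd : Degenerates 𝓗 F F₂) (hH : 𝓗 ≤ unifDiffeo)
    (hF : IsDiffeo F) (hh : h ∈ 𝓗) : Degenerates 𝓗 F (h * F₂ * h⁻¹) := by
  obtain ⟨H, h1, h2, h3⟩ := hd
  have hu : ∀ n, IsDiffeo (H n * F * (H n)⁻¹) := fun n => hF.conj (hH (h1 n)).1
  have he : ∀ n, h * H n * F * (h * H n)⁻¹ = h * (H n * F * (H n)⁻¹) * h⁻¹ := fun n => by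
    simp [mul_assoc]
  have hh' := hH hh
  refine ⟨fun n => h * H n, fun n => 𝓗.mul_mem hh (h1 n), ?_, ?_⟩
  · simp only [he]
    have hinv := unifDiffeo.inv_mem hh'
    refine LogBdd.mul (F := fun p : ℕ × ℝ => h * (H p.1 * F * (H p.1)⁻¹)) (G := fun _ => h⁻¹)
      (fun p => hh'.1.mul (hu p.1)) (fun _ => hh'.1.inv) ?_ (hinv.2.reindex fun p : ℕ × ℝ => p.2)
    refine LogBdd.mul (F := fun _ => h) (G := fun p : ℕ × ℝ => H p.1 * F * (H p.1)⁻¹)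
      (fun _ => hh'.1) (fun p => hu p.1)
      (hh'.2.reindex fun p : ℕ × ℝ => (H p.1 * F * (H p.1)⁻¹) (h⁻¹ p.2)) ?_
    exact h2.reindex fun p : ℕ × ℝ => (p.1, h⁻¹ p.2)
  · simp only [he]
    obtain ⟨L, hL, hLip⟩ := lipschitz_of_mem_unifDiffeo hh'
    rw [tendstoUniformly_iff_abs] at h3 ⊢
    intro ε hε
    filter_upwards [h3 (ε / L) (by positivity)] with n hn x
    have h4 := hn (h⁻¹ x)
    calc _ ≤ _ := hLip ((H n * F * (H n)⁻¹) (h⁻¹ x)) (F₂ (h⁻¹ x))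
      _ < L * (ε / L) := by gcongr
      _ = ε := by field_simp

lemma Degenerates.exists_near {h : 𝓐} (hd : Degenerates 𝓗 F F₂) (hH : 𝓗 ≤ unifDiffeo)
    (hF : IsDiffeo F) (hh : h ∈ 𝓗) (hε : 0 < ε) : ∃ f ∈ 𝓗, ∀ k ≤ r, ∀ x,
      |iteratedDeriv k (f * F * f⁻¹ : 𝓐) x - iteratedDeriv k (h * F₂ * h⁻¹ : 𝓐) x| < ε := by
  obtain ⟨H, h1, h2, h3⟩ := hd.conj hH hF hh
  have h4 := tendstoUniformly_iteratedDeriv (fun n => hF.conj (hH (h1 n)).1) h2 h3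
  obtain ⟨n, hn⟩ := ((eventually_all_finset (Finset.range (r + 1))).2 fun k _ =>
    tendstoUniformly_iff_abs.1 (h4 k) _ hε).exists
  exact ⟨H n, h1 n, fun k hk => hn k (Finset.mem_range_succ_iff.2 hk)⟩

lemma Degenerates.reducible (hd : Degenerates 𝓗 F F₂) (hH : 𝓗 ≤ unifDiffeo)
    (hF : IsDiffeo F) (h2 : Reducible 𝓗 R r ε F₂) : Reducible 𝓗 R r ε F := by
  obtain ⟨h, hh, ε', hε, hr⟩ := h2
  obtain ⟨f, hf, hn⟩ := hd.exists_near (r := r) (ε := (ε - ε') / 2) hH hF hh (by linarith)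
  refine ⟨f, hf, (ε + ε') / 2, by linarith, fun k hk x => ?_⟩
  have h6 := abs_lt.1 (hn k hk x)
  have h7 := abs_le.1 (hr k hk x)
  rw [abs_le]
  constructor <;> linarith

end UniformDiffeos

section WeightedCalculus

variable {ι : Type*}

/-- Sequences of at most polynomial growth in the inverse of the weight `w`. -/
def tameSeq (w : ι → ℝ) (hw : ∀ i, 0 < w i ∧ w i ≤ 1) : AddSubgroup (ι → ℝ) where
  carrier := {a | ∃ N : ℕ, ∃ C, ∀ i, |a i| * w i ^ N ≤ C}
  zero_mem' := ⟨0, 0, by simp⟩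
  add_mem' := by
    rintro a b ⟨N, C, hC⟩ ⟨N', C', hC'⟩
    refine ⟨N + N', C + C', fun i => ?_⟩
    have h1 : w i ^ (N + N') ≤ w i ^ N :=
      pow_le_pow_of_le_one (hw i).1.le (hw i).2 (Nat.le_add_right _ _)
    have h2 : w i ^ (N + N') ≤ w i ^ N' :=
      pow_le_pow_of_le_one (hw i).1.le (hw i).2 (Nat.le_add_left _ _)
    have h3 : 0 ≤ w i ^ (N + N') := pow_nonneg (hw i).1.le _
    calc |(a + b) i| * w i ^ (N + N') ≤ (|a i| + |b i|) * w i ^ (N + N') := by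
          gcongr
          exact abs_add_le _ _
      _ = |a i| * w i ^ (N + N') + |b i| * w i ^ (N + N') := by ring
      _ ≤ |a i| * w i ^ N + |b i| * w i ^ N' := by gcongr
      _ ≤ C + C' := add_le_add (hC i) (hC' i)
  neg_mem' := by simp

/-- Sequences bounded by multiples of `ς w ^ N` for all `N`. -/
def flatSeq (ς w : ι → ℝ) : AddSubgroup (ι → ℝ) where
  carrier := {a | ∀ N : ℕ, ∃ C, ∀ i, |a i| ≤ C * (ς i * w i ^ N)}
  zero_mem' := fun N => ⟨0, by simp⟩
  add_mem' := by
    intro a b ha hb N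
    obtain ⟨C, hC⟩ := ha N
    obtain ⟨C', hC'⟩ := hb N
    refine ⟨C + C', fun i => (abs_add_le _ _).trans ?_⟩
    rw [add_mul]
    exact add_le_add (hC i) (hC' i)
  neg_mem' := by simp

/-- Sequences bounded by multiples of `ς`. -/
def smallSeq (ς : ι → ℝ) : AddSubgroup (ι → ℝ) where
  carrier := {a | ∃ C, ∀ i, |a i| ≤ C * ς i}
  zero_mem' := ⟨0, by simp⟩
  add_mem' := by
    rintro a b ⟨C, hC⟩ ⟨C', hC'⟩
    refine ⟨C + C', fun i => (abs_add_le _ _).trans ?_⟩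
    rw [add_mul]
    exact add_le_add (hC i) (hC' i)
  neg_mem' := by simp

variable {w ς : ι → ℝ} {hw : ∀ i, 0 < w i ∧ w i ≤ 1}

lemma tame_mul_tame : ∀ a ∈ tameSeq w hw, ∀ b ∈ tameSeq w hw, a * b ∈ tameSeq w hw := by
  rintro a ⟨N, C, hC⟩ b ⟨N', C', hC'⟩
  refine ⟨N + N', C * C', fun i => ?_⟩
  have h0 := (hw i).1.le
  calc |(a * b) i| * w i ^ (N + N') = (|a i| * w i ^ N) * (|b i| * w i ^ N') := by
        rw [Pi.mul_apply, abs_mul, pow_add]; ring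
    _ ≤ C * C' := mul_le_mul (hC i) (hC' i) (by positivity)
        ((by positivity : 0 ≤ |a i| * w i ^ N).trans (hC i))

lemma flat_mul_tame : ∀ a ∈ flatSeq ς w, ∀ b ∈ tameSeq w hw, a * b ∈ flatSeq ς w := by
  rintro a ha b ⟨N', C', hC'⟩ N
  obtain ⟨C, hC⟩ := ha (N + N')
  refine ⟨C * C', fun i => ?_⟩
  have h0 := (hw i).1
  have hb : |b i| ≤ C' / w i ^ N' := by
    rw [le_div_iff₀ (by positivity)]
    exact hC' i
  calc |(a * b) i| = |a i| * |b i| := by rw [Pi.mul_apply, abs_mul]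
    _ ≤ (C * (ς i * w i ^ (N + N'))) * (C' / w i ^ N') :=
        mul_le_mul (hC i) hb (abs_nonneg _) ((abs_nonneg _).trans (hC i))
    _ = C * C' * (ς i * w i ^ N) := by
        rw [pow_add]
        field_simp

lemma tame_mul_flat (a : ι → ℝ) (ha : a ∈ tameSeq w hw) (b : ι → ℝ) (hb : b ∈ flatSeq ς w) :
    a * b ∈ flatSeq ς w := by
  rw [mul_comm]
  exact flat_mul_tame b hb a ha

lemma bdd_le_tame : bddSeq ι ≤ tameSeq w hw := by
  rintro a ⟨C, hC⟩
  exact ⟨0, C, by simpa using hC⟩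

lemma small_mul_flat :
    ∀ a ∈ smallSeq ς, ∀ b ∈ flatSeq (fun _ => 1) w, a * b ∈ flatSeq ς w := by
  rintro a ⟨C, hC⟩ b hb N
  obtain ⟨C', hC'⟩ := hb N
  refine ⟨C * C', fun i => ?_⟩
  calc |(a * b) i| = |a i| * |b i| := by rw [Pi.mul_apply, abs_mul]
    _ ≤ (C * ς i) * (C' * (1 * w i ^ N)) :=
        mul_le_mul (hC i) (hC' i) (abs_nonneg _) ((abs_nonneg _).trans (hC i))
    _ = C * C' * (ς i * w i ^ N) := by ring

lemma flat_le_bdd (hς : ∀ i, 0 ≤ ς i ∧ ς i ≤ 1) :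
    flatSeq ς w ≤ bddSeq ι := by
  intro a ha
  obtain ⟨C, hC⟩ := ha 0
  refine ⟨|C|, fun i => (hC i).trans ?_⟩
  rw [pow_zero, mul_one]
  calc C * ς i ≤ |C| * ς i := by
        gcongr
        · exact (hς i).1
        · exact le_abs_self C
    _ ≤ |C| * 1 := by
        gcongr
        exact (hς i).2
    _ = |C| := mul_one _

lemma flat_le_tame (hς : ∀ i, 0 ≤ ς i ∧ ς i ≤ 1) : flatSeq ς w ≤ tameSeq w hw :=
  (flat_le_bdd hς).trans bdd_le_tame

/-- Polynomial bounds in the inverse weight for all derivatives along the given segments. -/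
def TameOn (w : ι → ℝ) (x y : ι → ℝ) (φ : ι → ℝ → ℝ) : Prop :=
  (∀ i, ∀ z ∈ uIcc (x i) (y i), ContDiffAt ℝ ∞ (φ i) z) ∧
    ∀ j, ∃ N : ℕ, ∃ C, ∀ i, ∀ z ∈ uIcc (x i) (y i), |iteratedDeriv j (φ i) z| * w i ^ N ≤ C

variable {x y : ι → ℝ} {φ h m : ι → ℝ → ℝ} {n : ℕ}

lemma TameOn.deriv (hφ : TameOn w x y φ) : TameOn w x y fun i => deriv (φ i) := by
  refine ⟨fun i z hz => contDiffAt_deriv (hφ.1 i z hz), fun j => ?_⟩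
  simpa [iteratedDeriv_succ'] using hφ.2 (j + 1)

lemma TameOn.jet (hφ : TameOn w x y φ) : Jet (tameSeq w hw) n φ x := by
  intro j _
  obtain ⟨N, C, hC⟩ := hφ.2 j
  exact ⟨N, C, fun i => hC i _ left_mem_uIcc⟩

lemma TameOn.smoothAt (hφ : TameOn w x y φ) : SmoothAt φ x := fun i => hφ.1 i _ left_mem_uIcc

lemma TameOn.smoothAt_right (hφ : TameOn w x y φ) : SmoothAt φ y :=
  fun i => hφ.1 i _ right_mem_uIcc

lemma tameOn_increment (hw : ∀ i, 0 < w i ∧ w i ≤ 1) (hφ : TameOn w x y φ) :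
    ∃ N : ℕ, ∃ C, ∀ i, ∀ z ∈ uIcc (x i) (y i), ∀ z' ∈ uIcc (x i) (y i),
      |φ i z' - φ i z| * w i ^ N ≤ C * |z' - z| := by
  obtain ⟨N, C, hC⟩ := hφ.deriv.2 0
  refine ⟨N, C, fun i z hz z' hz' => ?_⟩
  have h0 : 0 < w i ^ N := pow_pos (hw i).1 _
  have := abs_sub_le_of_deriv_le (C := C / w i ^ N)
    (fun v hv => (hφ.1 i v (uIcc_subset_uIcc hz hz' hv)).differentiableAt (by simp)) fun v hv => by
      rw [le_div_iff₀ h0]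
      simpa using hC i v (uIcc_subset_uIcc hz hz' hv)
  calc |φ i z' - φ i z| * w i ^ N ≤ (C / w i ^ N * |z' - z|) * w i ^ N := by gcongr
    _ = C * |z' - z| := by field_simp

lemma jet_increment (hw : ∀ i, 0 < w i ∧ w i ≤ 1) (hς : ∀ i, 0 ≤ ς i ∧ ς i ≤ 1)
    (hh : SmoothAt h x) (hφ : TameOn w x (fun i => x i + h i (x i)) φ)
    (hj : Jet (flatSeq ς w) n h x) :
    Jet (flatSeq ς w) n (fun i z => φ i (z + h i z) - φ i z) x := by
  have h00 : ∀ {φ : ι → ℝ → ℝ}, TameOn w x (fun i => x i + h i (x i)) φ →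
      (fun i => φ i (x i + h i (x i)) - φ i (x i)) ∈ flatSeq ς w := by
    intro φ hφ N
    obtain ⟨N', C, hC⟩ := tameOn_increment hw hφ
    obtain ⟨C', hC'⟩ := hj.val (N + N')
    refine ⟨|C| * C', fun i => ?_⟩
    have h0 : 0 < w i ^ N' := pow_pos (hw i).1 _
    have h1 := hC i (x i) left_mem_uIcc _ right_mem_uIcc
    rw [add_sub_cancel_left] at h1
    have h2 : |φ i (x i + h i (x i)) - φ i (x i)| * w i ^ N' ≤
        (|C| * C' * (ς i * w i ^ N)) * w i ^ N' := by
      calc _ ≤ C * |h i (x i)| := h1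
        _ ≤ |C| * |h i (x i)| := by gcongr; exact le_abs_self C
        _ ≤ |C| * (C' * (ς i * w i ^ (N + N'))) := by gcongr; exact hC' i
        _ = _ := by rw [pow_add]; ring
    exact le_of_mul_le_mul_right h2 h0
  have hid : SmoothAt (fun i z => z + h i z) x := fun i => contDiffAt_id.add (hh i)
  induction n generalizing φ with
  | zero => exact jet_zero.2 (h00 hφ)
  | succ n ih =>
    refine jet_succ.2 ⟨h00 hφ, ?_⟩
    have h1 := ih hφ.deriv (hj.mono (Nat.le_succ n))
    have hs := hφ.deriv.smoothAt_right
    have hsx := hφ.deriv.smoothAt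
    have hsΔ : SmoothAt (fun i z => deriv (φ i) (z + h i z) - deriv (φ i) z) x :=
      (SmoothAt.comp (g := fun i z => z + h i z) hs hid).sub hsx
    have h2 : Jet (tameSeq w hw) n (fun i z => deriv (φ i) (z + h i z)) x := by
      have := (h1.mono_group (flat_le_tame (hw := hw) hς)).add hφ.deriv.jet hsΔ hsx
      simpa using this
    have h3 := h1.add (Jet.mul (tame_mul_flat (ς := ς)) h2 (jet_succ.1 hj).2
      (SmoothAt.comp (g := fun i z => z + h i z) hs hid) hh.deriv) hsΔ
      ((SmoothAt.comp (g := fun i z => z + h i z) hs hid).mul hh.deriv)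
    refine h3.congr fun i => ?_
    filter_upwards [eventually_differentiableAt (hφ.smoothAt i),
      (hid i).continuousAt.eventually (eventually_differentiableAt (hφ.smoothAt_right i)),
      eventually_differentiableAt (hh i)] with z hz1 hz2 hz3
    have h4 := ((hz2.hasDerivAt.comp z ((hasDerivAt_id z).add hz3.hasDerivAt)).sub
      hz1.hasDerivAt).deriv
    have h5 : deriv (fun z => φ i (z + h i z) - φ i z) z =
      deriv (φ i) (z + h i z) * (1 + deriv (h i) z) - deriv (φ i) z := h4
    rw [h5]
    ring

lemma abs_le_of_mem_uIcc {v Y : ℝ} (hv : v ∈ uIcc 0 Y) : |v| ≤ |Y| := by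
  simpa using abs_sub_left_of_mem_uIcc hv

lemma abs_exp_sub_one_le_mul (a : ℝ) : |exp a - 1| ≤ |a| * exp |a| := by
  have := abs_sub_le_of_deriv_le (fun v _ => differentiableAt_exp) fun v (hv : v ∈ uIcc 0 a) => by
    rw [Real.deriv_exp, abs_of_pos (exp_pos _), exp_le_exp]
    exact (le_abs_self v).trans (abs_le_of_mem_uIcc hv)
  simpa [mul_comm] using this

lemma jet_exp_sub_one (hw : ∀ i, 0 < w i ∧ w i ≤ 1) (hς : ∀ i, 0 ≤ ς i ∧ ς i ≤ 1)
    (hφ : Jet (flatSeq ς w) n φ x) (hs : SmoothAt φ x) :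
    Jet (flatSeq ς w) n (fun i z => exp (φ i z) - 1) x := by
  have hb := flat_le_bdd hς hφ.val
  have hexp : (fun i => exp (φ i (x i))) ∈ bddSeq ι := exp_bounded hb
  have h0 : (fun i => exp (φ i (x i)) - 1) ∈ flatSeq ς w := by
    obtain ⟨B, hB⟩ := hb
    intro N
    obtain ⟨C, hC⟩ := hφ.val N
    refine ⟨C * exp B, fun i => (abs_exp_sub_one_le_mul _).trans ?_⟩
    calc |φ i (x i)| * exp |φ i (x i)| ≤ (C * (ς i * w i ^ N)) * exp B :=
          mul_le_mul (hC i) (exp_le_exp.2 (hB i)) (exp_pos _).le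
            ((abs_nonneg _).trans (hC i))
      _ = _ := by ring
  cases n with
  | zero => exact jet_zero.2 h0
  | succ n =>
    refine jet_succ.2 ⟨h0, ?_⟩
    have h1 := (jet_succ.1 hφ).2
    have h2 : Jet (bddSeq ι) n (fun i z => exp (φ i z)) x :=
      (Jet.exp mul_mem_bddSeq hexp (h1.mono_group (flat_le_bdd hς)) hs).mono (Nat.le_succ n)
    have h3 := Jet.mul (flat_mul_tame (hw := hw)) h1 (h2.mono_group bdd_le_tame) hs.deriv hs.exp
    refine h3.congr fun i => ?_
    filter_upwards [eventually_differentiableAt (hs i)] with z hz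
    rw [(hz.hasDerivAt.exp.sub_const 1).deriv]
    ring

/-- A displacement `h` that is flat at order zero and solves
`1 + h' = exp (φ - φ ∘ (id + h)) (1 + m)` with `φ` tame and `m` flat is flat at all orders. -/
lemma jet_flat_displacement (hw : ∀ i, 0 < w i ∧ w i ≤ 1) (hς : ∀ i, 0 ≤ ς i ∧ ς i ≤ 1)
    (hh : SmoothAt h x) (hφ : TameOn w x (fun i => x i + h i (x i)) φ) (hms : SmoothAt m x)
    (hm : ∀ n, Jet (flatSeq ς w) n m x) (h0 : (fun i => h i (x i)) ∈ flatSeq ς w)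
    (he : ∀ i, deriv (h i) =ᶠ[𝓝 (x i)]
      fun z => exp (φ i z - φ i (z + h i z)) * (1 + m i z) - 1) (n : ℕ) :
    Jet (flatSeq ς w) n h x := by
  induction n with
  | zero => exact jet_zero.2 h0
  | succ n ih =>
    refine jet_succ.2 ⟨h0, ?_⟩
    have hid : SmoothAt (fun i z => z + h i z) x := fun i => contDiffAt_id.add (hh i)
    have hsc : SmoothAt (fun i z => φ i (z + h i z)) x :=
      SmoothAt.comp (g := fun i z => z + h i z) hφ.smoothAt_right hid
    have hsΔ := hsc.sub hφ.smoothAt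
    have h1 := jet_exp_sub_one hw hς (jet_increment hw hς hh hφ ih).neg hsΔ.neg
    have hone : SmoothAt (fun (_ : ι) (_ : ℝ) => (1 : ℝ)) x := fun i => contDiffAt_const
    have h2 : Jet (tameSeq w hw) n (fun i z => 1 + m i z) x :=
      (jet_const (c := fun _ => 1) (bdd_le_tame ⟨1, by simp⟩)).add
        ((hm n).mono_group (flat_le_tame (hw := hw) hς)) hone hms
    have hse : SmoothAt (fun i z => exp (-(φ i (z + h i z) - φ i z)) - 1) x :=
      hsΔ.neg.exp.sub hone
    have h3 := (Jet.mul (flat_mul_tame (hw := hw)) h1 h2 hse (hone.add hms)).add (hm n)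
      (hse.mul (hone.add hms)) hms
    refine h3.congr fun i => ?_
    grind

end WeightedCalculus

section Squeeze

/-- The logarithmic compression rate of the squeezing homeomorphisms. -/
def squeezeRate (κ y : ℝ) : ℝ := smoothTransition (2 - 2 * y ^ 2) * (y ^ 2 + κ)⁻¹

/-- The squeezing map `y ↦ y exp (-1 / (y ^ 2 + κ))` near `0`, the identity off `(-1, 1)`. -/
def squeezeFun (κ y : ℝ) : ℝ := y * exp (-squeezeRate κ y)

lemma squeezeRate_nonneg {κ : ℝ} (hκ : 0 ≤ κ) (y : ℝ) : 0 ≤ squeezeRate κ y :=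
  mul_nonneg (smoothTransition.nonneg _) (inv_nonneg.2 (by positivity))

lemma squeezeRate_eq_zero {κ y : ℝ} (hy : 1 ≤ |y|) : squeezeRate κ y = 0 := by
  rw [squeezeRate, smoothTransition.zero_of_nonpos, zero_mul]
  simp_all

lemma squeezeFun_eq_self {κ y : ℝ} (hy : 1 ≤ |y|) : squeezeFun κ y = y := by
  rw [squeezeFun, squeezeRate_eq_zero hy]
  simp

lemma squeezeFun_zero (κ : ℝ) : squeezeFun κ 0 = 0 := by simp [squeezeFun]

lemma squeezeRate_neg (κ y : ℝ) : squeezeRate κ (-y) = squeezeRate κ y := by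
  simp [squeezeRate]

lemma squeezeFun_neg (κ y : ℝ) : squeezeFun κ (-y) = -squeezeFun κ y := by
  simp [squeezeFun, squeezeRate_neg]

lemma squeezeRate_anti {κ y y' : ℝ} (hκ : 0 ≤ κ) (hy : y ≠ 0) (h : |y| ≤ |y'|) :
    squeezeRate κ y' ≤ squeezeRate κ y := by
  have h2 : y ^ 2 ≤ y' ^ 2 := sq_le_sq.2 h
  have hpos : 0 < y ^ 2 + κ := by positivity
  refine mul_le_mul (smoothTransition.monotone (by linarith)) ?_ (by positivity)
    (smoothTransition.nonneg _)
  exact inv_anti₀ hpos (by linarith)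

lemma abs_squeezeFun (κ y : ℝ) : |squeezeFun κ y| = |y| * exp (-squeezeRate κ y) := by
  rw [squeezeFun, abs_mul, abs_of_pos (exp_pos _)]

lemma abs_squeezeFun_le {κ : ℝ} (hκ : 0 ≤ κ) (y : ℝ) : |squeezeFun κ y| ≤ |y| := by
  rw [abs_squeezeFun]
  exact mul_le_of_le_one_right (abs_nonneg _)
    (exp_le_one_iff.2 (neg_nonpos.2 (squeezeRate_nonneg hκ y)))

lemma squeezeFun_strictMono {κ : ℝ} (hκ : 0 ≤ κ) : StrictMono (squeezeFun κ) := by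
  have h0 : ∀ y, 0 < y → 0 < squeezeFun κ y := fun y hy => mul_pos hy (exp_pos _)
  have h1 : ∀ y y', 0 ≤ y → y < y' → squeezeFun κ y < squeezeFun κ y' := by
    intro y y' hy hyy
    rcases hy.eq_or_lt with rfl | hy
    · rw [squeezeFun_zero]
      exact h0 _ hyy
    · refine mul_lt_mul hyy ?_ (exp_pos _) (by linarith)
      rw [exp_le_exp, neg_le_neg_iff]
      refine squeezeRate_anti hκ hy.ne' ?_
      grind
  intro y y' hyy
  rcases le_total 0 y with hy | hy
  · exact h1 y y' hy hyy
  · rcases le_total y' 0 with hy' | hy'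
    · have := h1 (-y') (-y) (by linarith) (by linarith)
      rw [squeezeFun_neg, squeezeFun_neg] at this
      linarith
    · have h2 : squeezeFun κ y ≤ 0 :=
        mul_nonpos_of_nonpos_of_nonneg hy (exp_pos _).le
      have h3 : 0 ≤ squeezeFun κ y' := mul_nonneg hy' (exp_pos _).le
      rcases hy.eq_or_lt with rfl | hy
      · exact h1 0 y' le_rfl hyy
      · have : squeezeFun κ y < 0 := mul_neg_of_neg_of_pos hy (exp_pos _)
        linarith

variable {ι : Type*} {κ y w : ι → ℝ}

lemma contDiffAt_squeezeRate {κ y : ℝ} (h : 0 < y ^ 2 + κ) :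
    ContDiffAt ℝ ∞ (squeezeRate κ) y := by
  unfold squeezeRate
  refine ContDiffAt.mul ?_ (ContDiffAt.inv (by fun_prop) h.ne')
  exact smoothTransition.contDiffAt.comp y (by fun_prop)

lemma contDiffAt_squeezeFun {κ y : ℝ} (h : 0 < y ^ 2 + κ) :
    ContDiffAt ℝ ∞ (squeezeFun κ) y :=
  contDiffAt_id.mul (contDiffAt_squeezeRate h).neg.exp

lemma continuous_squeezeFun {κ : ℝ} (hκ : 0 ≤ κ) : Continuous (squeezeFun κ) := by
  rw [continuous_iff_continuousAt]
  intro y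
  by_cases hy : y = 0
  · subst hy
    rw [ContinuousAt, squeezeFun_zero]
    refine squeeze_zero_norm (a := fun y => |y|) (fun y => abs_squeezeFun_le hκ y) ?_
    have : Continuous fun y : ℝ => |y| := continuous_abs
    simpa using this.tendsto 0
  · exact (contDiffAt_squeezeFun (by positivity)).continuousAt

lemma squeezeFun_surjective {κ : ℝ} (hκ : 0 ≤ κ) : Function.Surjective (squeezeFun κ) := by
  refine (continuous_squeezeFun hκ).surjective ?_ ?_
  · refine tendsto_id.congr' ?_
    filter_upwards [eventually_ge_atTop 1] with y hy
    exact (squeezeFun_eq_self (hy.trans (le_abs_self y))).symm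
  · refine tendsto_id.congr' ?_
    filter_upwards [eventually_le_atBot (-1)] with y hy
    have : 1 ≤ |y| := by linarith [neg_le_abs y]
    exact (squeezeFun_eq_self this).symm

/-- Bounds for derivatives of a smooth function along a bounded family of points. -/
lemma bddJet_of_contDiff {f : ℝ → ℝ} (hf : ContDiff ℝ ∞ f) (hy : ∃ C, ∀ i, |y i| ≤ C) :
    BddJet (fun _ => f) y := by
  rw [bddJet_iff]
  intro j
  obtain ⟨C, hC⟩ := hy
  have hc : Continuous (iteratedDeriv j f) := hf.continuous_iteratedDeriv j (natCast_le_infty j)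
  obtain ⟨B, hB⟩ := isCompact_Icc.exists_bound_of_continuousOn (s := Icc (-C) C) hc.continuousOn
  exact ⟨B, fun i => hB _ (abs_le.1 (hC i))⟩

lemma bddSeq_mul_tame {hw : ∀ i, 0 < w i ∧ w i ≤ 1} :
    ∀ a ∈ bddSeq ι, ∀ b ∈ tameSeq w hw, a * b ∈ tameSeq w hw :=
  fun a ha b hb => tame_mul_tame a (bdd_le_tame ha) b hb

lemma squeeze_weight (hκ : ∀ i, 0 ≤ κ i ∧ κ i ≤ 1) (hy : ∀ i, |y i| ≤ 3)
    (hpos : ∀ i, 0 < y i ^ 2 + κ i) (i : ι) :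
    0 < (y i ^ 2 + κ i) / 10 ∧ (y i ^ 2 + κ i) / 10 ≤ 1 := by
  refine ⟨by have := hpos i; positivity, ?_⟩
  have h1 := (hκ i).2
  have h2 : y i ^ 2 ≤ 9 := by
    rw [← sq_abs]
    nlinarith [hy i, abs_nonneg (y i)]
  linarith

lemma jet_squeezeRate (hκ : ∀ i, 0 ≤ κ i ∧ κ i ≤ 1) (hy : ∀ i, |y i| ≤ 3)
    (hpos : ∀ i, 0 < y i ^ 2 + κ i) (n : ℕ) :
    Jet (tameSeq _ (squeeze_weight hκ hy hpos)) n (fun i => squeezeRate (κ i)) y := by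
  set hw := squeeze_weight hκ hy hpos
  have hT : BddJet (fun (_ : ι) (z : ℝ) => smoothTransition (2 - 2 * z ^ 2)) y :=
    bddJet_of_contDiff (smoothTransition.contDiff.comp (by fun_prop)) ⟨3, hy⟩
  have hs : SmoothAt (fun i z => z ^ 2 + κ i) y := fun i => by fun_prop
  have hd : Jet (tameSeq _ hw) n (fun i => deriv fun z => z ^ 2 + κ i) y := by
    have h1 := (bddJet_of_contDiff (f := fun z => 2 * z) (by fun_prop) ⟨3, hy⟩ n).mono_group
      (bdd_le_tame (hw := hw))
    refine h1.congr fun i => Eventually.of_forall fun z => ?_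
    simp
  have hi : Jet (tameSeq _ hw) n (fun i z => (z ^ 2 + κ i)⁻¹) y := by
    refine (Jet.inv tame_mul_tame ⟨1, 1, fun i => ?_⟩ hd hs fun i => (hpos i).ne').mono
      (Nat.le_succ n)
    grind
  refine Jet.mul (bddSeq_mul_tame (hw := hw)) (hT n) hi (fun i => ?_)
    fun i => (hs i).inv (hpos i).ne'
  exact smoothTransition.contDiffAt.comp _ (by fun_prop)

lemma smoothAt_squeezeRate (hpos : ∀ i, 0 < y i ^ 2 + κ i) :
    SmoothAt (fun i => squeezeRate (κ i)) y := fun i => contDiffAt_squeezeRate (hpos i)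

lemma exp_neg_inv_le (N : ℕ) {t : ℝ} (ht : 0 < t) : exp (-t⁻¹) ≤ N.factorial * t ^ N := by
  have h := pow_div_factorial_le_exp t⁻¹ (by positivity) N
  rw [exp_neg]
  rw [div_le_iff₀ (by positivity), inv_pow] at h
  rw [inv_le_iff_one_le_mul₀ (exp_pos _)]
  calc (1 : ℝ) = (t ^ N)⁻¹ * t ^ N := by field_simp
    _ ≤ (exp t⁻¹ * N.factorial) * t ^ N := by gcongr
    _ = _ := by ring

lemma flat_exp_squeezeRate (hκ : ∀ i, 0 ≤ κ i ∧ κ i ≤ 1) (hpos : ∀ i, 0 < y i ^ 2 + κ i) :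
    (fun i => exp (-squeezeRate (κ i) (y i))) ∈
    flatSeq (fun _ => 1) fun i => (y i ^ 2 + κ i) / 10 := by
  intro N
  refine ⟨max (N.factorial * 10 ^ N) (20 ^ N), fun i => ?_⟩
  have h0 := hpos i
  rw [abs_of_pos (exp_pos _), one_mul]
  rcases le_total (y i ^ 2) (1 / 2) with h | h
  · rw [squeezeRate, smoothTransition.one_of_one_le (by linarith), one_mul]
    refine (exp_neg_inv_le N h0).trans ?_
    calc (N.factorial : ℝ) * (y i ^ 2 + κ i) ^ N
        = (N.factorial * 10 ^ N) * ((y i ^ 2 + κ i) / 10) ^ N := by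
          rw [div_pow]
          field_simp
      _ ≤ _ := by bound
  · calc exp (-squeezeRate (κ i) (y i)) ≤ 1 :=
          exp_le_one_iff.2 (neg_nonpos.2 (squeezeRate_nonneg (hκ i).1 _))
      _ ≤ (20 * ((y i ^ 2 + κ i) / 10)) ^ N := by
          refine one_le_pow₀ ?_
          linarith [(hκ i).1]
      _ = 20 ^ N * ((y i ^ 2 + κ i) / 10) ^ N := mul_pow _ _ _
      _ ≤ _ := by bound

lemma jet_exp_squeezeRate (hκ : ∀ i, 0 ≤ κ i ∧ κ i ≤ 1) (hy : ∀ i, |y i| ≤ 3)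
    (hpos : ∀ i, 0 < y i ^ 2 + κ i) (n : ℕ) :
    Jet (flatSeq (fun _ => 1) fun i => (y i ^ 2 + κ i) / 10) n
      (fun i z => exp (-squeezeRate (κ i) z)) y := by
  have h1 := (jet_succ.1 (jet_squeezeRate hκ hy hpos (n + 1)).neg).2
  exact (Jet.exp (f := fun i z => -squeezeRate (κ i) z) flat_mul_tame
    (flat_exp_squeezeRate hκ hpos) h1 (smoothAt_squeezeRate hpos).neg).mono (Nat.le_succ n)

lemma jet_squeezeFun (hκ : ∀ i, 0 ≤ κ i ∧ κ i ≤ 1) (hy : ∀ i, |y i| ≤ 3)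
    (hpos : ∀ i, 0 < y i ^ 2 + κ i) (n : ℕ) :
    Jet (flatSeq (fun _ => 1) fun i => (y i ^ 2 + κ i) / 10) n (fun i => squeezeFun (κ i)) y := by
  have h1 := (bddJet_of_contDiff (f := fun z => z) (by fun_prop) ⟨3, hy⟩ n).mono_group
      (bdd_le_tame (hw := squeeze_weight hκ hy hpos))
  exact Jet.mul tame_mul_flat h1 (jet_exp_squeezeRate hκ hy hpos n) (fun i => contDiffAt_id)
    (smoothAt_squeezeRate hpos).neg.exp

lemma deriv_squeezeFun {κ y : ℝ} (h : 0 < y ^ 2 + κ) :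
    deriv (squeezeFun κ) y =
      exp (-squeezeRate κ y) * (1 - y * deriv (squeezeRate κ) y) := by
  have h1 := ((contDiffAt_squeezeRate h).differentiableAt (by simp)).hasDerivAt
  have h2 := ((hasDerivAt_id y).mul h1.neg.exp).deriv
  have h3 : deriv (squeezeFun κ) y = 1 * exp (-squeezeRate κ y) +
    y * (exp (-squeezeRate κ y) * -deriv (squeezeRate κ) y) := h2
  rw [h3]
  ring

lemma mul_deriv_squeezeRate_nonpos {κ y : ℝ} (h : 0 < y ^ 2 + κ) :
    y * deriv (squeezeRate κ) y ≤ 0 := by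
  have hT : HasDerivAt smoothTransition (deriv smoothTransition (2 - 2 * y ^ 2))
      (2 - 2 * y ^ 2) :=
    (smoothTransition.contDiff (n := 1)).differentiable (by simp) _ |>.hasDerivAt
  have hp : HasDerivAt (fun y : ℝ => 2 - 2 * y ^ 2) (-(4 * y)) y := by
    have := ((hasDerivAt_pow 2 y).const_mul 2).const_sub 2
    refine this.congr_deriv ?_
    norm_num
    ring
  have hq : HasDerivAt (fun y : ℝ => (y ^ 2 + κ)⁻¹) (-(2 * y) / (y ^ 2 + κ) ^ 2) y := by
    have := ((hasDerivAt_pow 2 y).add_const κ).inv h.ne'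
    aesop
  have hd := ((hT.comp y hp).mul hq).deriv
  have hd' : deriv (squeezeRate κ) y = deriv smoothTransition (2 - 2 * y ^ 2) * -(4 * y) *
      (y ^ 2 + κ)⁻¹ + smoothTransition (2 - 2 * y ^ 2) * (-(2 * y) / (y ^ 2 + κ) ^ 2) := hd
  have hT0 : 0 ≤ deriv smoothTransition (2 - 2 * y ^ 2) :=
    smoothTransition.monotone.deriv_nonneg
  have hT1 := smoothTransition.nonneg (2 - 2 * y ^ 2)
  have : y * deriv (squeezeRate κ) y = -(deriv smoothTransition (2 - 2 * y ^ 2) *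
      (4 * y ^ 2) * (y ^ 2 + κ)⁻¹ +
      smoothTransition (2 - 2 * y ^ 2) * (2 * y ^ 2 / (y ^ 2 + κ) ^ 2)) := by
    rw [hd']
    ring
  rw [this, neg_nonpos]
  positivity

lemma deriv_squeezeFun_pos {κ y : ℝ} (h : 0 < y ^ 2 + κ) :
    0 < deriv (squeezeFun κ) y := by
  rw [deriv_squeezeFun h]
  have := mul_deriv_squeezeRate_nonpos h
  exact mul_pos (exp_pos _) (by linarith)

lemma eventually_add_pos {κ y : ℝ} (h : 0 < y ^ 2 + κ) : ∀ᶠ z in 𝓝 y, 0 < z ^ 2 + κ := by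
  have : Continuous fun z : ℝ => z ^ 2 + κ := by fun_prop
  exact this.continuousAt.eventually (lt_mem_nhds h)

/-- The logarithmic derivatives of the squeezing maps are tame. -/
lemma jet_log_deriv_squeezeFun (hκ : ∀ i, 0 ≤ κ i ∧ κ i ≤ 1) (hy : ∀ i, |y i| ≤ 3)
    (hpos : ∀ i, 0 < y i ^ 2 + κ i) (n : ℕ) :
    Jet (tameSeq _ (squeeze_weight hκ hy hpos)) n
      (fun i z => log (deriv (squeezeFun (κ i)) z)) y := by
  set hw := squeeze_weight hκ hy hpos
  have hsr := smoothAt_squeezeRate hpos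
  have hid : SmoothAt (fun (_ : ι) (z : ℝ) => z) y := fun i => contDiffAt_id
  have hone : SmoothAt (fun (_ : ι) (_ : ℝ) => (1 : ℝ)) y := fun i => contDiffAt_const
  have h1 := fun n => (bddJet_of_contDiff (f := fun z => z) (by fun_prop) ⟨3, hy⟩ n).mono_group
      (bdd_le_tame (hw := hw))
  have hsv : SmoothAt (fun i z => 1 - z * deriv (squeezeRate (κ i)) z) y :=
    hone.sub (hid.mul hsr.deriv)
  have hv : ∀ n, Jet (tameSeq _ hw) n (fun i z => 1 - z * deriv (squeezeRate (κ i)) z) y := by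
    intro n
    refine Jet.sub (jet_const (c := fun _ => 1) (bdd_le_tame ⟨1, by simp⟩)) ?_ hone
      (hid.mul hsr.deriv)
    exact Jet.mul tame_mul_tame (h1 n) (jet_succ.1 (jet_squeezeRate hκ hy hpos (n + 1))).2 hid
      hsr.deriv
  have hge : ∀ i, 1 ≤ 1 - y i * deriv (squeezeRate (κ i)) (y i) := fun i => by
    linarith [mul_deriv_squeezeRate_nonpos (hpos i)]
  have hinv : Jet (tameSeq _ hw) n (fun i z => (1 - z * deriv (squeezeRate (κ i)) z)⁻¹) y := by
    refine (Jet.inv tame_mul_tame (bdd_le_tame ⟨1, fun i => ?_⟩) (jet_succ.1 (hv (n + 1))).2 hsv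
      fun i => by linarith [hge i]).mono (Nat.le_succ n)
    rw [abs_of_pos (by have := hge i; positivity)]
    bound
  have hlog : Jet (tameSeq _ hw) (n + 1)
      (fun i z => log (1 - z * deriv (squeezeRate (κ i)) z)) y := by
    refine jet_succ.2 ⟨?_, ?_⟩
    · obtain ⟨N, C, hC⟩ := (hv 0).val
      refine ⟨N, C, fun i => le_trans ?_ (hC i)⟩
      have := hge i
      have hw0 := (hw i).1
      refine mul_le_mul_of_nonneg_right ?_ (by positivity)
      change |log (1 - y i * deriv (squeezeRate (κ i)) (y i))| ≤
        |1 - y i * deriv (squeezeRate (κ i)) (y i)|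
      rw [abs_of_nonneg (log_nonneg this), abs_of_nonneg (by linarith)]
      exact (log_le_sub_one_of_pos (by linarith)).trans (by linarith)
    · refine (Jet.mul tame_mul_tame (jet_succ.1 (hv (n + 1))).2 hinv hsv.deriv
        fun i => (hsv i).inv (by linarith [hge i])).congr fun i => ?_
      filter_upwards [eventually_differentiableAt (hsv i),
        (hsv i).continuousAt.eventually (lt_mem_nhds (show (0 : ℝ) < _ by linarith [hge i]))]
        with z hz1 hz2
      rw [(hz1.hasDerivAt.log hz2.ne').deriv, div_eq_mul_inv]
  have hfin := Jet.add (jet_squeezeRate hκ hy hpos n).neg (hlog.mono (Nat.le_succ n)) hsr.neg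
    fun i => (hsv i).log (by linarith [hge i])
  refine hfin.congr fun i => ?_
  filter_upwards [eventually_add_pos (hpos i)] with z hz
  have := mul_deriv_squeezeRate_nonpos hz
  rw [deriv_squeezeFun hz, log_mul (exp_pos _).ne' (by linarith), log_exp]

end Squeeze

section Flattening

/-- The squeezing homeomorphisms. -/
def squeeze (κ : ℝ) : 𝓐 :=
  (squeezeFun_strictMono (le_max_right κ 0)).orderIsoOfSurjective _
    (squeezeFun_surjective (le_max_right κ 0))

lemma coe_squeeze {κ : ℝ} (hκ : 0 ≤ κ) : (squeeze κ : ℝ → ℝ) = squeezeFun κ := by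
  have : (squeeze κ : ℝ → ℝ) = squeezeFun (max κ 0) := rfl
  rw [this, max_eq_left hκ]

lemma squeeze_apply_zero {κ : ℝ} (hκ : 0 ≤ κ) : squeeze κ 0 = 0 := by
  rw [coe_squeeze hκ, squeezeFun_zero]

lemma squeeze_eq_self {κ y : ℝ} (hκ : 0 ≤ κ) (hy : 1 ≤ |y|) : squeeze κ y = y := by
  rw [coe_squeeze hκ, squeezeFun_eq_self hy]

lemma squeeze_inv_eq_self {κ y : ℝ} (hκ : 0 ≤ κ) (hy : 1 ≤ |y|) : (squeeze κ)⁻¹ y = y := by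
  conv_lhs => rw [← squeeze_eq_self hκ hy]
  simp

lemma isDiffeo_squeeze {κ : ℝ} (hκ : 0 < κ) : IsDiffeo (squeeze κ) := by
  refine ⟨?_, fun x => ?_⟩
  · rw [coe_squeeze hκ.le, contDiff_iff_contDiffAt]
    exact fun y => contDiffAt_squeezeFun (by positivity)
  · rw [coe_squeeze hκ.le]
    exact deriv_squeezeFun_pos (by positivity)

lemma contDiffAt_orderIso_inv {f : 𝓐} {x : ℝ} (hf : ContDiffAt ℝ ∞ f x)
    (h : deriv f x ≠ 0) : ContDiffAt ℝ ∞ (f⁻¹ : 𝓐) (f x) := by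
  have hx : f.toHomeomorph.toOpenPartialHomeomorph.symm (f x) = x := f.symm_apply_apply x
  refine OpenPartialHomeomorph.contDiffAt_symm_deriv f.toHomeomorph.toOpenPartialHomeomorph
    h (mem_univ _) ?_ ?_
  · rw [hx]
    exact (hf.differentiableAt (by simp)).hasDerivAt
  · rw [hx]
    exact hf

lemma abs_sub_mul_le_squeeze {κ y y' : ℝ} (hκ : 0 ≤ κ) (h : 0 < y * y') :
    |y' - y| * exp (-squeezeRate κ y) ≤ |squeezeFun κ y' - squeezeFun κ y| := by
  have hy : y ≠ 0 := by rintro rfl; simp at h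
  have hy' : y' ≠ 0 := by rintro rfl; simp at h
  have key : ∀ a b : ℝ, 0 ≤ a * b → |(|a| - |b|)| = |a - b| := by
    intro a b hab
    rcases mul_nonneg_iff.1 hab with ⟨h1, h2⟩ | ⟨h1, h2⟩
    · grind
    · grind
  have h1 : 0 ≤ squeezeFun κ y' * squeezeFun κ y := by
    rw [squeezeFun, squeezeFun]
    have := (exp_pos (-squeezeRate κ y)).le
    have := (exp_pos (-squeezeRate κ y')).le
    calc 0 ≤ (y * y') * (exp (-squeezeRate κ y') * exp (-squeezeRate κ y)) := by
          positivity
      _ = _ := by ring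
  rw [← key _ _ h1, ← key y' y (by linarith [mul_comm y y']), abs_squeezeFun, abs_squeezeFun]
  have hp := exp_pos (-squeezeRate κ y)
  rcases le_total |y| |y'| with hle | hle
  · have he : exp (-squeezeRate κ y) ≤ exp (-squeezeRate κ y') :=
      exp_le_exp.2 (neg_le_neg (squeezeRate_anti hκ hy hle))
    rw [abs_of_nonneg (by linarith)]
    refine le_trans ?_ (le_abs_self _)
    nlinarith [abs_nonneg y']
  · have he : exp (-squeezeRate κ y') ≤ exp (-squeezeRate κ y) :=
      exp_le_exp.2 (neg_le_neg (squeezeRate_anti hκ hy' hle))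
    rw [abs_of_nonpos (by linarith)]
    refine le_trans ?_ (neg_le_abs _)
    nlinarith [abs_nonneg y']

/-- Conjugation by the inverse of a squeezing map. -/
def flatten (κ : ℝ) (Φ : 𝓐) : 𝓐 := (squeeze κ)⁻¹ * Φ * squeeze κ

lemma squeeze_flatten (κ : ℝ) (Φ : 𝓐) (y : ℝ) :
    squeeze κ (flatten κ Φ y) = Φ (squeeze κ y) := by
  simp [flatten]

lemma flatten_zero {κ : ℝ} (hκ : 0 ≤ κ) {Φ : 𝓐} (h : Φ 0 = 0) : flatten κ Φ 0 = 0 := by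
  apply (squeeze κ).injective
  rw [squeeze_flatten, squeeze_apply_zero hκ, h]

lemma mul_flatten_pos {κ : ℝ} (hκ : 0 ≤ κ) {Φ : 𝓐} (h : Φ 0 = 0) {y : ℝ} (hy : y ≠ 0) :
    0 < y * flatten κ Φ y := by
  rcases hy.lt_or_gt with hy | hy
  · have := (flatten κ Φ).strictMono hy
    rw [flatten_zero hκ h] at this
    nlinarith
  · have := (flatten κ Φ).strictMono hy
    rw [flatten_zero hκ h] at this
    exact mul_pos hy this

lemma abs_flatten_sub_le {κ c y : ℝ} (hκ : 0 ≤ κ) {Φ : 𝓐} (h : Φ 0 = 0)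
    (hc : |Φ (squeeze κ y) - squeeze κ y| ≤ c * |squeeze κ y|) : |flatten κ Φ y - y| ≤ c * |y| := by
  rcases eq_or_ne y 0 with rfl | hy
  · simp [flatten_zero hκ h]
  have h1 := abs_sub_mul_le_squeeze hκ (mul_flatten_pos hκ h hy)
  rw [← coe_squeeze hκ, squeeze_flatten] at h1
  have h2 := h1.trans hc
  rw [coe_squeeze hκ, abs_squeezeFun, ← mul_assoc] at h2
  exact le_of_mul_le_mul_right h2 (exp_pos _)

variable {ι : Type*} {κ y ς : ι → ℝ} {Φ : ι → 𝓐}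

/-- Quantitative closeness to the identity near a fixed point with derivative one. -/
structure NearId (ς : ι → ℝ) (Φ : ι → 𝓐) : Prop where
  isDiffeo : ∀ i, IsDiffeo (Φ i)
  map_zero : ∀ i, Φ i 0 = 0
  deriv_zero : ∀ i, deriv (Φ i) 0 = 1
  half : ∀ i Y, |Y| ≤ 2 → |Φ i Y - Y| ≤ 1 / 2 * |Y|
  bound : ∀ j, ∃ C, ∀ i Y, |Y| ≤ 2 → |iteratedDeriv (j + 2) (Φ i) Y| ≤ C * ς i

lemma NearId.deriv_sub_one (h : NearId ς Φ) :
    ∃ C, ∀ i Y, |Y| ≤ 2 → |deriv (Φ i) Y - 1| ≤ C * ς i * |Y| := by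
  obtain ⟨C, hC⟩ := h.bound 0
  refine ⟨C, fun i Y hY => ?_⟩
  have := abs_sub_le_of_deriv_le (x := 0) (y := Y)
    (fun v _ => (h.isDiffeo i).contDiff_deriv.differentiable (by simp) v)
    fun v hv => by simpa [iteratedDeriv_succ'] using hC i v ((abs_le_of_mem_uIcc hv).trans hY)
  simpa [h.deriv_zero i] using this

lemma NearId.sub_self (h : NearId ς Φ) :
    ∃ C, ∀ i Y, |Y| ≤ 2 → |Φ i Y - Y| ≤ C * ς i * |Y| * |Y| := by
  obtain ⟨C, hC⟩ := h.deriv_sub_one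
  refine ⟨C, fun i Y hY => ?_⟩
  have hd : ∀ v, HasDerivAt (fun v => Φ i v - v) (deriv (Φ i) v - 1) v := fun v =>
    ((h.isDiffeo i).differentiable v).hasDerivAt.sub (hasDerivAt_id v)
  have hCς : 0 ≤ C * ς i := by
    have := (abs_nonneg _).trans (hC i 1 (by norm_num))
    simpa using this
  have := abs_sub_le_of_deriv_le (x := 0) (y := Y) (fun v _ => (hd v).differentiableAt) fun v hv => by
    rw [(hd v).deriv]
    have := abs_le_of_mem_uIcc hv
    exact (hC i v (this.trans hY)).trans (mul_le_mul_of_nonneg_left this hCς)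
  simpa [h.map_zero i] using this

lemma NearId.abs_flatten_sub_le_half (h : NearId ς Φ) {κ : ℝ} (hκ : 0 ≤ κ) (i : ι) {y : ℝ}
    (hy : |y| ≤ 2) : |flatten κ (Φ i) y - y| ≤ 1 / 2 * |y| :=
  abs_flatten_sub_le hκ (h.map_zero i) (h.half i _
    (((coe_squeeze hκ ▸ abs_squeezeFun_le hκ y : |squeeze κ y| ≤ |y|)).trans hy))

lemma sq_le_four_mul_sq {y y' z : ℝ} (h : |y' - y| ≤ 1 / 2 * |y|) (hz : z ∈ uIcc y y') :
    y ^ 2 ≤ 4 * z ^ 2 ∧ |z| ≤ 3 / 2 * |y| := by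
  have h1 : |z - y| ≤ 1 / 2 * |y| := (abs_sub_left_of_mem_uIcc hz).trans h
  have h2 : |y| ≤ 2 * |z| := by grind
  constructor
  · rw [← sq_abs y, ← sq_abs z]
    nlinarith [abs_nonneg y]
  · grind

lemma contDiffAt_flatten {κ y : ℝ} (hκ : 0 ≤ κ) {Φ : 𝓐} (hΦ : IsDiffeo Φ)
    (h0 : 0 < y ^ 2 + κ) (h1 : 0 < flatten κ Φ y ^ 2 + κ) : ContDiffAt ℝ ∞ (flatten κ Φ) y := by
  have e : (flatten κ Φ : ℝ → ℝ) = fun z => (squeeze κ)⁻¹ (Φ (squeeze κ z)) := rfl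
  rw [e]
  have hS : ContDiffAt ℝ ∞ (squeeze κ) y := by
    rw [coe_squeeze hκ]
    exact contDiffAt_squeezeFun h0
  have hS' : ContDiffAt ℝ ∞ (squeeze κ) (flatten κ Φ y) := by
    rw [coe_squeeze hκ]
    exact contDiffAt_squeezeFun h1
  have hi := contDiffAt_orderIso_inv hS' (by
    rw [coe_squeeze hκ]
    exact (deriv_squeezeFun_pos h1).ne')
  rw [squeeze_flatten] at hi
  exact hi.comp y (hΦ.1.contDiffAt.comp y hS)

lemma deriv_flatten_sub {κ y : ℝ} (hκ : 0 ≤ κ) {Φ : 𝓐} (hΦ : IsDiffeo Φ)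
    (h0 : 0 < y ^ 2 + κ) (h1 : 0 < flatten κ Φ y ^ 2 + κ) :
    deriv (fun z => flatten κ Φ z - z) y =
      exp (log (deriv (squeezeFun κ) y) -
        log (deriv (squeezeFun κ) (flatten κ Φ y))) *
        (1 + (deriv Φ (squeeze κ y) - 1)) - 1 := by
  have hf : HasDerivAt (flatten κ Φ) (deriv (flatten κ Φ) y) y :=
    ((contDiffAt_flatten hκ hΦ h0 h1).differentiableAt (by simp)).hasDerivAt
  have hS : HasDerivAt (squeeze κ) (deriv (squeezeFun κ) y) y := by
    rw [coe_squeeze hκ]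
    exact ((contDiffAt_squeezeFun h0).differentiableAt (by simp)).hasDerivAt
  have hS' : HasDerivAt (squeeze κ) (deriv (squeezeFun κ) (flatten κ Φ y)) (flatten κ Φ y) := by
    rw [coe_squeeze hκ]
    exact ((contDiffAt_squeezeFun h1).differentiableAt (by simp)).hasDerivAt
  have e1 := hS'.comp y hf
  have e2 := ((hΦ.differentiable (squeeze κ y)).hasDerivAt).comp y hS
  have e3 : (squeeze κ ∘ flatten κ Φ) = Φ ∘ squeeze κ := funext fun z => squeeze_flatten κ Φ z
  rw [e3] at e1
  have e4 := e1.unique e2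
  have p0 := deriv_squeezeFun_pos h0
  have p1 := deriv_squeezeFun_pos h1
  have e5 : deriv (fun z => flatten κ Φ z - z) y = deriv (flatten κ Φ) y - 1 :=
    (hf.sub (hasDerivAt_id y)).deriv
  rw [e5, ← log_div p0.ne' p1.ne', exp_log (by positivity)]
  field_simp
  linarith

lemma tameOn_log_deriv_squeezeFun (h : NearId ς Φ) (hκ : ∀ i, 0 ≤ κ i ∧ κ i ≤ 1)
    (hy : ∀ i, |y i| ≤ 2) (hpos : ∀ i, 0 < y i ^ 2 + κ i) :
    TameOn (fun i => (y i ^ 2 + κ i) / 10) y (fun i => flatten (κ i) (Φ i) (y i))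
      (fun i z => log (deriv (squeezeFun (κ i)) z)) := by
  have hhalf := fun i => h.abs_flatten_sub_le_half (hκ i).1 i (hy i)
  have hposz : ∀ i, ∀ z ∈ uIcc (y i) (flatten (κ i) (Φ i) (y i)),
      (y i ^ 2 + κ i) / 10 ≤ 4 * ((z ^ 2 + κ i) / 10) := by
    intro i z hz
    have := (sq_le_four_mul_sq (hhalf i) hz).1
    linarith [(hκ i).1]
  refine ⟨fun i z hz => ?_, fun j => ?_⟩
  · have hz' : 0 < z ^ 2 + κ i := by linarith [hposz i z hz, hpos i]
    exact (contDiffAt_deriv (contDiffAt_squeezeFun hz')).log (deriv_squeezeFun_pos hz').ne'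
  · let J := {p : ι × ℝ // p.2 ∈ uIcc (y p.1) (flatten (κ p.1) (Φ p.1) (y p.1))}
    obtain ⟨N, C, hC⟩ := jet_log_deriv_squeezeFun (ι := J) (κ := fun p => κ p.1.1)
      (y := fun p => p.1.2) (fun p => hκ _)
      (fun p => (sq_le_four_mul_sq (hhalf p.1.1) p.2).2.trans (by linarith [hy p.1.1]))
      (fun p => by linarith [hposz p.1.1 p.1.2 p.2, hpos p.1.1]) j j le_rfl
    refine ⟨N, 4 ^ N * C, fun i z hz => ?_⟩
    have h0 := hpos i
    calc _ ≤ |iteratedDeriv j (fun z => log (deriv (squeezeFun (κ i)) z)) z| *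
          (4 * ((z ^ 2 + κ i) / 10)) ^ N := by
          gcongr
          exact hposz i z hz
      _ = 4 ^ N * (|iteratedDeriv j (fun z => log (deriv (squeezeFun (κ i)) z)) z| *
          ((z ^ 2 + κ i) / 10) ^ N) := by
          rw [mul_pow]
          ring
      _ ≤ 4 ^ N * C := by aesop

/-- The displacement of the flattened family is flat, uniformly in the parameters. -/
lemma jet_flatten (h : NearId ς Φ) (hς : ∀ i, 0 ≤ ς i ∧ ς i ≤ 1) (hκ : ∀ i, 0 ≤ κ i ∧ κ i ≤ 1)
    (hy : ∀ i, |y i| ≤ 2) (hpos : ∀ i, 0 < y i ^ 2 + κ i) (n : ℕ) :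
    Jet (flatSeq ς fun i => (y i ^ 2 + κ i) / 10) n (fun i z => flatten (κ i) (Φ i) z - z) y := by
  have hy3 : ∀ i, |y i| ≤ 3 := fun i => (hy i).trans (by norm_num)
  have hw := squeeze_weight hκ hy3 hpos
  have hhalf := fun i => h.abs_flatten_sub_le_half (hκ i).1 i (hy i)
  have hadd : ∀ i, y i + (flatten (κ i) (Φ i) (y i) - y i) = flatten (κ i) (Φ i) (y i) :=
    fun i => by ring
  have hposz : ∀ i, ∀ z ∈ uIcc (y i) (flatten (κ i) (Φ i) (y i)),
      (y i ^ 2 + κ i) / 10 ≤ 4 * ((z ^ 2 + κ i) / 10) := by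
    intro i z hz
    have := (sq_le_four_mul_sq (hhalf i) hz).1
    linarith [(hκ i).1]
  have hpos' : ∀ i, 0 < flatten (κ i) (Φ i) (y i) ^ 2 + κ i := fun i => by
    have := hposz i _ right_mem_uIcc
    linarith [hpos i]
  have hsm : ∀ i, ContDiffAt ℝ ∞ (flatten (κ i) (Φ i)) (y i) := fun i =>
    contDiffAt_flatten (hκ i).1 (h.isDiffeo i) (hpos i) (hpos' i)
  have hSs : SmoothAt (fun i => squeezeFun (κ i)) y := fun i => contDiffAt_squeezeFun (hpos i)
  have hSle : ∀ i, |squeezeFun (κ i) (y i)| ≤ 2 := fun i =>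
    (abs_squeezeFun_le (hκ i).1 _).trans (hy i)
  have hd1 : ∀ n, Jet (smallSeq ς) n (fun i => deriv (deriv (Φ i)))
      fun i => squeezeFun (κ i) (y i) := by
    intro n j _
    obtain ⟨C, hC⟩ := h.bound j
    refine ⟨C, fun i => ?_⟩
    simpa [iteratedDeriv_succ'] using hC i _ (hSle i)
  have hsm1 : SmoothAt (fun i => deriv (Φ i)) (fun i => squeezeFun (κ i) (y i)) :=
    fun i => (h.isDiffeo i).contDiff_deriv.contDiffAt
  have hone : SmoothAt (fun (_ : ι) (_ : ℝ) => (1 : ℝ)) y := fun i => contDiffAt_const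
  have hsm2 : SmoothAt (fun i z => deriv (Φ i) (squeezeFun (κ i) z) - 1) y :=
    (SmoothAt.comp hsm1 hSs).sub hone
  have hflat1 : flatSeq (fun _ => 1) (fun i => (y i ^ 2 + κ i) / 10) ≤ bddSeq ι := by
    refine flat_le_bdd (w := fun i => (y i ^ 2 + κ i) / 10) ?_
    simp
  refine jet_flat_displacement (φ := fun i z => log (deriv (squeezeFun (κ i)) z))
    (m := fun i z => deriv (Φ i) (squeezeFun (κ i) z) - 1) hw hς
    (h := fun i z => flatten (κ i) (Φ i) z - z) (fun i => (hsm i).sub contDiffAt_id) ?_ hsm2 ?_ ?_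
    ?_ n
  · simp only [hadd]
    exact tameOn_log_deriv_squeezeFun h hκ hy hpos
  · intro n
    cases n with
    | zero =>
      rw [jet_zero]
      obtain ⟨C, hC⟩ := h.deriv_sub_one
      intro N
      obtain ⟨C', hC'⟩ := (jet_squeezeFun hκ hy3 hpos 0).val N
      refine ⟨|C| * C', fun i => (hC i _ (hSle i)).trans ?_⟩
      have h0 := (hς i).1
      calc C * ς i * |squeezeFun (κ i) (y i)| ≤ |C| * ς i * (C' * (1 * ((y i ^ 2 + κ i) / 10) ^ N)) := by
            bound
        _ = _ := by ring
    | succ n =>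
      refine jet_succ.2 ⟨?_, ?_⟩
      · obtain ⟨C, hC⟩ := h.deriv_sub_one
        intro N
        obtain ⟨C', hC'⟩ := (jet_squeezeFun hκ hy3 hpos 0).val N
        refine ⟨|C| * C', fun i => (hC i _ (hSle i)).trans ?_⟩
        have h0 := (hς i).1
        calc C * ς i * |squeezeFun (κ i) (y i)|
            ≤ |C| * ς i * (C' * (1 * ((y i ^ 2 + κ i) / 10) ^ N)) := by bound
          _ = _ := by ring
      · have hS' := (jet_succ.1 (jet_squeezeFun hκ hy3 hpos (n + 1))).2
        have hsmall : ∀ a ∈ smallSeq ς, ∀ b ∈ bddSeq ι, a * b ∈ smallSeq ς := by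
          rintro a ⟨C, hC⟩ b ⟨C', hC'⟩
          refine ⟨C * C', fun i => ?_⟩
          rw [Pi.mul_apply, abs_mul]
          calc |a i| * |b i| ≤ (C * ς i) * C' :=
                mul_le_mul (hC i) (hC' i) (abs_nonneg _) ((abs_nonneg _).trans (hC i))
            _ = _ := by ring
        have hc := Jet.comp' (g := fun i => squeezeFun (κ i)) hsmall (hd1 n)
          (hS'.mono_group hflat1) hsm1.deriv hSs
        refine (Jet.mul small_mul_flat hc hS' (SmoothAt.comp hsm1.deriv hSs) hSs.deriv).congr
          fun i => ?_
        filter_upwards [eventually_differentiableAt (hSs i)] with z hz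
        have := ((((h.isDiffeo i).contDiff_deriv.differentiable (by simp) _).hasDerivAt.comp z
          hz.hasDerivAt).sub_const 1).deriv
        exact this
  · obtain ⟨C, hC⟩ := h.sub_self
    intro N
    obtain ⟨C', hC'⟩ := (jet_squeezeFun hκ hy3 hpos 0).val N
    refine ⟨|C| * C' * 2, fun i => ?_⟩
    have h0 := (hς i).1
    have := hC i (squeeze (κ i) (y i)) (coe_squeeze (hκ i).1 ▸ hSle i)
    refine (abs_flatten_sub_le (hκ i).1 (h.map_zero i) this).trans ?_
    rw [coe_squeeze (hκ i).1]
    have hb : 0 ≤ C' * (1 * ((y i ^ 2 + κ i) / 10) ^ N) := (abs_nonneg _).trans (hC' i)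
    calc C * ς i * |squeezeFun (κ i) (y i)| * |y i|
        ≤ |C| * ς i * (C' * (1 * ((y i ^ 2 + κ i) / 10) ^ N)) * 2 := by bound
      _ = _ := by ring
  · intro i
    have hc := (hsm i).continuousAt
    have hcc : ContinuousAt (fun z => flatten (κ i) (Φ i) z ^ 2 + κ i) (y i) :=
      (hc.pow 2).add continuousAt_const
    filter_upwards [eventually_add_pos (hpos i), hcc.eventually (lt_mem_nhds (hpos' i))]
      with z hz hz'
    rw [deriv_flatten_sub (hκ i).1 (h.isDiffeo i) hz hz', coe_squeeze (hκ i).1]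
    simp only [add_sub_cancel]

end Flattening

section Placement

lemma abs_log_deriv_flatten_sub_le {ι : Type*} {κ y ς : ι → ℝ} {Φ : ι → 𝓐}
    (h : NearId ς Φ) (hς : ∀ i, 0 ≤ ς i ∧ ς i ≤ 1) (hκ : ∀ i, 0 ≤ κ i ∧ κ i ≤ 1)
    (hy : ∀ i, |y i| ≤ 2) (hpos : ∀ i, 0 < y i ^ 2 + κ i) :
    ∃ C, ∀ i, |log (deriv (flatten (κ i) (Φ i)) (y i)) -
      log (deriv (Φ i) (squeeze (κ i) (y i)))| ≤ C := by
  have hw := squeeze_weight hκ (fun i => (hy i).trans (by norm_num)) hpos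
  obtain ⟨N, C, hC⟩ := tameOn_increment hw (tameOn_log_deriv_squeezeFun h hκ hy hpos)
  obtain ⟨C', hC'⟩ := (jet_flatten h hς hκ hy hpos 0).val N
  refine ⟨|C| * |C'|, fun i => ?_⟩
  have hpos' : 0 < flatten (κ i) (Φ i) (y i) ^ 2 + κ i := by
    have := (sq_le_four_mul_sq (h.abs_flatten_sub_le_half (hκ i).1 i (hy i))
      (right_mem_uIcc (a := y i))).1
    grind
  have e := deriv_flatten_sub (hκ i).1 (h.isDiffeo i) (hpos i) hpos'
  have hsm := (contDiffAt_flatten (hκ i).1 (h.isDiffeo i) (hpos i) hpos').differentiableAt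
    (by simp)
  rw [show deriv (fun z => flatten (κ i) (Φ i) z - z) (y i) = deriv (flatten (κ i) (Φ i)) (y i) - 1
    from (hsm.hasDerivAt.sub (hasDerivAt_id _)).deriv] at e
  have e2 : deriv (flatten (κ i) (Φ i)) (y i) =
      exp (log (deriv (squeezeFun (κ i)) (y i)) -
        log (deriv (squeezeFun (κ i)) (flatten (κ i) (Φ i) (y i)))) *
        deriv (Φ i) (squeeze (κ i) (y i)) := by linarith
  rw [e2, log_mul (exp_pos _).ne' ((h.isDiffeo i).2 _).ne', log_exp,
    add_sub_cancel_right, abs_sub_comm]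
  have h1 := hC i (y i) left_mem_uIcc _ right_mem_uIcc
  have h2 := hC' i
  have hp : 0 < ((y i ^ 2 + κ i) / 10) ^ N := pow_pos (hw i).1 N
  refine le_of_mul_le_mul_right (h1.trans ?_) hp
  calc C * |flatten (κ i) (Φ i) (y i) - y i| ≤ |C| * (|C'| * (1 * ((y i ^ 2 + κ i) / 10) ^ N)) := by
        refine mul_le_mul (le_abs_self C) (h2.trans ?_) (abs_nonneg _) (abs_nonneg _)
        refine mul_le_mul (le_abs_self C') ?_ (mul_nonneg (hς i).1 hp.le) (abs_nonneg _)
        exact mul_le_mul_of_nonneg_right (hς i).2 hp.le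
    _ = _ := by ring

lemma abs_squeeze_sub_le {κ δ : ℝ} (hκ : 0 ≤ κ) (hδ : 0 < δ) (h : κ ≤ δ ^ 4) (y : ℝ) :
    |squeeze κ y - squeeze 0 y| ≤ 2 * δ := by
  rw [coe_squeeze hκ, coe_squeeze le_rfl]
  rcases le_total |y| δ with hy | hy
  · have := abs_squeezeFun_le hκ y
    have := abs_squeezeFun_le le_rfl y
    grind
  · have hy2 : δ ^ 2 ≤ y ^ 2 := by
      rw [← sq_abs y]
      gcongr
    have hy0 : 0 < y ^ 2 := (pow_pos hδ 2).trans_le hy2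
    have hs0 := smoothTransition.nonneg (2 - 2 * y ^ 2)
    have hs1 := smoothTransition.le_one (2 - 2 * y ^ 2)
    have e : squeezeRate 0 y - squeezeRate κ y =
        smoothTransition (2 - 2 * y ^ 2) * (κ / (y ^ 2 * (y ^ 2 + κ))) := by
      have h1 : y ^ 2 + κ ≠ 0 := by positivity
      simp only [squeezeRate, add_zero]
      rw [div_eq_mul_inv, mul_inv]
      have e1 : (y ^ 2)⁻¹ - (y ^ 2 + κ)⁻¹ = κ * ((y ^ 2)⁻¹ * (y ^ 2 + κ)⁻¹) := by grind
      rw [← e1]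
      ring
    have h1 : 0 ≤ squeezeRate 0 y - squeezeRate κ y := by
      rw [e]
      positivity
    have h2 : squeezeRate 0 y - squeezeRate κ y ≤ κ / (y ^ 2 * (y ^ 2 + κ)) := by
      rw [e]
      exact mul_le_of_le_one_left (by positivity) hs1
    have h3 : |exp (-squeezeRate κ y) - exp (-squeezeRate 0 y)| ≤
        κ / (y ^ 2 * (y ^ 2 + κ)) := by
      have a1 : exp (-squeezeRate κ y) ≤ 1 :=
        exp_le_one_iff.2 (neg_nonpos.2 (squeezeRate_nonneg hκ y))
      have a2 : exp (-squeezeRate 0 y) =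
          exp (-squeezeRate κ y) * exp (-(squeezeRate 0 y - squeezeRate κ y)) := by
        rw [← exp_add]
        congr 1
        ring
      have a3 := add_one_le_exp (-(squeezeRate 0 y - squeezeRate κ y))
      have a4 : exp (-(squeezeRate 0 y - squeezeRate κ y)) ≤ 1 :=
        exp_le_one_iff.2 (neg_nonpos.2 h1)
      rw [a2, abs_of_nonneg]
      · have := exp_pos (-squeezeRate κ y)
        nlinarith
      · have := exp_pos (-squeezeRate κ y)
        nlinarith
    have e2 : squeezeFun κ y - squeezeFun 0 y =
        y * (exp (-squeezeRate κ y) - exp (-squeezeRate 0 y)) := by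
      simp only [squeezeFun]
      ring
    rw [e2, abs_mul]
    refine (mul_le_mul_of_nonneg_left h3 (abs_nonneg y)).trans ?_
    rw [← mul_div_assoc, div_le_iff₀ (by positivity)]
    have hy' : 0 < |y| := hδ.trans_le hy
    have b1 : δ ^ 3 ≤ |y| ^ 3 := by gcongr
    have b2 : y ^ 2 * (y ^ 2 + κ) ≥ |y| * |y| ^ 3 := by
      have : |y| * |y| ^ 3 = y ^ 2 * y ^ 2 := by grind
      simp_all
    calc |y| * κ ≤ |y| * δ ^ 4 := by gcongr
      _ = δ * (|y| * δ ^ 3) := by ring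
      _ ≤ δ * (|y| * |y| ^ 3) := by gcongr
      _ ≤ δ * (y ^ 2 * (y ^ 2 + κ)) := by gcongr
      _ ≤ 2 * δ * (y ^ 2 * (y ^ 2 + κ)) := by bound

lemma continuous_orderIso (f : 𝓐) : Continuous f := f.toHomeomorph.continuous

lemma uniformContinuous_of_eq_self_off {f : 𝓐} {M : ℝ} (h : ∀ x, M ≤ |x| → f x = x) :
    UniformContinuous f := by
  have hc : HasCompactSupport fun x => f x - x :=
    HasCompactSupport.intro (isCompact_Icc (a := -M) (b := M)) fun x hx => by grind
  have := (hc.uniformContinuous_of_continuous ((continuous_orderIso f).sub continuous_id)).add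
    uniformContinuous_id
  simpa using this

lemma abs_flatten_sub_flatten_zero {L ε : ℝ} (hε : 0 < ε) :
    ∃ κ₀ > 0, ∀ κ, 0 ≤ κ → κ ≤ κ₀ → ∀ Φ : 𝓐, (∀ u v, |Φ u - Φ v| ≤ L * |u - v|) →
      ∀ y, |flatten κ Φ y - flatten 0 Φ y| ≤ ε := by
  have huc := uniformContinuous_of_eq_self_off (f := (squeeze 0)⁻¹) (M := 1)
    fun x hx => squeeze_inv_eq_self le_rfl hx
  obtain ⟨ρ, hρ, hρ'⟩ := Metric.uniformContinuous_iff.1 huc (ε / 2) (by linarith)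
  simp only [dist_eq] at hρ'
  have hL : 0 < |L| + 1 := by positivity
  obtain ⟨δ, hδ0, hδ⟩ : ∃ δ > 0, 2 * δ * (|L| + 1) < ρ := by
    refine ⟨ρ / (4 * (|L| + 1)), by positivity, ?_⟩
    field_simp
    linarith
  refine ⟨δ ^ 4, by positivity, fun κ hκ hκ' Φ hΦ y => ?_⟩
  have hs := abs_squeeze_sub_le hκ hδ0 hκ'
  have hinv : ∀ u, |(squeeze κ)⁻¹ u - (squeeze 0)⁻¹ u| < ε / 2 := by
    intro u
    have h1 := hs ((squeeze κ)⁻¹ u)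
    rw [apply_inv_self, abs_sub_comm] at h1
    have h2 := hρ' (a := squeeze 0 ((squeeze κ)⁻¹ u)) (b := u) (by
      refine h1.trans_lt (lt_of_le_of_lt ?_ hδ)
      nlinarith [abs_nonneg L])
    simp_all
  have h3 : |Φ (squeeze κ y) - Φ (squeeze 0 y)| < ρ := by
    refine ((hΦ _ _).trans ?_).trans_lt hδ
    calc L * |squeeze κ y - squeeze 0 y| ≤ (|L| + 1) * (2 * δ) := by
          refine mul_le_mul (by linarith [le_abs_self L]) (hs y) (abs_nonneg _) hL.le
      _ = _ := by ring
  have h4 := hρ' h3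
  have h5 := hinv (Φ (squeeze κ y))
  have e : flatten κ Φ y - flatten 0 Φ y =
      ((squeeze κ)⁻¹ (Φ (squeeze κ y)) - (squeeze 0)⁻¹ (Φ (squeeze κ y))) +
      ((squeeze 0)⁻¹ (Φ (squeeze κ y)) - (squeeze 0)⁻¹ (Φ (squeeze 0 y))) := by
    simp [flatten]
  rw [e]
  refine (abs_add_le _ _).trans ?_
  linarith

/-- The affine map `y ↦ z + η * y`. -/
def affine (z η : ℝ) : 𝓐 :=
  OrderIso.addLeft z * if h : 0 < η then OrderIso.mulLeft₀ η h else 1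

lemma affine_apply {z η : ℝ} (hη : 0 < η) (y : ℝ) : affine z η y = z + η * y := by
  simp [affine, hη]

lemma affine_inv_apply {z η : ℝ} (hη : 0 < η) (x : ℝ) : (affine z η)⁻¹ x = (x - z) / η := by
  apply (affine z η).injective
  rw [apply_inv_self, affine_apply hη]
  field_simp
  ring

lemma coe_affine {z η : ℝ} (hη : 0 < η) : (affine z η : ℝ → ℝ) = fun y => z + η * y :=
  funext fun y => affine_apply hη y

lemma deriv_affine {z η : ℝ} (hη : 0 < η) (y : ℝ) : deriv (affine z η) y = η := by
  rw [coe_affine hη]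
  simp

lemma isDiffeo_affine {z η : ℝ} (hη : 0 < η) : IsDiffeo (affine z η) := by
  refine ⟨?_, fun x => ?_⟩
  · rw [coe_affine hη]
    fun_prop
  · rwa [deriv_affine hη]

/-- The map `Φ` seen in the coordinate `y` of `z + η * y`. -/
def rescale (z η : ℝ) (Φ : 𝓐) : 𝓐 := (affine z η)⁻¹ * Φ * affine z η

lemma rescale_apply {z η : ℝ} (hη : 0 < η) (Φ : 𝓐) (y : ℝ) :
    rescale z η Φ y = (Φ (z + η * y) - z) / η := by
  rw [rescale, mul_apply, mul_apply, affine_apply hη, affine_inv_apply hη]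

lemma isDiffeo_rescale {z η : ℝ} (hη : 0 < η) {Φ : 𝓐} (h : IsDiffeo Φ) :
    IsDiffeo (rescale z η Φ) :=
  ((isDiffeo_affine hη).inv.mul h).mul (isDiffeo_affine hη)

lemma iteratedDeriv_comp_affine {f : ℝ → ℝ} (hf : ContDiff ℝ ∞ f) (z η : ℝ) (k : ℕ) (y : ℝ) :
    iteratedDeriv k (fun t => f (z + η * t)) y = η ^ k * iteratedDeriv k f (z + η * y) := by
  have h1 : ContDiff ℝ ∞ fun t => f (z + t) := hf.comp (contDiff_const.add contDiff_id)
  rw [iteratedDeriv_comp_const_mul (f := fun t => f (z + t)) (h1.of_le (natCast_le_infty k)) η,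
    iteratedDeriv_comp_const_add]

/-- The displacement of a map. -/
def disp (F : 𝓐) (x : ℝ) : ℝ := F x - x

lemma iteratedDeriv_disp {F : 𝓐} {x : ℝ} {k : ℕ} (hF : ContDiffAt ℝ ∞ F x) :
    iteratedDeriv k (disp F) x = iteratedDeriv k F x - iteratedDeriv k id x :=
  iteratedDeriv_sub (hF.of_le (natCast_le_infty k)) contDiffAt_id

lemma IsDiffeo.contDiff_disp {F : 𝓐} (hF : IsDiffeo F) : ContDiff ℝ ∞ (disp F) :=
  hF.1.sub contDiff_id

lemma iteratedDeriv_disp_rescale {z η : ℝ} (hη : 0 < η) {Φ : 𝓐} (h : IsDiffeo Φ) (k : ℕ)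
    (y : ℝ) : iteratedDeriv k (disp (rescale z η Φ)) y =
      η⁻¹ * η ^ k * iteratedDeriv k (disp Φ) (z + η * y) := by
  have e : disp (rescale z η Φ) = fun t => η⁻¹ * disp Φ (z + η * t) := by
    funext t
    rw [disp, rescale_apply hη, disp]
    field_simp
    ring
  rw [e, iteratedDeriv_const_mul_field, iteratedDeriv_comp_affine h.contDiff_disp, mul_assoc]

lemma iteratedDeriv_add_two_disp {F : 𝓐} (hF : IsDiffeo F) (j : ℕ) :
    iteratedDeriv (j + 2) (disp F) = iteratedDeriv (j + 2) F := by
  funext x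
  rw [iteratedDeriv_disp hF.1.contDiffAt]
  have : iteratedDeriv (j + 2) (id : ℝ → ℝ) = 0 := by
    rw [iteratedDeriv_succ', iteratedDeriv_succ']
    funext t
    simp
  simp [this]

end Placement

section SqueezeSystems

/-- A family of homeomorphisms acting near each point of `Z` as a copy of `squeeze κ` at scale `η`,
and trivially elsewhere. -/
structure SqueezeSystem (Z : Set ℝ) (η : ℝ) (H : ℝ → 𝓐) : Prop where
  pos : 0 < η
  near : ∀ κ, 0 ≤ κ → ∀ z ∈ Z, ∀ y, |y| ≤ 3 → H κ (z + η * y) = z + η * squeeze κ y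
  far : ∀ κ, 0 ≤ κ → ∀ x, (∀ z ∈ Z, η ≤ |x - z|) → H κ x = x

/-- A diffeomorphism close to the identity at scale `η` near a fixed point `z` with
derivative one. -/
structure FlattenableAt (z η : ℝ) (Φ : 𝓐) : Prop where
  isDiffeo : IsDiffeo Φ
  map_self : Φ z = z
  deriv_self : deriv Φ z = 1
  quarter : ∀ y, |y| ≤ 2 → |Φ (z + η * y) - (z + η * y)| ≤ η * (1 / 4 * |y|)

variable {Z : Set ℝ} {z η κ : ℝ} {H : ℝ → 𝓐} {Φ : 𝓐}

lemma abs_squeeze_inv_le (hκ : 0 ≤ κ) (u : ℝ) : |(squeeze κ)⁻¹ u| ≤ max 1 |u| := by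
  by_contra! h
  have h1 := squeeze_eq_self hκ ((le_max_left _ _).trans h.le)
  rw [apply_inv_self] at h1
  grind

lemma SqueezeSystem.inv_near (h : SqueezeSystem Z η H) (hκ : 0 ≤ κ) (hz : z ∈ Z) {u : ℝ}
    (hu : |u| ≤ 3) : (H κ)⁻¹ (z + η * u) = z + η * (squeeze κ)⁻¹ u := by
  apply (H κ).injective
  rw [h.near κ hκ z hz _ ((abs_squeeze_inv_le hκ u).trans (max_le (by norm_num) hu)),
    apply_inv_self, apply_inv_self]

lemma SqueezeSystem.inv_far (h : SqueezeSystem Z η H) (hκ : 0 ≤ κ) {x : ℝ}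
    (hx : ∀ z ∈ Z, η ≤ |x - z|) : (H κ)⁻¹ x = x := by
  apply (H κ).injective
  rw [apply_inv_self, h.far κ hκ x hx]

lemma FlattenableAt.rescale_quarter (h : FlattenableAt z η Φ) (hη : 0 < η) {y : ℝ}
    (hy : |y| ≤ 2) : |rescale z η Φ y - y| ≤ 1 / 4 * |y| := by
  have e : rescale z η Φ y - y = (Φ (z + η * y) - (z + η * y)) / η := by
    rw [rescale_apply hη]
    field_simp
    ring
  rw [e, abs_div, abs_of_pos hη, div_le_iff₀ hη]
  linarith [h.quarter y hy]

lemma SqueezeSystem.conj_near (h : SqueezeSystem Z η H) (hκ : 0 ≤ κ) (hz : z ∈ Z)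
    (hΦ : FlattenableAt z η Φ) {y : ℝ} (hy : |y| ≤ 2) :
    ((H κ)⁻¹ * Φ * H κ) (z + η * y) = z + η * flatten κ (rescale z η Φ) y := by
  have hS : |squeeze κ y| ≤ 2 := by
    rw [coe_squeeze hκ]
    exact (abs_squeezeFun_le hκ y).trans hy
  have hR := hΦ.rescale_quarter h.pos hS
  have hR' : |rescale z η Φ (squeeze κ y)| ≤ 3 := by grind
  have e : Φ (z + η * squeeze κ y) = z + η * rescale z η Φ (squeeze κ y) := by
    rw [rescale_apply h.pos]
    have := h.pos.ne'
    field_simp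
    ring
  rw [mul_apply, mul_apply, h.near κ hκ z hz y (by linarith), e,
    h.inv_near hκ hz hR']
  rfl

lemma FlattenableAt.le_abs_sub (h : FlattenableAt z η Φ) (hη : 0 < η) {x : ℝ}
    (hx : 8 / 5 * η ≤ |x - z|) : η ≤ |Φ x - z| := by
  rcases le_total z x with hzx | hzx
  · rw [abs_of_nonneg (sub_nonneg.2 hzx)] at hx
    have h1 := Φ.monotone (show z + η * (8 / 5) ≤ x by linarith)
    have h2 := neg_le_of_abs_le (h.quarter (8 / 5) (by norm_num [abs_of_pos]))
    grind
  · rw [abs_of_nonpos (sub_nonpos.2 hzx)] at hx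
    have h1 := Φ.monotone (show x ≤ z + η * (-(8 / 5)) by linarith)
    have h2 := le_of_abs_le (h.quarter (-(8 / 5)) (by norm_num [abs_of_pos]))
    rw [abs_neg, abs_of_pos (by norm_num : (0 : ℝ) < 8 / 5)] at h2
    grind

lemma SqueezeSystem.conj_far (h : SqueezeSystem Z η H) (hκ : 0 ≤ κ)
    (hΦ : ∀ z ∈ Z, FlattenableAt z η Φ) {x : ℝ} (hx : ∀ z ∈ Z, 8 / 5 * η ≤ |x - z|) :
    ((H κ)⁻¹ * Φ * H κ) x = Φ x := by
  have hη := h.pos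
  rw [mul_apply, mul_apply, h.far κ hκ x fun z hz => by linarith [hx z hz],
    h.inv_far hκ fun z hz => (hΦ z hz).le_abs_sub hη (hx z hz)]

lemma SqueezeSystem.conj_eventuallyEq_far (h : SqueezeSystem Z η H) (hκ : 0 ≤ κ)
    (hΦ : ∀ z ∈ Z, FlattenableAt z η Φ) {x : ℝ} (hx : ∀ z ∈ Z, 2 * η ≤ |x - z|) :
    ((H κ)⁻¹ * Φ * H κ : 𝓐) =ᶠ[𝓝 x] Φ := by
  have hη := h.pos
  filter_upwards [Metric.ball_mem_nhds x (by linarith : 0 < 2 / 5 * η)] with x' hx'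
  refine h.conj_far hκ hΦ fun z hz => ?_
  have h1 := hx z hz
  have h2 := abs_sub_le x x' z
  rw [Metric.mem_ball, dist_eq, abs_sub_comm] at hx'
  linarith

lemma SqueezeSystem.conj_eventuallyEq_near (h : SqueezeSystem Z η H) (hκ : 0 ≤ κ) (hz : z ∈ Z)
    (hΦ : FlattenableAt z η Φ) {y : ℝ} (hy : |y| < 2) :
    ((H κ)⁻¹ * Φ * H κ : 𝓐) =ᶠ[𝓝 (z + η * y)]
      (affine z η * flatten κ (rescale z η Φ) * (affine z η)⁻¹ : 𝓐) := by
  have hη := h.pos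
  have hc : ContinuousAt (fun x => |(x - z) / η|) (z + η * y) := by fun_prop
  have hv : |(z + η * y - z) / η| < 2 := by grind
  filter_upwards [hc.eventually_lt_const hv] with x hx
  have e : z + η * ((x - z) / η) = x := by field_simp; ring
  have h1 := h.conj_near hκ hz hΦ hx.le
  rw [e] at h1
  rw [h1, mul_apply (affine z η * _), mul_apply (affine z η), affine_inv_apply hη,
    affine_apply hη]

lemma rescale_affine_conj (Ψ : 𝓐) :
    rescale z η (affine z η * Ψ * (affine z η)⁻¹) = Ψ := by
  simp only [rescale]
  group

lemma isDiffeo_flatten (hκ : 0 < κ) (h : IsDiffeo Φ) : IsDiffeo (flatten κ Φ) :=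
  ((isDiffeo_squeeze hκ).inv.mul h).mul (isDiffeo_squeeze hκ)

lemma SqueezeSystem.iteratedDeriv_disp_conj (h : SqueezeSystem Z η H) (hκ : 0 < κ) (hz : z ∈ Z)
    (hΦ : FlattenableAt z η Φ) {y : ℝ} (hy : |y| < 2) (k : ℕ) :
    η⁻¹ * η ^ k * iteratedDeriv k (disp ((H κ)⁻¹ * Φ * H κ)) (z + η * y) =
      iteratedDeriv k (disp (flatten κ (rescale z η Φ))) y := by
  have hη := h.pos
  have hd := isDiffeo_flatten hκ (isDiffeo_rescale (z := z) hη hΦ.isDiffeo)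
  have h1 := iteratedDeriv_disp_rescale (z := z) hη ((hd.conj (isDiffeo_affine (z := z) hη))) k y
  rw [rescale_affine_conj] at h1
  rw [h1]
  congr 1
  refine Filter.EventuallyEq.iteratedDeriv_eq k ?_
  filter_upwards [h.conj_eventuallyEq_near hκ.le hz hΦ hy] with x hx
  rw [disp, disp, hx]

lemma SqueezeSystem.deriv_conj (h : SqueezeSystem Z η H) (hκ : 0 < κ) (hz : z ∈ Z)
    (hΦ : FlattenableAt z η Φ) {y : ℝ} (hy : |y| < 2) :
    deriv ((H κ)⁻¹ * Φ * H κ : 𝓐) (z + η * y) =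
      deriv (flatten κ (rescale z η Φ)) y := by
  have hη := h.pos
  have hd := isDiffeo_flatten hκ (isDiffeo_rescale (z := z) hη hΦ.isDiffeo)
  rw [(h.conj_eventuallyEq_near hκ.le hz hΦ hy).deriv_eq]
  have ha := isDiffeo_affine (z := z) hη
  have e : (affine z η)⁻¹ (z + η * y) = y := by
    rw [affine_inv_apply hη, add_sub_cancel_left, mul_div_cancel_left₀ _ hη.ne']
  have ei : deriv ((affine z η)⁻¹ : 𝓐) (z + η * y) = η⁻¹ := by
    have : (((affine z η)⁻¹ : 𝓐) : ℝ → ℝ) = fun x => (x - z) / η :=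
      funext fun x => affine_inv_apply hη x
    rw [this]
    simp
  rw [(ha.mul hd).deriv_mul ha.inv, ha.deriv_mul hd, e, ei, deriv_affine hη]
  have := hη.ne'
  field_simp

lemma nearId_rescale {ι : Type*} {z η ς : ι → ℝ} {Φ : ι → 𝓐} (hη : ∀ i, 0 < η i)
    (h : ∀ i, FlattenableAt (z i) (η i) (Φ i))
    (hb : ∀ j, ∃ C, ∀ i Y, |Y| ≤ 2 →
      η i ^ (j + 1) * |iteratedDeriv (j + 2) (Φ i) (z i + η i * Y)| ≤ C * ς i) :
    NearId ς fun i => rescale (z i) (η i) (Φ i) where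
  isDiffeo i := isDiffeo_rescale (hη i) (h i).isDiffeo
  map_zero i := by simp [rescale_apply (hη i), (h i).map_self]
  deriv_zero i := by
    have e : (rescale (z i) (η i) (Φ i) : ℝ → ℝ) = fun y => (Φ i (z i + η i * y) - z i) / η i :=
      funext fun y => rescale_apply (hη i) _ y
    have h0 : HasDerivAt (fun y => z i + η i * y) (η i) 0 := by
      simpa using ((hasDerivAt_id (0 : ℝ)).const_mul (η i)).const_add (z i)
    have h1 : HasDerivAt (Φ i) 1 (z i + η i * 0) := by
      rw [mul_zero, add_zero, ← (h i).deriv_self]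
      exact ((h i).isDiffeo.differentiable _).hasDerivAt
    have h2 : HasDerivAt (fun y => (Φ i (z i + η i * y) - z i) / η i) (1 * η i / η i) 0 :=
      ((h1.comp 0 h0).sub_const (z i)).div_const (η i)
    rw [e, h2.deriv, one_mul, div_self (hη i).ne']
  half i Y hY := ((h i).rescale_quarter (hη i) hY).trans (by linarith [abs_nonneg Y])
  bound j := by
    obtain ⟨C, hC⟩ := hb j
    refine ⟨C, fun i Y hY => ?_⟩
    have hη' := hη i
    rw [← iteratedDeriv_add_two_disp (isDiffeo_rescale (hη i) (h i).isDiffeo),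
      iteratedDeriv_disp_rescale (hη i) (h i).isDiffeo, iteratedDeriv_add_two_disp (h i).isDiffeo,
      abs_mul, abs_of_pos (by positivity)]
    have : (η i)⁻¹ * η i ^ (j + 2) = η i ^ (j + 1) := by grind
    rw [this]
    exact hC i Y hY

lemma unifLogBdd_of_bounds {u : ℕ → 𝓐} (hu : ∀ n, IsDiffeo (u n))
    (h0 : ∃ C, ∀ n x, |ld (u n) x| ≤ C)
    (h : ∀ j, ∃ C, ∀ n x, |iteratedDeriv (j + 2) (u n) x| ≤ C) : UnifLogBdd u := by
  obtain ⟨C, hC⟩ := h0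
  refine logBdd_of_bddJet (fun p => hu p.1) ⟨C, fun p => hC _ _⟩ (bddJet_iff.2 fun j => ?_)
  cases j with
  | zero =>
    obtain ⟨C', hC'⟩ := exp_bounded (a := fun p : ℕ × ℝ => ld (u p.1) p.2) ⟨C, fun p => hC _ _⟩
    refine ⟨C', fun p => ?_⟩
    rw [iteratedDeriv_zero, ← (hu p.1).exp_ld]
    exact hC' p
  | succ j =>
    obtain ⟨C', hC'⟩ := h j
    refine ⟨C', fun p => ?_⟩
    rw [← iteratedDeriv_succ']
    exact hC' p.1 p.2

lemma iteratedDeriv_le_of_mem_unifDiffeo (h : Φ ∈ unifDiffeo) (j : ℕ) :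
    ∃ C, 0 < C ∧ ∀ x, |iteratedDeriv (j + 1) Φ x| ≤ C := by
  obtain ⟨hd, hb⟩ := mem_unifDiffeo.1 h
  obtain ⟨C, h0, hC⟩ := (LogBdd.bddJet_deriv (fun _ => hd) hb).bound j
  exact ⟨C, h0, fun x => by simpa [iteratedDeriv_succ'] using hC x⟩

lemma ld_le_of_mem_unifDiffeo (h : Φ ∈ unifDiffeo) : ∃ C, ∀ x, |ld Φ x| ≤ C := by
  obtain ⟨C, _, hC⟩ := BddJet.bound (mem_unifDiffeo.1 h).2 0
  bound

lemma isDiffeo_squeezeSystem_conj {𝓗 : Subgroup 𝓐} (hH : 𝓗 ≤ unifDiffeo) {A : 𝓐}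
    (hA : A ∈ 𝓗) (h : IsDiffeo Φ) : IsDiffeo (A⁻¹ * Φ * A) :=
  ((mem_unifDiffeo.1 (hH hA)).1.inv.mul h).mul (mem_unifDiffeo.1 (hH hA)).1

lemma SqueezeSystem.unifLogBdd (h : SqueezeSystem Z η H) (hη1 : η ≤ 1)
    (hH : ∀ κ, 0 < κ → H κ ∈ unifDiffeo) (hΦ : ∀ z ∈ Z, FlattenableAt z η Φ) (hu : Φ ∈ unifDiffeo)
    {κ : ℕ → ℝ} (hκ : ∀ n, 0 < κ n ∧ κ n ≤ 1) :
    UnifLogBdd fun n => (H (κ n))⁻¹ * Φ * H (κ n) := by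
  have hη := h.pos
  have hd : ∀ n, IsDiffeo ((H (κ n))⁻¹ * Φ * H (κ n)) := fun n =>
    isDiffeo_squeezeSystem_conj le_rfl (hH _ (hκ n).1) (mem_unifDiffeo.1 hu).1
  let J := {p : ℕ × Z × ℝ // |p.2.2| < 2}
  have hn : NearId (fun _ : J => (1 : ℝ)) fun p => rescale (p.1.2.1 : ℝ) η Φ := by
    refine nearId_rescale (z := fun p : J => (p.1.2.1 : ℝ)) (fun _ => hη)
      (fun p => hΦ _ p.1.2.1.2) fun j => ?_
    obtain ⟨C, hC0, hC⟩ := iteratedDeriv_le_of_mem_unifDiffeo hu (j + 1)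
    refine ⟨C, fun p Y _ => ?_⟩
    rw [mul_one]
    exact (mul_le_of_le_one_left (abs_nonneg _) (pow_le_one₀ hη.le hη1)).trans (hC _)
  have hς : ∀ p : J, (0 : ℝ) ≤ 1 ∧ (1 : ℝ) ≤ 1 := fun _ => by norm_num
  have hκJ : ∀ p : J, 0 ≤ κ p.1.1 ∧ κ p.1.1 ≤ 1 := fun p => ⟨(hκ _).1.le, (hκ _).2⟩
  have hyJ : ∀ p : J, |p.1.2.2| ≤ 2 := fun p => p.2.le
  have hpJ : ∀ p : J, 0 < p.1.2.2 ^ 2 + κ p.1.1 := fun p => by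
    have := (hκ p.1.1).1
    positivity
  have split : ∀ x, (∀ z ∈ Z, 2 * η ≤ |x - z|) ∨ ∃ z ∈ Z, ∃ y, |y| < 2 ∧ x = z + η * y := by
    intro x
    by_cases hx : ∀ z ∈ Z, 2 * η ≤ |x - z|
    · exact Or.inl hx
    · push Not at hx
      obtain ⟨z, hz, hlt⟩ := hx
      refine Or.inr ⟨z, hz, (x - z) / η, ?_, by field_simp; ring⟩
      rwa [abs_div, abs_of_pos hη, div_lt_iff₀ hη]
  refine unifLogBdd_of_bounds hd ?_ fun j => ?_
  · obtain ⟨C, hC⟩ := abs_log_deriv_flatten_sub_le hn hς hκJ hyJ hpJ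
    obtain ⟨C', hC'⟩ := ld_le_of_mem_unifDiffeo hu
    refine ⟨max (C + C') C', fun n x => ?_⟩
    rcases split x with hx | ⟨z, hz, y, hy, rfl⟩
    · rw [ld, (h.conj_eventuallyEq_far (hκ n).1.le hΦ hx).deriv_eq]
      bound
    · rw [ld, h.deriv_conj (hκ n).1 hz (hΦ z hz) hy]
      have h1 := hC ⟨(n, ⟨z, hz⟩, y), hy⟩
      simp only at h1
      have e : deriv (rescale z η Φ) (squeeze (κ n) y) = deriv Φ (z + η * squeeze (κ n) y) := by
        have ha := isDiffeo_affine (z := z) hη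
        have hΦd := (mem_unifDiffeo.1 hu).1
        have ei : ∀ x, deriv ((affine z η)⁻¹ : 𝓐) x = η⁻¹ := fun x => by
          have : (((affine z η)⁻¹ : 𝓐) : ℝ → ℝ) = fun x => (x - z) / η :=
            funext fun x => affine_inv_apply hη x
          rw [this]
          simp
        rw [rescale, (ha.inv.mul hΦd).deriv_mul ha, ha.inv.deriv_mul hΦd, ei, deriv_affine hη,
          affine_apply hη]
        grind
      rw [e] at h1
      have h2 := hC' (z + η * squeeze (κ n) y)
      rw [ld] at h2
      grind
  · obtain ⟨C, hC⟩ := (flat_le_bdd hς (jet_flatten hn hς hκJ hyJ hpJ (j + 2) (j + 2) le_rfl))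
    obtain ⟨C', _, hC'⟩ := iteratedDeriv_le_of_mem_unifDiffeo hu (j + 1)
    refine ⟨max (η * (η⁻¹) ^ (j + 2) * C) C', fun n x => ?_⟩
    rcases split x with hx | ⟨z, hz, y, hy, rfl⟩
    · rw [(h.conj_eventuallyEq_far (hκ n).1.le hΦ hx).iteratedDeriv_eq]
      exact (hC' x).trans (le_max_right _ _)
    · refine le_trans ?_ (le_max_left _ _)
      have h1 := h.iteratedDeriv_disp_conj (hκ n).1 hz (hΦ z hz) hy (j + 2)
      have h2 : |iteratedDeriv (j + 2) (disp (flatten (κ n) (rescale z η Φ))) y| ≤ C :=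
        hC ⟨(n, ⟨z, hz⟩, y), hy⟩
      rw [← h1, abs_mul, abs_of_pos (by positivity), iteratedDeriv_add_two_disp (hd n)] at h2
      calc _ = η * η⁻¹ ^ (j + 2) * (η⁻¹ * η ^ (j + 2) *
            |iteratedDeriv (j + 2) ((H (κ n))⁻¹ * Φ * H (κ n) : 𝓐) (z + η * y)|) := by
            rw [inv_pow]
            field_simp
        _ ≤ _ := by gcongr

lemma SqueezeSystem.tendstoUniformly (h : SqueezeSystem Z η H)
    (hΦ : ∀ z ∈ Z, FlattenableAt z η Φ) (hu : Φ ∈ unifDiffeo)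
    {κ : ℕ → ℝ} (hκ : ∀ n, 0 < κ n ∧ κ n ≤ 1) (hκ0 : Tendsto κ atTop (𝓝 0)) :
    TendstoUniformly (fun n => (((H (κ n))⁻¹ * Φ * H (κ n) : 𝓐) : ℝ → ℝ))
      ((H 0)⁻¹ * Φ * H 0 : 𝓐) atTop := by
  have hη := h.pos
  obtain ⟨L, hL, hlip⟩ := lipschitz_of_mem_unifDiffeo hu
  rw [tendstoUniformly_iff_abs]
  intro ε hε
  obtain ⟨κ₀, hκ₀, hk⟩ := abs_flatten_sub_flatten_zero (L := L) (ε := ε / 2 / η) (by positivity)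
  filter_upwards [hκ0.eventually_lt_const hκ₀] with n hn x
  by_cases hx : ∀ z ∈ Z, 2 * η ≤ |x - z|
  · rw [h.conj_far (hκ n).1.le hΦ fun z hz => by linarith [hx z hz],
      h.conj_far le_rfl hΦ fun z hz => by linarith [hx z hz], sub_self, abs_zero]
    exact hε
  · push Not at hx
    obtain ⟨z, hz, hlt⟩ := hx
    have hy : |(x - z) / η| < 2 := by rwa [abs_div, abs_of_pos hη, div_lt_iff₀ hη]
    have e : x = z + η * ((x - z) / η) := by field_simp; ring
    rw [e, h.conj_near (hκ n).1.le hz (hΦ z hz) hy.le, h.conj_near le_rfl hz (hΦ z hz) hy.le]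
    have := hk (κ n) (hκ n).1.le hn.le (rescale z η Φ) (fun u v => by
      rw [rescale_apply hη, rescale_apply hη, div_sub_div_same, abs_div, abs_of_pos hη,
        div_le_iff₀ hη, sub_sub_sub_cancel_right]
      refine (hlip _ _).trans (le_of_eq ?_)
      rw [add_sub_add_left_eq_sub, ← mul_sub, abs_mul, abs_of_pos hη]
      ring) ((x - z) / η)
    rw [add_sub_add_left_eq_sub, ← mul_sub, abs_mul, abs_of_pos hη]
    rw [div_div, le_div_iff₀ (by positivity)] at this
    linarith

/-- The standard sequence of parameters tending to zero. -/
def kappa (n : ℕ) : ℝ := 1 / ((n : ℝ) + 1)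

lemma kappa_mem (n : ℕ) : 0 < kappa n ∧ kappa n ≤ 1 :=
  ⟨Nat.one_div_pos_of_nat, by
    rw [kappa, div_le_one (by positivity)]
    linarith [n.cast_nonneg (α := ℝ)]⟩

lemma tendsto_kappa : Tendsto kappa atTop (𝓝 0) := tendsto_one_div_add_atTop_nhds_zero_nat

lemma SqueezeSystem.degenerates {𝓗 : Subgroup 𝓐} (h : SqueezeSystem Z η H) (hη1 : η ≤ 1)
    (hH : 𝓗 ≤ unifDiffeo) (hmem : ∀ κ, 0 < κ → H κ ∈ 𝓗) (hΦ : ∀ z ∈ Z, FlattenableAt z η Φ)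
    (hu : Φ ∈ unifDiffeo) : Degenerates 𝓗 Φ ((H 0)⁻¹ * Φ * H 0) := by
  refine ⟨fun n => (H (kappa n))⁻¹, fun n => 𝓗.inv_mem (hmem _ (kappa_mem n).1), ?_, ?_⟩
  · simpa only [inv_inv] using
      h.unifLogBdd hη1 (fun κ hκ => hH (hmem κ hκ)) hΦ hu kappa_mem
  · simpa only [inv_inv] using h.tendstoUniformly hΦ hu kappa_mem tendsto_kappa

lemma SqueezeSystem.tendsto_iteratedDeriv (h : SqueezeSystem Z η H) (hη1 : η ≤ 1)
    (hH : ∀ κ, 0 < κ → H κ ∈ unifDiffeo) (hΦ : ∀ z ∈ Z, FlattenableAt z η Φ)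
    (hu : Φ ∈ unifDiffeo) (j : ℕ) (x : ℝ) :
    Tendsto (fun n => iteratedDeriv j (disp ((H (kappa n))⁻¹ * Φ * H (kappa n))) x) atTop
      (𝓝 (iteratedDeriv j (disp ((H 0)⁻¹ * Φ * H 0)) x)) := by
  have hd : ∀ n, IsDiffeo ((H (kappa n))⁻¹ * Φ * H (kappa n)) := fun n =>
    isDiffeo_squeezeSystem_conj le_rfl (hH _ (kappa_mem n).1) (mem_unifDiffeo.1 hu).1
  have hb := h.unifLogBdd hη1 hH hΦ hu kappa_mem
  have ht := h.tendstoUniformly hΦ hu kappa_mem tendsto_kappa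
  have h0 := (mem_unifDiffeo.1 (mem_unifDiffeo_of_tendsto hd hb ht)).1
  simp only [iteratedDeriv_disp (hd _).1.contDiffAt, iteratedDeriv_disp h0.1.contDiffAt]
  exact ((tendstoUniformly_iteratedDeriv hd hb ht j).tendsto_at x).sub_const _

/-- The flattened maps are flat at the points of `Z`, with quantitative bounds. -/
lemma flat_of_squeezeSystem {ι : Type*} {Z : ι → Set ℝ} {z η ς : ι → ℝ} {H : ι → ℝ → 𝓐}
    {Φ : ι → 𝓐} (h : ∀ i, SqueezeSystem (Z i) (η i) (H i)) (hη1 : ∀ i, η i ≤ 1)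
    (hH : ∀ i κ, 0 < κ → H i κ ∈ unifDiffeo) (hΦ : ∀ i, ∀ z ∈ Z i, FlattenableAt z (η i) (Φ i))
    (hu : ∀ i, Φ i ∈ unifDiffeo) (hz : ∀ i, z i ∈ Z i) (hς : ∀ i, 0 ≤ ς i ∧ ς i ≤ 1)
    (hn : NearId ς fun i => rescale (z i) (η i) (Φ i)) (j N : ℕ) :
    ∃ C, ∀ i y, |y| < 2 →
      |iteratedDeriv j (disp ((H i 0)⁻¹ * Φ i * H i 0)) (z i + η i * y)| ≤
        C * ς i * (η i * (η i)⁻¹ ^ j) * |y| ^ N := by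
  let J := {p : ι × ℕ × ℝ // |p.2.2| < 2}
  have hn' : NearId (fun p : J => ς p.1.1) fun p : J => rescale (z p.1.1) (η p.1.1) (Φ p.1.1) :=
    ⟨fun p => hn.isDiffeo _, fun p => hn.map_zero _, fun p => hn.deriv_zero _,
      fun p => hn.half _, fun j => (hn.bound j).imp fun C hC p => hC p.1.1⟩
  have hpJ : ∀ p : J, 0 < p.1.2.2 ^ 2 + kappa p.1.2.1 := fun p => by
    have := (kappa_mem p.1.2.1).1
    positivity
  obtain ⟨C, hC⟩ := jet_flatten hn' (fun p => hς _)
    (fun p : J => ⟨(kappa_mem p.1.2.1).1.le, (kappa_mem p.1.2.1).2⟩) (fun p => p.2.le) hpJ j j le_rfl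
    N
  refine ⟨|C|, fun i y hy => ?_⟩
  have hη := (h i).pos
  have hlim := ((h i).tendsto_iteratedDeriv (hη1 i) (hH i) (hΦ i) (hu i) j
    (z i + η i * y)).abs
  have hr : Tendsto (fun n => |C| * ς i * (η i * (η i)⁻¹ ^ j) * ((y ^ 2 + kappa n) / 10) ^ N) atTop
      (𝓝 (|C| * ς i * (η i * (η i)⁻¹ ^ j) * ((y ^ 2 + 0) / 10) ^ N)) :=
    (((tendsto_kappa.const_add (y ^ 2)).div_const 10).pow N).const_mul _
  refine (le_of_tendsto_of_tendsto' hlim hr fun n => ?_).trans ?_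
  · have h1 := hC ⟨(i, n, y), hy⟩
    have h2 := (h i).iteratedDeriv_disp_conj (kappa_mem n).1 (hz i) (hΦ i _ (hz i)) hy j
    have h3 : |iteratedDeriv j (disp (flatten (kappa n) (rescale (z i) (η i) (Φ i)))) y| ≤
      C * (ς i * ((y ^ 2 + kappa n) / 10) ^ N) := h1
    have hk := (kappa_mem n).1
    have hs := (hς i).1
    rw [← h2, abs_mul, abs_of_pos (by positivity)] at h3
    calc _ = η i * (η i)⁻¹ ^ j * ((η i)⁻¹ * η i ^ j *
          |iteratedDeriv j (disp ((H i (kappa n))⁻¹ * Φ i * H i (kappa n))) (z i + η i * y)|) := by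
          rw [inv_pow]
          field_simp
      _ ≤ η i * (η i)⁻¹ ^ j * (|C| * (ς i * ((y ^ 2 + kappa n) / 10) ^ N)) :=
          mul_le_mul_of_nonneg_left
            (h3.trans (mul_le_mul_of_nonneg_right (le_abs_self C) (by positivity))) (by positivity)
      _ = _ := by ring
  · have hs := (hς i).1
    gcongr
    rw [add_zero, ← sq_abs]
    nlinarith [abs_nonneg y]

end SqueezeSystems

section Supported

variable {a b z : ℝ} {f g : 𝓐}

lemma ld_eventuallyEq_zero {x : ℝ} (h : (f : ℝ → ℝ) =ᶠ[𝓝 x] id) : ld f =ᶠ[𝓝 x] 0 := by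
  filter_upwards [h.deriv] with y hy
  rw [ld, hy]
  simp

lemma iteratedDeriv_eq_zero_of_eventuallyEq {φ : ℝ → ℝ} {x : ℝ} (h : φ =ᶠ[𝓝 x] 0) (j : ℕ) :
    iteratedDeriv j φ x = 0 := by
  rw [h.iteratedDeriv_eq]
  simp [Pi.zero_def]

lemma mem_unifDiffeo_of_eq_self_off (hf : IsDiffeo f) (h : ∀ x ∉ Icc a b, f x = x) :
    f ∈ unifDiffeo := by
  refine mem_unifDiffeo.2 ⟨hf, bddJet_iff.2 fun j => ?_⟩
  obtain ⟨C, hC⟩ := isCompact_Icc.exists_bound_of_continuousOn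
    (hf.contDiff_ld.continuous_iteratedDeriv j (natCast_le_infty j)).continuousOn (s := Icc a b)
  refine ⟨max C 0, fun x => ?_⟩
  by_cases hx : x ∈ Icc a b
  · simp_all
  · have h1 : ld f =ᶠ[𝓝 x] 0 := by
      refine ld_eventuallyEq_zero ?_
      filter_upwards [isClosed_Icc.isOpen_compl.mem_nhds hx] with y hy using h y hy
    refine (le_of_eq ?_).trans (le_max_right _ _)
    exact abs_eq_zero.2 (iteratedDeriv_eq_zero_of_eventuallyEq h1 j)

/-- Diffeomorphisms which are the identity off the interval `(a, b)`. -/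
def supported (a b : ℝ) : Subgroup 𝓐 where
  carrier := {f | IsDiffeo f ∧ ∀ x ∉ Ioo a b, f x = x}
  mul_mem' := by
    rintro f g ⟨hf, hf'⟩ ⟨hg, hg'⟩
    refine ⟨hf.mul hg, fun x hx => ?_⟩
    simp_all
  one_mem' := ⟨isDiffeo_one, fun x _ => rfl⟩
  inv_mem' := by
    rintro f ⟨hf, hf'⟩
    refine ⟨hf.inv, fun x hx => f.injective ?_⟩
    simp_all

lemma mem_supported : f ∈ supported a b ↔ IsDiffeo f ∧ ∀ x ∉ Ioo a b, f x = x := Iff.rfl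

lemma supported_le_unifDiffeo : supported a b ≤ unifDiffeo := fun _ hf =>
  mem_unifDiffeo_of_eq_self_off hf.1 fun x hx => hf.2 x fun h => hx (Ioo_subset_Icc_self h)

lemma supported_mono {a' b' : ℝ} (ha : a' ≤ a) (hb : b ≤ b') :
    supported a b ≤ supported a' b' := fun _ hf =>
  ⟨hf.1, fun x hx => hf.2 x fun h => hx (Ioo_subset_Ioo ha hb h)⟩

lemma supported_left (hf : f ∈ supported a b) : f a = a := hf.2 a fun h => h.1.false

lemma supported_right (hf : f ∈ supported a b) : f b = b := hf.2 b fun h => h.2.false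

lemma mem_Ioo_of_fixed (ha : f a = a) (hb : f b = b) {x : ℝ} (hx : x ∈ Ioo a b) :
    f x ∈ Ioo a b :=
  ⟨ha ▸ f.strictMono hx.1, hb ▸ f.strictMono hx.2⟩

lemma map_mem_Ioo (hf : f ∈ supported a b) {x : ℝ} (hx : x ∈ Ioo a b) : f x ∈ Ioo a b :=
  mem_Ioo_of_fixed (supported_left hf) (supported_right hf) hx

lemma commute_of_disjoint (hf : ∀ x ∉ Ioo a b, f x = x) (hg : ∀ x ∈ Ioo a b, g x = x) :
    Commute f g := by
  refine RelIso.ext fun x => ?_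
  have fa := hf a fun h => h.1.false
  have fb := hf b fun h => h.2.false
  rw [mul_apply, mul_apply]
  by_cases hx : x ∈ Ioo a b
  · rw [hg x hx, hg _ (mem_Ioo_of_fixed fa fb hx)]
  · rw [hf x hx]
    refine hf _ fun h => hx ?_
    rw [← g.injective (hg _ h)]
    exact h

lemma one_orderIso_apply (x : ℝ) : (1 : 𝓐) x = x := rfl

/-- Two homeomorphisms fixing `z`, glued at `z`. -/
def glueAt (z : ℝ) (f g : 𝓐) (hf : f z = z) (hg : g z = z) : 𝓐 :=
  StrictMono.orderIsoOfSurjective (fun x => if x ≤ z then f x else g x)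
    (fun x y hxy => by
      have h1 := f.strictMono hxy
      have h2 := g.strictMono hxy
      dsimp only
      split_ifs with hx hy hy
      · exact h1
      · have h3 := f.monotone hx
        have h4 := g.strictMono (not_le.1 hy)
        linarith
      · linarith
      · exact h2)
    (fun y => by
      rcases le_or_gt y z with hy | hy
      · refine ⟨f⁻¹ y, ?_⟩
        have : f⁻¹ y ≤ z := by
          rw [← f.le_iff_le, apply_inv_self, hf]
          exact hy
        simp [this]
      · refine ⟨g⁻¹ y, ?_⟩
        have : ¬ g⁻¹ y ≤ z := by
          rw [← g.le_iff_le, apply_inv_self, hg]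
          exact not_le.2 hy
        simp [this])

variable (hf : f z = z) (hg : g z = z)

lemma coe_glueAt : (glueAt z f g hf hg : ℝ → ℝ) = fun x => if x ≤ z then f x else g x := rfl

lemma glueAt_left {x : ℝ} (hx : x ≤ z) : glueAt z f g hf hg x = f x := if_pos hx

lemma glueAt_right {x : ℝ} (hx : z ≤ x) : glueAt z f g hf hg x = g x := by
  rcases hx.eq_or_lt with rfl | hx
  · rw [glueAt_left hf hg le_rfl, hf, hg]
  · exact if_neg (not_le.2 hx)

lemma hasDerivAt_ite {φ ψ φ' ψ' : ℝ → ℝ} (hφ : ∀ x, HasDerivAt φ (φ' x) x)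
    (hψ : ∀ x, HasDerivAt ψ (ψ' x) x) (h0 : φ z = ψ z) (h1 : φ' z = ψ' z) (x : ℝ) :
    HasDerivAt (fun x => if x ≤ z then φ x else ψ x) (if x ≤ z then φ' x else ψ' x) x := by
  rcases lt_trichotomy x z with hx | rfl | hx
  · rw [if_pos hx.le]
    refine (hφ x).congr_of_eventuallyEq ?_
    filter_upwards [eventually_lt_nhds hx] with y hy using if_pos hy.le
  · rw [if_pos le_rfl]
    have e1 : HasDerivWithinAt (fun y => if y ≤ x then φ y else ψ y) (φ' x) (Iic x) x :=
      (hφ x).hasDerivWithinAt.congr (fun y hy => if_pos hy) (if_pos le_rfl)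
    have e2 : HasDerivWithinAt (fun y => if y ≤ x then φ y else ψ y) (φ' x) (Ici x) x := by
      rw [h1]
      refine (hψ x).hasDerivWithinAt.congr (fun y hy => ?_) ((if_pos le_rfl).trans h0)
      grind
    have := e1.union e2
    simp_all
  · rw [if_neg (not_le.2 hx)]
    refine (hψ x).congr_of_eventuallyEq ?_
    filter_upwards [eventually_gt_nhds hx] with y hy using if_neg (not_le.2 hy)

lemma hasDerivAt_iteratedDeriv {φ : ℝ → ℝ} (hφ : ContDiff ℝ ∞ φ) (j : ℕ) (x : ℝ) :
    HasDerivAt (iteratedDeriv j φ) (iteratedDeriv (j + 1) φ x) x := by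
  rw [iteratedDeriv_succ]
  exact (hφ.differentiable_iteratedDeriv j (by exact_mod_cast WithTop.coe_lt_top _) x).hasDerivAt

lemma contDiff_ite {φ ψ : ℝ → ℝ} (hφ : ContDiff ℝ ∞ φ) (hψ : ContDiff ℝ ∞ ψ)
    (h : ∀ j, iteratedDeriv j φ z = iteratedDeriv j ψ z) :
    ContDiff ℝ ∞ (fun x => if x ≤ z then φ x else ψ x) := by
  have := contDiff_of_hasDerivAt_seq
    (G := fun j x => if x ≤ z then iteratedDeriv j φ x else iteratedDeriv j ψ x) fun j x =>
      hasDerivAt_ite (hasDerivAt_iteratedDeriv hφ j) (hasDerivAt_iteratedDeriv hψ j) (h j)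
        (h (j + 1)) x
  simpa only [iteratedDeriv_zero] using this

lemma isDiffeo_glueAt (hf' : IsDiffeo f) (hg' : IsDiffeo g)
    (h : ∀ j, iteratedDeriv j f z = iteratedDeriv j g z) : IsDiffeo (glueAt z f g hf hg) := by
  refine ⟨contDiff_ite hf'.1 hg'.1 h, fun x => ?_⟩
  have h1 := hasDerivAt_ite (fun x => (hf'.differentiable x).hasDerivAt)
    (fun x => (hg'.differentiable x).hasDerivAt) (hf.trans hg.symm)
    (by simpa [iteratedDeriv_one] using h 1) x
  rw [coe_glueAt, h1.deriv]
  split_ifs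
  · exact hf'.2 x
  · exact hg'.2 x

/-- All derivatives of the displacement vanish at `z`. -/
def FlatAt (f : 𝓐) (z : ℝ) : Prop := ∀ j, iteratedDeriv j (disp f) z = 0

lemma FlatAt.map_self (h : FlatAt f z) : f z = z := by
  have := h 0
  rw [iteratedDeriv_zero, disp] at this
  linarith

lemma FlatAt.iteratedDeriv_eq (h : FlatAt f z) (hf : IsDiffeo f) (j : ℕ) :
    iteratedDeriv j f z = iteratedDeriv j (1 : 𝓐) z := by
  have h1 := h j
  rw [iteratedDeriv_disp hf.1.contDiffAt] at h1
  exact sub_eq_zero.1 h1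

lemma flatAt_of_eventuallyEq (h : (f : ℝ → ℝ) =ᶠ[𝓝 z] id) : FlatAt f z := fun j => by
  refine iteratedDeriv_eq_zero_of_eventuallyEq ?_ j
  filter_upwards [h] with x hx
  rw [disp, hx]
  simp

/-- Flatness is a closed condition. -/
lemma isClosed_flatAt (hf : IsDiffeo f) : IsClosed {z | FlatAt f z} := by
  have : {z | FlatAt f z} = ⋂ j, {z | iteratedDeriv j (disp f) z = 0} := by
    ext z
    simp [FlatAt]
  rw [this]
  exact isClosed_iInter fun j => isClosed_eq
    (hf.contDiff_disp.continuous_iteratedDeriv j (natCast_le_infty j)) continuous_const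

/-- The restriction of `f` to the left of a fixed point. -/
def leftPart (z : ℝ) (f : 𝓐) (hf : f z = z) : 𝓐 := glueAt z f 1 hf (one_orderIso_apply z)

/-- The restriction of `f` to the right of a fixed point. -/
def rightPart (z : ℝ) (f : 𝓐) (hf : f z = z) : 𝓐 := glueAt z 1 f (one_orderIso_apply z) hf

lemma isDiffeo_leftPart (hf' : IsDiffeo f) (h : FlatAt f z) : IsDiffeo (leftPart z f hf) :=
  isDiffeo_glueAt _ _ hf' isDiffeo_one (h.iteratedDeriv_eq hf')

lemma isDiffeo_rightPart (hf' : IsDiffeo f) (h : FlatAt f z) : IsDiffeo (rightPart z f hf) :=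
  isDiffeo_glueAt _ _ isDiffeo_one hf' fun j => (h.iteratedDeriv_eq hf' j).symm

end Supported

section Chains

variable {𝓗 𝓗' : Subgroup 𝓐} {F F₂ F₃ A R : 𝓐}

lemma Degenerates.mono (h : Degenerates 𝓗 F F₂) (hH : 𝓗 ≤ 𝓗') : Degenerates 𝓗' F F₂ := by
  obtain ⟨H, h1, h2, h3⟩ := h
  exact ⟨H, fun n => hH (h1 n), h2, h3⟩

lemma UnifLogBdd.mul {u v : ℕ → 𝓐} (hu : UnifLogBdd u) (hv : UnifLogBdd v)
    (hu' : ∀ n, IsDiffeo (u n)) (hv' : ∀ n, IsDiffeo (v n)) : UnifLogBdd fun n => u n * v n :=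
  LogBdd.mul (F := fun p : ℕ × ℝ => u p.1) (G := fun p : ℕ × ℝ => v p.1) (fun p => hu' p.1)
    (fun p => hv' p.1) (hu.reindex fun p : ℕ × ℝ => (p.1, v p.1 p.2)) hv

lemma unifLogBdd_const {f : 𝓐} (hf : f ∈ unifDiffeo) : UnifLogBdd fun _ => f :=
  (mem_unifDiffeo.1 hf).2.reindex fun p : ℕ × ℝ => p.2

lemma UnifLogBdd.inv {u : ℕ → 𝓐} (hu : UnifLogBdd u) (hu' : ∀ n, IsDiffeo (u n)) :
    UnifLogBdd fun n => (u n)⁻¹ :=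
  LogBdd.inv' (F := fun p : ℕ × ℝ => u p.1) (fun p => hu' p.1)
    (hu.reindex fun p : ℕ × ℝ => (p.1, (u p.1)⁻¹ p.2))

lemma Degenerates.mul_commute (h : Degenerates 𝓗 F F₂) (hH : 𝓗 ≤ unifDiffeo)
    (hF : IsDiffeo F) (hR : R ∈ unifDiffeo) (hc : ∀ h ∈ 𝓗, Commute h R) :
    Degenerates 𝓗 (F * R) (F₂ * R) := by
  obtain ⟨H, h1, h2, h3⟩ := h
  have e : ∀ n, H n * (F * R) * (H n)⁻¹ = H n * F * (H n)⁻¹ * R := fun n => by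
    have h4 : R * (H n)⁻¹ = (H n)⁻¹ * R := ((hc _ (h1 n)).inv_left).eq.symm
    simp only [mul_assoc, h4]
  refine ⟨H, h1, ?_, ?_⟩
  · simp only [e]
    exact h2.mul (unifLogBdd_const hR) (fun n => hF.conj (hH (h1 n)).1) fun _ => hR.1
  · simp only [e]
    exact h3.comp R

lemma UnifLogBdd.conj {u : ℕ → 𝓐} (hu : UnifLogBdd u) (hu' : ∀ n, IsDiffeo (u n))
    (hA : A ∈ unifDiffeo) : UnifLogBdd fun n => A * u n * A⁻¹ :=
  ((unifLogBdd_const hA).mul hu (fun _ => hA.1) hu').mul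
    (unifLogBdd_const (unifDiffeo.inv_mem hA)) (fun n => hA.1.mul (hu' n)) fun _ => hA.1.inv

lemma TendstoUniformly.conj_unifDiffeo {u : ℕ → 𝓐}
    (hu : TendstoUniformly (fun n => (u n : ℝ → ℝ)) F atTop) (hA : A ∈ unifDiffeo) :
    TendstoUniformly (fun n => ((A * u n * A⁻¹ : 𝓐) : ℝ → ℝ)) (A * F * A⁻¹ : 𝓐)
      atTop := by
  obtain ⟨L, hL, hLip⟩ := lipschitz_of_mem_unifDiffeo hA
  have hU : UniformContinuous A :=
    (LipschitzWith.of_dist_le_mul (K := ⟨L, hL.le⟩) fun x y => hLip x y).uniformContinuous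
  exact (hU.comp_tendstoUniformly hu).comp (A⁻¹ : 𝓐)

lemma Degenerates.map_conj (h : Degenerates 𝓗 F F₂) (hH : 𝓗 ≤ unifDiffeo)
    (hF : IsDiffeo F) (hA : A ∈ unifDiffeo) (hc : ∀ h ∈ 𝓗, A * h * A⁻¹ ∈ 𝓗') :
    Degenerates 𝓗' (A * F * A⁻¹) (A * F₂ * A⁻¹) := by
  obtain ⟨H, h1, h2, h3⟩ := h
  have e : ∀ n, A * H n * A⁻¹ * (A * F * A⁻¹) * (A * H n * A⁻¹)⁻¹ =
      A * (H n * F * (H n)⁻¹) * A⁻¹ := fun n => by group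
  refine ⟨fun n => A * H n * A⁻¹, fun n => hc _ (h1 n), ?_, ?_⟩
  · simp only [e]
    exact h2.conj (fun n => hF.conj (hH (h1 n)).1) hA
  · simp only [e]
    exact TendstoUniformly.conj_unifDiffeo h3 hA

lemma Degenerates.inv (h : Degenerates 𝓗 F F₂) (hH : 𝓗 ≤ unifDiffeo) (hF : IsDiffeo F) :
    Degenerates 𝓗 F⁻¹ F₂⁻¹ := by
  have hF₂ := h.mem_unifDiffeo hH hF
  obtain ⟨H, h1, h2, h3⟩ := h
  have e : ∀ n, H n * F⁻¹ * (H n)⁻¹ = (H n * F * (H n)⁻¹)⁻¹ := fun n => by group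
  refine ⟨H, h1, ?_, ?_⟩
  · simp only [e]
    exact h2.inv fun n => hF.conj (hH (h1 n)).1
  · simp only [e]
    obtain ⟨L, hL, hLip⟩ := lipschitz_of_mem_unifDiffeo (unifDiffeo.inv_mem hF₂)
    rw [tendstoUniformly_iff_abs] at h3 ⊢
    intro ε hε
    filter_upwards [h3 (ε / L) (by positivity)] with n hn x
    set y := (H n * F * (H n)⁻¹)⁻¹ x with hy
    have hyx : (H n * F * (H n)⁻¹) y = x := by rw [hy, apply_inv_self]
    have h4 := hn y
    have h5 := hLip (F₂ y) x
    rw [inv_apply_self, abs_sub_comm (F₂ y)] at h5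
    rw [hyx] at h4
    calc _ ≤ _ := h5
      _ < L * (ε / L) := by gcongr
      _ = ε := by field_simp

end Chains

section FlowTime

open Real (sigmoid)

/-- The derivative of the logistic function. -/
def logisticWeight (u : ℝ) : ℝ := sigmoid u * (1 - sigmoid u)

lemma logisticWeight_pos (u : ℝ) : 0 < logisticWeight u :=
  mul_pos (sigmoid_pos u) (sub_pos.2 (sigmoid_lt_one u))

lemma logisticWeight_le_one (u : ℝ) : logisticWeight u ≤ 1 := by
  have h1 := sigmoid_pos u
  have h2 := sigmoid_lt_one u
  rw [logisticWeight]
  nlinarith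

lemma logisticWeight_eq (u : ℝ) : logisticWeight u = (2 + exp u + exp (-u))⁻¹ := by
  have h := exp_pos u
  rw [logisticWeight, sigmoid_def, exp_neg]
  field_simp
  ring

lemma logisticWeight_le (u v : ℝ) :
    logisticWeight v ≤ exp |v - u| * logisticWeight u := by
  have hu := exp_pos u
  have hu' := exp_pos (-u)
  have hv := exp_pos v
  have hv' := exp_pos (-v)
  rw [logisticWeight_eq, logisticWeight_eq, ← div_eq_mul_inv, inv_eq_one_div,
    div_le_div_iff₀ (by positivity) (by positivity)]
  have h1 : exp u ≤ exp |v - u| * exp v := by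
    rw [← exp_add]
    exact exp_le_exp.2 (by linarith [neg_abs_le (v - u)])
  have h2 : exp (-u) ≤ exp |v - u| * exp (-v) := by
    rw [← exp_add]
    exact exp_le_exp.2 (by linarith [le_abs_self (v - u)])
  have h3 : (1 : ℝ) ≤ exp |v - u| := one_le_exp (abs_nonneg _)
  linarith

lemma hasDerivAt_sigmoid' (u : ℝ) : HasDerivAt sigmoid (logisticWeight u) u := by
  have := hasDerivAt_sigmoid u
  bound

lemma contDiff_sigmoid' : ContDiff ℝ ∞ sigmoid := contDiff_sigmoid.of_le (by simp)

lemma contDiff_logisticWeight : ContDiff ℝ ∞ logisticWeight :=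
  contDiff_sigmoid'.mul (contDiff_const.sub contDiff_sigmoid')

/-- The density of the time coordinate with respect to the logistic coordinate. -/
def timeRate (u : ℝ) : ℝ := logisticWeight u * exp (logisticWeight u)⁻¹

lemma contDiff_timeRate : ContDiff ℝ ∞ timeRate :=
  contDiff_logisticWeight.mul
    (contDiff_logisticWeight.inv fun u => (logisticWeight_pos u).ne').exp

lemma one_le_timeRate (u : ℝ) : 1 ≤ timeRate u := by
  have h := logisticWeight_pos u
  have h1 : (logisticWeight u)⁻¹ ≤ exp (logisticWeight u)⁻¹ := by
    linarith [add_one_le_exp (logisticWeight u)⁻¹]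
  calc (1 : ℝ) = logisticWeight u * (logisticWeight u)⁻¹ := by field_simp
    _ ≤ _ := by rw [timeRate]; gcongr

/-- The time coordinate as a function of the logistic coordinate. -/
def flowTimeFun (u : ℝ) : ℝ := ∫ t in (0 : ℝ)..u, timeRate t

lemma hasDerivAt_flowTimeFun (u : ℝ) : HasDerivAt flowTimeFun (timeRate u) u :=
  (contDiff_timeRate.continuous.integral_hasStrictDerivAt 0 u).hasDerivAt

lemma strictMono_flowTimeFun : StrictMono flowTimeFun :=
  strictMono_of_hasDerivAt_pos hasDerivAt_flowTimeFun fun u =>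
    one_pos.trans_le (one_le_timeRate u)

lemma sub_le_flowTimeFun_sub {u v : ℝ} (h : u ≤ v) : v - u ≤ flowTimeFun v - flowTimeFun u := by
  have hm : Monotone fun u => flowTimeFun u - u :=
    monotone_of_hasDerivAt_nonneg (fun u => (hasDerivAt_flowTimeFun u).sub (hasDerivAt_id u))
      fun u => sub_nonneg.2 (one_le_timeRate u)
  linarith [hm h]

lemma surjective_flowTimeFun : Function.Surjective flowTimeFun := by
  have hc : Continuous flowTimeFun :=
    continuous_iff_continuousAt.2 fun u => (hasDerivAt_flowTimeFun u).continuousAt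
  have h0 : flowTimeFun 0 = 0 := by simp [flowTimeFun]
  refine hc.surjective ?_ ?_
  · refine tendsto_atTop_mono' _ ?_ tendsto_id
    filter_upwards [eventually_ge_atTop 0] with u hu
    have := sub_le_flowTimeFun_sub hu
    simpa [h0] using this
  · refine tendsto_atBot_mono' _ ?_ tendsto_id
    filter_upwards [eventually_le_atBot 0] with u hu
    have := sub_le_flowTimeFun_sub hu
    simp_all

/-- The time coordinate as a function of the logistic coordinate, as an order isomorphism. -/
def flowTime : 𝓐 :=
  StrictMono.orderIsoOfSurjective flowTimeFun strictMono_flowTimeFun surjective_flowTimeFun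

lemma hasDerivAt_flowTime (u : ℝ) : HasDerivAt flowTime (timeRate u) u :=
  hasDerivAt_flowTimeFun u

lemma isDiffeo_flowTime : IsDiffeo flowTime := by
  have hd : deriv flowTime = timeRate := funext fun u => (hasDerivAt_flowTime u).deriv
  refine ⟨contDiff_infty_iff_deriv.2 ⟨fun u => (hasDerivAt_flowTime u).differentiableAt, ?_⟩, ?_⟩
  · rw [hd]
    exact contDiff_timeRate
  · intro u
    rw [hd]
    exact one_pos.trans_le (one_le_timeRate u)

lemma isDiffeo_addRight (s : ℝ) : IsDiffeo (OrderIso.addRight s) := by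
  have hd : ∀ x, HasDerivAt (OrderIso.addRight s : 𝓐) 1 x := fun x => by
    exact (hasDerivAt_id x).add_const s
  refine ⟨contDiff_id.add contDiff_const, fun x => ?_⟩
  rw [(hd x).deriv]
  exact one_pos

/-- The translation flow in the logistic coordinate. -/
def logisticFlow (s : ℝ) : 𝓐 := flowTime⁻¹ * OrderIso.addRight s * flowTime

lemma flowTime_logisticFlow (s u : ℝ) : flowTime (logisticFlow s u) = flowTime u + s := by
  simp [logisticFlow, mul_apply, apply_inv_self]

lemma isDiffeo_logisticFlow (s : ℝ) : IsDiffeo (logisticFlow s) :=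
  (isDiffeo_flowTime.inv.mul (isDiffeo_addRight s)).mul isDiffeo_flowTime

lemma logisticFlow_add (s t : ℝ) : logisticFlow (s + t) = logisticFlow s * logisticFlow t := by
  refine RelIso.ext fun u => flowTime.injective ?_
  rw [mul_apply, flowTime_logisticFlow, flowTime_logisticFlow, flowTime_logisticFlow]
  ring

lemma deriv_logisticFlow (s u : ℝ) :
    HasDerivAt (logisticFlow s) (timeRate u / timeRate (logisticFlow s u)) u := by
  have h1 := ((isDiffeo_logisticFlow s).differentiable u).hasDerivAt
  have h2 := (hasDerivAt_flowTime (logisticFlow s u)).comp u h1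
  have h3 : ((flowTime : ℝ → ℝ) ∘ logisticFlow s) = fun u => flowTime u + s :=
    funext (flowTime_logisticFlow s)
  rw [h3] at h2
  have h4 := h2.unique ((hasDerivAt_flowTime u).add_const s)
  have h5 := one_pos.trans_le (one_le_timeRate (logisticFlow s u))
  have h6 := eq_div_of_mul_eq h5.ne' ((mul_comm _ _).trans h4)
  rwa [h6] at h1

lemma exists_timeRate_mul (s u : ℝ) : ∃ ξ ∈ uIcc u (logisticFlow s u),
    timeRate ξ * (logisticFlow s u - u) = s := by
  have h := flowTime_logisticFlow s u
  rcases eq_or_ne u (logisticFlow s u) with he | he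
  · refine ⟨u, left_mem_uIcc, ?_⟩
    grind
  · have hc : ContinuousOn flowTime (uIcc u (logisticFlow s u)) :=
      isDiffeo_flowTime.1.continuous.continuousOn
    rcases he.lt_or_gt with hl | hl
    · rw [uIcc_of_le hl.le] at hc ⊢
      obtain ⟨ξ, hξ, h2⟩ := exists_hasDerivAt_eq_slope _ _ hl hc fun x _ => hasDerivAt_flowTime x
      grind
    · rw [uIcc_of_ge hl.le] at hc ⊢
      obtain ⟨ξ, hξ, h2⟩ := exists_hasDerivAt_eq_slope _ _ hl hc fun x _ => hasDerivAt_flowTime x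
      grind

lemma abs_logisticFlow_sub_le (s u : ℝ) : |logisticFlow s u - u| ≤ |s| := by
  obtain ⟨ξ, -, h⟩ := exists_timeRate_mul s u
  have h1 := one_le_timeRate ξ
  have h2 : |s| = timeRate ξ * |logisticFlow s u - u| := by grind
  rw [h2]
  exact le_mul_of_one_le_left (abs_nonneg _) h1

lemma abs_sub_logisticFlow_le (N : ℕ) : ∃ C, ∀ s u, |s| ≤ 1 →
    |logisticFlow s u - u| ≤ C * (|s| * logisticWeight u ^ N) := by
  refine ⟨(N + 1).factorial * exp 1 ^ N, fun s u hs => ?_⟩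
  obtain ⟨ξ, hξ, h⟩ := exists_timeRate_mul s u
  have ha := logisticWeight_pos ξ
  have h1 := exp_neg_inv_le (N + 1) ha
  have h2 : |ξ - u| ≤ 1 :=
    (abs_sub_left_of_mem_uIcc hξ).trans ((abs_logisticFlow_sub_le s u).trans hs)
  have h3 : logisticWeight ξ ≤ exp 1 * logisticWeight u :=
    (logisticWeight_le u ξ).trans
      (mul_le_mul_of_nonneg_right (exp_le_exp.2 h2) (logisticWeight_pos u).le)
  have h4 : |logisticFlow s u - u| =
      |s| * ((logisticWeight ξ)⁻¹ * exp (-(logisticWeight ξ)⁻¹)) := by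
    have h5 : |s| = timeRate ξ * |logisticFlow s u - u| := by
      rw [← abs_of_pos (one_pos.trans_le (one_le_timeRate ξ)), ← abs_mul, h]
    rw [h5, timeRate, exp_neg]
    field_simp
  calc _ ≤ |s| * ((logisticWeight ξ)⁻¹ * ((N + 1).factorial * logisticWeight ξ ^ (N + 1))) := by
        rw [h4]; gcongr
    _ = |s| * ((N + 1).factorial * logisticWeight ξ ^ N) := by
      rw [pow_succ]; field_simp
    _ ≤ |s| * ((N + 1).factorial * (exp 1 * logisticWeight u) ^ N) := by gcongr
    _ = _ := by ring

end FlowTime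

section UnitFlow

open Real (sigmoid)

/-- The inverse of the logistic function on `(0, 1)`. -/
def logit (y : ℝ) : ℝ := log y - log (1 - y)

lemma sigmoid_logit {y : ℝ} (hy : y ∈ Ioo (0 : ℝ) 1) : sigmoid (logit y) = y := by
  have h1 := hy.1
  have h2 : 0 < 1 - y := sub_pos.2 hy.2
  rw [sigmoid_def, logit, neg_sub, exp_sub, exp_log h1, exp_log h2]
  field_simp
  ring

lemma logit_sigmoid (u : ℝ) : logit (sigmoid u) = u :=
  sigmoid_injective (sigmoid_logit ⟨sigmoid_pos u, sigmoid_lt_one u⟩)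

lemma sigmoid_mem (u : ℝ) : sigmoid u ∈ Ioo (0 : ℝ) 1 :=
  ⟨sigmoid_pos u, sigmoid_lt_one u⟩

/-- The transport of a homeomorphism of the line to the unit interval. -/
def unitMap (g : 𝓐) (y : ℝ) : ℝ := if y ∈ Ioo (0 : ℝ) 1 then sigmoid (g (logit y)) else y

lemma unitMap_sigmoid (g : 𝓐) (u : ℝ) : unitMap g (sigmoid u) = sigmoid (g u) := by
  rw [unitMap, if_pos (sigmoid_mem u), logit_sigmoid]

lemma unitMap_of_notMem (g : 𝓐) {y : ℝ} (hy : y ∉ Ioo (0 : ℝ) 1) : unitMap g y = y :=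
  if_neg hy

lemma unitMap_unitMap (g h : 𝓐) (y : ℝ) : unitMap g (unitMap h y) = unitMap (g * h) y := by
  by_cases hy : y ∈ Ioo (0 : ℝ) 1
  · rw [← sigmoid_logit hy, unitMap_sigmoid, unitMap_sigmoid, unitMap_sigmoid, mul_apply]
  · rw [unitMap_of_notMem h hy, unitMap_of_notMem g hy, unitMap_of_notMem _ hy]

lemma unitMap_one (y : ℝ) : unitMap 1 y = y := by
  by_cases hy : y ∈ Ioo (0 : ℝ) 1
  · rw [← sigmoid_logit hy, unitMap_sigmoid, one_orderIso_apply]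
  · exact unitMap_of_notMem _ hy

lemma unitMap_mem (g : 𝓐) {y : ℝ} (hy : y ∈ Ioo (0 : ℝ) 1) :
    unitMap g y ∈ Ioo (0 : ℝ) 1 := by
  rw [unitMap, if_pos hy]
  exact sigmoid_mem _

lemma strictMono_unitMap (g : 𝓐) : StrictMono (unitMap g) := by
  intro x y hxy
  by_cases hx : x ∈ Ioo (0 : ℝ) 1 <;> by_cases hy : y ∈ Ioo (0 : ℝ) 1
  · rw [← sigmoid_logit hx, ← sigmoid_logit hy] at hxy ⊢
    rw [unitMap_sigmoid, unitMap_sigmoid]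
    exact sigmoid_strictMono (g.strictMono (sigmoid_lt_iff.1 hxy))
  · rw [unitMap_of_notMem g hy]
    have h1 := (unitMap_mem g hx).2
    grind
  · rw [unitMap_of_notMem g hx]
    have h1 := (unitMap_mem g hy).1
    grind
  · rwa [unitMap_of_notMem g hx, unitMap_of_notMem g hy]

/-- The time `s` map of a smooth flow on the unit interval without fixed points inside. -/
def flow (s : ℝ) : 𝓐 :=
  StrictMono.orderIsoOfRightInverse (unitMap (logisticFlow s)) (strictMono_unitMap _)
    (unitMap (logisticFlow s)⁻¹) fun y => by rw [unitMap_unitMap, mul_inv_cancel, unitMap_one]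

lemma flow_apply (s y : ℝ) : flow s y = unitMap (logisticFlow s) y := rfl

lemma flow_sigmoid (s u : ℝ) : flow s (sigmoid u) = sigmoid (logisticFlow s u) :=
  unitMap_sigmoid _ u

lemma flow_of_notMem (s : ℝ) {y : ℝ} (hy : y ∉ Ioo (0 : ℝ) 1) : flow s y = y :=
  if_neg hy

lemma flow_mem (s : ℝ) {y : ℝ} (hy : y ∈ Ioo (0 : ℝ) 1) : flow s y ∈ Ioo (0 : ℝ) 1 :=
  unitMap_mem _ hy

lemma flow_add (s t : ℝ) : flow (s + t) = flow s * flow t :=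
  RelIso.ext fun y => by
    rw [mul_apply, flow_apply, flow_apply, flow_apply, unitMap_unitMap,
      logisticFlow_add]

lemma flow_zero : flow 0 = 1 := by
  have h := flow_add 0 0
  simp_all

lemma flow_neg (s : ℝ) : flow (-s) = (flow s)⁻¹ := by bound

lemma flow_commute (s t : ℝ) : Commute (flow s) (flow t) := by
  rw [commute_iff_eq, ← flow_add, ← flow_add, add_comm]

lemma flow_natCast_mul (n : ℕ) (s : ℝ) : flow (n * s) = flow s ^ n := by
  induction n with
  | zero => simp [flow_zero]
  | succ n ih => rw [pow_succ, ← ih, ← flow_add, Nat.cast_succ]; ring_nf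

lemma flow_strictMono {y : ℝ} (hy : y ∈ Ioo (0 : ℝ) 1) :
    StrictMono fun s => flow s y := by
  intro s t hst
  obtain ⟨u, rfl⟩ : ∃ u, sigmoid u = y := ⟨_, sigmoid_logit hy⟩
  simp only [flow_sigmoid]
  refine sigmoid_strictMono (flowTime.lt_iff_lt.1 ?_)
  rw [flowTime_logisticFlow, flowTime_logisticFlow]
  linarith

lemma exists_flow_eq {y y' : ℝ} (hy : y ∈ Ioo (0 : ℝ) 1) (hy' : y' ∈ Ioo (0 : ℝ) 1) :
    ∃ s, flow s y = y' := by
  obtain ⟨u, rfl⟩ : ∃ u, sigmoid u = y := ⟨_, sigmoid_logit hy⟩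
  obtain ⟨v, rfl⟩ : ∃ v, sigmoid v = y' := ⟨_, sigmoid_logit hy'⟩
  refine ⟨flowTime v - flowTime u, ?_⟩
  rw [flow_sigmoid]
  congr 1
  refine flowTime.injective ?_
  rw [flowTime_logisticFlow]
  ring

/-- The rate of the unit flow is `exp (-unitRate)`. -/
def unitRate (y : ℝ) : ℝ := (y * (1 - y))⁻¹

lemma logisticWeight_logit {y : ℝ} (hy : y ∈ Ioo (0 : ℝ) 1) :
    logisticWeight (logit y) = y * (1 - y) := by
  rw [logisticWeight, sigmoid_logit hy]

lemma contDiffAt_flow (s : ℝ) {y : ℝ} (hy : y ∈ Ioo (0 : ℝ) 1) :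
    ContDiffAt ℝ ∞ (flow s) y := by
  have h1 : ContDiffAt ℝ ∞ logit y :=
    (contDiffAt_id.log hy.1.ne').sub
      ((contDiffAt_const.sub contDiffAt_id).log (sub_pos.2 hy.2).ne')
  have h2 := (contDiff_sigmoid'.comp (isDiffeo_logisticFlow s).1).contDiffAt.comp y h1
  refine h2.congr_of_eventuallyEq ?_
  filter_upwards [isOpen_Ioo.mem_nhds hy] with z hz
  rw [flow_apply, unitMap, if_pos hz]
  rfl

lemma hasDerivAt_flow (s : ℝ) {y : ℝ} (hy : y ∈ Ioo (0 : ℝ) 1) :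
    HasDerivAt (flow s) (exp (unitRate y - unitRate (flow s y))) y := by
  obtain ⟨u, rfl⟩ : ∃ u, sigmoid u = y := ⟨_, sigmoid_logit hy⟩
  have h0 := ((contDiffAt_flow s hy).differentiableAt (by simp)).hasDerivAt
  have h1 := h0.comp u (hasDerivAt_sigmoid' u)
  have h2 : ((flow s : ℝ → ℝ) ∘ sigmoid) = sigmoid ∘ logisticFlow s :=
    funext (flow_sigmoid s)
  rw [h2] at h1
  have h3 := h1.unique ((hasDerivAt_sigmoid' _).comp u (deriv_logisticFlow s u))
  have hu := logisticWeight_pos u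
  have hv := logisticWeight_pos (logisticFlow s u)
  have h4 : deriv (flow s) (sigmoid u) =
      exp (unitRate (sigmoid u) - unitRate (flow s (sigmoid u))) := by
    rw [flow_sigmoid, unitRate, unitRate, ← logisticWeight, ← logisticWeight, exp_sub]
    rw [timeRate, timeRate] at h3
    refine mul_right_cancel₀ hu.ne' (h3.trans ?_)
    field_simp
  rwa [h4] at h0

lemma unit_weight_le {s y z : ℝ} (hs : |s| ≤ 1) (hy : y ∈ Ioo (0 : ℝ) 1)
    (hz : z ∈ uIcc y (flow s y)) :
    z ∈ Ioo (0 : ℝ) 1 ∧ y * (1 - y) ≤ exp 1 * (z * (1 - z)) := by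
  have hm : z ∈ Ioo (0 : ℝ) 1 := by
    have h1 := flow_mem s hy
    rcases mem_uIcc.1 hz with h | h
    · grind
    · grind
  refine ⟨hm, ?_⟩
  obtain ⟨u, rfl⟩ : ∃ u, sigmoid u = y := ⟨_, sigmoid_logit hy⟩
  obtain ⟨v, rfl⟩ : ∃ v, sigmoid v = z := ⟨_, sigmoid_logit hm⟩
  have hv : v ∈ uIcc u (logisticFlow s u) := by
    rw [flow_sigmoid] at hz
    rw [mem_uIcc, sigmoid_le_iff, sigmoid_le_iff, sigmoid_le_iff,
      sigmoid_le_iff] at hz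
    exact mem_uIcc.2 hz
  have h2 : |u - v| ≤ 1 := by
    rw [abs_sub_comm]
    exact (abs_sub_left_of_mem_uIcc hv).trans ((abs_logisticFlow_sub_le s u).trans hs)
  exact (logisticWeight_le v u).trans
    (mul_le_mul_of_nonneg_right (exp_le_exp.2 h2) (logisticWeight_pos v).le)

lemma sigmoid_lipschitz (u v : ℝ) : |sigmoid v - sigmoid u| ≤ |v - u| := by
  rw [← one_mul |v - u|]
  refine abs_sub_le_of_deriv_le (fun x _ => (hasDerivAt_sigmoid' x).differentiableAt) fun x _ => ?_
  rw [(hasDerivAt_sigmoid' x).deriv, abs_of_pos (logisticWeight_pos x)]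
  exact logisticWeight_le_one x

lemma abs_flow_sub_le (N : ℕ) : ∃ C, ∀ s y, |s| ≤ 1 → y ∈ Ioo (0 : ℝ) 1 →
    |flow s y - y| ≤ C * (|s| * (y * (1 - y)) ^ N) := by
  obtain ⟨C, hC⟩ := abs_sub_logisticFlow_le N
  refine ⟨C, fun s y hs hy => ?_⟩
  obtain ⟨u, rfl⟩ : ∃ u, sigmoid u = y := ⟨_, sigmoid_logit hy⟩
  rw [flow_sigmoid]
  exact (sigmoid_lipschitz _ _).trans (hC s u hs)

lemma unit_weight_pos {y : ℝ} (hy : y ∈ Ioo (0 : ℝ) 1) :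
    0 < y * (1 - y) ∧ y * (1 - y) ≤ 1 := by
  have h1 := hy.1
  have h2 := hy.2
  constructor <;> nlinarith

lemma contDiffAt_unitRate {y : ℝ} (hy : y ∈ Ioo (0 : ℝ) 1) : ContDiffAt ℝ ∞ unitRate y :=
  (contDiffAt_id.mul (contDiffAt_const.sub contDiffAt_id)).inv (unit_weight_pos hy).1.ne'

lemma jet_unitRate {ι : Type*} {y : ι → ℝ} (hy : ∀ i, y i ∈ Ioo (0 : ℝ) 1) (n : ℕ) :
    Jet (tameSeq (fun i => y i * (1 - y i)) fun i => unit_weight_pos (hy i)) n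
      (fun _ => unitRate) y := by
  have hb : BddJet (fun _ : ι => fun z : ℝ => z * (1 - z)) y := by
    have h1 : BddJet (fun _ : ι => fun z : ℝ => z) y := by
      refine bddJet_of_deriv ⟨1, fun i => ?_⟩ ?_
      · grind
      · simpa using bddJet_const (x := y) 1
    exact h1.mul ((bddJet_const 1).sub h1 (fun _ => contDiffAt_const) fun _ => contDiffAt_id)
      (fun _ => contDiffAt_id) fun _ => contDiffAt_const.sub contDiffAt_id
  refine (Jet.inv tame_mul_tame ⟨1, 1, fun i => ?_⟩ (hb.deriv n |>.mono_group bdd_le_tame)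
    (fun i => contDiffAt_id.mul (contDiffAt_const.sub contDiffAt_id))
    fun i => (unit_weight_pos (hy i)).1.ne').mono n.le_succ
  have h := (unit_weight_pos (hy i)).1
  rw [abs_of_pos (by positivity), pow_one, inv_mul_cancel₀ h.ne']

lemma jet_flow (j : ℕ) : ∀ N : ℕ, ∃ C, ∀ s y, |s| ≤ 1 → y ∈ Ioo (0 : ℝ) 1 →
    |iteratedDeriv j (disp (flow s)) y| ≤ C * (|s| * (y * (1 - y)) ^ N) := by
  let ι := {p : ℝ × ℝ // |p.1| ≤ 1 ∧ p.2 ∈ Ioo (0 : ℝ) 1}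
  have hadd : ∀ s y, y + disp (flow s) y = flow s y := fun s y => by
    rw [disp]; ring
  have htame : TameOn (fun i : ι => i.1.2 * (1 - i.1.2)) (fun i => i.1.2)
      (fun i => i.1.2 + disp (flow i.1.1) i.1.2) fun _ => unitRate := by
    refine ⟨fun i z hz => ?_, fun j => ?_⟩
    · simp only [hadd] at hz
      exact contDiffAt_unitRate (unit_weight_le i.2.1 i.2.2 hz).1
    · let J := {p : ι × ℝ // p.2 ∈ uIcc p.1.1.2 (flow p.1.1.1 p.1.1.2)}
      obtain ⟨N, C, hC⟩ := jet_unitRate (ι := J) (y := fun p => p.1.2)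
        (fun p => (unit_weight_le p.1.1.2.1 p.1.1.2.2 p.2).1) j j le_rfl
      refine ⟨N, exp 1 ^ N * C, fun i z hz => ?_⟩
      simp only [hadd] at hz
      have h1 := unit_weight_le i.2.1 i.2.2 hz
      have h2 := (unit_weight_pos i.2.2).1
      calc _ ≤ |iteratedDeriv j unitRate z| * (exp 1 * (z * (1 - z))) ^ N := by bound
        _ = exp 1 ^ N * (|iteratedDeriv j unitRate z| * (z * (1 - z)) ^ N) := by
            rw [mul_pow]; ring
        _ ≤ _ := by
            gcongr
            exact hC ⟨⟨i, z⟩, hz⟩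
  have h := jet_flat_displacement (ς := fun i : ι => |i.1.1|) (x := fun i => i.1.2)
    (h := fun i => disp (flow i.1.1)) (m := fun _ _ => 0)
    (fun i => unit_weight_pos i.2.2) (fun i => ⟨abs_nonneg _, i.2.1⟩)
    (fun i => (contDiffAt_flow _ i.2.2).sub contDiffAt_id) htame
    (fun _ => contDiffAt_const) (fun n => jet_const (AddSubgroup.zero_mem _)) ?_ ?_ j j le_rfl
  · intro N
    obtain ⟨C, hC⟩ := h N
    exact ⟨C, fun s y hs hy => hC ⟨(s, y), hs, hy⟩⟩
  · intro N
    obtain ⟨C, hC⟩ := abs_flow_sub_le N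
    bound
  · intro i
    filter_upwards [isOpen_Ioo.mem_nhds i.2.2] with z hz
    rw [hadd, add_zero, mul_one]
    exact ((hasDerivAt_flow i.1.1 hz).sub (hasDerivAt_id z)).deriv

lemma contDiffAt_iteratedDeriv {φ : ℝ → ℝ} {x : ℝ} (h : ContDiffAt ℝ ∞ φ x) (j : ℕ) :
    ContDiffAt ℝ ∞ (iteratedDeriv j φ) x := by
  induction j with
  | zero => rwa [iteratedDeriv_zero]
  | succ j ih =>
    rw [iteratedDeriv_succ]
    exact contDiffAt_deriv ih

/-- A function supported in `(0, 1)` all of whose derivatives are quadratically small at the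
boundary is smooth. -/
lemma contDiff_of_flat_off {φ : ℝ → ℝ} (h0 : ∀ y ∉ Ioo (0 : ℝ) 1, φ y = 0)
    (hs : ∀ y ∈ Ioo (0 : ℝ) 1, ContDiffAt ℝ ∞ φ y)
    (hb : ∀ j, ∃ C, ∀ y ∈ Ioo (0 : ℝ) 1, |iteratedDeriv j φ y| ≤ C * (y * (1 - y)) ^ 2) :
    ContDiff ℝ ∞ φ := by
  let G : ℕ → ℝ → ℝ := fun j y => if y ∈ Ioo (0 : ℝ) 1 then iteratedDeriv j φ y else 0
  have hG0 : G 0 = φ := by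
    funext y
    aesop
  rw [← hG0]
  refine contDiff_of_hasDerivAt_seq fun j y => ?_
  by_cases hy : y ∈ Ioo (0 : ℝ) 1
  · have h1 : HasDerivAt (iteratedDeriv j φ) (iteratedDeriv (j + 1) φ y) y := by
      rw [iteratedDeriv_succ]
      exact ((contDiffAt_iteratedDeriv (hs y hy) j).differentiableAt (by simp)).hasDerivAt
    simp only [G, if_pos hy]
    refine h1.congr_of_eventuallyEq ?_
    filter_upwards [isOpen_Ioo.mem_nhds hy] with z hz
    exact if_pos hz
  · obtain ⟨C, hC⟩ := hb j
    have hC0 : 0 ≤ C := by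
      have := (abs_nonneg _).trans (hC (1 / 2) (by constructor <;> norm_num))
      linarith
    have h1 : ∀ z, |G j z| ≤ C * |z - y| ^ 2 := by
      intro z
      by_cases hz : z ∈ Ioo (0 : ℝ) 1
      · simp only [G, if_pos hz]
        refine (hC z hz).trans ?_
        have h2 : z * (1 - z) ≤ |z - y| := by
          by_cases h3 : y ≤ 0
          · refine le_trans ?_ (le_abs_self _)
            nlinarith [hz.1, hz.2]
          · have h4 : 1 ≤ y := not_lt.1 fun h => hy ⟨not_le.1 h3, h⟩
            refine le_trans ?_ (neg_le_abs _)
            nlinarith [hz.1, hz.2]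
        have h3 := (unit_weight_pos hz).1
        gcongr
      · simp only [G, if_neg hz, abs_zero]
        positivity
    have h2 : G j y = 0 := if_neg hy
    have h3 : G (j + 1) y = 0 := if_neg hy
    rw [h3, hasDerivAt_iff_isLittleO, h2]
    simp only [sub_zero, smul_eq_mul, mul_zero]
    refine Asymptotics.IsBigO.trans_isLittleO (g := fun z => (z - y) ^ 2) ?_ ?_
    · refine Asymptotics.IsBigO.of_bound C (Eventually.of_forall fun z => ?_)
      simpa using h1 z
    · simpa [pow_two] using (Asymptotics.isLittleO_pow_sub_sub y (m := 2) (by norm_num))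

lemma isDiffeo_flow_of_le {s : ℝ} (hs : |s| ≤ 1) : IsDiffeo (flow s) := by
  have h1 : ContDiff ℝ ∞ (disp (flow s)) := by
    refine contDiff_of_flat_off (fun y hy => ?_)
      (fun y hy => (contDiffAt_flow s hy).sub contDiffAt_id) fun j => ?_
    · rw [disp, flow_of_notMem s hy, sub_self]
    · obtain ⟨C, hC⟩ := jet_flow j 2
      refine ⟨C * |s|, fun y hy => (hC s y hs hy).trans_eq (by ring)⟩
  have h2 : (flow s : ℝ → ℝ) = fun y => disp (flow s) y + y := by
    funext y
    rw [disp]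
    ring
  have h3 : ContDiff ℝ ∞ (flow s) := by
    rw [h2]
    exact h1.add contDiff_id
  refine ⟨h3, fun y => ?_⟩
  by_cases hy : y ∈ Ioo (0 : ℝ) 1
  · rw [(hasDerivAt_flow s hy).deriv]
    exact exp_pos _
  · have h4 : HasDerivAt (flow s) (deriv (flow s) y) y :=
      (h3.differentiable (by simp) y).hasDerivAt
    have h5 : deriv (flow s) y = 1 := by
      by_cases h6 : y ≤ 0
      · refine (uniqueDiffWithinAt_Iic y).eq_deriv _ h4.hasDerivWithinAt ?_
        refine (hasDerivWithinAt_id y _).congr (fun z hz => ?_) (flow_of_notMem s hy)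
        exact flow_of_notMem s fun hz' => (hz'.1.trans_le hz).not_ge h6
      · have h7 : 1 ≤ y := not_lt.1 fun h => hy ⟨not_le.1 h6, h⟩
        refine (uniqueDiffWithinAt_Ici y).eq_deriv _ h4.hasDerivWithinAt ?_
        refine (hasDerivWithinAt_id y _).congr (fun z hz => ?_) (flow_of_notMem s hy)
        exact flow_of_notMem s fun hz' => (h7.trans hz).not_gt hz'.2
    rw [h5]
    exact one_pos

lemma flow_mem_supported (s : ℝ) : flow s ∈ supported 0 1 := by
  obtain ⟨n, hn⟩ := exists_nat_ge |s|
  have h1 : s = (n + 1 : ℕ) * (s / (n + 1 : ℕ)) := by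
    field_simp
  rw [h1, flow_natCast_mul]
  refine Subgroup.pow_mem _
    (mem_supported.2 ⟨isDiffeo_flow_of_le ?_, fun y hy => flow_of_notMem _ hy⟩) _
  rw [abs_div, Nat.abs_cast, div_le_one (by positivity)]
  push_cast
  linarith

lemma isDiffeo_flow (s : ℝ) : IsDiffeo (flow s) := (flow_mem_supported s).1

lemma iteratedDeriv_flow_le (j : ℕ) : ∃ C, 0 ≤ C ∧ ∀ s y, |s| ≤ 1 →
    |iteratedDeriv j (disp (flow s)) y| ≤ C * |s| := by
  obtain ⟨C, hC⟩ := jet_flow j 0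
  have hC0 : 0 ≤ C := by
    have := (abs_nonneg _).trans (hC 1 (1 / 2) (by simp) (by constructor <;> norm_num))
    simpa using this
  refine ⟨C, hC0, fun s y hs => ?_⟩
  have hc := (isDiffeo_flow s).contDiff_disp.continuous_iteratedDeriv j (natCast_le_infty j)
  have hin : ∀ y ∈ Icc (0 : ℝ) 1, |iteratedDeriv j (disp (flow s)) y| ≤ C * |s| := by
    have hcl : IsClosed {y | |iteratedDeriv j (disp (flow s)) y| ≤ C * |s|} :=
      isClosed_le hc.abs continuous_const
    intro y hy
    rw [← closure_Ioo (by norm_num : (0 : ℝ) ≠ 1)] at hy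
    exact hcl.closure_subset_iff.2 (fun z hz => by simpa using hC s z hs hz) hy
  by_cases hy : y ∈ Icc (0 : ℝ) 1
  · exact hin y hy
  · have h1 : disp (flow s) =ᶠ[𝓝 y] 0 := by
      filter_upwards [isClosed_Icc.isOpen_compl.mem_nhds hy] with z hz
      rw [disp, flow_of_notMem s fun h => hz (Ioo_subset_Icc_self h), sub_self]
      rfl
    rw [iteratedDeriv_eq_zero_of_eventuallyEq h1, abs_zero]
    positivity

lemma ld_flow_le : ∃ C, 0 ≤ C ∧ ∀ s y, |s| ≤ 1 → |ld (flow s) y| ≤ C := by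
  obtain ⟨C, h0, hC⟩ := iteratedDeriv_flow_le 1
  have h1 : ∀ s y, |s| ≤ 1 → ld (flow s) y ≤ C := by
    intro s y hs
    have hd := (isDiffeo_flow s).2 y
    have h2 := hC s y hs
    rw [iteratedDeriv_disp (isDiffeo_flow s).1.contDiffAt, iteratedDeriv_one,
      iteratedDeriv_one, deriv_id] at h2
    have h3 : C * |s| ≤ C := mul_le_of_le_one_right h0 hs
    have h4 := log_le_sub_one_of_pos hd
    rw [ld]
    linarith [le_abs_self (deriv (flow s) y - 1)]
  refine ⟨C, h0, fun s y hs => abs_le.2 ⟨?_, h1 s y hs⟩⟩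
  have h2 := h1 (-s) (flow s y) (by rwa [abs_neg])
  rw [flow_neg, ld_inv_apply (isDiffeo_flow s)] at h2
  linarith

lemma logBdd_flow {ι : Type*} {s y : ι → ℝ} (hs : ∀ i, |s i| ≤ 1) :
    LogBdd (fun i => flow (s i)) y := by
  obtain ⟨C, h0, hC⟩ := ld_flow_le
  refine logBdd_of_bddJet (fun i => isDiffeo_flow _) ⟨C, fun i => hC _ _ (hs i)⟩
    (bddJet_iff.2 fun j => ?_)
  obtain ⟨C', h0', hC'⟩ := iteratedDeriv_flow_le (j + 1)
  refine ⟨C' + 1, fun i => ?_⟩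
  rw [← iteratedDeriv_succ']
  have h1 := hC' (s i) (y i) (hs i)
  rw [iteratedDeriv_disp (isDiffeo_flow _).1.contDiffAt] at h1
  have h2 : |iteratedDeriv (j + 1) id (y i)| ≤ 1 := by
    cases j <;> simp [iteratedDeriv_id]
  have h3 : C' * |s i| ≤ C' := mul_le_of_le_one_right h0' (hs i)
  calc _ = |(iteratedDeriv (j + 1) (flow (s i)) (y i) - iteratedDeriv (j + 1) id (y i)) +
        iteratedDeriv (j + 1) id (y i)| := by ring_nf
    _ ≤ _ := (abs_add_le _ _).trans (by linarith)

lemma ld_flow_le_weight : ∃ C, 0 ≤ C ∧ ∀ s y, |s| ≤ 1 → y ∈ Ioo (0 : ℝ) 1 →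
    |ld (flow s) y| ≤ C * (y * (1 - y)) := by
  obtain ⟨C, hC⟩ := jet_flow 1 1
  have h0 : 0 ≤ C := by
    have := (abs_nonneg _).trans (hC 1 (1 / 2) (by simp) (by constructor <;> norm_num))
    linarith
  have h1 : ∀ s y, |s| ≤ 1 → y ∈ Ioo (0 : ℝ) 1 → ld (flow s) y ≤ C * (y * (1 - y)) := by
    intro s y hs hy
    have hd := (isDiffeo_flow s).2 y
    have h2 := hC s y hs hy
    have hw := (unit_weight_pos hy).1
    rw [iteratedDeriv_disp (isDiffeo_flow s).1.contDiffAt, iteratedDeriv_one,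
      iteratedDeriv_one, deriv_id, pow_one] at h2
    have h3 : C * (|s| * (y * (1 - y))) ≤ C * (y * (1 - y)) :=
      mul_le_mul_of_nonneg_left (mul_le_of_le_one_left hw.le hs) h0
    have h4 := log_le_sub_one_of_pos hd
    rw [ld]
    linarith [le_abs_self (deriv (flow s) y - 1)]
  refine ⟨C * exp 1, by positivity, fun s y hs hy => abs_le.2 ⟨?_, ?_⟩⟩
  · have h2 := h1 (-s) (flow s y) (by rwa [abs_neg]) (flow_mem s hy)
    rw [flow_neg, ld_inv_apply (isDiffeo_flow s)] at h2
    have h3 := (unit_weight_le (s := -s) (z := y) (by rwa [abs_neg]) (flow_mem s hy) (by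
      rw [flow_neg, inv_apply_self]
      exact right_mem_uIcc)).2
    nlinarith
  · refine (h1 s y hs hy).trans ?_
    have hw := (unit_weight_pos hy).1
    bound

end UnitFlow

section Distortion

lemma ld_pow {f : 𝓐} (hf : IsDiffeo f) (k : ℕ) :
    ld (f ^ k) = fun y => ∑ i ∈ Finset.range k, ld f ((f ^ i) y) := by
  induction k with
  | zero => funext y; simp [ld_one]
  | succ k ih =>
    funext y
    rw [pow_succ', ld_mul hf (hf.pow k), ih, Finset.sum_range_succ]
    ring

variable {B : Type*} {f : B → 𝓐} {w₀ w₁ : B → ℝ}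

/-- Classical distortion estimate. -/
lemma abs_ld_pow_sub_le (hf : ∀ b, IsDiffeo (f b))
    (hb : LogBdd (fun p : B × ℝ => f p.1) fun p => p.2) :
    ∃ C, 0 < C ∧ ∀ b (k : ℕ) (w₀ w₁ : ℝ), ∀ y ∈ Icc w₀ w₁, ∀ y' ∈ Icc w₀ w₁,
      |ld (f b ^ k) y' - ld (f b ^ k) y| ≤
        C * ∑ i ∈ Finset.range k, ((f b ^ i) w₁ - (f b ^ i) w₀) := by
  obtain ⟨C, h0, hC⟩ := hb.bound 1
  refine ⟨C, h0, fun b k w₀ w₁ y hy y' hy' => ?_⟩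
  have hlip : ∀ z z', |ld (f b) z' - ld (f b) z| ≤ C * |z' - z| := fun z z' =>
    abs_sub_le_of_deriv_le (fun x _ => (hf b).contDiff_ld.differentiable (by simp) x)
      fun x _ => by simpa using hC (b, x)
  rw [ld_pow (hf b)]
  simp only
  rw [← Finset.sum_sub_distrib, Finset.mul_sum]
  refine (Finset.abs_sum_le_sum_abs _ _).trans (Finset.sum_le_sum fun i _ => ?_)
  refine (hlip _ _).trans (mul_le_mul_of_nonneg_left ?_ h0.le)
  have h1 := (f b ^ i).monotone hy.1
  have h2 := (f b ^ i).monotone hy.2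
  have h3 := (f b ^ i).monotone hy'.1
  have h4 := (f b ^ i).monotone hy'.2
  exact abs_le.2 ⟨by linarith, by linarith⟩

lemma deriv_pow_le (hf : ∀ b, IsDiffeo (f b))
    (hb : LogBdd (fun p : B × ℝ => f p.1) fun p => p.2) {μ L : ℝ} (hμ : 0 < μ)
    (hw : ∀ b, μ ≤ w₁ b - w₀ b)
    (hL : ∀ b (m : ℕ), ∑ i ∈ Finset.range m, ((f b ^ i) (w₁ b) - (f b ^ i) (w₀ b)) ≤ L) :
    ∃ C, ∀ b (k : ℕ), ∀ y ∈ Icc (w₀ b) (w₁ b),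
      deriv (f b ^ k : 𝓐) y ≤ C * ((f b ^ k) (w₁ b) - (f b ^ k) (w₀ b)) := by
  obtain ⟨C, h0, hC⟩ := abs_ld_pow_sub_le hf hb
  refine ⟨exp (C * L) / μ, fun b k y hy => ?_⟩
  have hlt : w₀ b < w₁ b := by linarith [hw b]
  have hd := (hf b).pow k
  obtain ⟨ξ, hξ, h1⟩ := exists_deriv_eq_slope (f b ^ k : 𝓐) hlt hd.1.continuous.continuousOn
    hd.differentiable.differentiableOn
  have h2 := hC b k _ _ ξ (Ioo_subset_Icc_self hξ) y hy
  have h3 : ld (f b ^ k) y ≤ C * L + ld (f b ^ k) ξ := by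
    have := mul_le_mul_of_nonneg_left (hL b k) h0.le
    grind
  have h4 := hw b
  have h5 : 0 ≤ (f b ^ k) (w₁ b) - (f b ^ k) (w₀ b) :=
    sub_nonneg.2 ((f b ^ k).monotone hlt.le)
  calc deriv (f b ^ k : 𝓐) y = exp (ld (f b ^ k) y) := (hd.exp_ld y).symm
    _ ≤ exp (C * L) * exp (ld (f b ^ k) ξ) := by
      rw [← exp_add]
      exact exp_le_exp.2 h3
    _ = exp (C * L) * (((f b ^ k) (w₁ b) - (f b ^ k) (w₀ b)) / (w₁ b - w₀ b)) := by
      rw [hd.exp_ld, h1]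
    _ ≤ exp (C * L) * (((f b ^ k) (w₁ b) - (f b ^ k) (w₀ b)) / μ) := by gcongr
    _ = _ := by ring

/-- Higher order distortion estimate: the iterates of diffeomorphisms along orbits of intervals of
bounded total length have logarithmic derivatives with bounded jets. -/
lemma bddJet_deriv_ld_pow (hf : ∀ b, IsDiffeo (f b))
    (hb : LogBdd (fun p : B × ℝ => f p.1) fun p => p.2) {μ L : ℝ} (hμ : 0 < μ)
    (hw : ∀ b, μ ≤ w₁ b - w₀ b)
    (hL : ∀ b (m : ℕ), ∑ i ∈ Finset.range m, ((f b ^ i) (w₁ b) - (f b ^ i) (w₀ b)) ≤ L) :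
    BddJet (fun p : {p : B × ℕ × ℝ // p.2.2 ∈ Icc (w₀ p.1) (w₁ p.1)} =>
      deriv (ld (f p.1.1 ^ p.1.2.1))) fun p => p.1.2.2 := by
  let Q := {p : B × ℕ × ℝ // p.2.2 ∈ Icc (w₀ p.1) (w₁ p.1)}
  let x : Q → ℝ := fun p => p.1.2.2
  let F : Q → 𝓐 := fun p => f p.1.1 ^ p.1.2.1
  let ℓ : Q → ℝ := fun p =>
    (f p.1.1 ^ p.1.2.1) (w₁ p.1.1) - (f p.1.1 ^ p.1.2.1) (w₀ p.1.1)
  have hF : ∀ p, IsDiffeo (F p) := fun p => (hf _).pow _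
  have hlt : ∀ b, w₀ b ≤ w₁ b := fun b => by linarith [hw b]
  have hℓ0 : ∀ b (i : ℕ), 0 ≤ (f b ^ i) (w₁ b) - (f b ^ i) (w₀ b) := fun b i =>
    sub_nonneg.2 ((f b ^ i).monotone (hlt b))
  have hℓL : ∀ b (i : ℕ), (f b ^ i) (w₁ b) - (f b ^ i) (w₀ b) ≤ L := fun b i =>
    (Finset.single_le_sum (f := fun i => (f b ^ i) (w₁ b) - (f b ^ i) (w₀ b))
      (fun i _ => hℓ0 b i) (Finset.self_mem_range_succ i)).trans (hL b (i + 1))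
  have hsmall : smallSeq ℓ ≤ bddSeq Q := by
    rintro a ⟨C, hC⟩
    refine ⟨|C| * L, fun p => (hC p).trans ?_⟩
    exact mul_le_mul (le_abs_self C) (hℓL _ _) (hℓ0 _ _) (abs_nonneg C)
  have hmul : ∀ a ∈ smallSeq ℓ, ∀ b ∈ bddSeq Q, a * b ∈ smallSeq ℓ := by
    rintro a ⟨C, hC⟩ b ⟨D, hD⟩
    refine ⟨C * D, fun p => ?_⟩
    rw [Pi.mul_apply, abs_mul]
    calc |a p| * |b p| ≤ (C * ℓ p) * D :=
          mul_le_mul (hC p) (hD p) (abs_nonneg _) ((abs_nonneg _).trans (hC p))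
      _ = _ := by ring
  have hD0 : (fun p => deriv (F p) (x p)) ∈ smallSeq ℓ := by
    obtain ⟨C, hC⟩ := deriv_pow_le hf hb hμ hw hL
    exact ⟨C, fun p => by
      rw [abs_of_pos ((hF p).2 _)]
      exact hC p.1.1 p.1.2.1 _ p.2⟩
  have hstep : ∀ n, Jet (smallSeq ℓ) n (fun p => deriv (F p)) x →
      Jet (bddSeq Q) n (fun p => deriv (ld (F p))) x := by
    intro n hn
    have h1 : Jet (smallSeq ℓ) n
        (fun p y => deriv (F p) y * deriv (ld (f p.1.1)) (F p y)) x := by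
      refine hn.mul hmul (Jet.comp' mul_mem_bddSeq ?_ (hn.mono_group hsmall) ?_ (smoothAt_coe hF))
        (smoothAt_deriv hF) ?_
      · exact (BddJet.deriv hb).reindex (fun p : Q => (p.1.1, F p (x p))) n
      · exact SmoothAt.deriv (smoothAt_ld fun p => hf _)
      · exact SmoothAt.comp (SmoothAt.deriv (smoothAt_ld fun p => hf _)) (smoothAt_coe hF)
    intro j hj
    obtain ⟨C, hC⟩ := h1 j hj
    refine ⟨|C| * L, fun p => ?_⟩
    have hs : ∀ i, ContDiff ℝ ∞ fun y =>
        deriv (f p.1.1 ^ i : 𝓐) y * deriv (ld (f p.1.1)) ((f p.1.1 ^ i) y) := fun i =>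
      ((hf _).pow i).contDiff_deriv.mul
        ((contDiff_infty_iff_deriv.1 (hf p.1.1).contDiff_ld).2.comp ((hf _).pow i).1)
    have h2 : deriv (ld (F p)) = fun y => ∑ i ∈ Finset.range p.1.2.1,
        deriv (f p.1.1 ^ i : 𝓐) y * deriv (ld (f p.1.1)) ((f p.1.1 ^ i) y) := by
      funext y
      rw [ld_pow (hf _)]
      refine (HasDerivAt.fun_sum fun i _ => ?_).deriv
      have h3 := ((hf p.1.1).contDiff_ld.differentiable (by simp) ((f p.1.1 ^ i) y)).hasDerivAt
      have h4 := (((hf p.1.1).pow i).differentiable y).hasDerivAt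
      rw [mul_comm]
      exact h3.comp y h4
    simp only
    rw [h2, iteratedDeriv_fun_sum fun i _ => (hs i).contDiffAt.of_le (natCast_le_infty j)]
    refine (Finset.abs_sum_le_sum_abs _ _).trans ?_
    refine le_trans ?_ (mul_le_mul_of_nonneg_left (hL p.1.1 p.1.2.1) (abs_nonneg C))
    rw [Finset.mul_sum]
    refine Finset.sum_le_sum fun i _ => ?_
    exact (hC ⟨(p.1.1, i, p.1.2.2), p.2⟩).trans
      (mul_le_mul_of_nonneg_right (le_abs_self C) (hℓ0 _ _))
  have hind : ∀ n, Jet (smallSeq ℓ) n (fun p => deriv (F p)) x := by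
    intro n
    induction n with
    | zero => exact jet_zero.2 hD0
    | succ n ih =>
      refine jet_of_deriv_eq_mul hmul hD0 (hstep n ih) (smoothAt_deriv hF)
        (SmoothAt.deriv (smoothAt_ld hF)) fun p => Eventually.of_forall fun y => ?_
      show deriv (deriv (F p)) y = deriv (F p) y * deriv (ld (F p)) y
      rw [(hF p).deriv_ld]
      have := (hF p).2 y
      field_simp
  exact fun n => hstep n (hind n)

end Distortion

section Cutoff

/-- A smooth cutoff equal to one near zero and supported in the unit ball. -/
def cutoff : ContDiffBump (0 : ℝ) := ⟨1 / 2, 1, by norm_num, by norm_num⟩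

lemma cutoff_eq_one {x : ℝ} (hx : |x| ≤ 1 / 2) : cutoff x = 1 :=
  cutoff.one_of_mem_closedBall (by simpa [cutoff] using hx)

lemma cutoff_eq_zero {x : ℝ} (hx : 1 ≤ |x|) : cutoff x = 0 :=
  cutoff.zero_of_le_dist (by simpa [cutoff] using hx)

lemma contDiff_cutoff : ContDiff ℝ ∞ cutoff := cutoff.contDiff

lemma cutoff_iteratedDeriv_le (j : ℕ) : ∃ C, ∀ x, |iteratedDeriv j cutoff x| ≤ C := by
  have hcont := contDiff_cutoff.continuous_iteratedDeriv j (natCast_le_infty j)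
  have hcs : HasCompactSupport (iteratedDeriv j cutoff) := by
    refine HasCompactSupport.intro (isCompact_closedBall (0 : ℝ) 1) fun x hx => ?_
    refine iteratedDeriv_eq_zero_of_eventuallyEq ?_ j
    filter_upwards [Metric.isClosed_closedBall.isOpen_compl.mem_nhds hx] with y hy
    refine cutoff_eq_zero ?_
    have : ¬ |y| ≤ 1 := by simpa using hy
    exact (not_le.1 this).le
  obtain ⟨C, hC⟩ := hcont.bounded_above_of_compact_support hcs
  exact ⟨C, hC⟩

lemma abs_iteratedDeriv_le_pow {w : ℝ → ℝ} (hw : ContDiff ℝ ∞ w) {z : ℝ}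
    (h0 : ∀ j, iteratedDeriv j w z = 0) (N : ℕ) :
    ∀ j, ∃ C, ∀ x, |x - z| ≤ 1 → |iteratedDeriv j w x| ≤ C * |x - z| ^ N := by
  induction N with
  | zero =>
    intro j
    obtain ⟨C, hC⟩ := (isCompact_Icc (a := z - 1) (b := z + 1)).exists_bound_of_continuousOn
      (hw.continuous_iteratedDeriv j (natCast_le_infty j)).continuousOn
    refine ⟨C, fun x hx => ?_⟩
    have := abs_le.1 hx
    simpa using hC x ⟨by linarith, by linarith⟩
  | succ N ih =>
    intro j
    obtain ⟨C, hC⟩ := ih (j + 1)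
    refine ⟨C, fun x hx => ?_⟩
    have := abs_sub_le_of_deriv_le (C := C * |x - z| ^ N)
      (fun y _ => (hasDerivAt_iteratedDeriv hw j y).differentiableAt) fun y (hy : y ∈ uIcc z x) => ?_
    · rw [h0 j, sub_zero] at this
      rw [pow_succ, ← mul_assoc]
      exact this
    · have h1 : |y - z| ≤ |x - z| := abs_sub_left_of_mem_uIcc hy
      rw [(hasDerivAt_iteratedDeriv hw j y).deriv]
      have h2 := hC x hx
      refine (hC y (h1.trans hx)).trans ?_
      have h3 : 0 ≤ C := by
        by_contra hneg
        have h4 := hC (z + 1) (by simp)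
        have h5 := abs_nonneg (iteratedDeriv (j + 1) w (z + 1))
        simp at h4
        linarith
      gcongr

/-- Cutting off a flat function at a small scale yields a small function. -/
lemma cutoff_mul_flat {w : ℝ → ℝ} (hw : ContDiff ℝ ∞ w) {z : ℝ}
    (h0 : ∀ j, iteratedDeriv j w z = 0) (j : ℕ) :
    ∃ C, ∀ c x, 0 < c → c ≤ 1 / 2 →
      |iteratedDeriv j (fun x => cutoff ((x - z) / c) * w x) x| ≤ C * c := by
  let ι := {p : ℝ × ℝ // (0 < p.1 ∧ p.1 ≤ 1 / 2) ∧ |p.2 - z| ≤ 2 * p.1}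
  let W : ι → ℝ := fun p => p.1.1
  have hW : ∀ p, 0 < W p ∧ W p ≤ 1 := fun p => ⟨p.2.1.1, p.2.1.2.trans (by norm_num)⟩
  let x : ι → ℝ := fun p => p.1.2
  have hs : ∀ c : ℝ, ContDiff ℝ ∞ fun y => cutoff ((y - z) / c) := fun c =>
    contDiff_cutoff.comp ((contDiff_id.sub contDiff_const).div_const c)
  have h1 : ∀ n, Jet (tameSeq W hW) n (fun p y => cutoff ((y - z) / p.1.1)) x := by
    intro n i hi
    obtain ⟨C, hC⟩ := cutoff_iteratedDeriv_le i
    refine ⟨i, C, fun p => ?_⟩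
    have hp := (hW p).1
    have h2 : (fun y => cutoff ((y - z) / p.1.1)) =
        fun y => (fun t => cutoff t) (-z / p.1.1 + (p.1.1)⁻¹ * y) := by
      funext y
      congr 1
      field_simp
      ring
    beta_reduce
    rw [h2, iteratedDeriv_comp_affine contDiff_cutoff, abs_mul, abs_pow, abs_of_pos (inv_pos.2 hp)]
    calc _ = |iteratedDeriv i cutoff (-z / p.1.1 + (p.1.1)⁻¹ * x p)| *
          ((p.1.1)⁻¹ * p.1.1) ^ i := by rw [mul_pow]; ring
      _ ≤ C := by
        rw [inv_mul_cancel₀ (ne_of_gt hp), one_pow, mul_one]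
        exact hC _
  have h2 : ∀ n, Jet (flatSeq (fun _ => 1) W) n (fun (_ : ι) => w) x := by
    intro n i hi N
    obtain ⟨C, hC⟩ := abs_iteratedDeriv_le_pow hw h0 N i
    refine ⟨|C| * 2 ^ N, fun p => ?_⟩
    have hp := (hW p).1
    refine (hC _ (p.2.2.trans (by linarith [p.2.1.2]))).trans ?_
    calc C * |x p - z| ^ N ≤ |C| * (2 * W p) ^ N := by bound
      _ = _ := by rw [mul_pow]; ring
  have h3 := (h1 j).mul tame_mul_flat (h2 j) (fun p => (hs p.1.1).contDiffAt) fun p =>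
    hw.contDiffAt
  obtain ⟨C, hC⟩ := h3 j le_rfl 1
  refine ⟨|C|, fun c y hc hc1 => ?_⟩
  by_cases hy : |y - z| ≤ 2 * c
  · refine (hC ⟨(c, y), ⟨hc, hc1⟩, hy⟩).trans ?_
    bound
  · rw [iteratedDeriv_eq_zero_of_eventuallyEq]
    · simp_all
    · have h4 : ∀ᶠ t in 𝓝 y, 2 * c < |t - z| :=
        (continuous_id.sub continuous_const).abs.continuousAt.eventually (lt_mem_nhds (not_le.1 hy))
      filter_upwards [h4] with t ht
      rw [cutoff_eq_zero, zero_mul, Pi.zero_apply]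
      rw [abs_div, abs_of_pos hc, le_div_iff₀ hc]
      linarith

lemma strictMono_of_deriv_pos' {u : ℝ → ℝ} (hu : ContDiff ℝ ∞ u) (h : ∀ x, 0 < deriv u x)
    {a b : ℝ} (hab : ∀ x ∉ Ioo a b, u x = x) : ∃ F : 𝓐, F ∈ supported a b ∧ (F : ℝ → ℝ) = u := by
  have hm : StrictMono u := strictMono_of_deriv_pos h
  have hs : Function.Surjective u := by
    refine hu.continuous.surjective ?_ ?_
    · refine tendsto_id.congr' ?_
      filter_upwards [eventually_ge_atTop b] with x hx
      simp_all
    · refine tendsto_id.congr' ?_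
      filter_upwards [eventually_le_atBot a] with x hx
      simp_all
  exact ⟨hm.orderIsoOfSurjective u hs, mem_supported.2 ⟨⟨hu, h⟩, hab⟩, rfl⟩

lemma iteratedDeriv_sub_eq_zero_of_mem_supported {a b : ℝ} {G E : 𝓐}
    (hG : G ∈ supported a b) (hE : E ∈ supported a b) (j : ℕ) {z : ℝ}
    (hz : z ∉ Ioo a b) :
    iteratedDeriv j (fun x => G x - E x) z = 0 := by
  have hc : IsClosed {x | iteratedDeriv j (fun x => G x - E x) x = 0} :=
    isClosed_singleton.preimage
      ((hG.1.1.sub hE.1.1).continuous_iteratedDeriv j (natCast_le_infty j))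
  have hsub : (Icc a b)ᶜ ⊆ {x | iteratedDeriv j (fun x => G x - E x) x = 0} := fun x hx => by
    refine iteratedDeriv_eq_zero_of_eventuallyEq ?_ j
    filter_upwards [isClosed_Icc.isOpen_compl.mem_nhds hx] with y hy
    have hy' : y ∉ Ioo a b := fun h => hy (Ioo_subset_Icc_self h)
    simp [hG.2 y hy', hE.2 y hy']
  refine hc.closure_subset_iff.2 hsub ?_
  rw [closure_compl, interior_Icc]
  exact hz

/-- Interpolation of two diffeomorphisms of the unit interval which are flat at the end points:
the result agrees with the first one near the end points and with the second one elsewhere. -/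
lemma exists_interpolation {G E : 𝓐} (hG : G ∈ supported 0 1) (hE : E ∈ supported 0 1)
    {δ : ℝ} (hδ : 0 < δ) : ∃ (F : ℕ → 𝓐) (c : ℕ → ℝ), (∀ n, F n ∈ supported 0 1) ∧
      UnifLogBdd F ∧ TendstoUniformly (fun n => (F n : ℝ → ℝ)) E atTop ∧
      (∀ n x, F n x ∈ segment ℝ (E x) (G x)) ∧ (∀ n, 0 < c n ∧ c n ≤ δ) ∧
      Tendsto c atTop (𝓝 0) ∧ (∀ n x, c n ≤ x → x ≤ 1 - c n → F n x = E x) ∧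
      ∀ n x, x ≤ c n / 2 ∨ 1 - c n / 2 ≤ x → F n x = G x := by
  have hw : ContDiff ℝ ∞ fun x => G x - E x := hG.1.1.sub hE.1.1
  have hz : ∀ j, ∃ C, 0 < C ∧ ∀ c x, 0 < c → c ≤ 1 / 2 →
      |iteratedDeriv j (fun x => (cutoff ((x - 0) / c) + cutoff ((x - 1) / c)) * (G x - E x)) x|
        ≤ C * c := by
    intro j
    obtain ⟨C₀, h0⟩ := cutoff_mul_flat hw (z := 0) (fun j =>
      iteratedDeriv_sub_eq_zero_of_mem_supported hG hE j (by simp)) j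
    obtain ⟨C₁, h1⟩ := cutoff_mul_flat hw (z := 1) (fun j =>
      iteratedDeriv_sub_eq_zero_of_mem_supported hG hE j (by simp)) j
    refine ⟨|C₀ + C₁| + 1, by positivity, fun c x hc hc1 => ?_⟩
    have hs : ∀ z, ContDiff ℝ ∞ fun x => cutoff ((x - z) / c) * (G x - E x) := fun z =>
      (contDiff_cutoff.comp ((contDiff_id.sub contDiff_const).div_const c)).mul hw
    have he : (fun x => (cutoff ((x - 0) / c) + cutoff ((x - 1) / c)) * (G x - E x)) =
        (fun x => cutoff ((x - 0) / c) * (G x - E x)) +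
          fun x => cutoff ((x - 1) / c) * (G x - E x) := by
      funext x
      simp only [Pi.add_apply]
      ring
    rw [he, iteratedDeriv_add ((hs 0).contDiffAt.of_le (natCast_le_infty j))
      ((hs 1).contDiffAt.of_le (natCast_le_infty j))]
    refine (abs_add_le _ _).trans ?_
    have := mul_le_mul_of_nonneg_right (le_abs_self (C₀ + C₁)) hc.le
    linarith [h0 c x hc hc1, h1 c x hc hc1]
  choose C hC0 hC using hz
  have hEu := supported_le_unifDiffeo hE
  obtain ⟨D, hD⟩ := ld_le_of_mem_unifDiffeo hEu
  have hDE : ∀ x, exp (-D) ≤ deriv E x := fun x => by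
    rw [← hE.1.exp_ld]
    exact exp_le_exp.2 (abs_le.1 (hD x)).1
  have hDE' : ∀ x, deriv E x ≤ exp D := fun x => by
    rw [← hE.1.exp_ld]
    exact exp_le_exp.2 (abs_le.1 (hD x)).2
  let m := min (min δ (1 / 2)) (exp (-D) / 2 / C 1)
  have hC1 := hC0 1
  have hm : 0 < m := by positivity
  let c : ℕ → ℝ := fun n => m * kappa n
  have hκ := kappa_mem
  have hc : ∀ n, 0 < c n ∧ c n ≤ m := fun n =>
    ⟨mul_pos hm (hκ n).1, mul_le_of_le_one_right hm.le (hκ n).2⟩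
  have hcδ : ∀ n, c n ≤ δ := fun n => (hc n).2.trans ((min_le_left _ _).trans (min_le_left _ _))
  have hc2 : ∀ n, c n ≤ 1 / 2 := fun n =>
    (hc n).2.trans ((min_le_left _ _).trans (min_le_right _ _))
  have hcD : ∀ n, C 1 * c n ≤ exp (-D) / 2 := fun n => by
    have := (hc n).2.trans (min_le_right _ _)
    rwa [le_div_iff₀ hC1, mul_comm] at this
  have hclim : Tendsto c atTop (𝓝 0) := by simpa using tendsto_kappa.const_mul m
  let v : ℕ → ℝ → ℝ := fun n x => (cutoff ((x - 0) / c n) + cutoff ((x - 1) / c n)) * (G x - E x)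
  have hv : ∀ n, ContDiff ℝ ∞ (v n) := fun n =>
    ((contDiff_cutoff.comp ((contDiff_id.sub contDiff_const).div_const (c n))).add
      (contDiff_cutoff.comp ((contDiff_id.sub contDiff_const).div_const (c n)))).mul hw
  have hvC : ∀ n j x, |iteratedDeriv j (v n) x| ≤ C j * c n := fun n j x =>
    hC j (c n) x (hc n).1 (hc2 n)
  have hu : ∀ n, ContDiff ℝ ∞ (⇑E + v n) := fun n => hE.1.1.add (hv n)
  have hdu : ∀ n x, |deriv (⇑E + v n) x - deriv E x| ≤ C 1 * c n := fun n x => by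
    have := hvC n 1 x
    rw [iteratedDeriv_one] at this
    rwa [deriv_add (hE.1.differentiable x) ((hv n).differentiable (by simp) x),
      add_sub_cancel_left]
  have hlow : ∀ n x, exp (-D) / 2 ≤ deriv (⇑E + v n) x := fun n x => by
    linarith [(abs_le.1 (hdu n x)).1, hcD n, hDE x]
  have hup : ∀ n x, deriv (⇑E + v n) x ≤ exp D + exp (-D) / 2 := fun n x => by
    linarith [(abs_le.1 (hdu n x)).2, hcD n, hDE' x]
  have hoff : ∀ n, ∀ x ∉ Ioo (0 : ℝ) 1, (⇑E + v n) x = x := fun n x hx => by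
    simp [v, hG.2 x hx, hE.2 x hx]
  choose F hF hFv using fun n => strictMono_of_deriv_pos' (hu n)
    (fun x => (half_pos (exp_pos _)).trans_le (hlow n x)) (hoff n)
  have hFx : ∀ n x, F n x =
      E x + (cutoff ((x - 0) / c n) + cutoff ((x - 1) / c n)) * (G x - E x) := fun n x =>
    congrFun (hFv n) x
  refine ⟨F, c, hF, ?_, ?_, fun n x => ?_, fun n => ⟨(hc n).1, hcδ n⟩, hclim, fun n x hx hx1 => ?_,
    fun n x hx => ?_⟩
  · refine unifLogBdd_of_bounds (fun n => (hF n).1)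
      ⟨max |log (exp (-D) / 2)| |log (exp D + exp (-D) / 2)|,
        fun n x => ?_⟩ fun j => ?_
    · have h1 := hlow n x
      have h2 := hup n x
      rw [← hFv] at h1 h2
      have h3 : 0 < exp (-D) / 2 := by positivity
      exact abs_le_max_abs_abs (log_le_log h3 h1) (log_le_log (h3.trans_le h1) h2)
    · obtain ⟨C', hC'0, hC'⟩ := iteratedDeriv_le_of_mem_unifDiffeo hEu (j + 1)
      refine ⟨C' + C (j + 2) * m, fun n x => ?_⟩
      rw [hFv, iteratedDeriv_add (hE.1.1.contDiffAt.of_le (natCast_le_infty _))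
        ((hv n).contDiffAt.of_le (natCast_le_infty _))]
      exact (abs_add_le _ _).trans (add_le_add (hC' x) ((hvC n _ x).trans
        (mul_le_mul_of_nonneg_left (hc n).2 (hC0 _).le)))
  · rw [tendstoUniformly_iff_abs]
    intro ε hε
    have h1 : Tendsto (fun n => C 0 * c n) atTop (𝓝 0) := by simpa using hclim.const_mul (C 0)
    filter_upwards [h1.eventually (gt_mem_nhds hε)] with n hn x
    have h2 := hvC n 0 x
    rw [iteratedDeriv_zero] at h2
    rw [hFv, Pi.add_apply, add_sub_cancel_left]
    exact h2.trans_lt hn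
  · have hcn := (hc n).1
    have h01 : ∃ t ∈ Icc (0 : ℝ) 1,
        t = cutoff ((x - 0) / c n) + cutoff ((x - 1) / c n) := by
      refine ⟨_, ⟨add_nonneg cutoff.nonneg cutoff.nonneg, ?_⟩, rfl⟩
      rcases le_total x (1 / 2) with h | h
      · rw [cutoff_eq_zero (x := (x - 1) / c n), add_zero]
        · exact cutoff.le_one
        · rw [abs_div, abs_of_pos hcn, le_div_iff₀ hcn, abs_of_nonpos (by linarith)]
          linarith [hc2 n]
      · rw [cutoff_eq_zero (x := (x - 0) / c n), zero_add]
        · exact cutoff.le_one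
        · rw [abs_div, abs_of_pos hcn, le_div_iff₀ hcn, abs_of_nonneg (by linarith)]
          linarith [hc2 n]
    obtain ⟨t, ht, hte⟩ := h01
    rw [segment_eq_image']
    refine ⟨t, ht, ?_⟩
    rw [hFx, ← hte]
    simp
  · have hcn := (hc n).1
    rw [hFx, cutoff_eq_zero, cutoff_eq_zero]
    · simp
    · rw [abs_div, abs_of_pos hcn, le_div_iff₀ hcn, abs_of_nonpos (by linarith)]
      linarith
    · rw [abs_div, abs_of_pos hcn, le_div_iff₀ hcn, abs_of_nonneg (by linarith)]
      linarith
  · have hcn := (hc n).1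
    have hcn2 := hc2 n
    by_cases h01 : x ∈ Ioo (0 : ℝ) 1
    · rw [hFx]
      rcases hx with hx | hx
      · rw [cutoff_eq_one (x := (x - 0) / c n), cutoff_eq_zero (x := (x - 1) / c n)]
        · ring
        · rw [abs_div, abs_of_pos hcn, le_div_iff₀ hcn, abs_of_nonpos (by linarith [h01.2])]
          linarith
        · rw [abs_div, abs_of_pos hcn, div_le_iff₀ hcn, abs_of_nonneg (by linarith [h01.1])]
          linarith
      · rw [cutoff_eq_zero (x := (x - 0) / c n), cutoff_eq_one (x := (x - 1) / c n)]
        · ring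
        · rw [abs_div, abs_of_pos hcn, div_le_iff₀ hcn, abs_of_nonpos (by linarith [h01.2])]
          linarith
        · rw [abs_div, abs_of_pos hcn, le_div_iff₀ hcn, abs_of_nonneg (by linarith [h01.1])]
          linarith
    · rw [(hF n).2 x h01, hG.2 x h01]

end Cutoff

section Orbits

variable {f : 𝓐}

lemma pow_mem_Ioo {a b : ℝ} (h0 : f a = a) (h1 : f b = b) {y : ℝ} (hy : y ∈ Ioo a b) (n : ℕ) :
    (f ^ n) y ∈ Ioo a b := by
  induction n with
  | zero => simpa using hy
  | succ n ih =>
    rw [pow_succ', mul_apply]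
    exact mem_Ioo_of_fixed h0 h1 ih

lemma tendsto_of_fixed_limit {y l : ℝ} (h : Tendsto (fun n => (f ^ n) y) atTop (𝓝 l)) :
    f l = l := by
  have h1 : Tendsto (fun n => (f ^ (n + 1)) y) atTop (𝓝 (f l)) := by
    simp only [pow_succ', mul_apply]
    exact ((continuous_orderIso f).tendsto l).comp h
  exact tendsto_nhds_unique h1 (h.comp (tendsto_add_atTop_nat 1))

lemma monotone_pow_apply {y : ℝ} (hy : y ≤ f y) : Monotone fun n => (f ^ n) y :=
  monotone_nat_of_le_succ fun n => (f ^ n).monotone hy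

lemma antitone_pow_apply {y : ℝ} (hy : f y ≤ y) : Antitone fun n => (f ^ n) y :=
  antitone_nat_of_succ_le fun n => (f ^ n).monotone hy

lemma tendsto_pow_right {a b : ℝ} (h0 : f a = a) (h1 : f b = b) (hf : ∀ y ∈ Ioo a b, y < f y)
    {y : ℝ} (hy : y ∈ Ioo a b) : Tendsto (fun n => (f ^ n) y) atTop (𝓝 b) := by
  have hm := monotone_pow_apply (hf y hy).le
  have hb := fun n => (pow_mem_Ioo h0 h1 hy n).2.le
  have hl := tendsto_atTop_ciSup hm ⟨b, forall_mem_range.2 hb⟩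
  rcases (le_of_tendsto' hl hb).eq_or_lt with h | h
  · rwa [h] at hl
  · exact absurd (tendsto_of_fixed_limit hl)
      (hf _ ⟨hy.1.trans_le (hm.ge_of_tendsto hl 0), h⟩).ne'

lemma tendsto_pow_left {a b : ℝ} (h0 : f a = a) (h1 : f b = b) (hf : ∀ y ∈ Ioo a b, f y < y)
    {y : ℝ} (hy : y ∈ Ioo a b) : Tendsto (fun n => (f ^ n) y) atTop (𝓝 a) := by
  have hm := antitone_pow_apply (hf y hy).le
  have hb := fun n => (pow_mem_Ioo h0 h1 hy n).1.le
  have hl := tendsto_atTop_ciInf hm ⟨a, forall_mem_range.2 hb⟩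
  rcases (ge_of_tendsto' hl hb).eq_or_lt with h | h
  · rwa [← h] at hl
  · exact absurd (tendsto_of_fixed_limit hl) (hf _ ⟨h, (hm.le_of_tendsto hl 0).trans_lt hy.2⟩).ne

lemma sum_pow_apply_sub (f : 𝓐) (z : ℝ) (m r : ℕ) :
    ∑ i ∈ Finset.range m, ((f ^ i) ((f ^ r) z) - (f ^ i) z) =
      ∑ j ∈ Finset.range r, ((f ^ m) ((f ^ j) z) - (f ^ j) z) := by
  induction r with
  | zero => simp
  | succ r ih =>
    rw [Finset.sum_range_succ, ← ih]
    have h := Finset.sum_range_sub (fun i => (f ^ i) ((f ^ r) z)) m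
    rw [pow_zero, one_orderIso_apply] at h
    rw [← h, ← Finset.sum_add_distrib]
    refine Finset.sum_congr rfl fun i _ => ?_
    rw [← mul_apply (f ^ i) (f ^ (r + 1)), ← mul_apply (f ^ (i + 1)) (f ^ r),
      ← pow_add, ← pow_add, show i + (r + 1) = i + 1 + r by ring]
    ring

end Orbits

section SideMaps

lemma ld_flow (t : ℝ) {y : ℝ} (hy : y ∈ Ioo (0 : ℝ) 1) :
    ld (flow t) y = unitRate y - unitRate (flow t y) := by
  rw [ld, (hasDerivAt_flow t hy).deriv, log_exp]

/-- The maps conjugating `g` to `f n` near an end point of the unit interval, where the two maps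
coincide. -/
def sideMap (g : 𝓐) (f : ℕ → 𝓐) (k k' : ℕ → ℕ) (n : ℕ) : 𝓐 :=
  (f n ^ k' n)⁻¹ * g ^ k n

/-- The hypotheses controlling `sideMap` on an interval `[w₀, w₁]`. -/
structure SideData (g : 𝓐) (f : ℕ → 𝓐) (w w₀ w₁ u₀ u₁ L ν : ℝ) (θ : ℕ → ℝ)
    (k k' : ℕ → ℕ) (s : ℕ → ℝ) : Prop where
  g_mem : g ∈ unifDiffeo
  f_diffeo : ∀ n, IsDiffeo (f n)
  f_bdd : UnifLogBdd f
  w_lt : w₀ < w₁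
  u_pos : 0 < u₀
  u_lt : u₀ < u₁
  u_lt_one : u₁ < 1
  g_sum : ∀ m : ℕ, ∑ i ∈ Finset.range m, ((g ^ i) w₁ - (g ^ i) w₀) ≤ L
  f_sum : ∀ n (m : ℕ), ∑ i ∈ Finset.range m, ((f n ^ i) u₁ - (f n ^ i) u₀) ≤ L
  mid : ∀ M : ℕ, ∀ᶠ n in atTop, ∀ y ∈ Icc u₀ u₁,
    (f n ^ M : 𝓐) =ᶠ[𝓝 y] (flow w ^ M : 𝓐)
  tail : ∀ M : ℕ, ∀ᶠ n in atTop, ∀ m : ℕ, ∑ i ∈ Finset.range m,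
    ((f n ^ i) ((flow w ^ M) u₁) - (f n ^ i) ((flow w ^ M) u₀)) ≤ θ M
  close : ∀ M : ℕ, ∀ y ∈ Icc u₀ u₁, (flow w ^ M) y * (1 - (flow w ^ M) y) ≤ θ M
  theta : Tendsto θ atTop (𝓝 0)
  k'_lim : Tendsto k' atTop atTop
  s_le : ∀ n, |s n| ≤ 1
  left_mem : ∀ n, sideMap g f k k' n w₀ ∈ Icc u₀ u₁
  right_mem : ∀ n, sideMap g f k k' n w₁ ∈ Icc u₀ u₁
  nu_pos : 0 < ν
  nu_le : ∀ n, ν ≤ sideMap g f k k' n w₁ - sideMap g f k k' n w₀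
  time : ∀ a ∈ Icc u₀ u₁, ∀ b ∈ Icc u₀ u₁, ∃ t, |t| ≤ 1 ∧ flow t a = b

variable {g : 𝓐} {f : ℕ → 𝓐} {w w₀ w₁ u₀ u₁ L ν : ℝ} {θ : ℕ → ℝ} {k k' : ℕ → ℕ}
  {s : ℕ → ℝ}

lemma SideData.isDiffeo (h : SideData g f w w₀ w₁ u₀ u₁ L ν θ k k' s) (n : ℕ) :
    IsDiffeo (sideMap g f k k' n) :=
  ((h.f_diffeo n).pow _).inv.mul (h.g_mem.1.pow _)

lemma SideData.mem (h : SideData g f w w₀ w₁ u₀ u₁ L ν θ k k' s) (n : ℕ) {x : ℝ}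
    (hx : x ∈ Icc w₀ w₁) : sideMap g f k k' n x ∈ Icc u₀ u₁ :=
  ⟨(h.left_mem n).1.trans ((sideMap g f k k' n).monotone hx.1),
    ((sideMap g f k k' n).monotone hx.2).trans (h.right_mem n).2⟩

lemma SideData.mem_Ioo (h : SideData g f w w₀ w₁ u₀ u₁ L ν θ k k' s) {y : ℝ}
    (hy : y ∈ Icc u₀ u₁) : y ∈ Ioo (0 : ℝ) 1 :=
  ⟨h.u_pos.trans_le hy.1, hy.2.trans_lt h.u_lt_one⟩

lemma ld_sideMap (hg : IsDiffeo g) (hf : ∀ n, IsDiffeo (f n)) (n : ℕ) (x : ℝ) :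
    ld (sideMap g f k k' n) x =
      ld (g ^ k n) x - ld (f n ^ k' n) (sideMap g f k k' n x) := by
  rw [sideMap, ld_mul ((hf n).pow _).inv (hg.pow _), ld_inv ((hf n).pow _), mul_apply]
  ring

lemma SideData.logBdd (h : SideData g f w w₀ w₁ u₀ u₁ L ν θ k k' s) :
    LogBdd (fun p : {p : ℕ × ℝ // p.2 ∈ Icc w₀ w₁} => sideMap g f k k' p.1.1)
      fun p => p.1.2 := by
  have hgb : LogBdd (fun p : Unit × ℝ => g) fun p => p.2 :=
    h.g_mem.2.reindex fun p : Unit × ℝ => p.2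
  have hK := h.isDiffeo
  have ha := (bddJet_deriv_ld_pow (B := Unit) (f := fun _ => g) (w₀ := fun _ => w₀)
    (w₁ := fun _ => w₁) (L := L) (fun _ => h.g_mem.1) hgb (sub_pos.2 h.w_lt) (fun _ => le_rfl)
    (fun _ => h.g_sum)).reindex
    fun p : {p : ℕ × ℝ // p.2 ∈ Icc w₀ w₁} => ⟨((), k p.1.1, p.1.2), p.2⟩
  have hb := (bddJet_deriv_ld_pow (B := ℕ) (f := f) (w₀ := fun _ => u₀)
    (w₁ := fun _ => u₁) (L := L) h.f_diffeo h.f_bdd (sub_pos.2 h.u_lt) (fun _ => le_rfl)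
    h.f_sum).reindex
    fun p : {p : ℕ × ℝ // p.2 ∈ Icc w₀ w₁} =>
      ⟨(p.1.1, k' p.1.1, sideMap g f k k' p.1.1 p.1.2), h.mem _ p.2⟩
  refine logBdd_of_ld_eq_sub (fun p => hK _) ?_ ha hb (smoothAt_ld fun _ => h.g_mem.1.pow _)
    (smoothAt_ld fun _ => (h.f_diffeo _).pow _)
    fun p => Eventually.of_forall fun y => ld_sideMap h.g_mem.1 h.f_diffeo _ y
  obtain ⟨C, hC0, hC⟩ := abs_ld_pow_sub_le (B := Unit) (f := fun _ => g) (fun _ => h.g_mem.1) hgb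
  obtain ⟨D, hD0, hD⟩ := abs_ld_pow_sub_le h.f_diffeo h.f_bdd
  refine ⟨C * L + D * L + max |log (ν / (w₁ - w₀))| |log ((u₁ - u₀) / (w₁ - w₀))|, ?_⟩
  rintro ⟨⟨n, x⟩, hx⟩
  simp only at hx ⊢
  obtain ⟨ξ, hξ, h1⟩ := exists_deriv_eq_slope (sideMap g f k k' n) h.w_lt
    (hK n).1.continuous.continuousOn (hK n).differentiable.differentiableOn
  have hξ' := Ioo_subset_Icc_self hξ
  have hpos := sub_pos.2 h.w_lt
  have h2 := hC () (k n) w₀ w₁ ξ hξ' x hx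
  have h3 := hD n (k' n) u₀ u₁ _ (h.mem n hξ') _ (h.mem n hx)
  have h4 := mul_le_mul_of_nonneg_left (h.g_sum (k n)) hC0.le
  have h5 := mul_le_mul_of_nonneg_left (h.f_sum n (k' n)) hD0.le
  have h6 : |ld (sideMap g f k k' n) ξ| ≤
      max |log (ν / (w₁ - w₀))| |log ((u₁ - u₀) / (w₁ - w₀))| := by
    rw [ld, h1]
    refine abs_le_max_abs_abs (log_le_log (div_pos h.nu_pos hpos) ?_)
      (log_le_log (div_pos (h.nu_pos.trans_le (h.nu_le n)) hpos) ?_)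
    · exact div_le_div_of_nonneg_right (h.nu_le n) hpos.le
    · exact div_le_div_of_nonneg_right (by linarith [(h.left_mem n).1, (h.right_mem n).2]) hpos.le
  have h7 : ld (sideMap g f k k' n) x = (ld (g ^ k n) x - ld (g ^ k n) ξ) -
      (ld (f n ^ k' n) (sideMap g f k k' n x) - ld (f n ^ k' n) (sideMap g f k k' n ξ)) +
      ld (sideMap g f k k' n) ξ := by
    rw [ld_sideMap h.g_mem.1 h.f_diffeo n x, ld_sideMap h.g_mem.1 h.f_diffeo n ξ]
    ring
  rw [h7]
  refine (abs_add_le _ _).trans (add_le_add ((abs_sub _ _).trans (add_le_add ?_ ?_)) h6)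
  · exact h2.trans h4
  · exact h3.trans h5

lemma SideData.logBdd_side (h : SideData g f w w₀ w₁ u₀ u₁ L ν θ k k' s) :
    LogBdd (fun p : {p : ℕ × ℝ // p.2 ∈ Icc w₀ w₁} =>
      flow (s p.1.1) * sideMap g f k k' p.1.1) fun p => p.1.2 :=
  LogBdd.mul (fun _ => isDiffeo_flow _) (fun _ => h.isDiffeo _)
    (logBdd_flow fun _ => h.s_le _) h.logBdd

lemma SideData.abs_unitRate_sub_le (h : SideData g f w w₀ w₁ u₀ u₁ L ν θ k k' s) {ε : ℝ}
    (hε : 0 < ε) : ∀ᶠ n in atTop, ∀ a ∈ Icc u₀ u₁, ∀ b ∈ Icc u₀ u₁,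
      |(unitRate a - unitRate b) - (ld (f n ^ k' n) a - ld (f n ^ k' n) b)| ≤ ε := by
  obtain ⟨C, hC0, hC⟩ := ld_flow_le_weight
  obtain ⟨D, hD0, hD⟩ := abs_ld_pow_sub_le h.f_diffeo h.f_bdd
  have hlim : Tendsto (fun M => (C + D) * θ M) atTop (𝓝 0) := by simpa using h.theta.const_mul (C + D)
  obtain ⟨M, hM⟩ := (hlim.eventually (ge_mem_nhds hε)).exists
  filter_upwards [h.mid M, h.tail M, h.k'_lim.eventually (eventually_ge_atTop M)]
    with n hmid htail hk a ha b hb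
  obtain ⟨r, hr⟩ := Nat.exists_eq_add_of_le' hk
  have hsplit : ∀ y ∈ Icc u₀ u₁, ld (f n ^ k' n) y =
      ld (f n ^ r) ((flow w ^ M) y) + (unitRate y - unitRate ((flow w ^ M) y)) := by
    intro y hy
    have h1 := hmid y hy
    rw [hr, pow_add, ld_mul ((h.f_diffeo n).pow r) ((h.f_diffeo n).pow M), h1.eq_of_nhds]
    congr 1
    rw [ld, h1.deriv_eq, ← ld, ← flow_natCast_mul, ld_flow _ (h.mem_Ioo hy)]
  obtain ⟨t, ht, htab⟩ := h.time a ha b hb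
  have haM : (flow w ^ M) a ∈ Ioo (0 : ℝ) 1 := by
    rw [← flow_natCast_mul]
    exact flow_mem _ (h.mem_Ioo ha)
  have hbM : (flow w ^ M) b = flow t ((flow w ^ M) a) := by
    rw [← htab, ← mul_apply, ← mul_apply, ← flow_natCast_mul,
      (flow_commute _ _).eq]
  have h2 := hC t _ ht haM
  rw [ld_flow t haM, ← hbM] at h2
  have h3 := mul_le_mul_of_nonneg_left (h.close M a ha) hC0
  have hmono := (flow w ^ M : 𝓐).monotone
  have h4 := hD n r _ _ _ ⟨hmono hb.1, hmono hb.2⟩ _ ⟨hmono ha.1, hmono ha.2⟩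
  have h5 := mul_le_mul_of_nonneg_left (htail r) hD0.le
  rw [hsplit a ha, hsplit b hb]
  have h6 := abs_le.1 (h2.trans h3)
  have h7 := abs_le.1 (h4.trans h5)
  refine abs_le.2 ⟨?_, ?_⟩ <;> linarith [h6.1, h6.2, h7.1, h7.2]

/-- In the time coordinate of the flow the nonlinearity of the side maps is asymptotically the one
of the iterates of `g`. -/
lemma SideData.oscillation (h : SideData g f w w₀ w₁ u₀ u₁ L ν θ k k' s) {ε : ℝ} (hε : 0 < ε) :
    ∀ᶠ n in atTop, ∀ x ∈ Icc w₀ w₁, ∀ x' ∈ Icc w₀ w₁,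
      |((ld (flow (s n) * sideMap g f k k' n) x +
          unitRate ((flow (s n) * sideMap g f k k' n) x)) -
        (ld (flow (s n) * sideMap g f k k' n) x' +
          unitRate ((flow (s n) * sideMap g f k k' n) x'))) -
        (ld (g ^ k n) x - ld (g ^ k n) x')| ≤ ε := by
  filter_upwards [h.abs_unitRate_sub_le hε] with n hn x hx x' hx'
  have h1 : ∀ x ∈ Icc w₀ w₁, ld (flow (s n) * sideMap g f k k' n) x +
      unitRate ((flow (s n) * sideMap g f k k' n) x) =
      unitRate (sideMap g f k k' n x) + (ld (g ^ k n) x -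
        ld (f n ^ k' n) (sideMap g f k k' n x)) := fun x hx => by
    rw [ld_mul (isDiffeo_flow _) (h.isDiffeo n), ld_flow _ (h.mem_Ioo (h.mem n hx)),
      ld_sideMap h.g_mem.1 h.f_diffeo, mul_apply]
    ring
  rw [h1 x hx, h1 x' hx']
  have h2 := abs_le.1 (hn _ (h.mem n hx) _ (h.mem n hx'))
  refine abs_le.2 ⟨?_, ?_⟩ <;> linarith [h2.1, h2.2]

end SideMaps

section Gluing

lemma LogBdd.of_cases {ι : Type*} {F : ι → 𝓐} {x : ι → ℝ} (P : ι → Prop)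
    (h1 : LogBdd (fun i : {i // P i} => F i) fun i => x i)
    (h2 : LogBdd (fun i : {i // ¬P i} => F i) fun i => x i) : LogBdd F x := by
  refine bddJet_iff.2 fun j => ?_
  obtain ⟨C, hC⟩ := bddJet_iff.1 h1 j
  obtain ⟨D, hD⟩ := bddJet_iff.1 h2 j
  refine ⟨max C D, fun i => ?_⟩
  by_cases hi : P i
  · simp_all
  · simp_all

variable {G E : 𝓐} {Hl Hr L R : ℕ → 𝓐} {x₀ : ℝ}

/-- Transition function between `x₀` and `x₁`. -/
def ramp (x₀ x₁ x : ℝ) : ℝ := smoothTransition ((x - x₀) / (x₁ - x₀))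

lemma contDiff_ramp (x₀ x₁ : ℝ) : ContDiff ℝ ∞ (ramp x₀ x₁) :=
  smoothTransition.contDiff.comp ((contDiff_id.sub contDiff_const).div_const _)

lemma ramp_left {x₀ x₁ x : ℝ} (h : x₀ < x₁) (hx : x ≤ x₀) : ramp x₀ x₁ x = 0 :=
  smoothTransition.zero_of_nonpos (div_nonpos_of_nonpos_of_nonneg (by linarith) (by linarith))

lemma ramp_right {x₀ x₁ x : ℝ} (h : x₀ < x₁) (hx : x₁ ≤ x) : ramp x₀ x₁ x = 1 :=
  smoothTransition.one_of_one_le ((one_le_div (by linarith)).2 (by linarith))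

lemma ramp_mem (x₀ x₁ x : ℝ) : 0 ≤ ramp x₀ x₁ x ∧ ramp x₀ x₁ x ≤ 1 :=
  ⟨smoothTransition.nonneg _, smoothTransition.le_one _⟩

/-- Interpolation between two sequences of conjugacies which are asymptotically equal on a
fundamental domain. -/
lemma exists_glued (hl : ∀ n, Hl n ∈ supported 0 1) (hr : ∀ n, Hr n ∈ supported 0 1)
    {x₁ w₀ w₁ : ℝ} (hw0 : w₀ < x₀) (h01 : x₀ < x₁) (hw1 : x₁ < w₁)
    (hlb : LogBdd (fun p : {p : ℕ × ℝ // p.2 ∈ Icc w₀ w₁} => Hl p.1.1) fun p => p.1.2)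
    (hrb : LogBdd (fun p : {p : ℕ × ℝ // p.2 ∈ Icc w₀ w₁} => Hr p.1.1) fun p => p.1.2)
    (hw : Icc w₀ w₁ ⊆ Ioo 0 1)
    (hc : ∀ ε > 0, ∀ᶠ n in atTop, ∀ x ∈ Icc x₀ x₁, |Hr n x - Hl n x| ≤ ε) :
    ∃ N : ℕ, ∃ H : ℕ → 𝓐, (∀ n, H n ∈ supported 0 1) ∧
      LogBdd (fun p : {p : ℕ × ℝ // p.2 ∈ Icc w₀ w₁} => H p.1.1) (fun p => p.1.2) ∧
      ∀ n x, H n x = Hl (n + N) x + ramp x₀ x₁ x * (Hr (n + N) x - Hl (n + N) x) := by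
  obtain ⟨A, hA0, hA⟩ := hlb.bound 0
  obtain ⟨B, hB0, hB⟩ := hrb.bound 0
  set m := min (exp (-A)) (exp (-B)) with hm
  have hm0 : 0 < m := by positivity
  have hlm : ∀ n, ∀ x ∈ Icc w₀ w₁, m ≤ deriv (Hl n) x := fun n x hx => by
    rw [← (hl n).1.exp_ld]
    refine (min_le_left _ _).trans (exp_le_exp.2 ?_)
    have := hA ⟨(n, x), hx⟩
    rw [iteratedDeriv_zero] at this
    exact (abs_le.1 this).1
  have hrm : ∀ n, ∀ x ∈ Icc w₀ w₁, m ≤ deriv (Hr n) x := fun n x hx => by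
    rw [← (hr n).1.exp_ld]
    refine (min_le_right _ _).trans (exp_le_exp.2 ?_)
    have := hB ⟨(n, x), hx⟩
    rw [iteratedDeriv_zero] at this
    exact (abs_le.1 this).1
  have hχ := contDiff_ramp x₀ x₁
  obtain ⟨K, hK⟩ := (isCompact_Icc (a := x₀) (b := x₁)).exists_bound_of_continuousOn
    (hχ.continuous_deriv (by simp)).continuousOn
  have hK0 : 0 ≤ K := (norm_nonneg _).trans (hK x₀ (left_mem_Icc.2 h01.le))
  obtain ⟨N, hN⟩ := eventually_atTop.1 (hc (m / 2 / (K + 1)) (by positivity))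
  let T : ℕ → ℝ → ℝ := fun n x =>
    Hl (n + N) x + ramp x₀ x₁ x * (Hr (n + N) x - Hl (n + N) x)
  have hT : ∀ n, ContDiff ℝ ∞ (T n) := fun n =>
    (hl _).1.1.add (hχ.mul ((hr _).1.1.sub (hl _).1.1))
  have hTl : ∀ n, ∀ x < x₀, T n =ᶠ[𝓝 x] Hl (n + N) := fun n x hx => by
    filter_upwards [Iio_mem_nhds hx] with y hy
    simp [T, ramp_left h01 (le_of_lt hy)]
  have hTr : ∀ n, ∀ x > x₁, T n =ᶠ[𝓝 x] Hr (n + N) := fun n x hx => by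
    filter_upwards [Ioi_mem_nhds hx] with y hy
    simp [T, ramp_right h01 (le_of_lt hy)]
  have hTm : ∀ n, ∀ x ∈ Icc x₀ x₁, m / 2 ≤ deriv (T n) x := fun n x hx => by
    have hxI : x ∈ Icc w₀ w₁ := ⟨hw0.le.trans hx.1, hx.2.trans hw1.le⟩
    have h1 := ((hl (n + N)).1.differentiable x).hasDerivAt
    have h2 := ((hr (n + N)).1.differentiable x).hasDerivAt
    have h3 := (hχ.differentiable (by simp) x).hasDerivAt
    have h4 : deriv (T n) x = _ := (h1.add (h3.mul (h2.sub h1))).deriv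
    rw [h4]
    have h5 := hlm (n + N) x hxI
    have h6 := hrm (n + N) x hxI
    have h7 := ramp_mem x₀ x₁ x
    have h8 := hN (n + N) (by omega) x hx
    have h9 : |deriv (ramp x₀ x₁) x * (Hr (n + N) x - Hl (n + N) x)| ≤ m / 2 := by
      rw [abs_mul]
      calc _ ≤ (K + 1) * (m / 2 / (K + 1)) :=
            mul_le_mul ((hK x hx).trans (by linarith)) h8 (abs_nonneg _) (by positivity)
        _ = _ := by field_simp
    have h10 := (abs_le.1 h9).1
    simp only [Pi.sub_apply]
    nlinarith
  have hpos : ∀ n x, 0 < deriv (T n) x := fun n x => by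
    rcases lt_or_ge x x₀ with h | h
    · rw [(hTl n x h).deriv_eq]
      exact (hl _).1.2 x
    rcases lt_or_ge x₁ x with h' | h'
    · rw [(hTr n x h').deriv_eq]
      exact (hr _).1.2 x
    · exact (half_pos hm0).trans_le (hTm n x ⟨h, h'⟩)
  choose H hH hHT using fun n => strictMono_of_deriv_pos' (a := 0) (b := 1) (hT n) (hpos n)
    fun x hx => by simp [T, (hl (n + N)).2 x hx, (hr (n + N)).2 x hx]
  refine ⟨N, H, hH, ?_, fun n x => congrFun (hHT n) x⟩
  let Q := {p : ℕ × ℝ // p.2 ∈ Icc w₀ w₁}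
  let σ : Q → Q := fun p => ⟨(p.1.1 + N, p.1.2), p.2⟩
  have hlJ : BddJet (fun p : Q => (Hl (p.1.1 + N) : ℝ → ℝ)) fun p => p.1.2 := by
    refine bddJet_of_deriv ⟨1, fun p => ?_⟩
      ((hlb.reindex σ).bddJet_deriv fun _ => (hl _).1)
    have := map_mem_Ioo (hl (p.1.1 + N)) (hw p.2)
    grind
  have hrJ : BddJet (fun p : Q => (Hr (p.1.1 + N) : ℝ → ℝ)) fun p => p.1.2 := by
    refine bddJet_of_deriv ⟨1, fun p => ?_⟩
      ((hrb.reindex σ).bddJet_deriv fun _ => (hr _).1)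
    have := map_mem_Ioo (hr (p.1.1 + N)) (hw p.2)
    exact abs_le.2 ⟨by linarith [this.1], this.2.le⟩
  have hχJ : BddJet (fun _ : Q => ramp x₀ x₁) fun p => p.1.2 := by
    refine bddJet_iff.2 fun j => ?_
    obtain ⟨C, hC⟩ := (isCompact_Icc (a := w₀) (b := w₁)).exists_bound_of_continuousOn
      (hχ.continuous_iteratedDeriv j (natCast_le_infty j)).continuousOn
    bound
  have hls : SmoothAt (fun p : Q => (Hl (p.1.1 + N) : ℝ → ℝ)) fun p => p.1.2 :=
    smoothAt_coe fun _ => (hl _).1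
  have hrs : SmoothAt (fun p : Q => (Hr (p.1.1 + N) : ℝ → ℝ)) fun p => p.1.2 :=
    smoothAt_coe fun _ => (hr _).1
  have hχs : SmoothAt (fun _ : Q => ramp x₀ x₁) fun p => p.1.2 := fun _ => hχ.contDiffAt
  have hTJ : BddJet (fun p : Q => T p.1.1) fun p => p.1.2 :=
    hlJ.add (hχJ.mul (hrJ.sub hlJ hrs hls) hχs (hrs.sub hls)) hls (hχs.mul (hrs.sub hls))
  obtain ⟨C, hC0, hC⟩ := hTJ.bound 1
  refine logBdd_of_bddJet (fun _ => (hH _).1) ⟨max |log (m / 2)| |log C|, fun p => ?_⟩ ?_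
  · have h1 := hC p
    rw [iteratedDeriv_one] at h1
    have h2 : m / 2 ≤ deriv (T p.1.1) p.1.2 := by
      rcases lt_or_ge p.1.2 x₀ with h | h
      · rw [(hTl _ _ h).deriv_eq]
        grind
      rcases lt_or_ge x₁ p.1.2 with h' | h'
      · rw [(hTr _ _ h').deriv_eq]
        grind
      · exact hTm _ _ ⟨h, h'⟩
    rw [ld, hHT]
    exact abs_le_max_abs_abs (log_le_log (by positivity) h2)
      (log_le_log (hpos _ _) ((le_abs_self _).trans h1))
  · have : (fun p : Q => (H p.1.1 : ℝ → ℝ)) = fun p => T p.1.1 := funext fun p => hHT _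
    simp only [hHT]
    exact hTJ.deriv

lemma degenerates_of_side_maps (hG : G ∈ supported 0 1) (hx₀ : x₀ ∈ Ioo (0 : ℝ) 1)
    (hfix : ∀ x ∈ Ioo (0 : ℝ) 1, x < G x) (hE : E ∈ unifDiffeo)
    (hl : ∀ n, Hl n ∈ supported 0 1) (hr : ∀ n, Hr n ∈ supported 0 1)
    (hlb : LogBdd (fun p : {p : ℕ × ℝ // p.2 ∈ Icc (G⁻¹ x₀) (G (G x₀))} => Hl p.1.1)
      fun p => p.1.2)
    (hrb : LogBdd (fun p : {p : ℕ × ℝ // p.2 ∈ Icc (G⁻¹ x₀) (G (G x₀))} => Hr p.1.1)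
      fun p => p.1.2)
    (hLb : UnifLogBdd L) (hRb : UnifLogBdd R)
    (hLE : TendstoUniformly (fun n => (L n : ℝ → ℝ)) E atTop)
    (hRE : TendstoUniformly (fun n => (R n : ℝ → ℝ)) E atTop)
    (hlG : ∀ n, ∀ x ≤ G x₀, Hl n (G x) = L n (Hl n x))
    (hrG : ∀ n x, G⁻¹ x₀ ≤ x → Hr n (G x) = R n (Hr n x))
    (hc : ∀ ε > 0, ∀ᶠ n in atTop, ∀ x ∈ Icc x₀ (G x₀), |Hr n x - Hl n x| ≤ ε) :
    Degenerates (supported 0 1) G E := by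
  have hG0 := supported_left hG
  have hG1 := supported_right hG
  have hw0 : G⁻¹ x₀ ∈ Ioo (0 : ℝ) 1 :=
    map_mem_Ioo (inv_mem hG) hx₀
  have hw : G (G⁻¹ x₀) = x₀ := apply_inv_self G x₀
  have h0 : G⁻¹ x₀ < x₀ := by simpa only [hw] using hfix _ hw0
  have h1 := hfix x₀ hx₀
  have hx1 := mem_Ioo_of_fixed hG0 hG1 hx₀
  have h2 := hfix _ hx1
  have hx2 := mem_Ioo_of_fixed hG0 hG1 hx1
  obtain ⟨N, H, hH, hHb, hHx⟩ := exists_glued hl hr h0 h1 h2 hlb hrb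
    (fun x hx => ⟨hw0.1.trans_le hx.1, hx.2.trans_lt hx2.2⟩) hc
  have hHl : ∀ n, ∀ x ≤ x₀, H n x = Hl (n + N) x := fun n x hx => by
    rw [hHx, ramp_left h1 hx]; ring
  have hHr : ∀ n x, G x₀ ≤ x → H n x = Hr (n + N) x := fun n x hx => by
    rw [hHx, ramp_right h1 hx]; ring
  have hdiff : ∀ n, ∀ x ∈ Icc x₀ (G x₀), |H n x - Hl (n + N) x| ≤ |Hr (n + N) x - Hl (n + N) x| ∧
      |H n x - Hr (n + N) x| ≤ |Hr (n + N) x - Hl (n + N) x| := fun n x _ => by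
    have h3 := ramp_mem x₀ (G x₀) x
    constructor
    · rw [hHx, add_sub_cancel_left, abs_mul, abs_of_nonneg h3.1]
      exact mul_le_of_le_one_left (abs_nonneg _) h3.2
    · have : H n x - Hr (n + N) x =
          (1 - ramp x₀ (G x₀) x) * -(Hr (n + N) x - Hl (n + N) x) := by rw [hHx]; ring
      rw [this, abs_mul, abs_neg, abs_of_nonneg (sub_nonneg.2 h3.2)]
      exact mul_le_of_le_one_left (abs_nonneg _) (by linarith [h3.1])
  have hconj : ∀ n y, (H n * G * (H n)⁻¹ : 𝓐) y = H n (G ((H n)⁻¹ y)) := fun n y => rfl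
  have hself : ∀ n y, H n ((H n)⁻¹ y) = y := fun n y => apply_inv_self _ _
  have hUl : ∀ n y, (H n)⁻¹ y ≤ G⁻¹ x₀ → (H n * G * (H n)⁻¹ : 𝓐) y = L (n + N) y := by
    intro n y hy
    have h3 : G ((H n)⁻¹ y) ≤ x₀ := by
      rw [← hw]
      exact G.monotone hy
    grind
  have hUr : ∀ n y, G x₀ ≤ (H n)⁻¹ y → (H n * G * (H n)⁻¹ : 𝓐) y = R (n + N) y := by
    intro n y hy
    rw [hconj, hHr n _ (G.monotone (h1.le.trans hy)),
      hrG _ _ (h0.le.trans (h1.le.trans hy)), ← hHr n _ hy, hself]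
  have hGu := supported_le_unifDiffeo hG
  refine ⟨H, hH, ?_, ?_⟩
  · refine LogBdd.of_cases (fun p : ℕ × ℝ => (H p.1)⁻¹ p.2 < G⁻¹ x₀) ?_ ?_
    · refine LogBdd.congr (hLb.reindex fun p : {p : ℕ × ℝ // (H p.1)⁻¹ p.2 < G⁻¹ x₀} =>
        (p.1.1 + N, p.1.2)) fun p => ?_
      filter_upwards [(continuous_orderIso (H p.1.1)⁻¹).continuousAt.eventually (gt_mem_nhds p.2)]
        with y hy using hUl _ _ (le_of_lt hy)
    · refine LogBdd.of_cases (fun p : {p : ℕ × ℝ // ¬(H p.1)⁻¹ p.2 < G⁻¹ x₀} =>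
        G x₀ < (H p.1.1)⁻¹ p.1.2) ?_ ?_
      · refine LogBdd.congr (hRb.reindex fun p : {p : {p : ℕ × ℝ // ¬(H p.1)⁻¹ p.2 < G⁻¹ x₀} //
          G x₀ < (H p.1.1)⁻¹ p.1.2} => (p.1.1.1 + N, p.1.1.2)) fun p => ?_
        filter_upwards [(continuous_orderIso (H p.1.1.1)⁻¹).continuousAt.eventually
          (lt_mem_nhds p.2)] with y hy using hUr _ _ (le_of_lt hy)
      · let Q := {p : {p : ℕ × ℝ // ¬(H p.1)⁻¹ p.2 < G⁻¹ x₀} // ¬G x₀ < (H p.1.1)⁻¹ p.1.2}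
        have hge : ∀ p : Q, G⁻¹ x₀ ≤ (H p.1.1.1)⁻¹ p.1.1.2 := fun p => not_lt.1 p.1.2
        have hle : ∀ p : Q, (H p.1.1.1)⁻¹ p.1.1.2 ≤ G x₀ := fun p => not_lt.1 p.2
        refine LogBdd.mul (fun _ => (hH _).1.mul hG.1) (fun _ => (hH _).1.inv)
          (LogBdd.mul (fun _ => (hH _).1) (fun _ => hG.1) ?_ ?_)
          (LogBdd.inv' (fun _ => (hH _).1) ?_)
        · refine hHb.reindex fun p : Q => ⟨(p.1.1.1, G ((H p.1.1.1)⁻¹ p.1.1.2)), ?_, ?_⟩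
          · grind
          · exact G.monotone (hle p)
        · exact hGu.2.reindex fun p : Q => (H p.1.1.1)⁻¹ p.1.1.2
        · exact hHb.reindex fun p : Q => ⟨(p.1.1.1, (H p.1.1.1)⁻¹ p.1.1.2), hge p,
            (hle p).trans h2.le⟩
  · obtain ⟨D, hD0, hD⟩ := lipschitz_of_mem_unifDiffeo hE
    rw [tendstoUniformly_iff_abs] at hLE hRE ⊢
    intro ε hε
    have hδ : 0 < ε / (2 * (D + 1)) := by positivity
    have hev : ∀ {P : ℕ → Prop}, (∀ᶠ n in atTop, P n) → ∀ᶠ n in atTop, P (n + N) := fun h =>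
      (tendsto_add_atTop_nat N).eventually h
    filter_upwards [hev (hLE (ε / 2) (by positivity)), hev (hRE (ε / 2) (by positivity)),
      hev (hc _ hδ)] with n hL hR hc y
    have hδ1 : ε / (2 * (D + 1)) ≤ ε / 2 := by
      gcongr
      linarith
    have hδ2 : D * (ε / (2 * (D + 1))) ≤ ε / 2 := by
      rw [mul_div_assoc', div_le_div_iff₀ (by positivity) (by positivity)]
      nlinarith
    rcases le_or_gt ((H n)⁻¹ y) (G⁻¹ x₀) with hy | hy
    · rw [hUl n y hy]
      linarith [hL y]
    rcases le_or_gt (G x₀) ((H n)⁻¹ y) with hy' | hy'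
    · rw [hUr n y hy']
      linarith [hR y]
    rw [hconj]
    rcases le_or_gt ((H n)⁻¹ y) x₀ with hy2 | hy2
    · have h4 : G ((H n)⁻¹ y) ∈ Icc x₀ (G x₀) := by
        refine ⟨?_, G.monotone hy2⟩
        rw [← hw]
        exact G.monotone hy.le
      have h5 := ((hdiff n _ h4).1.trans (hc _ h4)).trans hδ1
      have h6 := hL y
      rw [hlG _ _ hy'.le, ← hHl n _ hy2, hself] at h5
      have := abs_sub_le (H n (G ((H n)⁻¹ y))) (L (n + N) y) (E y)
      linarith
    · have h4 : (H n)⁻¹ y ∈ Icc x₀ (G x₀) := ⟨hy2.le, hy'.le⟩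
      have h5 := (hdiff n _ h4).2.trans (hc _ h4)
      rw [hself] at h5
      have h6 := hR (Hr (n + N) ((H n)⁻¹ y))
      rw [hHr n _ (G.monotone hy2.le), hrG _ _ hy.le]
      have h7 := hD (Hr (n + N) ((H n)⁻¹ y)) y
      rw [abs_sub_comm _ y] at h7
      have h8 := mul_le_mul_of_nonneg_left h5 hD0.le
      have := abs_sub_le (R (n + N) (Hr (n + N) ((H n)⁻¹ y))) (E (Hr (n + N) ((H n)⁻¹ y))) (E y)
      linarith

end Gluing

section Choice

lemma exists_pow_inv_mem_Ico {f : 𝓐} {a y : ℝ} {n : ℕ} (hy : y ≤ f y)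
    (ha : (f ^ (n + 1)) y ≤ a) (h : ∃ i : ℕ, (f ^ i)⁻¹ a < f y) :
    ∃ k, n ≤ k ∧ (f ^ k)⁻¹ a ∈ Ico y (f y) := by
  classical
  have hn : n < Nat.find h := (Nat.lt_find_iff h n).2 fun i hi => not_lt.2
    ((f ^ i).le_symm_apply.2 ((monotone_pow_apply hy (Nat.succ_le_succ hi)).trans ha))
  refine ⟨Nat.find h, hn.le, ?_, Nat.find_spec h⟩
  obtain ⟨d, hd⟩ := Nat.exists_eq_add_of_lt hn
  have h1 := not_lt.1 (Nat.find_min h (m := n + d) (by lia))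
  rw [hd]
  exact (f ^ (n + d + 1)).le_symm_apply.2 ((f ^ (n + d)).le_symm_apply.1 h1)

lemma exists_pow_inv_mem_Ioc {f : 𝓐} {a y : ℝ} {n : ℕ} (hy : f y ≤ y)
    (ha : a ≤ (f ^ (n + 1)) y) (h : ∃ i : ℕ, f y < (f ^ i)⁻¹ a) :
    ∃ k, n ≤ k ∧ (f ^ k)⁻¹ a ∈ Ioc (f y) y := by
  classical
  have hn : n < Nat.find h := (Nat.lt_find_iff h n).2 fun i hi => not_lt.2
    ((f ^ i).symm_apply_le.2 (ha.trans (antitone_pow_apply hy (Nat.succ_le_succ hi))))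
  refine ⟨Nat.find h, hn.le, Nat.find_spec h, ?_⟩
  obtain ⟨d, hd⟩ := Nat.exists_eq_add_of_lt hn
  have h1 := not_lt.1 (Nat.find_min h (m := n + d) (by lia))
  rw [hd]
  exact (f ^ (n + d + 1)).symm_apply_le.2 ((f ^ (n + d)).symm_apply_le.1 h1)

lemma eventually_pow_eq {f : ℕ → 𝓐} {e : 𝓐} (he : e ∈ supported 0 1)
    (h : ∀ a b, 0 < a → b < 1 → ∀ᶠ n in atTop, ∀ y ∈ Icc a b, f n y = e y) (M : ℕ) :
    ∀ a b, 0 < a → a < 1 → 0 < b → b < 1 →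
      ∀ᶠ n in atTop, ∀ y ∈ Icc a b, (f n ^ M) y = (e ^ M) y := by
  have hmem := fun {y : ℝ} (hy : y ∈ Ioo (0 : ℝ) 1) => map_mem_Ioo he hy
  induction M with
  | zero => exact fun a b _ _ _ _ => Eventually.of_forall fun n y _ => rfl
  | succ M ih =>
    intro a b ha ha' hb hb'
    filter_upwards [h a b ha hb', ih (e a) (e b) (hmem ⟨ha, ha'⟩).1 (hmem ⟨ha, ha'⟩).2
      (hmem ⟨hb, hb'⟩).1 (hmem ⟨hb, hb'⟩).2] with n h1 h2 y hy
    rw [pow_succ, pow_succ, mul_apply, mul_apply, h1 y hy]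
    exact h2 _ ⟨e.monotone hy.1, e.monotone hy.2⟩

lemma abs_sum_pow_sub_le {f : 𝓐} (h0 : f 0 = 0) (h1 : f 1 = 1) {z : ℝ}
    (hz : z ∈ Ioo (0 : ℝ) 1) (m r : ℕ) :
    |∑ i ∈ Finset.range m, ((f ^ i) ((f ^ r) z) - (f ^ i) z)| ≤ r := by
  rw [sum_pow_apply_sub]
  refine (Finset.abs_sum_le_sum_abs _ _).trans ?_
  refine (Finset.sum_le_card_nsmul _ _ 1 fun j _ => ?_).trans (by simp)
  have h3 := pow_mem_Ioo h0 h1 hz j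
  have h4 := pow_mem_Ioo h0 h1 h3 m
  rw [abs_le]
  constructor <;> linarith [h3.1, h3.2, h4.1, h4.2]

variable {v y₀ : ℝ}

lemma flow_apply_add (s t y : ℝ) : flow (s + t) y = flow s (flow t y) := by
  rw [flow_add, mul_apply]

lemma flow_pow_apply (w : ℝ) (n : ℕ) (y : ℝ) :
    (flow w ^ n) y = flow (n * w) y := by
  rw [flow_natCast_mul]

lemma flow_mono (hy : y₀ ∈ Ioo (0 : ℝ) 1) {s t : ℝ} (h : s ≤ t) :
    flow s y₀ ≤ flow t y₀ :=
  (flow_strictMono hy).monotone h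

lemma exists_time (hy : y₀ ∈ Ioo (0 : ℝ) 1) {s t y : ℝ}
    (h : y ∈ Icc (flow s y₀) (flow t y₀)) : ∃ τ ∈ Icc s t, flow τ y₀ = y := by
  have h1 : y ∈ Ioo (0 : ℝ) 1 :=
    ⟨(flow_mem s hy).1.trans_le h.1, h.2.trans_lt (flow_mem t hy).2⟩
  obtain ⟨τ, rfl⟩ := exists_flow_eq hy h1
  exact ⟨τ, ⟨(flow_strictMono hy).le_iff_le.1 h.1,
    (flow_strictMono hy).le_iff_le.1 h.2⟩, rfl⟩

lemma tendsto_flow_mul (hy : y₀ ∈ Ioo (0 : ℝ) 1) (hv : 0 < v) (c : ℝ) :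
    Tendsto (fun M : ℕ => flow (M * v + c) y₀) atTop (𝓝 1) := by
  have h := tendsto_pow_right (f := flow v) (flow_of_notMem v (by simp))
    (flow_of_notMem v (by simp)) (fun y hy => ?_) (flow_mem c hy)
  · refine h.congr fun M => ?_
    rw [flow_pow_apply, flow_apply_add]
  · have := flow_strictMono hy hv
    simpa [flow_zero, one_orderIso_apply] using this

lemma tendsto_flow_mul_neg (hy : y₀ ∈ Ioo (0 : ℝ) 1) (hv : 0 < v) (c : ℝ) :
    Tendsto (fun M : ℕ => flow (M * (-v) + c) y₀) atTop (𝓝 0) := by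
  have h := tendsto_pow_left (f := flow (-v)) (flow_of_notMem _ (by simp))
    (flow_of_notMem _ (by simp)) (fun y hy => ?_) (flow_mem c hy)
  · refine h.congr fun M => ?_
    rw [flow_pow_apply, flow_apply_add]
  · have := flow_strictMono hy (neg_lt_zero.2 hv)
    simpa [flow_zero, one_orderIso_apply] using this

end Choice

section FlowSides

variable {g : 𝓐} {f : ℕ → 𝓐} {v w w₀ w₁ y₀ : ℝ} {k k' : ℕ → ℕ} {s : ℕ → ℝ}

lemma pow_apply_flow_eq {f : 𝓐} (hv : 0 < v) (hw : w = v ∨ w = -v)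
    (hy : y₀ ∈ Ioo (0 : ℝ) 1)
    (hJ : ∀ y ∈ Icc (flow (-(3 * v)) y₀) (flow (3 * v) y₀), f y = flow w y)
    {i : ℕ} (hi : i ≤ 6) : (f ^ i) (flow (-(3 * w)) y₀) = flow ((i - 3) * w) y₀ := by
  induction i with
  | zero => simp [one_orderIso_apply]
  | succ i ih =>
    have h6 : (i : ℝ) ≤ 5 := by exact_mod_cast (by omega : i ≤ 5)
    have h0 : (0 : ℝ) ≤ i := Nat.cast_nonneg i
    rw [pow_succ', mul_apply, ih (by omega), hJ, ← flow_apply_add]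
    · congr 2
      push_cast
      ring
    · constructor <;> apply flow_mono hy <;> rcases hw with rfl | rfl <;> nlinarith

lemma abs_sum_flow_le {f : 𝓐} (hf : f ∈ supported 0 1) (hv : 0 < v)
    (hw : w = v ∨ w = -v) (hy : y₀ ∈ Ioo (0 : ℝ) 1)
    (hJ : ∀ y ∈ Icc (flow (-(3 * v)) y₀) (flow (3 * v) y₀), f y = flow w y) (m : ℕ) :
    ∑ i ∈ Finset.range m, ((f ^ i) (flow (3 * v) y₀) - (f ^ i) (flow (-(3 * v)) y₀))
      ≤ 6 := by
  have h := abs_sum_pow_sub_le (supported_left hf) (supported_right hf)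
    (flow_mem (-(3 * w)) hy) m 6
  rw [pow_apply_flow_eq hv hw hy hJ le_rfl] at h
  rcases hw with rfl | rfl
  · rw [show (((6 : ℕ) : ℝ) - 3) * w = 3 * w by push_cast; ring] at h
    exact (abs_le.1 h).2.trans (by norm_num)
  · rw [show (((6 : ℕ) : ℝ) - 3) * -v = -(3 * v) by push_cast; ring,
      show -(3 * -v) = 3 * v by ring] at h
    have h2 := (abs_le.1 h).1
    have h3 : ∀ i, (f ^ i) (flow (-(3 * v)) y₀) - (f ^ i) (flow (3 * v) y₀) =
      -((f ^ i) (flow (3 * v) y₀) - (f ^ i) (flow (-(3 * v)) y₀)) := fun i => by ring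
    simp only [h3] at h2
    rw [Finset.sum_neg_distrib] at h2
    push_cast at h2
    linarith

lemma abs_sum_pow_le {g : 𝓐} (hg : g ∈ supported 0 1) (hw0 : w₀ ∈ Ioo (0 : ℝ) 1)
    (hw1 : w₁ ∈ Ioo (0 : ℝ) 1) {r : ℕ} (h : (g ^ r) w₀ = w₁ ∨ (g ^ r) w₁ = w₀) (m : ℕ) :
    ∑ i ∈ Finset.range m, ((g ^ i) w₁ - (g ^ i) w₀) ≤ r := by
  rcases h with h | h
  · rw [← h]
    exact (abs_le.1 (abs_sum_pow_sub_le (supported_left hg)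
      (supported_right hg) hw0 m r)).2
  · have h2 := (abs_le.1 (abs_sum_pow_sub_le (supported_left hg)
      (supported_right hg) hw1 m r)).1
    rw [h] at h2
    have h3 : ∀ i, (g ^ i) w₀ - (g ^ i) w₁ = -((g ^ i) w₁ - (g ^ i) w₀) := fun i => by ring
    simp only [h3, Finset.sum_neg_distrib] at h2
    linarith

lemma eventually_tail_eq {M : ℕ} (hy : y₀ ∈ Ioo (0 : ℝ) 1)
    (hmid : ∀ a b, 0 < a → b < 1 → ∀ᶠ n in atTop, ∀ y ∈ Icc a b, f n y = flow w y) :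
    ∀ᶠ n in atTop, ∀ m : ℕ, ∑ i ∈ Finset.range m, ((f n ^ i) (flow (M * w + 3 * w) y₀) -
      (f n ^ i) (flow (M * w + -(3 * w)) y₀)) = ∑ j ∈ Finset.range 6,
        ((f n ^ m) (flow (M * w + (j - 3) * w) y₀) - flow (M * w + (j - 3) * w) y₀) := by
  set z := flow (M * w + -(3 * w)) y₀ with hz
  have hz' : z ∈ Ioo (0 : ℝ) 1 := flow_mem _ hy
  have hall : ∀ᶠ n in atTop, ∀ j ∈ Finset.range 7, (f n ^ j) z = (flow w ^ j) z := by
    refine (Finset.eventually_all _).2 fun j _ => ?_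
    filter_upwards [eventually_pow_eq (flow_mem_supported w) hmid j z z hz'.1 hz'.2 hz'.1
      hz'.2] with n hn using hn z ⟨le_rfl, le_rfl⟩
  filter_upwards [hall] with n hn m
  have he : ∀ j : ℕ, (flow w ^ j) z = flow (M * w + (j - 3) * w) y₀ := by
    intro j
    rw [flow_pow_apply, hz, ← flow_apply_add]
    congr 2
    ring
  have h6 := hn 6 (by simp)
  rw [he] at h6
  have h7 : M * w + ((6 : ℕ) - 3) * w = M * w + 3 * w := by push_cast; ring
  rw [h7] at h6
  rw [← h6, sum_pow_apply_sub]
  refine Finset.sum_congr rfl fun j hj => ?_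
  rw [hn j (by simp at hj ⊢; omega), he]

lemma exists_tail_bound (hf : ∀ n, f n ∈ supported 0 1) (hv : 0 < v) (hw : w = v ∨ w = -v)
    (hy : y₀ ∈ Ioo (0 : ℝ) 1)
    (hmid : ∀ a b, 0 < a → b < 1 → ∀ᶠ n in atTop, ∀ y ∈ Icc a b, f n y = flow w y) :
    ∃ θ : ℕ → ℝ, Tendsto θ atTop (𝓝 0) ∧ (∀ M : ℕ, ∀ᶠ n in atTop, ∀ m : ℕ,
      ∑ i ∈ Finset.range m, ((f n ^ i) ((flow w ^ M) (flow (3 * v) y₀)) -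
        (f n ^ i) ((flow w ^ M) (flow (-(3 * v)) y₀))) ≤ θ M) ∧
      ∀ M : ℕ, ∀ y ∈ Icc (flow (-(3 * v)) y₀) (flow (3 * v) y₀),
        (flow w ^ M) y * (1 - (flow w ^ M) y) ≤ θ M := by
  have hpm := fun n {y : ℝ} (hy : y ∈ Ioo (0 : ℝ) 1) m => map_mem_Ioo (pow_mem (hf n) m) hy
  rcases hw with rfl | rfl
  · refine ⟨fun M => 6 * (1 - flow (M * w + -(3 * w)) y₀), ?_, fun M => ?_, ?_⟩
    · simpa using ((tendsto_flow_mul hy hv (-(3 * w))).const_sub 1).const_mul 6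
    · filter_upwards [eventually_tail_eq (M := M) hy hmid] with n hn m
      simp only [flow_pow_apply, ← flow_apply_add, hn]
      refine (Finset.sum_le_card_nsmul _ _ (1 - flow (M * w + -(3 * w)) y₀)
        fun j _ => ?_).trans (by simp)
      have h1 := (hpm n (flow_mem (M * w + (j - 3) * w) hy) m).2
      have h2 : flow (M * w + -(3 * w)) y₀ ≤ flow (M * w + (j - 3) * w) y₀ :=
        flow_mono hy (by have : (0 : ℝ) ≤ j := Nat.cast_nonneg j; nlinarith)
      linarith
    · intro M y hyJ
      have h1 := (flow w ^ M).monotone hyJ.1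
      rw [flow_pow_apply, ← flow_apply_add] at h1
      obtain ⟨τ, -, rfl⟩ := exists_time hy hyJ
      rw [flow_pow_apply, ← flow_apply_add] at h1 ⊢
      have h2 := flow_mem (M * w + τ) hy
      nlinarith [h2.1, h2.2]
  · refine ⟨fun M => 6 * flow (M * -v + 3 * v) y₀, ?_, fun M => ?_, ?_⟩
    · simpa using (tendsto_flow_mul_neg hy hv (3 * v)).const_mul 6
    · filter_upwards [eventually_tail_eq (M := M) hy hmid] with n hn m
      have h3 : ∀ i : ℕ, (f n ^ i) (flow (M * -v + 3 * v) y₀) -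
          (f n ^ i) (flow (M * -v + -(3 * v)) y₀) =
          -((f n ^ i) (flow (M * -v + 3 * -v) y₀) -
            (f n ^ i) (flow (M * -v + -(3 * -v)) y₀)) := by
        intro i
        rw [show (3 * -v) = -(3 * v) by ring, neg_neg]
        ring
      simp only [flow_pow_apply, ← flow_apply_add, h3, Finset.sum_neg_distrib, hn]
      rw [← Finset.sum_neg_distrib]
      refine (Finset.sum_le_card_nsmul _ _ (flow (M * -v + 3 * v) y₀)
        fun j _ => ?_).trans (by simp)
      have h1 := (hpm n (flow_mem (M * -v + (j - 3) * -v) hy) m).1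
      have h2 : flow (M * -v + (j - 3) * -v) y₀ ≤ flow (M * -v + 3 * v) y₀ :=
        flow_mono hy (by have : (0 : ℝ) ≤ j := Nat.cast_nonneg j; nlinarith)
      linarith
    · intro M y hyJ
      have h1 := (flow (-v) ^ M).monotone hyJ.2
      rw [flow_pow_apply, flow_pow_apply, ← flow_apply_add] at h1
      obtain ⟨τ, -, rfl⟩ := exists_time hy hyJ
      rw [← flow_apply_add] at h1
      rw [flow_pow_apply, ← flow_apply_add]
      have h2 := flow_mem (M * -v + τ) hy
      nlinarith [h2.1, h2.2]

lemma SideData.of_flow (hg : g ∈ supported 0 1) (hf : ∀ n, f n ∈ supported 0 1)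
    (hfb : UnifLogBdd f) (hv : 0 < v) (hv1 : v ≤ 1 / 6) (hw : w = v ∨ w = -v)
    (hy : y₀ ∈ Ioo (0 : ℝ) 1)
    (hmid : ∀ a b, 0 < a → b < 1 → ∀ᶠ n in atTop, ∀ y ∈ Icc a b, f n y = flow w y)
    (hJ : ∀ n, ∀ y ∈ Icc (flow (-(3 * v)) y₀) (flow (3 * v) y₀), f n y = flow w y)
    (hw01 : w₀ < w₁) (hw0 : w₀ ∈ Ioo (0 : ℝ) 1) (hw1 : w₁ ∈ Ioo (0 : ℝ) 1)
    (hgw : (g ^ 4) w₀ = w₁ ∨ (g ^ 4) w₁ = w₀) (hk' : Tendsto k' atTop atTop)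
    (hs : ∀ n, |s n| ≤ v) (hl : ∀ n, sideMap g f k k' n w₀ = flow (-(2 * v) - s n) y₀)
    (hr : ∀ n, sideMap g f k k' n w₁ = flow (2 * v - s n) y₀) :
    ∃ θ, SideData g f w w₀ w₁ (flow (-(3 * v)) y₀) (flow (3 * v) y₀) 6
      (flow v y₀ - flow (-v) y₀) θ k k' s := by
  obtain ⟨θ, hθ, htail, hclose⟩ := exists_tail_bound hf hv hw hy hmid
  have hlt : flow (-(3 * v)) y₀ < flow (3 * v) y₀ :=
    flow_strictMono hy (by linarith)
  have h0 := flow_mem (-(3 * v)) hy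
  have h1 := flow_mem (3 * v) hy
  have hs1 := fun n => (abs_le.1 (hs n)).1
  have hs2 := fun n => (abs_le.1 (hs n)).2
  refine ⟨θ, supported_le_unifDiffeo hg, fun n => (hf n).1, hfb, hw01, h0.1, hlt, h1.2,
    fun m => (abs_sum_pow_le hg hw0 hw1 hgw m).trans (by norm_num),
    fun n m => abs_sum_flow_le (hf n) hv hw hy (hJ n) m, fun M => ?_, htail, hclose, hθ, hk',
    fun n => (hs n).trans (by linarith), fun n => ?_, fun n => ?_,
    sub_pos.2 (flow_strictMono hy (by linarith)), fun n => ?_, ?_⟩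
  · filter_upwards [eventually_pow_eq (flow_mem_supported w) hmid M
      (flow (-(3 * v)) y₀ / 2) ((1 + flow (3 * v) y₀) / 2) (by linarith [h0.1])
      (by linarith [h0.2]) (by linarith [h1.1]) (by linarith [h1.2])] with n hn y hyJ
    filter_upwards [Icc_mem_nhds (by linarith [hyJ.1, h0.1] : flow (-(3 * v)) y₀ / 2 < y)
      (by linarith [hyJ.2, h1.2] : y < (1 + flow (3 * v) y₀) / 2)] with z hz using hn z hz
  · rw [hl]
    constructor <;> apply flow_mono hy <;> linarith [hs1 n, hs2 n]
  · rw [hr]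
    constructor <;> apply flow_mono hy <;> linarith [hs1 n, hs2 n]
  · rw [hl, hr]
    have h2 : flow v y₀ ≤ flow (2 * v - s n) y₀ :=
      flow_mono hy (by linarith [hs2 n])
    have h3 : flow (-(2 * v) - s n) y₀ ≤ flow (-v) y₀ :=
      flow_mono hy (by linarith [hs1 n])
    linarith
  · intro a ha b hb
    obtain ⟨τ, h2, rfl⟩ := exists_time hy ha
    obtain ⟨τ', h3, rfl⟩ := exists_time hy hb
    refine ⟨τ' - τ, ?_, ?_⟩
    · rw [abs_le]
      constructor <;> linarith [h2.1, h2.2, h3.1, h3.2]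
    · rw [← flow_apply_add]
      congr 2
      ring

end FlowSides

section Sides

variable {g : 𝓐} {f : ℕ → 𝓐} {v w x₀ y₀ : ℝ} {k k' : ℕ → ℕ} {s : ℕ → ℝ}

lemma sideMap_apply_of_eq {n : ℕ} {z : ℝ} (h : f n ((g ^ k n) z) = g ((g ^ k n) z)) :
    sideMap g f k k' n (g z) = f n (sideMap g f k k' n z) := by
  have h1 : (g ^ k n) (g z) = f n ((g ^ k n) z) := by
    rw [h, ← mul_apply, ← pow_succ, pow_succ', mul_apply]
  have h2 : (f n ^ k' n)⁻¹ * f n = f n * (f n ^ k' n)⁻¹ :=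
    ((Commute.refl (f n)).pow_left _).inv_left.eq
  rw [sideMap, mul_apply, h1, ← mul_apply, h2]
  rfl

lemma sideMap_values (hv : 0 < v) (hw : w = v ∨ w = -v) (hy : y₀ ∈ Ioo (0 : ℝ) 1)
    (hJ : ∀ n, ∀ y ∈ Icc (flow (-(3 * v)) y₀) (flow (3 * v) y₀), f n y = flow w y)
    {n : ℕ} (hs : |s n| ≤ v) (h0 : sideMap g f k k' n x₀ = flow (-s n) y₀)
    (hc : ∀ i < 4, sideMap g f k k' n (g ((g ^ i) ((g ^ 2)⁻¹ x₀))) =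
      f n (sideMap g f k k' n ((g ^ i) ((g ^ 2)⁻¹ x₀)))) :
    sideMap g f k k' n ((g ^ 2)⁻¹ x₀) = flow (-(2 * w) - s n) y₀ ∧
      sideMap g f k k' n ((g ^ 2) x₀) = flow (2 * w - s n) y₀ := by
  set K := sideMap g f k k' n
  have hstep : ∀ c : ℝ, -2 ≤ c → c ≤ 2 →
      f n (flow (c * w - s n) y₀) = flow ((c + 1) * w - s n) y₀ := by
    intro c hc1 hc2
    rw [hJ, ← flow_apply_add]
    · congr 2
      ring
    · have h1 := abs_le.1 hs
      constructor <;> apply flow_mono hy <;> rcases hw with rfl | rfl <;>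
        nlinarith [h1.1, h1.2]
  have h2 : (g ^ 2) ((g ^ 2)⁻¹ x₀) = x₀ := apply_inv_self _ _
  set z := (g ^ 2)⁻¹ x₀ with hz
  have e0 := hc 0 (by norm_num)
  have e1 := hc 1 (by norm_num)
  have e2 := hc 2 (by norm_num)
  have e3 := hc 3 (by norm_num)
  have hpow : ∀ i : ℕ, g ((g ^ i) z) = (g ^ (i + 1)) z := fun i => by
    rw [pow_succ' g i, mul_apply]
  simp only [hpow] at e0 e1 e2 e3
  have s2 := h0
  rw [← h2] at s2
  norm_num at e0 e1 e2 e3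
  have b1 : K (g z) = flow (-1 * w - s n) y₀ := by
    apply (f n).injective
    grind
  have b0 : K z = flow (-2 * w - s n) y₀ := by
    apply (f n).injective
    grind
  refine ⟨b0.trans (by congr 2; ring), ?_⟩
  have h4 : (g ^ 2) x₀ = (g ^ 4) z := by
    rw [← h2, ← mul_apply, ← pow_add]
  rw [h4, e3, e2, s2]
  have := hstep 0 (by norm_num) (by norm_num)
  rw [show -s n = 0 * w - s n by ring, this, hstep (0 + 1) (by norm_num) (by norm_num)]
  congr 2
  ring

lemma pow_four_apply (g : 𝓐) (x : ℝ) : (g ^ 4) ((g ^ 2)⁻¹ x) = (g ^ 2) x := by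
  rw [show 4 = 2 + 2 from rfl, pow_add, mul_apply, apply_inv_self]

lemma inv_pow_mem_Ioo (hg : g ∈ supported 0 1) {x : ℝ} (hx : x ∈ Ioo (0 : ℝ) 1) (n : ℕ) :
    (g ^ n)⁻¹ x ∈ Ioo (0 : ℝ) 1 := by
  have h := (supported 0 1).inv_mem ((supported 0 1).pow_mem hg n)
  exact map_mem_Ioo h hx

lemma inv_lt_self (hg : g ∈ supported 0 1) (h : ∀ x ∈ Ioo (0 : ℝ) 1, x < g x) {x : ℝ}
    (hx : x ∈ Ioo (0 : ℝ) 1) : g⁻¹ x < x := by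
  simpa using h _ (inv_pow_mem_Ioo hg hx 1)

lemma lt_inv_self (hg : g ∈ supported 0 1) (h : ∀ x ∈ Ioo (0 : ℝ) 1, g x < x) {x : ℝ}
    (hx : x ∈ Ioo (0 : ℝ) 1) : x < g⁻¹ x := by
  simpa using h _ (inv_pow_mem_Ioo hg hx 1)

/-- The powers and times of a sequence of side maps which intertwine `g` and `f` on `P`. -/
def HasSide (g : 𝓐) (f : ℕ → 𝓐) (v w x₀ y₀ a b : ℝ) (P : ℝ → Prop) : Prop :=
  ∃ k k' s θ, SideData g f w a b (flow (-(3 * v)) y₀) (flow (3 * v) y₀) 6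
    (flow v y₀ - flow (-v) y₀) θ k k' s ∧ Tendsto k atTop atTop ∧ (∀ n, |s n| ≤ v) ∧
    (∀ n, flow (s n) (sideMap g f k k' n x₀) = y₀) ∧
    ∀ n z, P z → sideMap g f k k' n (g z) = f n (sideMap g f k k' n z)

lemma mem_Icc_flow (hv : 0 < v) (hy : y₀ ∈ Ioo (0 : ℝ) 1) :
    y₀ ∈ Icc (flow (-(3 * v)) y₀) (flow (3 * v) y₀) := by
  have h1 := flow_mono hy (by linarith : -(3 * v) ≤ 0)
  have h2 := flow_mono hy (by linarith : 0 ≤ 3 * v)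
  rw [flow_zero] at h1 h2
  exact ⟨h1, h2⟩

lemma hasSide_of_forall_exists (hg : g ∈ supported 0 1) (hf : ∀ n, f n ∈ supported 0 1)
    (hfb : UnifLogBdd f) (hv : 0 < v) (hv1 : v ≤ 1 / 6) (hx : x₀ ∈ Ioo (0 : ℝ) 1)
    (hy : y₀ ∈ Ioo (0 : ℝ) 1)
    (hmid : ∀ a b, 0 < a → b < 1 → ∀ᶠ n in atTop, ∀ y ∈ Icc a b, f n y = flow w y)
    (hJ : ∀ n, ∀ y ∈ Icc (flow (-(3 * v)) y₀) (flow (3 * v) y₀), f n y = flow w y)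
    {a b : ℝ} (hab : a < b) {P : ℝ → Prop} (hP : ∀ i, P ((g ^ i) ((g ^ 2)⁻¹ x₀)))
    (h : w = v ∧ a = (g ^ 2)⁻¹ x₀ ∧ b = (g ^ 2) x₀ ∨ w = -v ∧ a = (g ^ 2) x₀ ∧ b = (g ^ 2)⁻¹ x₀)
    (key : ∀ n, ∃ k k' : ℕ, ∃ s : ℝ, n ≤ k ∧ n ≤ k' ∧ |s| ≤ v ∧
      (f n ^ k')⁻¹ ((g ^ k) x₀) = flow (-s) y₀ ∧
      ∀ z, P z → f n ((g ^ k) z) = g ((g ^ k) z)) : HasSide g f v w x₀ y₀ a b P := by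
  have hz := inv_pow_mem_Ioo hg hx 2
  have hx2 := map_mem_Ioo (pow_mem hg 2) hx
  choose k k' s hk hk' hs h0 hcomm using key
  have hc : ∀ n z, P z → sideMap g f k k' n (g z) = f n (sideMap g f k k' n z) :=
    fun n z h => sideMap_apply_of_eq (hcomm n z h)
  have hw : w = v ∨ w = -v := h.imp And.left And.left
  have hval := fun n => sideMap_values hv hw hy hJ (hs n) (h0 n) fun i _ => hc n _ (hP i)
  have ht := tendsto_atTop_mono hk' tendsto_id
  have hθ : ∃ θ, SideData g f w a b (flow (-(3 * v)) y₀) (flow (3 * v) y₀) 6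
      (flow v y₀ - flow (-v) y₀) θ k k' s := by
    rcases h with ⟨rfl, rfl, rfl⟩ | ⟨rfl, rfl, rfl⟩
    · exact SideData.of_flow hg hf hfb hv hv1 hw hy hmid hJ hab hz hx2
        (.inl (pow_four_apply g x₀)) ht hs (fun n => (hval n).1) fun n => (hval n).2
    · exact SideData.of_flow hg hf hfb hv hv1 hw hy hmid hJ hab hx2 hz
        (.inr (pow_four_apply g x₀)) ht hs (fun n => by simpa using (hval n).2)
        fun n => by simpa using (hval n).1
  obtain ⟨θ, hθ⟩ := hθ
  refine ⟨k, k', s, θ, hθ, tendsto_atTop_mono hk tendsto_id, hs, fun n => ?_, hc⟩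
  change flow (s n) ((f n ^ k' n)⁻¹ ((g ^ k n) x₀)) = y₀
  rw [h0, ← flow_apply_add, add_neg_cancel, flow_zero, one_orderIso_apply]

lemma exists_right_side (hg : g ∈ supported 0 1) (hgx : ∀ x ∈ Ioo (0 : ℝ) 1, x < g x)
    (hf : ∀ n, f n ∈ supported 0 1) (hfx : ∀ n, ∀ x ∈ Ioo (0 : ℝ) 1, x < f n x)
    (hfb : UnifLogBdd f) (hv : 0 < v) (hv1 : v ≤ 1 / 6) (hx : x₀ ∈ Ioo (0 : ℝ) 1)
    (hy : y₀ ∈ Ioo (0 : ℝ) 1)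
    (hmid : ∀ a b, 0 < a → b < 1 → ∀ᶠ n in atTop, ∀ y ∈ Icc a b, f n y = flow v y)
    (hJ : ∀ n, ∀ y ∈ Icc (flow (-(3 * v)) y₀) (flow (3 * v) y₀), f n y = flow v y)
    (hnear : ∀ n, ∃ c < 1, ∀ y, c ≤ y → f n y = g y) :
    HasSide g f v v x₀ y₀ ((g ^ 2)⁻¹ x₀) ((g ^ 2) x₀) fun z => (g ^ 2)⁻¹ x₀ ≤ z := by
  have hz := inv_pow_mem_Ioo hg hx 2
  have hup := monotone_pow_apply (hgx _ hz).le
  refine hasSide_of_forall_exists hg hf hfb hv hv1 hx hy hmid hJ ?_ (fun i => hup i.zero_le)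
    (.inl ⟨rfl, rfl, rfl⟩) fun n => ?_
  · rw [← pow_four_apply]
    exact (hgx _ hz).trans_le (hup (by simp : 1 ≤ 4))
  obtain ⟨c, hc, hcf⟩ := hnear n
  have ht := fun {x} => tendsto_pow_right (supported_left hg)
    (supported_right hg) hgx (y := x)
  have hfy := map_mem_Ioo (pow_mem (hf n) (n + 1)) hy
  obtain ⟨k, h1, h2, h3⟩ := (((ht hx).eventually (lt_mem_nhds hfy.2)).and
    (((ht hz).eventually (lt_mem_nhds hc)).and (eventually_ge_atTop n))).exists
  have hfi := (supported 0 1).inv_mem (hf n)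
  obtain ⟨i, hi⟩ := ((tendsto_pow_left (supported_left hfi)
    (supported_right hfi) (fun y hy => inv_lt_self (hf n) (hfx n) hy)
    (map_mem_Ioo (pow_mem hg k) hx)).eventually
    (gt_mem_nhds (map_mem_Ioo (hf n) hy).1)).exists
  rw [inv_pow] at hi
  obtain ⟨k', h4, h5⟩ := exists_pow_inv_mem_Ico (hfx n y₀ hy).le h1.le ⟨i, hi⟩
  rw [hJ n y₀ (mem_Icc_flow hv hy)] at h5
  obtain ⟨τ, h6, h7⟩ := exists_time (s := 0) hy ⟨by rw [flow_zero]; exact h5.1, h5.2.le⟩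
  refine ⟨k, k', -τ, h3, h4, ?_, by rw [neg_neg]; exact h7.symm, fun z hz => hcf _
    (h2.le.trans ((g ^ k).monotone hz))⟩
  rw [abs_neg, abs_of_nonneg h6.1]
  exact h6.2

lemma exists_left_side (hg : g ∈ supported 0 1) (hgx : ∀ x ∈ Ioo (0 : ℝ) 1, g x < x)
    (hf : ∀ n, f n ∈ supported 0 1) (hfx : ∀ n, ∀ x ∈ Ioo (0 : ℝ) 1, f n x < x)
    (hfb : UnifLogBdd f) (hv : 0 < v) (hv1 : v ≤ 1 / 6) (hx : x₀ ∈ Ioo (0 : ℝ) 1)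
    (hy : y₀ ∈ Ioo (0 : ℝ) 1)
    (hmid : ∀ a b, 0 < a → b < 1 → ∀ᶠ n in atTop, ∀ y ∈ Icc a b, f n y = flow (-v) y)
    (hJ : ∀ n, ∀ y ∈ Icc (flow (-(3 * v)) y₀) (flow (3 * v) y₀),
      f n y = flow (-v) y)
    (hnear : ∀ n, ∃ c > 0, ∀ y, y ≤ c → f n y = g y) :
    HasSide g f v (-v) x₀ y₀ ((g ^ 2) x₀) ((g ^ 2)⁻¹ x₀) fun z => z ≤ (g ^ 2)⁻¹ x₀ := by
  have hz := inv_pow_mem_Ioo hg hx 2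
  have hdown := antitone_pow_apply (hgx _ hz).le
  refine hasSide_of_forall_exists hg hf hfb hv hv1 hx hy hmid hJ ?_ (fun i => hdown i.zero_le)
    (.inr ⟨rfl, rfl, rfl⟩) fun n => ?_
  · rw [← pow_four_apply]
    exact (hdown (by simp : 1 ≤ 4)).trans_lt (hgx _ hz)
  obtain ⟨c, hc, hcf⟩ := hnear n
  have ht := fun {x} => tendsto_pow_left (supported_left hg)
    (supported_right hg) hgx (y := x)
  have hfy := map_mem_Ioo (pow_mem (hf n) (n + 1)) hy
  obtain ⟨k, h1, h2, h3⟩ := (((ht hx).eventually (gt_mem_nhds hfy.1)).and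
    (((ht hz).eventually (gt_mem_nhds hc)).and (eventually_ge_atTop n))).exists
  have hfi := (supported 0 1).inv_mem (hf n)
  obtain ⟨i, hi⟩ := ((tendsto_pow_right (supported_left hfi)
    (supported_right hfi) (fun y hy => lt_inv_self (hf n) (hfx n) hy)
    (map_mem_Ioo (pow_mem hg k) hx)).eventually
    (lt_mem_nhds (map_mem_Ioo (hf n) hy).2)).exists
  rw [inv_pow] at hi
  obtain ⟨k', h4, h5⟩ := exists_pow_inv_mem_Ioc (hfx n y₀ hy).le h1.le ⟨i, hi⟩
  rw [hJ n y₀ (mem_Icc_flow hv hy)] at h5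
  obtain ⟨τ, h6, h7⟩ := exists_time (t := 0) hy ⟨h5.1.le, by rw [flow_zero]; exact h5.2⟩
  refine ⟨k, k', -τ, h3, h4, ?_, by rw [neg_neg]; exact h7.symm, fun z hz => hcf _
    (((g ^ k).monotone hz).trans h2.le)⟩
  rw [abs_neg, abs_of_nonpos h6.2]
  linarith [h6.1]

end Sides

section Closeness

/-- The time coordinate of the unit flow on the unit interval. -/
def unitTime (y : ℝ) : ℝ := flowTime (logit y)

lemma unitTime_flow (s : ℝ) {y : ℝ} (hy : y ∈ Ioo (0 : ℝ) 1) :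
    unitTime (flow s y) = unitTime y + s := by
  obtain ⟨u, rfl⟩ : ∃ u, sigmoid u = y := ⟨_, sigmoid_logit hy⟩
  rw [unitTime, unitTime, flow_sigmoid, logit_sigmoid, logit_sigmoid, flowTime_logisticFlow]

lemma hasDerivAt_unitTime {y : ℝ} (hy : y ∈ Ioo (0 : ℝ) 1) :
    HasDerivAt unitTime (exp (unitRate y)) y := by
  have h0 := unit_weight_pos hy
  have h1 : HasDerivAt logit (y⁻¹ - (-1) / (1 - y)) y :=
    (hasDerivAt_log hy.1.ne').sub
      (((hasDerivAt_id y).const_sub 1).log (sub_pos.2 hy.2).ne')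
  refine ((hasDerivAt_flowTime (logit y)).comp y h1).congr_deriv ?_
  rw [timeRate, logisticWeight_logit hy, unitRate]
  have := hy.1.ne'
  have := (sub_pos.2 hy.2).ne'
  field_simp
  ring

lemma IsDiffeo.hasDerivAt {f : 𝓐} (hf : IsDiffeo f) (x : ℝ) :
    HasDerivAt f (exp (ld f x)) x := by
  rw [ld, exp_log (hf.2 x)]
  exact (hf.differentiable x).hasDerivAt

lemma hasDerivAt_unitTime_comp {h : 𝓐} (hh : IsDiffeo h) {x : ℝ}
    (hx : h x ∈ Ioo (0 : ℝ) 1) :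
    HasDerivAt (fun x => unitTime (h x)) (exp (ld h x + unitRate (h x))) x := by
  refine ((hasDerivAt_unitTime hx).comp x (hh.hasDerivAt x)).congr_deriv ?_
  rw [add_comm, exp_add]

lemma abs_sub_le_abs_unitTime_sub {y z : ℝ} (hy : y ∈ Ioo (0 : ℝ) 1) (hz : z ∈ Ioo (0 : ℝ) 1) :
    |y - z| ≤ |unitTime y - unitTime z| := by
  have hmono : MonotoneOn (fun y => unitTime y - y) (Ioo 0 1) := by
    refine monotoneOn_of_hasDerivWithinAt_nonneg (convex_Ioo 0 1)
      (fun y hy => (((hasDerivAt_unitTime hy).sub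
        (hasDerivAt_id y)).continuousAt).continuousWithinAt)
      (fun y hy => ((hasDerivAt_unitTime (interior_subset hy)).sub
        (hasDerivAt_id y)).hasDerivWithinAt) fun y hy => ?_
    have h1 := unit_weight_pos (interior_subset hy)
    have : 0 ≤ unitRate y := by
      rw [unitRate]
      exact inv_nonneg.2 h1.1.le
    simp_all
  rcases le_total y z with h | h
  · have := hmono hy hz h
    grind
  · have := hmono hz hy h
    grind

lemma abs_sub_le_of_oscillation {h₁ h₂ : 𝓐} (hh1 : IsDiffeo h₁) (hh2 : IsDiffeo h₂)
    {a b ε : ℝ} (hab : a < b) (hε : 0 ≤ ε) (hm1 : ∀ x ∈ Icc a b, h₁ x ∈ Ioo (0 : ℝ) 1)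
    (hm2 : ∀ x ∈ Icc a b, h₂ x ∈ Ioo (0 : ℝ) 1) (ha : h₁ a = h₂ a) (hb : h₁ b = h₂ b)
    (hlen : unitTime (h₂ b) - unitTime (h₂ a) ≤ 1)
    (hosc : ∀ x ∈ Icc a b, ∀ x' ∈ Icc a b,
      |((ld h₁ x + unitRate (h₁ x)) - (ld h₁ x' + unitRate (h₁ x'))) -
        ((ld h₂ x + unitRate (h₂ x)) - (ld h₂ x' + unitRate (h₂ x')))| ≤ ε)
    {x : ℝ} (hx : x ∈ Icc a b) : |h₁ x - h₂ x| ≤ exp ε - 1 := by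
  have d1 := fun x hx => hasDerivAt_unitTime_comp hh1 (hm1 x hx)
  have d2 := fun x hx => hasDerivAt_unitTime_comp hh2 (hm2 x hx)
  set A := fun x => ld h₁ x + unitRate (h₁ x)
  set B := fun x => ld h₂ x + unitRate (h₂ x)
  have hI := fun x (hx : x ∈ Ioo a b) => Ioo_subset_Icc_self hx
  obtain ⟨ξ, hξ, hξ'⟩ := exists_hasDerivAt_eq_zero (f := fun x => unitTime (h₁ x) - unitTime (h₂ x))
    (f' := fun x => exp (A x) - exp (B x)) hab
    (fun x hx => ((d1 x hx).sub (d2 x hx)).continuousAt.continuousWithinAt)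
    (by simp only [ha, hb, sub_self]) fun x hx => (d1 x (hI x hx)).sub (d2 x (hI x hx))
  have hAB : ∀ x ∈ Icc a b, |A x - B x| ≤ ε := by
    intro x hx
    have h1 := hosc x hx ξ (hI ξ hξ)
    have h2 : A ξ = B ξ := exp_injective (sub_eq_zero.1 hξ')
    grind
  have hd : ∀ x ∈ Icc a b, |exp (A x) - exp (B x)| ≤ (exp ε - 1) * exp (B x) := by
    intro x hx
    have h1 := abs_le.1 (hAB x hx)
    have h2 : exp (A x) = exp (A x - B x) * exp (B x) := by
      rw [← exp_add]
      ring_nf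
    have h3 : exp (A x - B x) ≤ exp ε := exp_le_exp.2 h1.2
    have h4 : 1 - (exp ε - 1) ≤ exp (A x - B x) := by
      have h5 : exp (-ε) ≤ exp (A x - B x) := exp_le_exp.2 h1.1
      have h6 : exp (-ε) * exp ε = 1 := by rw [← exp_add]; simp
      nlinarith [exp_pos ε, exp_pos (-ε), sq_nonneg (exp ε - 1),
        one_le_exp hε]
    rw [h2, ← sub_one_mul, abs_mul, abs_of_pos (exp_pos (B x))]
    gcongr
    grind
  have hbound : ∀ σ : ℝ, |σ| = 1 → MonotoneOn (fun x => (exp ε - 1) * unitTime (h₂ x) +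
      σ * (unitTime (h₁ x) - unitTime (h₂ x))) (Icc a b) := by
    intro σ hσ
    refine monotoneOn_of_hasDerivWithinAt_nonneg (convex_Icc a b)
      (fun x hx => ((((d2 x hx).const_mul _).add
        (((d1 x hx).sub (d2 x hx)).const_mul σ)).continuousAt).continuousWithinAt)
      (fun x hx => (((d2 x (interior_subset hx)).const_mul _).add
        (((d1 x (interior_subset hx)).sub
          (d2 x (interior_subset hx))).const_mul σ)).hasDerivWithinAt) fun x hx => ?_
    have h1 := hd x (interior_subset hx)
    have h2 : |σ * (exp (A x) - exp (B x))| ≤ (exp ε - 1) * exp (B x) := by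
      rwa [abs_mul, hσ, one_mul]
    have := (abs_le.1 h2).1
    change 0 ≤ (exp ε - 1) * exp (B x) + σ * (exp (A x) - exp (B x))
    linarith
  refine (abs_sub_le_abs_unitTime_sub (hm1 x hx) (hm2 x hx)).trans ?_
  have hxa := left_mem_Icc.2 hab.le
  have m1 := hbound 1 (by simp) hxa hx hx.1
  have m2 := hbound (-1) (by simp) hxa hx hx.1
  have m3 : unitTime (h₂ x) ≤ unitTime (h₂ b) := by
    have : MonotoneOn (fun x => unitTime (h₂ x)) (Icc a b) :=
      monotoneOn_of_hasDerivWithinAt_nonneg (convex_Icc a b)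
        (fun x hx => (d2 x hx).continuousAt.continuousWithinAt)
        (fun x hx => (d2 x (interior_subset hx)).hasDerivWithinAt) fun x hx => (exp_pos _).le
    exact this hx (right_mem_Icc.2 hab.le) hx.2
  simp only [ha] at m1 m2
  have he : 0 ≤ exp ε - 1 := sub_nonneg.2 (one_le_exp hε)
  have m4 : (exp ε - 1) * (unitTime (h₂ x) - unitTime (h₂ a)) ≤ (exp ε - 1) * 1 :=
    mul_le_mul_of_nonneg_left (by linarith) he
  rw [abs_le]
  constructor <;> linarith

lemma eventually_le_of_lipschitz {u : ℕ → ℝ → ℝ} {a b C : ℝ}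
    (hC : ∀ n, ∀ x ∈ Icc a b, ∀ y ∈ Icc a b, |u n x - u n y| ≤ C * |x - y|)
    (hu : ∀ x ∈ Icc a b, Tendsto (fun n => u n x) atTop (𝓝 0)) {ε : ℝ} (hε : 0 < ε) :
    ∀ᶠ n in atTop, ∀ x ∈ Icc a b, |u n x| ≤ ε := by
  have hD : 0 < |C| + 1 := by positivity
  obtain ⟨t, ht, htf, hcov⟩ := (isCompact_Icc (a := a) (b := b)).finite_cover_balls
    (e := ε / 2 / (|C| + 1)) (by positivity)
  have h1 : ∀ᶠ n in atTop, ∀ y ∈ t, |u n y| < ε / 2 := by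
    refine (htf.eventually_all).2 fun y hy => ?_
    have := (hu y (ht hy)).abs
    rw [abs_zero] at this
    exact this.eventually (gt_mem_nhds (by positivity))
  filter_upwards [h1] with n hn x hx
  obtain ⟨y, hy, hxy⟩ := mem_iUnion₂.1 (hcov hx)
  rw [Metric.mem_ball, dist_eq, lt_div_iff₀ hD] at hxy
  have h2 := hC n x hx y (ht hy)
  have h3 : C * |x - y| ≤ ε / 2 := by
    nlinarith [le_abs_self C, abs_nonneg (x - y)]
  have h4 := hn y hy
  have h5 := abs_add_le (u n x - u n y) (u n y)
  rw [sub_add_cancel] at h5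
  linarith

lemma lipschitz_ld_pow {g : 𝓐} (hg : g ∈ unifDiffeo) {w₀ w₁ L : ℝ} (hw : w₀ < w₁)
    (hL : ∀ m : ℕ, ∑ i ∈ Finset.range m, ((g ^ i) w₁ - (g ^ i) w₀) ≤ L) :
    ∃ C, ∀ n : ℕ, ∀ x ∈ Icc w₀ w₁, ∀ y ∈ Icc w₀ w₁, |ld (g ^ n) x - ld (g ^ n) y| ≤ C * |x - y| := by
  have h := bddJet_deriv_ld_pow (B := Unit) (f := fun _ => g) (w₀ := fun _ => w₀)
    (w₁ := fun _ => w₁) (fun _ => hg.1)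
    (LogBdd.reindex hg.2 fun p : Unit × ℝ => p.2) (sub_pos.2 hw) (fun _ => le_rfl)
    (fun _ m => hL m)
  obtain ⟨C, -, hC⟩ := h.bound 0
  refine ⟨C, fun n x hx y hy => ?_⟩
  have h2 := (convex_Icc w₀ w₁).norm_image_sub_le_of_norm_deriv_le (f := ld (g ^ n)) (C := C)
    (fun z _ => ((hg.1.pow n).contDiff_ld.differentiable (by simp)) z)
    (fun z hz => by simpa using hC ⟨((), n, z), hz⟩) hy hx
  simpa [norm_eq_abs] using h2

end Closeness

section Gap

/-- The forward and the backward transition between two points agree. -/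
def TransitionEq (G : 𝓐) (x x' : ℝ) : Prop :=
  ∃ l, Tendsto (fun m : ℕ => ld (G⁻¹ ^ m) x' - ld (G⁻¹ ^ m) x) atTop (𝓝 l) ∧
    Tendsto (fun m : ℕ => ld (G ^ m) x' - ld (G ^ m) x) atTop (𝓝 l)

lemma logBdd_flow_of_le {f : ℕ → 𝓐} {s : ℕ → ℝ} (hf : UnifLogBdd f)
    (hf' : ∀ n, IsDiffeo (f n)) (hs : ∀ n, |s n| ≤ 1) :
    UnifLogBdd fun n => flow (s n) * f n * (flow (s n))⁻¹ := by
  have h1 : UnifLogBdd fun n => flow (s n) := logBdd_flow fun p : ℕ × ℝ => hs p.1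
  have hd := fun n => isDiffeo_flow (s n)
  exact (h1.mul hf hd hf').mul (h1.inv hd) (fun n => (hd n).mul (hf' n)) fun n => (hd n).inv

lemma tendstoUniformly_flow_conj {f : ℕ → 𝓐} {s : ℕ → ℝ} {v : ℝ}
    (hf : TendstoUniformly (fun n => (f n : ℝ → ℝ)) (flow v) atTop) (hs : ∀ n, |s n| ≤ 1) :
    TendstoUniformly (fun n => ((flow (s n) * f n * (flow (s n))⁻¹ : 𝓐) : ℝ → ℝ))
      (flow v) atTop := by
  obtain ⟨C, -, hC⟩ := ld_flow_le
  rw [tendstoUniformly_iff_abs] at hf ⊢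
  intro ε hε
  filter_upwards [hf (ε / exp C) (by positivity)] with n hn y
  set z := (flow (s n))⁻¹ y with hz
  have h1 : flow v y = flow (s n) (flow v z) := by
    have := congrArg (fun F : 𝓐 => F z) (flow_commute v (s n)).eq
    simp_all
  rw [h1]
  refine (abs_sub_le_of_deriv_le (φ := flow (s n)) (x := flow v z) (y := f n z)
    (fun x _ => (isDiffeo_flow (s n)).differentiable x) fun x _ => ?_).trans_lt
    ((lt_div_iff₀' (exp_pos C)).1 (hn z))
  rw [← (isDiffeo_flow (s n)).exp_ld, abs_of_pos (exp_pos _)]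
  exact exp_le_exp.2 ((le_abs_self _).trans (hC _ _ (hs n)))

/-- A diffeomorphism without fixed points inside the unit interval, whose forward and backward
transitions agree, degenerates to any short time map of the unit flow. -/
lemma degenerates_flow {G : 𝓐} (hG : G ∈ supported 0 1)
    (hfix : ∀ x ∈ Ioo (0 : ℝ) 1, x < G x)
    (htr : ∀ x ∈ Ioo (0 : ℝ) 1, ∀ x' ∈ Ioo (0 : ℝ) 1, TransitionEq G x x') {v : ℝ} (hv : 0 < v)
    (hv1 : v ≤ 1 / 6) : Degenerates (supported 0 1) G (flow v) := by
  obtain ⟨x₀, hx⟩ : ∃ x₀ : ℝ, x₀ ∈ Ioo (0 : ℝ) 1 := ⟨1 / 2, by norm_num⟩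
  have hmU := fun t => flow_mem t hx
  obtain ⟨F, c, hF, hFb, hFE, hseg, hc, hc0, hmidF, hout⟩ := exists_interpolation hG
    (flow_mem_supported v) (lt_min (hmU (-(4 * v))).1 (sub_pos.2 (hmU (3 * v)).2))
  have hE := fun {y : ℝ} (hy : y ∈ Ioo (0 : ℝ) 1) => flow_strictMono hy hv
  simp only [flow_zero, one_orderIso_apply] at hE
  have hFx : ∀ n, ∀ x ∈ Ioo (0 : ℝ) 1, x < F n x := fun n x hx =>
    (convex_Ioi x).segment_subset (hE hx) (hfix x hx) (hseg n x)
  have hJ4 : ∀ n, ∀ t ∈ Icc (-(4 * v)) (3 * v), F n (flow t x₀) = flow (v + t) x₀ := by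
    intro n t ht
    have h1 := flow_mono hx ht.1
    have h2 := flow_mono hx ht.2
    have h3 := le_min_iff.1 (hc n).2
    rw [hmidF n _ (h3.1.trans h1) (by linarith [h3.2]), flow_apply_add]
  have hmid : ∀ a b, 0 < a → b < 1 → ∀ᶠ n in atTop, ∀ y ∈ Icc a b, F n y = flow v y := by
    intro a b ha hb
    filter_upwards [hc0.eventually (gt_mem_nhds (lt_min ha (sub_pos.2 hb)))] with n hn y hy
    grind
  have hGi := (supported 0 1).inv_mem hG
  have hFi := fun n => (supported 0 1).inv_mem (hF n)
  have hinv : ∀ {f : 𝓐}, f ∈ supported 0 1 → (∀ x ∈ Ioo (0 : ℝ) 1, x < f x) →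
      ∀ x ∈ Ioo (0 : ℝ) 1, f⁻¹ x < x := by
    intro f hf hfx x hx
    have h1 := (supported 0 1).inv_mem hf
    have h2 := hfx _ (map_mem_Ioo h1 hx)
    rwa [apply_inv_self] at h2
  obtain ⟨kr, kr', sr, θr, hr, hkr, hsr, hr0, hrc⟩ := exists_right_side hG hfix hF hFx hFb hv hv1
    hx hx hmid (fun n y hy => by
      obtain ⟨t, ht, rfl⟩ := exists_time hx hy
      rw [hJ4 n t ⟨by linarith [ht.1], ht.2⟩, flow_apply_add])
    fun n => ⟨1 - c n / 2, by linarith [(hc n).1], fun y hy => hout n y (.inr hy)⟩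
  have hnearl : ∀ n, ∃ c' > 0, ∀ y, y ≤ c' → (F n)⁻¹ y = G⁻¹ y := by
    intro n
    refine ⟨G (c n / 2), ?_, fun y hy => ?_⟩
    · have h1 := (hc n).1
      have h2 := (le_min_iff.1 (hc n).2).1
      exact (map_mem_Ioo hG
        ⟨by positivity, by linarith [(hmU (-(4 * v))).2]⟩).1
    · apply (F n).injective
      have h1 := (G⁻¹).monotone hy
      rw [inv_apply_self] at h1
      rw [apply_inv_self, hout n _ (.inl h1), apply_inv_self]
  obtain ⟨kl, kl', sl, θl, hl, hkl, hsl, hl0, hlc⟩ := exists_left_side hGi (hinv hG hfix) hFi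
    (fun n => hinv (hF n) (hFx n)) (hFb.inv fun n => (hF n).1) hv hv1 hx hx
    (fun a b ha hb => by
      rcases lt_or_ge b a with hab | hab
      · exact Eventually.of_forall fun n y hy => absurd (hy.1.trans hy.2) (not_le.2 hab)
      · filter_upwards [hmid _ _ (flow_mem (-v) ⟨ha, hab.trans_lt hb⟩).1
          (flow_mem (-v) ⟨ha.trans_le hab, hb⟩).2] with n hn y hy
        apply (F n).injective
        rw [hn _ ⟨(flow (-v)).monotone hy.1, (flow (-v)).monotone hy.2⟩,
          apply_inv_self, ← flow_apply_add, add_neg_cancel, flow_zero,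
          one_orderIso_apply])
    (fun n y hy => by
      obtain ⟨t, ht, rfl⟩ := exists_time hx hy
      apply (F n).injective
      rw [apply_inv_self, ← flow_apply_add, hJ4 n _ ⟨by linarith [ht.1],
        by linarith [ht.2]⟩]
      congr 2
      ring)
    hnearl
  have e2 : (G⁻¹ ^ 2)⁻¹ = G ^ 2 := by rw [inv_pow, inv_inv]
  rw [e2] at hl
  simp only [e2] at hlc
  rw [inv_pow] at hl
  have hx1 : x₀ < G x₀ := hfix _ hx
  have hGx := map_mem_Ioo hG hx
  have hG2 : (G ^ 2) x₀ = G (G x₀) := by rw [pow_two, mul_apply]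
  have hGi2 : (G ^ 2)⁻¹ x₀ ≤ G⁻¹ x₀ := by
    rw [pow_two, mul_inv_rev, mul_apply]
    exact (hinv hG hfix _ (inv_pow_mem_Ioo hG hx 1)).le
  have hsub : Icc (G⁻¹ x₀) (G (G x₀)) ⊆ Icc ((G ^ 2)⁻¹ x₀) ((G ^ 2) x₀) := by grind
  have hsub' : Icc x₀ (G x₀) ⊆ Icc ((G ^ 2)⁻¹ x₀) ((G ^ 2) x₀) :=
    (Icc_subset_Icc (hinv hG hfix _ hx).le (hfix _ hGx).le).trans hsub
  have hv1' : v ≤ 1 := hv1.trans (by norm_num)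
  set Kl := sideMap G⁻¹ (fun n => (F n)⁻¹) kl kl'
  set Kr := sideMap G F kr kr'
  have hKl : ∀ n x, x ≤ G x₀ → Kl n (G x) = F n (Kl n x) := by
    intro n x hx
    have h1 := hlc n (G x) (by rw [hG2]; exact G.monotone hx)
    rw [inv_apply_self] at h1
    rw [h1, apply_inv_self]
  have hKr : ∀ n x, G⁻¹ x₀ ≤ x → Kr n (G x) = F n (Kr n x) :=
    fun n x hx => hrc n x (hGi2.trans hx)
  have hself : ∀ s y, (flow s)⁻¹ (flow s y) = y := fun s y => inv_apply_self _ _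
  have hend : ∀ n s, |s| ≤ v → ∀ K : 𝓐, K (G x₀) = F n (K x₀) → flow s (K x₀) = x₀ →
      (flow s * K) (G x₀) = flow v x₀ := by
    intro n s hs K hK h0
    have h2 : K x₀ = flow (-s) x₀ := by rw [flow_neg, ← h0, hself, h0]
    have h1 := abs_le.1 hs
    rw [mul_apply, hK, h2, hJ4 n _ ⟨by linarith, by linarith⟩, ← flow_apply_add]
    congr 2
    ring
  have hKlm : ∀ n, flow (sl n) * Kl n ∈ supported 0 1 := fun n =>
    (supported 0 1).mul_mem (flow_mem_supported _) ((supported 0 1).mul_mem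
      ((supported 0 1).inv_mem ((supported 0 1).pow_mem (hFi n) _))
      ((supported 0 1).pow_mem hGi _))
  have hKrm : ∀ n, flow (sr n) * Kr n ∈ supported 0 1 := fun n =>
    (supported 0 1).mul_mem (flow_mem_supported _) ((supported 0 1).mul_mem
      ((supported 0 1).inv_mem ((supported 0 1).pow_mem (hF n) _))
      ((supported 0 1).pow_mem hG _))
  have hsl1 := fun n => (hsl n).trans hv1'
  have hsr1 := fun n => (hsr n).trans hv1'
  refine degenerates_of_side_maps (Hl := fun n => flow (sl n) * Kl n)
    (Hr := fun n => flow (sr n) * Kr n)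
    (L := fun n => flow (sl n) * F n * (flow (sl n))⁻¹)
    (R := fun n => flow (sr n) * F n * (flow (sr n))⁻¹) hG hx hfix
    (supported_le_unifDiffeo (flow_mem_supported v)) hKlm hKrm
    (hl.logBdd_side.reindex fun p : {p : ℕ × ℝ // p.2 ∈ Icc (G⁻¹ x₀) (G (G x₀))} =>
      ⟨p.1, hsub p.2⟩)
    (hr.logBdd_side.reindex fun p : {p : ℕ × ℝ // p.2 ∈ Icc (G⁻¹ x₀) (G (G x₀))} =>
      ⟨p.1, hsub p.2⟩)
    (logBdd_flow_of_le hFb (fun n => (hF n).1) hsl1) (logBdd_flow_of_le hFb (fun n => (hF n).1) hsr1)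
    (tendstoUniformly_flow_conj hFE hsl1) (tendstoUniformly_flow_conj hFE hsr1)
    (fun n x hx => ?_) (fun n x hx => ?_) fun ε hε => ?_
  · simp only [mul_apply, hself, hKl n x hx]
  · simp only [mul_apply, hself, hKr n x hx]
  · obtain ⟨C, hC⟩ := lipschitz_ld_pow (supported_le_unifDiffeo hG) hr.w_lt hr.g_sum
    obtain ⟨C', hC'⟩ := lipschitz_ld_pow (supported_le_unifDiffeo hGi) hl.w_lt hl.g_sum
    have hε' : 0 < log (1 + ε) := log_pos (by linarith)
    set δ := log (1 + ε) with hδ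
    have hT := eventually_le_of_lipschitz (a := x₀) (b := G x₀) (C := C' + C)
      (u := fun n x => (ld (G⁻¹ ^ kl n) x - ld (G⁻¹ ^ kl n) x₀) -
        (ld (G ^ kr n) x - ld (G ^ kr n) x₀))
      (fun n x hx y hy => by
        have h1 := abs_le.1 (hC (kr n) x (hsub' hx) y (hsub' hy))
        have h2 := abs_le.1 (hC' (kl n) x (hsub' hx) y (hsub' hy))
        rw [abs_le]
        constructor <;> linarith)
      (fun x hx' => by
        obtain ⟨l, h1, h2⟩ := htr x₀ hx x ⟨hx.1.trans_le hx'.1, hx'.2.trans_lt hGx.2⟩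
        have := (h1.comp hkl).sub (h2.comp hkr)
        rwa [sub_self] at this) (by positivity : 0 < δ / 6)
    filter_upwards [hT, hl.oscillation (by positivity : 0 < δ / 3),
      hr.oscillation (by positivity : 0 < δ / 3)] with n h1 h2 h3 x hx'
    have hmem : ∀ {H : 𝓐}, H ∈ supported 0 1 → ∀ x ∈ Icc x₀ (G x₀), H x ∈ Ioo (0 : ℝ) 1 :=
      fun hH x hx' => map_mem_Ioo hH ⟨hx.1.trans_le hx'.1, hx'.2.trans_lt hGx.2⟩
    have hla := hend n (sl n) (hsl n) (Kl n) (hKl n x₀ hx1.le) (hl0 n)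
    have hra := hend n (sr n) (hsr n) (Kr n) (hKr n x₀ (hinv hG hfix _ hx).le) (hr0 n)
    have h4 := abs_sub_le_of_oscillation (hKrm n).1 (hKlm n).1 hx1 hε'.le (hmem (hKrm n))
      (hmem (hKlm n)) ((hr0 n).trans (hl0 n).symm) (hra.trans hla.symm) ?_ ?_ hx'
    · rw [hδ, exp_log (by linarith)] at h4
      linarith
    · have h5 : (flow (sl n) * Kl n) x₀ = x₀ := hl0 n
      rw [hla, h5, unitTime_flow v hx]
      linarith
    · intro y hy y' hy'
      have a1 := abs_le.1 (h1 y hy)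
      have a2 := abs_le.1 (h1 y' hy')
      have a3 := abs_le.1 (h2 y (hsub' hy) y' (hsub' hy'))
      have a4 := abs_le.1 (h3 y (hsub' hy) y' (hsub' hy'))
      rw [abs_le]
      constructor <;> linarith

end Gap

section Transition

lemma lt_or_gt_of_gap {f : 𝓐} {a b : ℝ} (h : ∀ y ∈ Ioo a b, f y ≠ y) :
    (∀ y ∈ Ioo a b, y < f y) ∨ ∀ y ∈ Ioo a b, f y < y := by
  by_contra! hc
  obtain ⟨⟨y, hy, hy'⟩, z, hz, hz'⟩ := hc
  have h1 := isPreconnected_Ioo.intermediate_value hy hz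
    (((continuous_orderIso f).sub continuous_id).continuousOn)
  obtain ⟨u, hu, hu'⟩ := h1 (show (0 : ℝ) ∈ Icc _ _ from ⟨by simpa using hy', by simpa using hz'⟩)
  exact h u hu (sub_eq_zero.1 hu')

variable {f g S : 𝓐} {a b w x x' : ℝ} {lam : ℝ → ℝ}

/-- The function `lam` is continuous at `w`, or monotone on the part of a neighbourhood of `w`
inside `(a, b)`. -/
def RegularEnd (lam : ℝ → ℝ) (a b w : ℝ) : Prop :=
  ContinuousAt lam w ∨ ∃ U ∈ 𝓝 w, ∀ u ∈ U ∩ Ioo a b, ∀ u' ∈ U ∩ Ioo a b, ∀ u'' ∈ U ∩ Ioo a b,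
    u' ∈ uIcc u u'' → lam u' ∈ uIcc (lam u) (lam u'')

lemma RegularEnd.tendsto_of_mem_uIcc (hw : RegularEnd lam a b w) (ha : f a = a) (hb : f b = b)
    (hf : Tendsto (fun u => lam (f u) - lam u) (𝓝[Ioo a b] w) (𝓝 0))
    (ht : ∀ y ∈ Ioo a b, Tendsto (fun n => (f ^ n) y) atTop (𝓝 w)) {N : ℕ} (hx : x ∈ Ioo a b)
    (hx' : x' ∈ Ioo a b) (hN : x' ∈ uIcc x ((f ^ N) x)) :
    Tendsto (fun m => lam ((f ^ m) x') - lam ((f ^ m) x)) atTop (𝓝 0) := by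
  rcases hw with hw | ⟨U, hU, hb'⟩
  · simpa using (hw.tendsto.comp (ht x' hx')).sub (hw.tendsto.comp (ht x hx))
  have h1 : ∀ N : ℕ, Tendsto (fun m => lam ((f ^ m) ((f ^ N) x)) - lam ((f ^ m) x)) atTop
      (𝓝 0) := by
    intro N
    induction N with
    | zero => simp
    | succ N ih =>
      have hy := pow_mem_Ioo ha hb hx N
      have h2 := hf.comp (tendsto_nhdsWithin_iff.2 ⟨ht _ hy,
        Eventually.of_forall fun m => pow_mem_Ioo ha hb hy m⟩)
      have h3 := h2.add ih
      rw [add_zero] at h3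
      refine h3.congr fun m => ?_
      have : (f ^ m) ((f ^ (N + 1)) x) = f ((f ^ m) ((f ^ N) x)) := by
        have e : f ^ m * f ^ (N + 1) = f * (f ^ m * f ^ N) := by
          rw [← pow_add, ← pow_add, ← pow_succ', add_assoc]
        exact congrArg (fun g : 𝓐 => g x) e
      grind
  refine squeeze_zero_norm' ?_ (tendsto_norm_zero.comp (h1 N))
  have hyN := pow_mem_Ioo ha hb hx N
  filter_upwards [ht x hx hU, ht x' hx' hU, ht _ hyN hU] with m h2 h3 h4
  exact abs_sub_left_of_mem_uIcc (hb' _ ⟨h2, pow_mem_Ioo ha hb hx m⟩ _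
    ⟨h3, pow_mem_Ioo ha hb hx' m⟩ _ ⟨h4, pow_mem_Ioo ha hb hyN m⟩
    ((f ^ m).monotone.image_uIcc_subset ⟨_, hN, rfl⟩))

lemma tendsto_of_regularEnd (hwa : RegularEnd lam a b a) (hwb : RegularEnd lam a b b)
    (ha : f a = a) (hb : f b = b) (hgap : ∀ y ∈ Ioo a b, f y ≠ y)
    (hfa : Tendsto (fun u => lam (f u) - lam u) (𝓝[Ioo a b] a) (𝓝 0))
    (hfb : Tendsto (fun u => lam (f u) - lam u) (𝓝[Ioo a b] b) (𝓝 0)) (hx : x ∈ Ioo a b)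
    (hx' : x' ∈ Ioo a b) :
    Tendsto (fun m => lam ((f ^ m) x') - lam ((f ^ m) x)) atTop (𝓝 0) := by
  have hsymm : ∀ {u u' : ℝ}, Tendsto (fun m => lam ((f ^ m) u') - lam ((f ^ m) u)) atTop (𝓝 0) →
      Tendsto (fun m => lam ((f ^ m) u) - lam ((f ^ m) u')) atTop (𝓝 0) := by
    intro u u' h
    simpa using h.neg
  rcases lt_or_gt_of_gap hgap with hlt | hlt
  · have ht := fun y hy => tendsto_pow_right ha hb hlt (y := y) hy
    have key : ∀ u ∈ Ioo a b, ∀ u' ∈ Ioo a b, u ≤ u' →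
        Tendsto (fun m => lam ((f ^ m) u') - lam ((f ^ m) u)) atTop (𝓝 0) := by
      intro u hu u' hu' huu
      obtain ⟨N, hN⟩ := ((ht u hu).eventually (lt_mem_nhds hu'.2)).exists
      exact hwb.tendsto_of_mem_uIcc ha hb hfb ht hu hu' (mem_uIcc.2 (.inl ⟨huu, hN.le⟩))
    rcases le_total x x' with h | h
    · exact key x hx x' hx' h
    · exact hsymm (key x' hx' x hx h)
  · have ht := fun y hy => tendsto_pow_left ha hb hlt (y := y) hy
    have key : ∀ u ∈ Ioo a b, ∀ u' ∈ Ioo a b, u' ≤ u →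
        Tendsto (fun m => lam ((f ^ m) u') - lam ((f ^ m) u)) atTop (𝓝 0) := by
      intro u hu u' hu' huu
      obtain ⟨N, hN⟩ := ((ht u hu).eventually (gt_mem_nhds hu'.1)).exists
      exact hwa.tendsto_of_mem_uIcc ha hb hfa ht hu hu' (mem_uIcc.2 (.inr ⟨hN.le, huu⟩))
    rcases le_total x' x with h | h
    · exact key x hx x' hx' h
    · exact hsymm (key x' hx' x hx h)

lemma ld_semiconj (hf : IsDiffeo f) (hg : IsDiffeo g) (hS : ∀ᶠ u in 𝓝 x, S (g u) = f (S u))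
    (h1 : 0 < deriv S x) (h2 : 0 < deriv S (g x)) : ld S (g x) + ld g x = ld f (S x) + ld S x := by
  have hS1 : DifferentiableAt ℝ S x := differentiableAt_of_deriv_ne_zero h1.ne'
  have hS2 : DifferentiableAt ℝ S (g x) := differentiableAt_of_deriv_ne_zero h2.ne'
  have h3 : deriv (S ∘ g) x = deriv (f ∘ S) x := Filter.EventuallyEq.deriv_eq hS
  rw [deriv_comp _ hS2 hg.differentiable.differentiableAt,
    deriv_comp _ hf.differentiable.differentiableAt hS1] at h3
  have h4 := congrArg log h3
  rwa [log_mul h2.ne' (hg.2 x).ne', log_mul (hf.2 _).ne' h1.ne'] at h4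

lemma semiconj_pow (ha : g a = a) (hb : g b = b) (hS : ∀ u ∈ Ioo a b, S (g u) = f (S u))
    (m : ℕ) {u : ℝ} (hu : u ∈ Ioo a b) : S ((g ^ m) u) = (f ^ m) (S u) := by
  induction m with
  | zero => rfl
  | succ m ih =>
    rw [pow_succ', mul_apply, hS _ (pow_mem_Ioo ha hb hu m), ih, pow_succ' f,
      mul_apply]

lemma tendsto_ld_of_semiconj (hf : IsDiffeo f) (hg : IsDiffeo g)
    (hS : ∀ u ∈ Ioo a b, S (g u) = f (S u)) (hSd : ∀ u ∈ Ioo a b, 0 < deriv S u) (ha : g a = a) (hb : g b = b)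
    (hgap : ∀ y ∈ Ioo a b, g y ≠ y) (hra : RegularEnd (ld S) a b a)
    (hrb : RegularEnd (ld S) a b b) (hga : ld f (S a) = ld g a) (hgb : ld f (S b) = ld g b)
    (hx : x ∈ Ioo a b) (hx' : x' ∈ Ioo a b) {l : ℝ}
    (h : Tendsto (fun m => ld (f ^ m) (S x') - ld (f ^ m) (S x)) atTop (𝓝 l)) :
    Tendsto (fun m => ld (g ^ m) x' - ld (g ^ m) x) atTop (𝓝 (l + (ld S x' - ld S x))) := by
  have hlim : ∀ w, ld f (S w) = ld g w →
      Tendsto (fun u => ld S (g u) - ld S u) (𝓝[Ioo a b] w) (𝓝 0) := by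
    intro w hw
    have h1 : ContinuousAt (fun u => ld f (S u) - ld g u) w :=
      ((hf.contDiff_ld.continuous.comp (continuous_orderIso S)).sub
        hg.contDiff_ld.continuous).continuousAt
    have h2 : Tendsto (fun u => ld f (S u) - ld g u) (𝓝[Ioo a b] w) (𝓝 0) := by
      simpa [hw] using h1.tendsto.mono_left nhdsWithin_le_nhds
    refine h2.congr' (eventually_nhdsWithin_of_forall fun u hu => ?_)
    have := ld_semiconj hf hg (eventually_of_mem (isOpen_Ioo.mem_nhds hu) hS) (hSd u hu)
      (hSd _ (mem_Ioo_of_fixed ha hb hu))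
    linarith
  have h1 := tendsto_of_regularEnd hra hrb ha hb hgap (hlim a hga) (hlim b hgb) hx hx'
  have h2 := (h.add (tendsto_const_nhds (x := ld S x' - ld S x))).sub h1
  rw [sub_zero] at h2
  refine h2.congr fun m => ?_
  have h3 : ∀ y ∈ Ioo a b, ld S ((g ^ m) y) + ld (g ^ m) y = ld (f ^ m) (S y) + ld S y :=
    fun y hy => ld_semiconj (hf.pow m) (hg.pow m) (eventually_of_mem (isOpen_Ioo.mem_nhds hy)
      fun u hu => semiconj_pow ha hb hS m hu) (hSd y hy)
      (hSd _ (pow_mem_Ioo ha hb hy m))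
  linarith [h3 x hx, h3 x' hx']

lemma TransitionEq.of_semiconj (hf : IsDiffeo f) (hg : IsDiffeo g)
    (hS : ∀ u ∈ Ioo a b, S (g u) = f (S u)) (hSd : ∀ u ∈ Ioo a b, 0 < deriv S u) (ha : g a = a)
    (hb : g b = b) (hgap : ∀ y ∈ Ioo a b, g y ≠ y) (hra : RegularEnd (ld S) a b a)
    (hrb : RegularEnd (ld S) a b b) (hSa : f (S a) = S a)
    (hSb : f (S b) = S b) (hga : ld f (S a) = ld g a) (hgb : ld f (S b) = ld g b)
    (hx : x ∈ Ioo a b) (hx' : x' ∈ Ioo a b) (h : TransitionEq f (S x) (S x')) :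
    TransitionEq g x x' := by
  obtain ⟨l, h1, h2⟩ := h
  have ha' : g⁻¹ a = a := by rw [← ha, inv_apply_self, ha]
  have hb' : g⁻¹ b = b := by rw [← hb, inv_apply_self, hb]
  have hS' : ∀ u ∈ Ioo a b, S (g⁻¹ u) = f⁻¹ (S u) := fun u hu => by
    apply f.injective
    rw [← hS _ (mem_Ioo_of_fixed ha' hb' hu), apply_inv_self, apply_inv_self]
  have hfix : ∀ w, g w = w → f (S w) = S w → ld f (S w) = ld g w →
      ld f⁻¹ (S w) = ld g⁻¹ w := by
    intro w hw hSw h3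
    have h4 := ld_inv_apply hf (S w)
    have h5 := ld_inv_apply hg w
    rw [hSw] at h4
    rw [hw] at h5
    rw [h4, h5, h3]
  refine ⟨_, tendsto_ld_of_semiconj hf.inv hg.inv hS' hSd ha' hb' (fun y hy h3 => hgap y hy ?_)
    hra hrb (hfix a ha hSa hga) (hfix b hb hSb hgb) hx hx' h1,
    tendsto_ld_of_semiconj hf hg hS hSd ha hb hgap hra hrb hga hgb hx hx' h2⟩
  conv_lhs => rw [← h3]
  exact apply_inv_self g y

end Transition

section Flattening

lemma log_deriv_squeezeFun {y : ℝ} (h0 : y ≠ 0) (hy : |y| < 1 / 2) :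
    log (deriv (squeezeFun 0) y) = log (1 + 2 * (y ^ 2)⁻¹) - (y ^ 2)⁻¹ := by
  have hpos : 0 < y ^ 2 + 0 := by positivity
  have h1 : squeezeRate 0 =ᶠ[𝓝 y] fun t => (t ^ 2)⁻¹ := by
    filter_upwards [continuous_abs.continuousAt.eventually (gt_mem_nhds hy)] with t ht
    rw [squeezeRate, smoothTransition.one_of_one_le, one_mul, add_zero]
    nlinarith [sq_abs t, abs_nonneg t]
  have h2 : HasDerivAt (fun t : ℝ => (t ^ 2)⁻¹) (-(2 * y) / (y ^ 2) ^ 2) y := by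
    have := (hasDerivAt_pow 2 y).fun_inv (by positivity)
    simpa using this
  rw [deriv_squeezeFun hpos, h1.deriv_eq, h2.deriv, h1.self_of_nhds]
  have h3 : 1 - y * (-(2 * y) / (y ^ 2) ^ 2) = 1 + 2 * (y ^ 2)⁻¹ := by
    field_simp
    ring
  rw [h3, log_mul (exp_pos _).ne' (by positivity), log_exp]
  ring

lemma log_deriv_squeezeFun_le {y y' : ℝ} (h0 : y ≠ 0) (h : |y| ≤ |y'|) (hy : |y'| < 1 / 2) :
    log (deriv (squeezeFun 0) y) ≤ log (deriv (squeezeFun 0) y') := by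
  have h0' : y' ≠ 0 := abs_pos.1 ((abs_pos.2 h0).trans_le h)
  rw [log_deriv_squeezeFun h0 (h.trans_lt hy), log_deriv_squeezeFun h0' hy]
  have h1 : (y' ^ 2)⁻¹ ≤ (y ^ 2)⁻¹ := inv_anti₀ (by positivity) (sq_le_sq.2 h)
  have h2 : 4 ≤ (y' ^ 2)⁻¹ := by
    rw [le_inv_comm₀ (by norm_num) (by positivity)]
    nlinarith [sq_abs y', abs_nonneg y']
  set s := (y ^ 2)⁻¹
  set s' := (y' ^ 2)⁻¹
  have h3 := log_le_sub_one_of_pos (x := (1 + 2 * s) / (1 + 2 * s'))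
    (div_pos (by linarith) (by linarith))
  rw [log_div (by linarith) (by linarith)] at h3
  have h4 : (1 + 2 * s) / (1 + 2 * s') - 1 ≤ s - s' := by
    rw [sub_le_iff_le_add, div_le_iff₀ (by linarith)]
    nlinarith
  linarith

variable {Z : Set ℝ} {z η x : ℝ} {H : ℝ → 𝓐} {Φ : 𝓐}

lemma SqueezeSystem.hasDerivAt_near (h : SqueezeSystem Z η H) (hz : z ∈ Z) (hx : x ≠ z)
    (hxz : |x - z| < 3 * η) : HasDerivAt (H 0) (deriv (squeezeFun 0) ((x - z) / η)) x ∧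
      ContDiffAt ℝ ∞ (H 0) x := by
  have hη := h.pos
  have h1 : (H 0 : ℝ → ℝ) =ᶠ[𝓝 x] fun u => z + η * squeezeFun 0 ((u - z) / η) := by
    have : ∀ᶠ u in 𝓝 x, |u - z| < 3 * η :=
      (continuous_abs.comp (continuous_id.sub continuous_const)).continuousAt.eventually
        (gt_mem_nhds hxz)
    filter_upwards [this] with u hu
    have h2 := h.near 0 le_rfl z hz ((u - z) / η) (by
      rw [abs_div, abs_of_pos hη, div_le_iff₀ hη]
      exact hu.le)
    rw [mul_div_cancel₀ _ hη.ne', add_sub_cancel, coe_squeeze le_rfl] at h2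
    exact h2
  have h0 : (x - z) / η ≠ 0 := div_ne_zero (sub_ne_zero.2 hx) hη.ne'
  have hc : ContDiffAt ℝ ∞ (squeezeFun 0) ((x - z) / η) := contDiffAt_squeezeFun (by positivity)
  have hl : ContDiff ℝ ∞ fun u : ℝ => (u - z) / η := by fun_prop
  constructor
  · refine HasDerivAt.congr_of_eventuallyEq ?_ h1
    have h3 := (hc.differentiableAt (by simp)).hasDerivAt
    have h4 : HasDerivAt (fun u : ℝ => (u - z) / η) (1 / η) x :=
      ((hasDerivAt_id x).sub_const z).div_const η
    have h5 := ((h3.comp x h4).const_mul η).const_add z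
    grind
  · refine ContDiffAt.congr_of_eventuallyEq ?_ h1
    have h2 : ContDiffAt ℝ ∞ (squeezeFun 0 ∘ fun u : ℝ => (u - z) / η) x :=
      hc.comp x hl.contDiffAt
    exact contDiffAt_const.add (contDiffAt_const.mul h2)

lemma SqueezeSystem.smooth_off (h : SqueezeSystem Z η H) (hx : x ∉ Z) :
    0 < deriv (H 0) x ∧ ContDiffAt ℝ ∞ (H 0) x := by
  have hη := h.pos
  by_cases hc : ∃ z ∈ Z, |x - z| < 3 * η
  · obtain ⟨z, hz, hxz⟩ := hc
    have hne : x ≠ z := fun h => hx (h ▸ hz)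
    have h1 := h.hasDerivAt_near hz hne hxz
    rw [h1.1.deriv]
    have h0 : (x - z) / η ≠ 0 := div_ne_zero (sub_ne_zero.2 hne) hη.ne'
    exact ⟨deriv_squeezeFun_pos (by positivity), h1.2⟩
  · push Not at hc
    have h1 : (H 0 : ℝ → ℝ) =ᶠ[𝓝 x] id := by
      filter_upwards [Metric.ball_mem_nhds x hη] with u hu
      refine h.far 0 le_rfl u fun z hz => ?_
      rw [Metric.mem_ball, dist_eq] at hu
      grind
    refine ⟨?_, contDiffAt_id.congr_of_eventuallyEq h1⟩
    rw [h1.deriv_eq, deriv_id]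
    exact one_pos

lemma SqueezeSystem.regularEnd (h : SqueezeSystem Z η H) {a b w : ℝ} (hw : w = a ∨ w = b) :
    RegularEnd (ld (H 0)) a b w := by
  have hη := h.pos
  by_cases hwZ : w ∈ Z
  · right
    have key : ∀ u u', u ≠ w → |u - w| ≤ |u' - w| → |u' - w| < η / 2 →
        ld (H 0) u ≤ ld (H 0) u' := by
      intro u u' hu h1 h2
      have hu' : u' ≠ w := by grind
      rw [ld, ld, (h.hasDerivAt_near hwZ hu (by linarith)).1.deriv,
        (h.hasDerivAt_near hwZ hu' (by linarith)).1.deriv]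
      refine log_deriv_squeezeFun_le (div_ne_zero (sub_ne_zero.2 hu) hη.ne') ?_ ?_
      · rw [abs_div, abs_div]
        gcongr
      · rw [abs_div, abs_of_pos hη, div_lt_iff₀ hη]
        linarith
    refine ⟨Metric.ball w (η / 2), Metric.ball_mem_nhds _ (by positivity), ?_⟩
    rintro u ⟨hu, hu1⟩ u' ⟨hu', hu1'⟩ u'' ⟨hu'', hu1''⟩ hb
    rw [Metric.mem_ball, dist_eq] at hu hu' hu''
    rcases hw with rfl | rfl
    · have h1 : ∀ {p q}, p ∈ Ioo w b → q ∈ Ioo w b → p ≤ q → |q - w| < η / 2 →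
          ld (H 0) p ≤ ld (H 0) q := by
        intro p q hp hq hpq hq'
        refine key p q hp.1.ne' ?_ hq'
        rw [abs_of_pos (sub_pos.2 hp.1), abs_of_pos (sub_pos.2 hq.1)]
        linarith
      rcases mem_uIcc.1 hb with hb | hb
      · exact mem_uIcc.2 (.inl ⟨h1 hu1 hu1' hb.1 hu', h1 hu1' hu1'' hb.2 hu''⟩)
      · exact mem_uIcc.2 (.inr ⟨h1 hu1'' hu1' hb.1 hu', h1 hu1' hu1 hb.2 hu⟩)
    · have h1 : ∀ {p q}, p ∈ Ioo a w → q ∈ Ioo a w → p ≤ q → |p - w| < η / 2 →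
          ld (H 0) q ≤ ld (H 0) p := by
        intro p q hp hq hpq hq'
        refine key q p hq.2.ne ?_ hq'
        rw [abs_of_neg (sub_neg.2 hp.2), abs_of_neg (sub_neg.2 hq.2)]
        linarith
      rcases mem_uIcc.1 hb with hb | hb
      · exact mem_uIcc.2 (.inr ⟨h1 hu1' hu1'' hb.2 hu', h1 hu1 hu1' hb.1 hu⟩)
      · exact mem_uIcc.2 (.inl ⟨h1 hu1' hu1 hb.2 hu', h1 hu1'' hu1' hb.1 hu''⟩)
  · left
    obtain ⟨h1, h2⟩ := h.smooth_off hwZ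
    exact ((contDiffAt_deriv h2).continuousAt).log h1.ne'

/-- Fixed points have derivative one and the transition maps between fixed points are trivial. -/
structure Parabolic (G : 𝓐) : Prop where
  mem : G ∈ unifDiffeo
  deriv_fixed : ∀ x, G x = x → deriv G x = 1
  transition : ∀ a b, G a = a → G b = b → (∀ y ∈ Ioo a b, G y ≠ y) →
    ∀ x ∈ Ioo a b, ∀ x' ∈ Ioo a b, TransitionEq G x x'

lemma Parabolic.of_semiconj {f g S : 𝓐} (hp : Parabolic f) (hg : g ∈ unifDiffeo)
    (hS : ∀ u, S (g u) = f (S u)) (hd : ∀ x, g x = x → deriv g x = 1)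
    (hreg : ∀ a b, g a = a → g b = b → (∀ y ∈ Ioo a b, g y ≠ y) → (∀ u ∈ Ioo a b, 0 < deriv S u) ∧
      RegularEnd (ld S) a b a ∧ RegularEnd (ld S) a b b) : Parabolic g := by
  refine ⟨hg, hd, fun a b ha hb hgap x hx x' hx' => ?_⟩
  obtain ⟨h1, h2, h3⟩ := hreg a b ha hb hgap
  have hf : ∀ w, g w = w → f (S w) = S w := fun w hw => by rw [← hS, hw]
  have hld : ∀ w, g w = w → ld f (S w) = ld g w := fun w hw => by
    rw [ld, ld, hd w hw, hp.deriv_fixed _ (hf w hw)]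
  have hm := S.strictMono
  refine TransitionEq.of_semiconj hp.mem.1 hg.1 (fun u _ => hS u) h1 ha hb hgap h2 h3 (hf a ha)
    (hf b hb) (hld a ha) (hld b hb) hx hx' (hp.transition (S a) (S b) (hf a ha) (hf b hb)
      (fun y hy hy' => ?_) _ ⟨hm hx.1, hm hx.2⟩ _ ⟨hm hx'.1, hm hx'.2⟩)
  obtain ⟨u, rfl⟩ := S.surjective y
  rw [← hS] at hy'
  exact hgap u ⟨S.lt_iff_lt.1 hy.1, S.lt_iff_lt.1 hy.2⟩ (S.injective hy')

lemma SqueezeSystem.flatAt (h : SqueezeSystem Z η H) (hη1 : η ≤ 1)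
    (hH : ∀ κ, 0 < κ → H κ ∈ unifDiffeo) (hΦ : ∀ z ∈ Z, FlattenableAt z η Φ)
    (hu : Φ ∈ unifDiffeo) (hz : z ∈ Z) : FlatAt ((H 0)⁻¹ * Φ * H 0) z := by
  intro j
  have hn : NearId (fun _ : Unit => (1 : ℝ)) fun _ => rescale z η Φ := by
    refine nearId_rescale (fun _ => h.pos) (fun _ => hΦ z hz) fun j => ?_
    obtain ⟨C, hC0, hC⟩ := iteratedDeriv_le_of_mem_unifDiffeo hu (j + 1)
    refine ⟨η ^ (j + 1) * C, fun _ Y _ => ?_⟩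
    rw [mul_one]
    exact mul_le_mul_of_nonneg_left (hC _) (pow_nonneg h.pos.le _)
  obtain ⟨C, hC⟩ := flat_of_squeezeSystem (ι := Unit) (fun _ => h) (fun _ => hη1) (fun _ => hH)
    (fun _ => hΦ) (fun _ => hu) (fun _ => hz) (fun _ => ⟨zero_le_one, le_rfl⟩) hn j 1
  have := hC () 0 (by norm_num)
  simpa using this

lemma SqueezeSystem.semiconj (H : ℝ → 𝓐) (Φ : 𝓐) (u : ℝ) :
    H 0 (((H 0)⁻¹ * Φ * H 0) u) = Φ (H 0 u) := by
  rw [mul_apply, mul_apply, apply_inv_self]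

lemma SqueezeSystem.conj_fixed_iff (H : ℝ → 𝓐) (Φ : 𝓐) (u : ℝ) :
    ((H 0)⁻¹ * Φ * H 0) u = u ↔ Φ (H 0 u) = H 0 u := by
  rw [← SqueezeSystem.semiconj H Φ u]
  exact (EmbeddingLike.apply_eq_iff_eq _).symm

lemma FlatAt.deriv_eq_one {G : 𝓐} (h : FlatAt G z) (hG : IsDiffeo G) : deriv G z = 1 := by
  have h1 := h.iteratedDeriv_eq hG 1
  simp_all

lemma SqueezeSystem.parabolic (h : SqueezeSystem Z η H) (hη1 : η ≤ 1)
    (hH : ∀ κ, 0 < κ → H κ ∈ unifDiffeo) (hΦ : ∀ z ∈ Z, FlattenableAt z η Φ)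
    (hp : Parabolic Φ) : Parabolic ((H 0)⁻¹ * Φ * H 0) := by
  have hf := hp.mem.1
  have hmem : (H 0)⁻¹ * Φ * H 0 ∈ unifDiffeo :=
    (h.degenerates hη1 le_rfl hH hΦ hp.mem).mem_unifDiffeo le_rfl hf
  have hG := hmem.1
  have hd : ∀ x, ((H 0)⁻¹ * Φ * H 0) x = x → deriv ((H 0)⁻¹ * Φ * H 0 : 𝓐) x = 1 := by
    intro x hx
    by_cases hZ : x ∈ Z
    · exact (h.flatAt hη1 hH hΦ hp.mem hZ).deriv_eq_one hG
    · have h1 := (h.smooth_off hZ).1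
      have h2 := ld_semiconj hf hG (.of_forall (SqueezeSystem.semiconj H Φ)) h1 (by rwa [hx])
      have h3 := hp.deriv_fixed _ ((SqueezeSystem.conj_fixed_iff H Φ x).1 hx)
      have h4 : ld ((H 0)⁻¹ * Φ * H 0) x = 0 := by
        have : ld Φ (H 0 x) = 0 := by rw [ld, h3, log_one]
        simp_all
      rw [← hG.exp_ld, h4, exp_zero]
  refine hp.of_semiconj hmem (SqueezeSystem.semiconj H Φ) hd fun a b _ _ hgap =>
    ⟨fun u hu => (h.smooth_off fun hZ => hgap u hu ?_).1, h.regularEnd (.inl rfl),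
      h.regularEnd (.inr rfl)⟩
  exact (h.flatAt hη1 hH hΦ hp.mem hZ).map_self

end Flattening

section LocalReduction
variable {r : ℕ} {ε ε' x y z : ℝ} {G G' G₂ : 𝓐} {s t : Set ℝ}

/-- The displacement of `G` is bounded by `ε` on `s` together with its first `r` derivatives. -/
def SmallOn (r : ℕ) (ε : ℝ) (G : 𝓐) (s : Set ℝ) : Prop :=
  ∀ k ≤ r, ∀ x ∈ s, |iteratedDeriv k (disp G) x| ≤ ε

/-- Some conjugate of `G` by a diffeomorphism supported in `(x, y)` is `ε`-close to the identity
on `(x, y)`. -/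
def IntervalReducible (r : ℕ) (ε : ℝ) (G : 𝓐) (x y : ℝ) : Prop :=
  ∃ h ∈ supported x y, SmallOn r ε (h * G * h⁻¹) (Ioo x y)

lemma eventuallyEq_disp {w : ℝ} (h : (G : ℝ → ℝ) =ᶠ[𝓝 w] G') : disp G =ᶠ[𝓝 w] disp G' := by
  filter_upwards [h] with u hu
  rw [disp, disp, hu]

lemma SmallOn.congr (h : SmallOn r ε G s) (hs : IsOpen s) (he : EqOn G G' s) :
    SmallOn r ε G' s := fun k hk w hw => by
  rw [← (eventuallyEq_disp (eventually_of_mem (hs.mem_nhds hw) he)).iteratedDeriv_eq k]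
  exact h k hk w hw

lemma SmallOn.mono (h : SmallOn r ε G s) (hs : t ⊆ s) : SmallOn r ε G t :=
  fun k hk w hw => h k hk w (hs hw)

lemma SmallOn.closure (h : SmallOn r ε G s) (hG : IsDiffeo G) :
    SmallOn r ε G (closure s) := fun k hk => by
  have hc : IsClosed {w | |iteratedDeriv k (disp G) w| ≤ ε} :=
    isClosed_le (hG.contDiff_disp.continuous_iteratedDeriv k (natCast_le_infty k)).abs
      continuous_const
  exact fun w hw => closure_minimal (fun u hu => h k hk u hu) hc hw

lemma SmallOn.Ioo_union (hG : IsDiffeo G) (hz : z ∈ Ioo x y) (h1 : SmallOn r ε G (Ioo x z))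
    (h2 : SmallOn r ε G (Ioo z y)) : SmallOn r ε G (Ioo x y) := fun k hk w hw => by
  rcases le_or_gt w z with h | h
  · refine h1.closure hG k hk w ?_
    rw [closure_Ioo hz.1.ne]
    exact ⟨hw.1.le, h⟩
  · aesop

lemma inv_fixed {f : 𝓐} (h : f x = x) : f⁻¹ x = x := by
  conv_lhs => rw [← h]
  simp

/-- Two conjugacies supported on adjacent intervals can be combined. -/
lemma IntervalReducible.concat (hG : IsDiffeo G) (hz : z ∈ Ioo x y) (hx : G x = x)
    (hzf : G z = z) (hy : G y = y) (h1 : IntervalReducible r ε G x z)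
    (h2 : IntervalReducible r ε G z y) : IntervalReducible r ε G x y := by
  obtain ⟨f, hf, hf'⟩ := h1
  obtain ⟨g, hg, hg'⟩ := h2
  have hf1 := supported_mono le_rfl hz.2.le hf
  have hg1 := supported_mono hz.1.le le_rfl hg
  have hfi := inv_mem hf
  have hgi := inv_mem hg
  have off1 : ∀ w ∈ Ioo x z, g w = w := fun w hw => hg.2 w fun h => lt_asymm hw.2 h.1
  have off1' : ∀ w ∈ Ioo x z, g⁻¹ w = w := fun w hw => hgi.2 w fun h => lt_asymm hw.2 h.1
  have off2 : ∀ w ∈ Ioo z y, f w = w := fun w hw => hf.2 w fun h => lt_asymm hw.1 h.2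
  have off2' : ∀ w ∈ Ioo z y, f⁻¹ w = w := fun w hw => hfi.2 w fun h => lt_asymm hw.1 h.2
  refine ⟨f * g, mul_mem hf1 hg1, ?_⟩
  have hd : IsDiffeo ((f * g) * G * (f * g)⁻¹) := hG.conj (hf.1.mul hg.1)
  have hc : f * g = g * f := commute_of_disjoint hf.2 off1
  refine SmallOn.Ioo_union hd hz (hf'.congr isOpen_Ioo fun w hw => ?_)
    (hg'.congr isOpen_Ioo fun w hw => ?_)
  · have h3 := mem_Ioo_of_fixed (inv_fixed (supported_left hf))
      (inv_fixed (supported_right hf)) hw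
    rw [mul_inv_rev]
    simp only [mul_apply]
    rw [off1' _ h3, off1 _ (mem_Ioo_of_fixed hx hzf h3)]
  · have h3 := mem_Ioo_of_fixed (inv_fixed (supported_left hg))
      (inv_fixed (supported_right hg)) hw
    rw [hc, mul_inv_rev]
    simp only [mul_apply]
    rw [off2' _ h3, off2 _ (mem_Ioo_of_fixed hzf hy h3)]

lemma IntervalReducible.of_degenerates (hd : Degenerates (supported x y) G G₂)
    (hG : IsDiffeo G) (h2 : IntervalReducible r ε' G₂ x y) (hε : ε' < ε) :
    IntervalReducible r ε G x y := by
  obtain ⟨h, hh, hr⟩ := h2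
  have hG2 := hd.mem_unifDiffeo supported_le_unifDiffeo hG
  obtain ⟨f, hf, hn⟩ := hd.exists_near (r := r) supported_le_unifDiffeo hG hh (sub_pos.2 hε)
  refine ⟨f, hf, fun k hk w hw => ?_⟩
  have h6 := abs_lt.1 (hn k hk w)
  have h7 := hr k hk w hw
  rw [iteratedDeriv_disp (hG2.1.conj hh.1).1.contDiffAt] at h7
  rw [iteratedDeriv_disp (hG.conj hf.1).1.contDiffAt]
  rw [abs_le] at h7 ⊢
  constructor <;> linarith

lemma IntervalReducible.congr (h : IntervalReducible r ε G x y) (he : EqOn G G' (Ioo x y)) :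
    IntervalReducible r ε G' x y := by
  obtain ⟨f, hf, hf'⟩ := h
  refine ⟨f, hf, hf'.congr isOpen_Ioo fun w hw => ?_⟩
  have h3 := mem_Ioo_of_fixed (inv_fixed (supported_left hf))
      (inv_fixed (supported_right hf)) hw
  simp only [mul_apply]
  rw [he h3]

/-- A diffeomorphism flat at `x` and `y` agrees on `[x, y]` with one supported there. -/
lemma exists_mem_supported_eqOn (hG : IsDiffeo G) (hx : FlatAt G x) (hy : FlatAt G y) (hxy : x < y) :
    ∃ R ∈ supported x y, EqOn R G (Icc x y) := by
  have h1 : rightPart x G hx.map_self y = y := by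
    rw [rightPart, glueAt_right _ _ hxy.le, hy.map_self]
  have h2 := isDiffeo_rightPart hx.map_self hG hx
  have h3 : FlatAt (rightPart x G hx.map_self) y := fun j => by
    rw [← hy j]
    refine (eventuallyEq_disp ?_).iteratedDeriv_eq j
    filter_upwards [lt_mem_nhds hxy] with w hw
    exact glueAt_right _ _ (le_of_lt hw)
  refine ⟨leftPart y _ h1, ⟨isDiffeo_leftPart h1 h2 h3, fun w hw => ?_⟩, fun w hw => ?_⟩
  · rcases le_or_gt y w with h | h
    · exact glueAt_right _ _ h
    · have h4 : w ≤ x := not_lt.1 fun h4 => hw ⟨h4, h⟩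
      rw [leftPart, glueAt_left _ _ h.le, rightPart, glueAt_left _ _ h4, one_orderIso_apply]
  · rw [leftPart, glueAt_left _ _ hw.2, rightPart, glueAt_right _ _ hw.1]

lemma mem_unifDiffeo_affine {η : ℝ} (hη : 0 < η) : affine x η ∈ unifDiffeo := by
  refine mem_unifDiffeo.2 ⟨isDiffeo_affine hη, bddJet_iff.2 fun j => ?_⟩
  have h : ld (affine x η) = fun _ => log η := funext fun u => by rw [ld, deriv_affine hη]
  refine ⟨|log η|, fun u => ?_⟩
  rw [h, iteratedDeriv_const]
  grind

lemma flatAt_of_mem_supported {w : ℝ} (hG : G ∈ supported x y) (hw : w = x ∨ w = y) :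
    FlatAt G w := by
  rcases hw with rfl | rfl
  · refine closure_minimal (s := Iio w) (fun u hu => ?_) (isClosed_flatAt hG.1)
      (by rw [closure_Iio]; exact self_mem_Iic)
    refine flatAt_of_eventuallyEq (eventually_of_mem (Iio_mem_nhds hu) fun v hv => hG.2 v ?_)
    grind
  · refine closure_minimal (s := Ioi w) (fun u hu => ?_) (isClosed_flatAt hG.1)
      (by rw [closure_Ioi]; exact self_mem_Ici)
    refine flatAt_of_eventuallyEq (eventually_of_mem (Ioi_mem_nhds hu) fun v hv => hG.2 v ?_)
    grind

lemma TransitionEq.inv {u u' : ℝ} (h : TransitionEq G u u') : TransitionEq G⁻¹ u u' := by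
  obtain ⟨l, h1, h2⟩ := h
  exact ⟨l, by rwa [inv_inv], h1⟩

lemma Degenerates.exists_flow {G : 𝓐} (hG : G ∈ supported 0 1)
    (hfix : ∀ x ∈ Ioo (0 : ℝ) 1, G x ≠ x)
    (htr : ∀ x ∈ Ioo (0 : ℝ) 1, ∀ x' ∈ Ioo (0 : ℝ) 1, TransitionEq G x x') {v : ℝ} (hv : 0 < v)
    (hv1 : v ≤ 1 / 6) : ∃ w, |w| = v ∧ Degenerates (supported 0 1) G (flow w) := by
  rcases lt_or_gt_of_gap hfix with h | h
  · exact ⟨v, abs_of_pos hv, degenerates_flow hG h htr hv hv1⟩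
  · refine ⟨-v, by rw [abs_neg, abs_of_pos hv], ?_⟩
    have h1 : ∀ u ∈ Ioo (0 : ℝ) 1, u < G⁻¹ u := fun u hu => by
      have h2 := mem_Ioo_of_fixed (inv_fixed (supported_left hG))
        (inv_fixed (supported_right hG)) hu
      have h3 := h _ h2
      simp_all
    have h2 := (degenerates_flow (inv_mem hG) h1
      (fun u hu u' hu' => (htr u hu u' hu').inv) hv hv1).inv supported_le_unifDiffeo
      (inv_mem hG).1
    bound

/-- Without fixed points inside, a parabolic interval diffeomorphism is reducible. -/
lemma IntervalReducible.of_gap (hG : Parabolic G) (hx : FlatAt G x) (hy : FlatAt G y)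
    (hxy : x < y) (hgap : ∀ w ∈ Ioo x y, G w ≠ w) (hε : 0 < ε) :
    IntervalReducible r ε G x y := by
  obtain ⟨R, hR, hRG⟩ := exists_mem_supported_eqOn hG.mem.1 hx hy hxy
  refine IntervalReducible.congr ?_ (hRG.mono Ioo_subset_Icc_self)
  set η := y - x with hη'
  have hη : 0 < η := sub_pos.2 hxy
  set A := affine x η
  have hA : A ∈ unifDiffeo := mem_unifDiffeo_affine hη
  have hAd := isDiffeo_affine (z := x) hη
  have hA01 : ∀ u, A u ∈ Ioo x y ↔ u ∈ Ioo (0 : ℝ) 1 := fun u => by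
    rw [affine_apply hη, mem_Ioo, mem_Ioo]
    refine and_congr ⟨fun h => pos_of_mul_pos_right (by linarith : 0 < η * u) hη.le,
      fun h => by nlinarith⟩ ⟨fun h => by nlinarith, fun h => by nlinarith⟩
  have hsupp : ∀ h : 𝓐, h ∈ supported 0 1 → A * h * A⁻¹ ∈ supported x y := by
    refine fun h hh => ⟨hh.1.conj hAd, fun u hu => ?_⟩
    simp only [mul_apply]
    rw [hh.2 _ fun h4 => hu (by simpa using (hA01 _).2 h4), apply_inv_self]
  set G₀ := A⁻¹ * R * A with hG₀
  have hG0R : A * G₀ * A⁻¹ = R := by rw [hG₀]; group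
  have hG0 : G₀ ∈ supported 0 1 := by
    refine ⟨(hAd.inv.mul hR.1).mul hAd, fun u hu => ?_⟩
    simp only [hG₀, mul_apply]
    rw [hR.2 _ fun h => hu ((hA01 u).1 h), inv_apply_self]
  have hsemi : ∀ u ∈ Icc (0 : ℝ) 1, A (G₀ u) = G (A u) := fun u hu => by
    simp only [hG₀, mul_apply, apply_inv_self]
    refine hRG ?_
    rw [affine_apply hη]
    constructor <;> nlinarith [hu.1, hu.2]
  have h0 : A 0 = x := by rw [affine_apply hη]; ring
  have h1 : A 1 = y := by rw [affine_apply hη, hη']; ring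
  have hgap0 : ∀ u ∈ Ioo (0 : ℝ) 1, G₀ u ≠ u := fun u hu h => by grind
  have hld : ∀ u, ld A u = log η := fun u => by rw [ld, deriv_affine hη]
  have hcont : ∀ u, ContinuousAt (ld A) u := fun u => by
    rw [show ld A = fun _ => log η from funext hld]
    exact continuousAt_const
  have hflat0 : ld G₀ 0 = 0 := by
    have h2 := (flatAt_of_mem_supported hG0 (.inl rfl)).deriv_eq_one hG0.1
    rw [ld, h2, log_one]
  have hflat1 : ld G₀ 1 = 0 := by
    have h2 := (flatAt_of_mem_supported hG0 (.inr rfl)).deriv_eq_one hG0.1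
    rw [ld, h2, log_one]
  have htr : ∀ u ∈ Ioo (0 : ℝ) 1, ∀ u' ∈ Ioo (0 : ℝ) 1, TransitionEq G₀ u u' := by
    intro u hu u' hu'
    refine TransitionEq.of_semiconj hG.mem.1 hG0.1
      (fun u hu => hsemi u (Ioo_subset_Icc_self hu)) (fun u _ => by rw [deriv_affine hη]; exact hη)
      (supported_left hG0) (supported_right hG0) hgap0
      (.inl (hcont 0)) (.inl (hcont 1)) (by rw [h0, hx.map_self]) (by rw [h1, hy.map_self])
      ?_ ?_ hu hu' (hG.transition x y hx.map_self hy.map_self hgap _ ((hA01 u).2 hu) _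
        ((hA01 u').2 hu'))
    · rw [h0, hflat0, ld, hx.deriv_eq_one hG.mem.1, log_one]
    · rw [h1, hflat1, ld, hy.deriv_eq_one hG.mem.1, log_one]
  choose C hC0 hC using iteratedDeriv_flow_le
  have hsmall : ∀ᶠ v in 𝓝[>] (0 : ℝ), v ≤ 1 / 6 ∧ ∀ k ∈ Finset.range (r + 1),
      η * (η ^ k)⁻¹ * (C k * v) < ε / 2 := by
    refine Filter.Eventually.and (Filter.mem_of_superset
      (Ioc_mem_nhdsGT (by norm_num : (0 : ℝ) < 1 / 6)) fun v h => h.2) ?_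
    rw [Filter.eventually_all_finset]
    intro k _
    have h3 : Tendsto (fun v : ℝ => η * (η ^ k)⁻¹ * (C k * v)) (𝓝[>] 0) (𝓝 0) :=
      ((by fun_prop : Continuous fun v : ℝ => η * (η ^ k)⁻¹ * (C k * v)).tendsto' 0 0
        (by simp)).mono_left nhdsWithin_le_nhds
    exact h3.eventually (gt_mem_nhds (half_pos hε))
  obtain ⟨v, ⟨hv1, hv⟩, hv0 : 0 < v⟩ := (hsmall.and self_mem_nhdsWithin).exists
  obtain ⟨w, hw, hd⟩ := Degenerates.exists_flow hG0 hgap0 htr hv0 hv1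
  have hd' := hd.map_conj supported_le_unifDiffeo hG0.1 hA hsupp
  rw [hG0R] at hd'
  refine IntervalReducible.of_degenerates hd' hR.1 (ε' := ε / 2) ⟨1, one_mem _, ?_⟩
    (half_lt_self hε)
  rw [one_mul, inv_one, mul_one]
  intro k hk u _
  have hU := (isDiffeo_flow w).conj hAd
  have h3 := iteratedDeriv_disp_rescale (z := x) hη hU k (A⁻¹ u)
  rw [rescale_affine_conj, ← affine_apply hη, apply_inv_self] at h3
  have h4 := hC k w (A⁻¹ u) (by rw [hw]; linarith)
  have h5 : iteratedDeriv k (disp (A * flow w * A⁻¹)) u =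
      η * (η ^ k)⁻¹ * iteratedDeriv k (disp (flow w)) (A⁻¹ u) := by
    rw [h3]
    rw [mul_assoc, mul_assoc]
    field_simp
  rw [h5, abs_mul, abs_of_pos (by positivity : 0 < η * (η ^ k)⁻¹)]
  refine (mul_le_mul_of_nonneg_left h4 (by positivity)).trans ?_
  rw [hw]
  exact (hv k (Finset.mem_range.2 (by omega))).le

end LocalReduction

section PointFlattening
variable {r : ℕ} {ε x y z η κ : ℝ} {G : 𝓐}

/-- The squeeze centred at `z` at scale `η`. -/
def pointSqueeze (z η κ : ℝ) : 𝓐 := affine z η * squeeze κ * (affine z η)⁻¹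

lemma pointSqueeze_near (hη : 0 < η) (y : ℝ) :
    pointSqueeze z η κ (z + η * y) = z + η * squeeze κ y := by
  rw [pointSqueeze, mul_apply, mul_apply, ← affine_apply hη,
    inv_apply_self, affine_apply hη]

lemma exists_eq_affine (z : ℝ) (hη : 0 < η) (x : ℝ) :
    ∃ y, x = z + η * y ∧ |x - z| = η * |y| := by
  refine ⟨(x - z) / η, by field_simp; ring, ?_⟩
  rw [abs_div, abs_of_pos hη]
  field_simp

lemma pointSqueeze_far (hη : 0 < η) (hκ : 0 ≤ κ) (h : η ≤ |x - z|) :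
    pointSqueeze z η κ x = x := by
  obtain ⟨y, rfl, hy⟩ := exists_eq_affine z hη x
  rw [pointSqueeze_near hη, squeeze_eq_self hκ]
  rw [hy] at h
  exact le_of_mul_le_mul_left (by rwa [mul_one]) hη

lemma squeezeSystem_point (z : ℝ) (hη : 0 < η) : SqueezeSystem {z} η (pointSqueeze z η) where
  pos := hη
  near κ _ w hw y _ := by
    rw [mem_singleton_iff.1 hw]
    exact pointSqueeze_near hη y
  far κ hκ x hx := pointSqueeze_far hη hκ (hx z rfl)

lemma pointSqueeze_mem_supported (hη : 0 < η) (hκ : 0 < κ) (hx : x ≤ z - η) (hy : z + η ≤ y) :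
    pointSqueeze z η κ ∈ supported x y := by
  refine ⟨(isDiffeo_squeeze hκ).conj (isDiffeo_affine hη), fun w hw => ?_⟩
  refine pointSqueeze_far hη hκ.le (le_of_not_gt fun h => hw ?_)
  rw [abs_lt] at h
  constructor <;> linarith

lemma pointSqueeze_mem_unifDiffeo (hη : 0 < η) (hκ : 0 < κ) :
    pointSqueeze z η κ ∈ unifDiffeo :=
  supported_le_unifDiffeo (pointSqueeze_mem_supported hη hκ le_rfl le_rfl)

/-- The limit of conjugates of `G` by stronger and stronger squeezes at `z`. -/
def flattened (z η : ℝ) (G : 𝓐) : 𝓐 :=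
  (pointSqueeze z η 0)⁻¹ * G * pointSqueeze z η 0

lemma flatAt_flattened (hη : 0 < η) (hη1 : η ≤ 1) (hG : G ∈ unifDiffeo)
    (h : FlattenableAt z η G) : FlatAt (flattened z η G) z :=
  (squeezeSystem_point z hη).flatAt hη1 (fun _ => pointSqueeze_mem_unifDiffeo hη)
    (fun w hw => by rwa [mem_singleton_iff.1 hw]) hG rfl

lemma parabolic_flattened (hη : 0 < η) (hη1 : η ≤ 1) (hG : Parabolic G)
    (h : FlattenableAt z η G) : Parabolic (flattened z η G) :=
  (squeezeSystem_point z hη).parabolic hη1 (fun _ => pointSqueeze_mem_unifDiffeo hη)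
    (fun w hw => by rwa [mem_singleton_iff.1 hw]) hG

lemma flattened_eventuallyEq (hη : 0 < η) (h : FlattenableAt z η G) (hx : 2 * η ≤ |x - z|) :
    (flattened z η G : ℝ → ℝ) =ᶠ[𝓝 x] G :=
  (squeezeSystem_point z hη).conj_eventuallyEq_far le_rfl
    (fun w hw => by rwa [mem_singleton_iff.1 hw])
    fun w hw => by rwa [mem_singleton_iff.1 hw]

lemma flatAt_flattened_far (hη : 0 < η) (h : FlattenableAt z η G) (hx : 2 * η ≤ |x - z|)
    (hf : FlatAt G x) : FlatAt (flattened z η G) x := fun j => by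
  rw [(eventuallyEq_disp (flattened_eventuallyEq hη h hx)).iteratedDeriv_eq j]
  exact hf j

lemma degenerates_flattened (hη : 0 < η) (hη1 : η ≤ 1) (hG : G ∈ unifDiffeo)
    (h : FlattenableAt z η G) (hx : x ≤ z - η) (hy : z + η ≤ y) :
    Degenerates (supported x y) G (flattened z η G) :=
  (squeezeSystem_point z hη).degenerates hη1 supported_le_unifDiffeo
    (fun _ hκ => pointSqueeze_mem_supported hη hκ hx hy)
    (fun w hw => by rwa [mem_singleton_iff.1 hw]) hG

/-- The fixed points of the flattened map in an interval with fixed endpoints correspond to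
fixed points of `G`. -/
lemma flattened_fixed {u : ℝ} (hx : pointSqueeze z η 0 x = x)
    (hy : pointSqueeze z η 0 y = y) (hu : u ∈ Ioo x y) (h : flattened z η G u = u) :
    pointSqueeze z η 0 u ∈ Ioo x y ∧ G (pointSqueeze z η 0 u) = pointSqueeze z η 0 u :=
  ⟨mem_Ioo_of_fixed hx hy hu, (SqueezeSystem.conj_fixed_iff (pointSqueeze z η) G u).1 h⟩

lemma pointSqueeze_self (hη : 0 < η) : pointSqueeze z η 0 z = z := by
  have := pointSqueeze_near (z := z) (κ := 0) hη 0
  rwa [squeeze_apply_zero le_rfl, mul_zero, add_zero] at this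

/-- The mean value inequality around a zero of a function. -/
lemma abs_le_of_deriv_le {φ : ℝ → ℝ} (hφ : Differentiable ℝ φ) {c C ρ : ℝ} (h0 : φ c = 0)
    (h : ∀ x, |x - c| ≤ ρ → |deriv φ x| ≤ C) (hx : |x - c| ≤ ρ) : |φ x| ≤ C * |x - c| := by
  have := abs_sub_le_of_deriv_le (fun v _ => hφ v) fun v (hv : v ∈ uIcc c x) =>
    h v ((abs_sub_left_of_mem_uIcc hv).trans hx)
  rwa [h0, sub_zero] at this

lemma exists_flattenableAt (hG : G ∈ unifDiffeo) : ∃ η₀ > 0, η₀ ≤ 1 ∧ ∀ z η, G z = z →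
    deriv G z = 1 → 0 < η → η ≤ η₀ → FlattenableAt z η G := by
  obtain ⟨C, hC0, hC⟩ := iteratedDeriv_le_of_mem_unifDiffeo hG 1
  refine ⟨min 1 (1 / (8 * C)), by positivity, min_le_left _ _, fun z η hz hz' hη hle => ?_⟩
  refine ⟨hG.1, hz, hz', fun y hy => ?_⟩
  have hd := hG.1.contDiff_disp
  have hdd : Differentiable ℝ (deriv (disp G)) := by
    rw [← iteratedDeriv_one]
    exact fun v => (hasDerivAt_iteratedDeriv hd 1 v).differentiableAt
  have hz1 : deriv (disp G) z = 0 := by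
    have : HasDerivAt (disp G) (deriv G z - 1) z :=
      (hG.1.differentiable z).hasDerivAt.sub (hasDerivAt_id z)
    rw [this.deriv, hz', sub_self]
  have h2 : ∀ x, |deriv (deriv (disp G)) x| ≤ C := fun x => by
    have h3 := hC x
    have h4 := congrFun (iteratedDeriv_add_two_disp hG.1 0) x
    rw [zero_add, iteratedDeriv_succ, iteratedDeriv_one] at h4
    rwa [h4]
  have h3 : ∀ x, |deriv (disp G) x| ≤ C * |x - z| := fun x =>
    abs_le_of_deriv_le hdd hz1 (fun x _ => h2 x) le_rfl
  have h4 := abs_le_of_deriv_le (hd.differentiable (by simp)) (x := z + η * y)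
    (by rw [disp, hz, sub_self])
    (fun x hx => (h3 x).trans (mul_le_mul_of_nonneg_left hx hC0.le)) le_rfl
  rw [disp, add_sub_cancel_left, abs_mul, abs_of_pos hη] at h4
  refine h4.trans ?_
  have h5 : η * (8 * C) ≤ 1 := by
    have := hle.trans (min_le_right _ _)
    rwa [le_div_iff₀ (by positivity)] at this
  have h6 : C * (η * |y|) ≤ 1 / 4 := by nlinarith [abs_nonneg y, mul_pos hη hC0]
  nlinarith [mul_nonneg hη.le (abs_nonneg y)]

/-- A smooth function with vanishing jet at `c` decays superpolynomially there. -/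
lemma exists_flat_bound {φ : ℝ → ℝ} (hφ : ContDiff ℝ ∞ φ) {c : ℝ}
    (h : ∀ j, iteratedDeriv j φ c = 0) (ρ : ℝ) (N : ℕ) :
    ∀ k, ∃ C, 0 ≤ C ∧ ∀ x, |x - c| ≤ ρ → |iteratedDeriv k φ x| ≤ C * |x - c| ^ N := by
  induction N with
  | zero =>
    intro k
    obtain ⟨C, hC⟩ := (isCompact_closedBall c ρ).exists_bound_of_continuousOn
      (hφ.continuous_iteratedDeriv k (natCast_le_infty k)).continuousOn
    refine ⟨max C 0, le_max_right _ _, fun x hx => ?_⟩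
    rw [pow_zero, mul_one]
    exact (hC x hx).trans (le_max_left _ _)
  | succ N ih =>
    intro k
    obtain ⟨C, hC0, hC⟩ := ih (k + 1)
    refine ⟨C, hC0, fun x hx => ?_⟩
    have h1 := abs_le_of_deriv_le (ρ := |x - c|) (C := C * |x - c| ^ N) (x := x)
      (fun v => (hasDerivAt_iteratedDeriv hφ k v).differentiableAt) (h k) (fun u hu => ?_) le_rfl
    · rwa [pow_succ, ← mul_assoc]
    · rw [← iteratedDeriv_succ]
      exact (hC u (hu.trans hx)).trans
        (mul_le_mul_of_nonneg_left (pow_le_pow_left₀ (abs_nonneg _) hu N) hC0)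

/-- Flattening at fixed points close to a flat point at comparable scales yields small maps. -/
lemma Parabolic.exists_smallOn_flattened (hG : Parabolic G) {c : ℝ} (hc : FlatAt G c) (r : ℕ)
    (hε : 0 < ε) : ∃ δ > 0, ∀ z, G z = z → 0 < |z - c| → |z - c| < δ →
      FlattenableAt z (|z - c| / 8) G ∧ |z - c| ≤ 1 ∧
        SmallOn r ε (flattened z (|z - c| / 8) G) {x | |x - c| ≤ |z - c|} := by
  obtain ⟨η₀, hη₀, hη₁, hfl⟩ := exists_flattenableAt hG.mem
  set ι := {z : ℝ // G z = z ∧ 0 < |z - c| ∧ |z - c| ≤ η₀}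
  have hd := hG.mem.1.contDiff_disp
  have hflat := exists_flat_bound hd hc 10
  let η : ι → ℝ := fun i => |i.1 - c| / 8
  have hη : ∀ i, 0 < η i := fun i => by have := i.2.2.1; positivity
  have hηe : ∀ i : ι, |i.1 - c| = 8 * η i := fun i => by simp only [η]; ring
  have hη0 : ∀ i, η i ≤ η₀ := fun i => by have := i.2.2.2; linarith [hηe i, hη i]
  have hη1 : ∀ i, η i ≤ 1 := fun i => (hη0 i).trans hη₁
  have hF : ∀ i : ι, FlattenableAt i.1 (η i) G := fun i =>
    hfl _ _ i.2.1 (hG.deriv_fixed _ i.2.1) (hη i) (hη0 i)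
  have hn : NearId (fun i : ι => η i ^ r) fun i => rescale i.1 (η i) G := by
    refine nearId_rescale hη hF fun j => ?_
    obtain ⟨C, hC0, hC⟩ := hflat r (j + 2)
    refine ⟨C * 10 ^ r, fun i Y hY => ?_⟩
    have h1 : |i.1 + η i * Y - c| ≤ 10 * η i := by
      have h2 : |η i * Y| ≤ η i * 2 := by
        rw [abs_mul, abs_of_pos (hη i)]
        exact mul_le_mul_of_nonneg_left hY (hη i).le
      calc |i.1 + η i * Y - c| = |(i.1 - c) + η i * Y| := by ring_nf
        _ ≤ _ := abs_add_le _ _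
        _ ≤ _ := by linarith [hηe i]
    have h3 := hC _ (h1.trans (by linarith [hη1 i]))
    rw [iteratedDeriv_add_two_disp hG.mem.1] at h3
    calc _ ≤ 1 * (C * (10 * η i) ^ r) := mul_le_mul (pow_le_one₀ (hη i).le (hη1 i))
          (h3.trans (mul_le_mul_of_nonneg_left (pow_le_pow_left₀ (abs_nonneg _) h1 r) hC0))
          (abs_nonneg _) zero_le_one
      _ = _ := by rw [mul_pow]; ring
  have hbd : ∀ j, ∃ C, ∀ i y, |y| < 2 →
      |iteratedDeriv j (disp (flattened i.1 (η i) G)) (i.1 + η i * y)| ≤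
        C * η i ^ r * (η i * (η i)⁻¹ ^ j) * |y| ^ 0 := fun j =>
    flat_of_squeezeSystem (Z := fun i : ι => {i.1}) (z := fun i => i.1) (η := η)
      (H := fun i => pointSqueeze i.1 (η i)) (Φ := fun _ => G)
      (fun i => squeezeSystem_point i.1 (hη i)) hη1
      (fun i _ => pointSqueeze_mem_unifDiffeo (hη i))
      (fun i w hw => by rw [mem_singleton_iff.1 hw]; exact hF i) (fun _ => hG.mem)
      (fun _ => rfl) (fun i => ⟨pow_nonneg (hη i).le r, pow_le_one₀ (hη i).le (hη1 i)⟩) hn j 0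
  choose C hC using hbd
  choose D hD0 hD using hflat 1
  have hsmall : ∀ᶠ t in 𝓝 (0 : ℝ), ∀ k ∈ Finset.range (r + 1), |C k| * t < ε ∧ D k * t < ε := by
    rw [Filter.eventually_all_finset]
    intro k _
    have h1 : Tendsto (fun t : ℝ => |C k| * t) (𝓝 0) (𝓝 0) :=
      (by fun_prop : Continuous fun t : ℝ => |C k| * t).tendsto' 0 0 (by simp)
    have h2 : Tendsto (fun t : ℝ => D k * t) (𝓝 0) (𝓝 0) :=
      (by fun_prop : Continuous fun t : ℝ => D k * t).tendsto' 0 0 (by simp)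
    exact (h1.eventually (gt_mem_nhds hε)).and (h2.eventually (gt_mem_nhds hε))
  obtain ⟨δ, hδ, hball⟩ := Metric.eventually_nhds_iff.1 hsmall
  refine ⟨min δ η₀, lt_min hδ hη₀, fun z hz h0 hlt => ?_⟩
  let i : ι := ⟨z, hz, h0, (hlt.trans_le (min_le_right _ _)).le⟩
  have hz1 : |z - c| ≤ 1 := (hlt.trans_le (min_le_right _ _)).le.trans hη₁
  refine ⟨hF i, hz1, fun k hk x hx => ?_⟩
  have hk' := Finset.mem_range.2 (Nat.lt_succ_of_le hk)
  obtain ⟨y, rfl, hy⟩ := exists_eq_affine z (hη i) x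
  rcases lt_or_ge |y| 2 with h2 | h2
  · refine (hC k i y h2).trans ?_
    rw [pow_zero, mul_one]
    have e : η i ^ r * (η i)⁻¹ ^ k ≤ 1 := by
      rw [inv_pow, ← div_eq_mul_inv, div_le_one (pow_pos (hη i) k)]
      exact pow_le_pow_of_le_one (hη i).le (hη1 i) hk
    have h3 := (hball (y := η i) (by
      rw [dist_eq, sub_zero, abs_of_pos (hη i)]
      have : |z - c| = 8 * η i := hηe i
      linarith [hη i, min_le_left δ η₀]) k hk').1
    have h4 : 0 ≤ η i ^ r * (η i)⁻¹ ^ k := by have := hη i; positivity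
    calc C k * η i ^ r * (η i * (η i)⁻¹ ^ k) = C k * η i * (η i ^ r * (η i)⁻¹ ^ k) := by ring
      _ ≤ |C k| * η i * (η i ^ r * (η i)⁻¹ ^ k) := by
        have := hη i
        gcongr
        exact le_abs_self _
      _ ≤ |C k| * η i * 1 := by
        have := hη i
        gcongr
      _ ≤ ε := by rw [mul_one]; exact h3.le
  · have h3 : 2 * η i ≤ |z + η i * y - z| := by
      rw [hy, mul_comm]
      exact mul_le_mul_of_nonneg_left h2 (hη i).le
    rw [(eventuallyEq_disp (flattened_eventuallyEq (hη i) (hF i) h3)).iteratedDeriv_eq k]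
    refine (hD k _ (le_trans hx (by linarith))).trans ?_
    rw [pow_one]
    refine (mul_le_mul_of_nonneg_left hx (hD0 k)).trans ?_
    refine ((hball (y := |z - c|) ?_ k hk').2).le
    rw [dist_eq, sub_zero, abs_abs]
    exact hlt.trans_le (min_le_left _ _)

end PointFlattening

section IntervalTheorem
variable {r : ℕ} {ε a b x y z η : ℝ} {G : 𝓐}

lemma SmallOn.intervalReducible (h : SmallOn r ε G (Ioo x y)) :
    IntervalReducible r ε G x y := by
  refine ⟨1, one_mem _, ?_⟩
  rwa [one_mul, inv_one, mul_one]

/-- Cutting an interval at an interior fixed point after flattening it. -/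
lemma IntervalReducible.of_flattened (hG : Parabolic G) (hx : G x = x) (hy : G y = y)
    (hF : FlattenableAt z η G) (hη : 0 < η) (hη1 : η ≤ 1) (hxz : x + 2 * η ≤ z)
    (hzy : z + 2 * η ≤ y) (hε : 0 < ε) (h1 : IntervalReducible r (ε / 2) (flattened z η G) x z)
    (h2 : IntervalReducible r (ε / 2) (flattened z η G) z y) : IntervalReducible r ε G x y := by
  refine IntervalReducible.of_degenerates (degenerates_flattened hη hη1 hG.mem hF
    (by linarith) (by linarith)) hG.mem.1 ?_ (half_lt_self hε)
  refine IntervalReducible.concat (parabolic_flattened hη hη1 hG hF).mem.1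
    ⟨by linarith, by linarith⟩ ?_ (flatAt_flattened hη hη1 hG.mem hF).map_self ?_ h1 h2
  · rw [(flattened_eventuallyEq hη hF (by rw [abs_sub_comm]; exact (le_abs_self _).trans' (by linarith))).eq_of_nhds, hx]
  · rw [(flattened_eventuallyEq hη hF ((le_abs_self _).trans' (by linarith))).eq_of_nhds, hy]

lemma IntervalReducible.of_encard_le (n : ℕ) : ∀ {ε : ℝ} {G : 𝓐} {x y : ℝ}, 0 < ε → Parabolic G → FlatAt G x →
    FlatAt G y → x < y → {w ∈ Ioo x y | G w = w}.encard ≤ n → IntervalReducible r ε G x y := by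
  induction n with
  | zero =>
    intro ε G x y hε hG hx hy hxy hn
    refine IntervalReducible.of_gap hG hx hy hxy (fun w hw hw' => ?_) hε
    rw [Nat.cast_zero, nonpos_iff_eq_zero, encard_eq_zero] at hn
    exact eq_empty_iff_forall_notMem.1 hn w ⟨hw, hw'⟩
  | succ n ih =>
    intro ε G x y hε hG hx hy hxy hn
    by_cases hgap : ∀ w ∈ Ioo x y, G w ≠ w
    · exact IntervalReducible.of_gap hG hx hy hxy hgap hε
    push Not at hgap
    obtain ⟨z, hz, hzf⟩ := hgap
    obtain ⟨η₀, hη₀, hη₁, hfl⟩ := exists_flattenableAt hG.mem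
    obtain ⟨η, hη, hle⟩ : ∃ η > 0, η ≤ min η₀ (min ((z - x) / 2) ((y - z) / 2)) :=
      ⟨_, lt_min hη₀ (lt_min (by linarith [hz.1]) (by linarith [hz.2])), le_rfl⟩
    rw [le_min_iff, le_min_iff] at hle
    have hη1 := hle.1.trans hη₁
    have hF := hfl z η hzf (hG.deriv_fixed z hzf) hη hle.1
    have hsz : pointSqueeze z η 0 z = z := pointSqueeze_self hη
    have hfx : 2 * η ≤ |x - z| := by
      rw [abs_sub_comm]
      exact (le_abs_self _).trans' (by linarith)
    have hfy : 2 * η ≤ |y - z| := (le_abs_self _).trans' (by linarith)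
    have hsx : pointSqueeze z η 0 x = x := pointSqueeze_far hη le_rfl (by linarith)
    have hsy : pointSqueeze z η 0 y = y := pointSqueeze_far hη le_rfl (by linarith)
    have hcard : ∀ p q : ℝ, pointSqueeze z η 0 p = p → pointSqueeze z η 0 q = q →
        x ≤ p → q ≤ y → z ∉ Ioo p q →
        {w ∈ Ioo p q | flattened z η G w = w}.encard ≤ n := by
      intro p q hp hq hxp hqy hzpq
      rw [← (pointSqueeze z η 0).injective.encard_image]
      have h1 : pointSqueeze z η 0 '' {w ∈ Ioo p q | flattened z η G w = w} ⊆
          {w ∈ Ioo x y | G w = w} \ {z} := by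
        rintro _ ⟨w, hw, rfl⟩
        have h2 := flattened_fixed hp hq hw.1 hw.2
        exact ⟨⟨⟨hxp.trans_lt h2.1.1, h2.1.2.trans_le hqy⟩, h2.2⟩,
          fun h => hzpq (mem_singleton_iff.1 h ▸ h2.1)⟩
      refine (encard_le_encard h1).trans ?_
      have h3 := encard_sdiff_singleton_add_one (show z ∈ {w ∈ Ioo x y | G w = w} from ⟨hz, hzf⟩)
      rw [← h3, Nat.cast_add, Nat.cast_one] at hn
      exact (ENat.add_le_add_iff_right ENat.one_ne_top).1 hn
    have hG1 := parabolic_flattened hη hη1 hG hF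
    have hflz := flatAt_flattened hη hη1 hG.mem hF
    refine IntervalReducible.of_flattened hG hx.map_self hy.map_self hF hη hη1 (by linarith)
      (by linarith) hε ?_ ?_
    · exact ih (half_pos hε) hG1 (flatAt_flattened_far hη hF hfx hx) hflz hz.1
        (hcard x z hsx hsz le_rfl hz.2.le fun h => lt_irrefl _ h.2)
    · exact ih (half_pos hε) hG1 hflz (flatAt_flattened_far hη hF hfy hy) hz.2
        (hcard z y hsz hsy hz.1.le le_rfl fun h => lt_irrefl _ h.1)

lemma IntervalReducible.of_finite (hε : 0 < ε) (hG : Parabolic G) (hx : FlatAt G x)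
    (hy : FlatAt G y) (hxy : x < y) (hfin : {w ∈ Ioo x y | G w = w}.Finite) :
    IntervalReducible r ε G x y :=
  IntervalReducible.of_encard_le hfin.toFinset.card hε hG hx hy hxy
    (by rw [hfin.encard_eq_coe_toFinset_card])

lemma exists_mem_of_infinite {P : ℝ → Prop} {p q : ℝ} (h : ¬ {w ∈ Ioo x y | P w}.Finite)
    (hf : {w ∈ Ioo x y | P w ∧ w ∉ Ioo p q}.Finite) : ∃ w ∈ Ioo x y, w ∈ Ioo p q ∧ P w := by
  by_contra! hc
  exact h (hf.subset fun w hw => ⟨hw.1, hw.2, fun h' => hc w hw.1 h' hw.2⟩)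

/-- The case where fixed points only accumulate at the left endpoint. -/
lemma IntervalReducible.of_finite_right (hε : 0 < ε) (hG : Parabolic G) (hx : FlatAt G x)
    (hy : FlatAt G y) (hxy : x < y)
    (hfin : ∀ c ∈ Ioo x y, {w ∈ Ioo c y | G w = w}.Finite) : IntervalReducible r ε G x y := by
  by_cases hall : {w ∈ Ioo x y | G w = w}.Finite
  · exact IntervalReducible.of_finite hε hG hx hy hxy hall
  obtain ⟨δ, hδ, hD⟩ := hG.exists_smallOn_flattened hx r (half_pos hε)
  obtain ⟨z, hz, hzI, hzf⟩ : ∃ z ∈ Ioo x y, z ∈ Ioo x (x + min δ ((y - x) / 2)) ∧ G z = z := by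
    set m := min δ ((y - x) / 2)
    have hm : 0 < m := lt_min hδ (by linarith)
    have hm2 : m ≤ (y - x) / 2 := min_le_right _ _
    refine exists_mem_of_infinite hall ((hfin (x + m / 2) ⟨by linarith, by linarith⟩).subset ?_)
    refine fun w hw => ⟨⟨?_, hw.1.2⟩, hw.2.1⟩
    have := not_lt.1 fun h => hw.2.2 ⟨hw.1.1, h⟩
    linarith
  have hd : |z - x| = z - x := abs_of_pos (sub_pos.2 hz.1)
  have hm := hzI.2
  have hm1 := min_le_left δ ((y - x) / 2)
  have hm2 := min_le_right δ ((y - x) / 2)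
  obtain ⟨hF, h1, hS⟩ := hD z hzf (by rw [hd]; exact sub_pos.2 hz.1) (by rw [hd]; linarith)
  rw [hd] at hF h1 hS
  have hη : 0 < (z - x) / 8 := by linarith [hz.1]
  have hη1 : (z - x) / 8 ≤ 1 := by linarith
  have hfy : 2 * ((z - x) / 8) ≤ |y - z| := (le_abs_self _).trans' (by linarith)
  have hsy : pointSqueeze z ((z - x) / 8) 0 y = y := pointSqueeze_far hη le_rfl (by linarith)
  refine IntervalReducible.of_flattened hG hx.map_self hy.map_self hF hη hη1 (by linarith)
    (by linarith) hε (SmallOn.intervalReducible (hS.mono fun w hw => ?_)) ?_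
  · rw [mem_ofPred_eq, abs_of_pos (sub_pos.2 hw.1)]
    linarith [hw.2]
  · refine IntervalReducible.of_finite (half_pos hε) (parabolic_flattened hη hη1 hG hF)
      (flatAt_flattened hη hη1 hG.mem hF) (flatAt_flattened_far hη hF hfy hy) hz.2 ?_
    refine Finite.of_finite_image ((hfin z hz).subset ?_)
      (pointSqueeze z ((z - x) / 8) 0).injective.injOn
    rintro _ ⟨w, hw, rfl⟩
    exact flattened_fixed (pointSqueeze_self hη) hsy hw.1 hw.2

/-- The case where fixed points only accumulate at the endpoints. -/
lemma IntervalReducible.of_locally_finite (hε : 0 < ε) (hG : Parabolic G) (hx : FlatAt G x)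
    (hy : FlatAt G y) (hxy : x < y)
    (hfin : ∀ c d, x < c → d < y → {w ∈ Ioo c d | G w = w}.Finite) :
    IntervalReducible r ε G x y := by
  by_cases hall : ∀ c ∈ Ioo x y, {w ∈ Ioo c y | G w = w}.Finite
  · exact IntervalReducible.of_finite_right hε hG hx hy hxy hall
  push Not at hall
  obtain ⟨c₀, hc₀, hinf⟩ := hall
  obtain ⟨δ, hδ, hD⟩ := hG.exists_smallOn_flattened hy r (half_pos hε)
  obtain ⟨z, hz₀, hzI, hzf⟩ :
      ∃ z ∈ Ioo c₀ y, z ∈ Ioo (y - min δ ((y - x) / 2)) y ∧ G z = z := by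
    set m := min δ ((y - x) / 2)
    have hm : 0 < m := lt_min hδ (by linarith)
    refine exists_mem_of_infinite hinf ((hfin c₀ (y - m / 2) hc₀.1 (by linarith)).subset ?_)
    refine fun w hw => ⟨⟨hw.1.1, ?_⟩, hw.2.1⟩
    have := not_lt.1 fun h => hw.2.2 ⟨h, hw.1.2⟩
    linarith
  have hz : z ∈ Ioo x y := ⟨hc₀.1.trans hz₀.1, hz₀.2⟩
  have hd : |z - y| = y - z := by rw [abs_sub_comm]; exact abs_of_pos (sub_pos.2 hz.2)
  have hm := hzI.1
  have hm1 := min_le_left δ ((y - x) / 2)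
  have hm2 := min_le_right δ ((y - x) / 2)
  obtain ⟨hF, h1, hS⟩ := hD z hzf (by rw [hd]; exact sub_pos.2 hz.2) (by rw [hd]; linarith)
  rw [hd] at hF h1 hS
  have hη : 0 < (y - z) / 8 := by linarith [hz.2]
  have hη1 : (y - z) / 8 ≤ 1 := by linarith
  have hfx : 2 * ((y - z) / 8) ≤ |x - z| := by
    rw [abs_sub_comm]
    exact (le_abs_self _).trans' (by linarith)
  have hsx : pointSqueeze z ((y - z) / 8) 0 x = x := pointSqueeze_far hη le_rfl (by linarith)
  refine IntervalReducible.of_flattened hG hx.map_self hy.map_self hF hη hη1 (by linarith)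
    (by linarith) hε ?_ (SmallOn.intervalReducible (hS.mono fun w hw => ?_))
  · refine IntervalReducible.of_finite_right (half_pos hε) (parabolic_flattened hη hη1 hG hF)
      (flatAt_flattened_far hη hF hfx hx) (flatAt_flattened hη hη1 hG.mem hF) hz.1 fun c hc => ?_
    have hc' := mem_Ioo_of_fixed hsx (pointSqueeze_self hη) hc
    refine Finite.of_finite_image ((hfin _ z hc'.1 hz.2).subset ?_)
      (pointSqueeze z ((y - z) / 8) 0).injective.injOn
    rintro _ ⟨w, hw, rfl⟩
    have h2 := flattened_fixed hsx (pointSqueeze_self hη) ⟨hc.1.trans hw.1.1, hw.1.2⟩ hw.2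
    exact ⟨⟨(pointSqueeze z ((y - z) / 8) 0).strictMono hw.1.1, h2.1.2⟩, h2.2⟩
  · rw [mem_ofPred_eq, abs_sub_comm, abs_of_pos (sub_pos.2 hw.2)]
    linarith [hw.1]

/-- Zeros of the derivative accumulate where zeros of the function do. -/
lemma frequently_deriv_eq_zero {φ : ℝ → ℝ} (hφ : Differentiable ℝ φ) {w : ℝ}
    (h : ∃ᶠ u in 𝓝[≠] w, φ u = 0) : ∃ᶠ u in 𝓝[≠] w, deriv φ u = 0 := by
  have hw : φ w = 0 := by
    by_contra hne
    refine h ?_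
    exact ((hφ w).continuousAt.eventually_ne hne).filter_mono nhdsWithin_le_nhds
  intro hev
  obtain ⟨ρ, hρ, hball⟩ := Metric.eventually_nhds_iff_ball.1 (eventually_nhdsWithin_iff.1 hev)
  obtain ⟨u, ⟨hu0, hub⟩, hne⟩ := ((h.and_eventually (eventually_nhdsWithin_of_eventually_nhds
    (Metric.ball_mem_nhds w hρ))).and_eventually self_mem_nhdsWithin).exists
  have hne' : u ≠ w := hne
  rw [dist_eq, abs_lt] at hub
  rcases lt_or_gt_of_ne hne' with hlt | hlt
  · obtain ⟨v, hv, hv'⟩ := exists_deriv_eq_zero hlt hφ.continuous.continuousOn (hu0.trans hw.symm)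
    refine hball v ?_ hv.2.ne hv'
    rw [Metric.mem_ball, dist_eq, abs_lt]
    constructor <;> linarith [hv.1, hv.2]
  · obtain ⟨v, hv, hv'⟩ := exists_deriv_eq_zero hlt hφ.continuous.continuousOn (hw.trans hu0.symm)
    refine hball v ?_ hv.1.ne' hv'
    rw [Metric.mem_ball, dist_eq, abs_lt]
    constructor <;> linarith [hv.1, hv.2]

lemma flatAt_of_accPt (hG : IsDiffeo G) {w : ℝ} (h : AccPt w (𝓟 {u | G u = u})) :
    FlatAt G w := by
  have hd := hG.contDiff_disp
  have h1 : ∀ j, ∃ᶠ u in 𝓝[≠] w, iteratedDeriv j (disp G) u = 0 := by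
    intro j
    induction j with
    | zero =>
      rw [accPt_iff_frequently_nhdsNE] at h
      exact h.mono fun u hu => by rw [iteratedDeriv_zero, disp, show G u = u from hu, sub_self]
    | succ j ih =>
      rw [iteratedDeriv_succ]
      exact frequently_deriv_eq_zero
        (fun v => (hasDerivAt_iteratedDeriv hd j v).differentiableAt) ih
  intro j
  by_contra hne
  exact h1 j (((hasDerivAt_iteratedDeriv hd j w).continuousAt.eventually_ne hne).filter_mono
    nhdsWithin_le_nhds)

lemma IntervalReducible.concat_of_le (hG : IsDiffeo G) (hxz : x ≤ z) (hzy : z ≤ y)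
    (hx : G x = x) (hz : G z = z) (hy : G y = y) (h1 : IntervalReducible r ε G x z)
    (h2 : IntervalReducible r ε G z y) : IntervalReducible r ε G x y := by
  rcases hxz.eq_or_lt with rfl | hxz
  · exact h2
  rcases hzy.eq_or_lt with rfl | hzy
  · exact h1
  exact h1.concat hG ⟨hxz, hzy⟩ hx hz hy h2

/-- Between nearby flat points a diffeomorphism is close to the identity. -/
lemma exists_smallOn_of_flat (hG : IsDiffeo G) (hε : 0 < ε) (a b : ℝ) (r : ℕ) :
    ∃ δ > 0, ∀ s ∈ Icc a b, ∀ t ∈ Icc a b, FlatAt G s → t - s < δ → SmallOn r ε G (Ioo s t) := by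
  have h : ∀ k, ∃ δ > 0, ∀ s ∈ Icc a b, ∀ t ∈ Icc a b, dist s t < δ →
      dist (iteratedDeriv k (disp G) s) (iteratedDeriv k (disp G) t) < ε := fun k =>
    Metric.uniformContinuousOn_iff.1 (isCompact_Icc.uniformContinuousOn_of_continuous
      (hG.contDiff_disp.continuous_iteratedDeriv k (natCast_le_infty k)).continuousOn) ε hε
  choose δ hδ hD using h
  obtain ⟨m, hm, hmin⟩ := Finset.exists_min_image (Finset.range (r + 1)) δ ⟨0, by simp⟩
  refine ⟨δ m, hδ m, fun s hs t ht hf hst k hk u hu => ?_⟩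
  have h1 := hD k s hs u ⟨hs.1.trans hu.1.le, hu.2.le.trans ht.2⟩ (by
    rw [dist_eq, abs_sub_comm, abs_of_pos (sub_pos.2 hu.1)]
    linarith [hmin k (Finset.mem_range.2 (by omega)), hu.2])
  rw [hf k, dist_zero_left] at h1
  exact h1.le

/-- A parabolic diffeomorphism is almost reducible to the identity on an interval with flat ends,
by diffeomorphisms supported in that interval. -/
lemma Parabolic.intervalReducible (hG : Parabolic G) (ha : FlatAt G a) (hb : FlatAt G b)
    (hab : a < b) (hε : 0 < ε) : IntervalReducible r ε G a b := by
  have hd := hG.mem.1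
  have hcl := isClosed_flatAt hd
  obtain ⟨δ, hδ, hD⟩ := exists_smallOn_of_flat hd hε a b r
  set P : Set ℝ := {t | t ∈ Icc a b ∧ FlatAt G t ∧ IntervalReducible r ε G a t}
  have haP : a ∈ P := by
    refine ⟨left_mem_Icc.2 hab.le, ha, SmallOn.intervalReducible fun k _ u hu => ?_⟩
    exact absurd (hu.1.trans hu.2) (lt_irrefl a)
  have hbdd : BddAbove P := ⟨b, fun t ht => ht.1.2⟩
  have hstep : ∀ s ∈ P, ∀ t ∈ Icc a b, s ≤ t → FlatAt G t → IntervalReducible r ε G s t →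
      t ∈ P := fun s hs t ht hst hft h =>
    ⟨ht, hft, hs.2.2.concat_of_le hd hs.1.1 hst ha.map_self hs.2.1.map_self hft.map_self h⟩
  set s := sSup P
  have hsI : s ∈ Icc a b := ⟨le_csSup hbdd haP, csSup_le ⟨a, haP⟩ fun t ht => ht.1.2⟩
  have hsf : FlatAt G s :=
    closure_minimal (fun t ht => ht.2.1) hcl (csSup_mem_closure ⟨a, haP⟩ hbdd)
  have hsP : s ∈ P := by
    obtain ⟨t, ht, hlt⟩ := exists_lt_of_lt_csSup ⟨a, haP⟩ (show s - δ < sSup P from by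
      change s - δ < s; linarith)
    exact hstep t ht s hsI (le_csSup hbdd ht) hsf
      (hD t ht.1 s hsI ht.2.1 (by linarith)).intervalReducible
  rcases hsI.2.eq_or_lt with heq | hsb
  · rw [← heq]
    exact hsP.2.2
  exfalso
  have hnot : ∀ t ∈ Ioc s b, FlatAt G t → ¬ IntervalReducible r ε G s t := fun t ht hft h =>
    (le_csSup hbdd (hstep s hsP t ⟨hsI.1.trans ht.1.le, ht.2⟩ ht.1.le hft h)).not_gt ht.1
  set T : Set ℝ := {t | FlatAt G t} ∩ Icc (s + δ) b
  have hfar : ∀ t ∈ Ioc s b, FlatAt G t → t ∈ T := by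
    refine fun t ht hft => ⟨hft, not_lt.1 fun h => hnot t ht hft ?_, ht.2⟩
    exact (hD s hsI t ⟨hsI.1.trans ht.1.le, ht.2⟩ hsf (by linarith)).intervalReducible
  have hTc : IsCompact T := isCompact_Icc.inter_left hcl
  have hbT : b ∈ T := hfar b ⟨hsb, le_rfl⟩ hb
  obtain ⟨t, htT, htmin⟩ := hTc.exists_isLeast ⟨b, hbT⟩
  have hst : s < t := by linarith [htT.2.1]
  refine hnot t ⟨hst, htT.2.2⟩ htT.1 (IntervalReducible.of_locally_finite hε hG hsf htT.1 hst
    fun c d hc hdt => ?_)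
  by_contra hinf
  obtain ⟨w, hw, hacc⟩ := Set.Infinite.exists_accPt_of_subset_isCompact hinf
    (isCompact_Icc (a := c) (b := d)) fun u hu => Ioo_subset_Icc_self hu.1
  have hwf : FlatAt G w := flatAt_of_accPt hd (hacc.mono (principal_mono.2 fun u hu => hu.2))
  exact (htmin (hfar w ⟨by linarith [hw.1], by linarith [hw.2, htT.2.2]⟩ hwf)).not_gt
    (by linarith [hw.2])

end IntervalTheorem

section Variation
variable {L a b x x' : ℝ} {F G : 𝓐}

/-- Diffeomorphisms of the line commuting with the translation by `L`. -/
def equivariant (L : ℝ) : Subgroup 𝓐 where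
  carrier := {h | IsDiffeo h ∧ ∀ x, h (x + L) = h x + L}
  mul_mem' {f g} hf hg := ⟨hf.1.mul hg.1, fun x => by
    rw [mul_apply, hg.2, hf.2, mul_apply]⟩
  one_mem' := ⟨isDiffeo_one, fun _ => rfl⟩
  inv_mem' {f} hf := ⟨hf.1.inv, fun x => f.injective (by
    rw [apply_inv_self, hf.2, apply_inv_self])⟩

lemma ld_add_of_mem_equivariant (hF : F ∈ equivariant L) (x : ℝ) : ld F (x + L) = ld F x := by
  rw [ld, ← deriv_comp_add_const, show (fun x => F (x + L)) = fun x => F x + L from funext hF.2,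
    deriv_add_const, ld]

lemma mem_unifDiffeo_of_periodic (hF : IsDiffeo F) (hL : 0 < L)
    (h : ∀ x, ld F (x + L) = ld F x) : F ∈ unifDiffeo := by
  refine mem_unifDiffeo.2 ⟨hF, bddJet_iff.2 fun j => ?_⟩
  obtain ⟨C, hC⟩ := isCompact_Icc.exists_bound_of_continuousOn
    (hF.contDiff_ld.continuous_iteratedDeriv j (natCast_le_infty j)).continuousOn (s := Icc 0 L)
  refine ⟨C, fun x => ?_⟩
  have hp : Function.Periodic (iteratedDeriv j (ld F)) L := fun x => by
    rw [← congrFun (iteratedDeriv_comp_add_const j (ld F) L) x, funext h]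
  obtain ⟨y, hy, hxy⟩ := hp.exists_mem_Ico₀ hL x
  exact (congrArg abs hxy).le.trans (hC y ⟨hy.1, hy.2.le⟩)

lemma equivariant_le_unifDiffeo (hL : 0 < L) : equivariant L ≤ unifDiffeo := fun _ hF =>
  mem_unifDiffeo_of_periodic hF.1 hL (ld_add_of_mem_equivariant hF)

lemma exists_ld_lipschitz (hF : F ∈ unifDiffeo) :
    ∃ C : NNReal, LipschitzWith C (ld F) := by
  obtain ⟨C, hC⟩ := bddJet_iff.1 (mem_unifDiffeo.1 hF).2 1
  refine ⟨C.toNNReal, lipschitzWith_of_nnnorm_deriv_le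
    (hF.1.contDiff_ld.differentiable (by simp)) fun x => ?_⟩
  have h := hC x
  rw [iteratedDeriv_one] at h
  exact NNReal.le_toNNReal_of_coe_le h

/-- The variation of the logarithm of the derivative over the unit interval. -/
def ldVar (F : 𝓐) : ℝ := (eVariationOn (ld F) (Icc 0 1)).toReal

lemma eVariationOn_ld_le (hF : F ∈ equivariant 1) (n : ℤ) {s : Set ℝ}
    (hs : s ⊆ Icc (n : ℝ) (n + 2)) : eVariationOn (ld F) s ≤ ENNReal.ofReal (2 * ldVar F) := by
  obtain ⟨C, hC⟩ := exists_ld_lipschitz (equivariant_le_unifDiffeo one_pos hF)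
  have hfin : eVariationOn (ld F) (Icc 0 1) ≠ ⊤ := by
    have h := hC.locallyBoundedVariationOn univ 0 1 (mem_univ _) (mem_univ _)
    rwa [univ_inter] at h
  have h1 : ∀ m : ℤ, eVariationOn (ld F) (Icc (m : ℝ) (m + 1)) =
      eVariationOn (ld F) (Icc 0 1) := fun m => by
    have hp : Function.Periodic (ld F) 1 := ld_add_of_mem_equivariant hF
    have h := eVariationOn.comp_eq_of_monotoneOn (ld F) (t := Icc 0 1) (fun x => x + m)
      fun x _ y _ h => by simpa using h
    rw [image_add_const_Icc, zero_add, add_comm (1 : ℝ)] at h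
    rw [← h]
    congr 1
    funext x
    simpa using hp.int_mul m x
  have h2 := eVariationOn.Icc_add_Icc (ld F) (s := univ) (a := n) (b := n + 1) (c := n + 2)
    (by linarith) (by linarith) (mem_univ _)
  have h3 := h1 (n + 1)
  push_cast at h3
  rw [add_assoc, one_add_one_eq_two] at h3
  rw [univ_inter, univ_inter, univ_inter, h1, h3, ← two_mul] at h2
  rw [ldVar, ENNReal.ofReal_mul zero_le_two, ENNReal.ofReal_toReal hfin, ENNReal.ofReal_ofNat, h2]
  exact eVariationOn.mono _ hs

lemma ldVar_nonneg (F : 𝓐) : 0 ≤ ldVar F := ENNReal.toReal_nonneg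

lemma sum_abs_ld_sub_le (hF : F ∈ equivariant 1) (n : ℤ) (N : ℕ) (hx : (n : ℝ) ≤ x)
    (hxx : x ≤ x') (hx' : x' ≤ G x) (hN : (G ^ N) x ≤ n + 2) :
    ∑ k ∈ Finset.range N, |ld F ((G ^ k) x') - ld F ((G ^ k) x)| ≤ 2 * ldVar F := by
  have hmono : ∀ k : ℕ, x ≤ (G ^ k) x ∧ (G ^ k) x ≤ (G ^ (k + 1)) x := fun k => by
    have h : ∀ k : ℕ, (G ^ k) x ≤ (G ^ (k + 1)) x := fun k => by
      rw [pow_succ, mul_apply]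
      exact (G ^ k).monotone (hxx.trans hx')
    exact ⟨(monotone_nat_of_le_succ h) (Nat.zero_le k), h k⟩
  have key : ∀ N : ℕ, ENNReal.ofReal (∑ k ∈ Finset.range N,
      |ld F ((G ^ k) x') - ld F ((G ^ k) x)|) ≤ eVariationOn (ld F) (Icc x ((G ^ N) x)) := by
    intro N
    induction N with
    | zero => simp
    | succ N ih =>
      have h := eVariationOn.Icc_add_Icc (ld F) (s := univ) (hmono N).1 (hmono N).2 (mem_univ _)
      simp only [univ_inter] at h
      rw [Finset.sum_range_succ, ENNReal.ofReal_add (Finset.sum_nonneg fun _ _ => abs_nonneg _)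
        (abs_nonneg _), ← h, ← dist_eq, ← edist_dist]
      refine add_le_add ih (eVariationOn.edist_le _ ⟨(G ^ N).monotone hxx, ?_⟩
        ⟨le_rfl, (hmono N).2⟩)
      rw [pow_succ, mul_apply]
      exact (G ^ N).monotone hx'
  exact (ENNReal.ofReal_le_ofReal_iff (mul_nonneg zero_le_two (ldVar_nonneg F))).1
    ((key N).trans (eVariationOn_ld_le hF n (Icc_subset_Icc hx hN)))

lemma coe_pow_orderIso (f : 𝓐) (n : ℕ) : ((f ^ n : 𝓐) : ℝ → ℝ) = f^[n] := by
  induction n with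
  | zero => rfl
  | succ n ih => rw [pow_succ, coe_mul_eq_comp, ih, Function.iterate_succ]

lemma deriv_eq_one_of_ldVar (hG : G ∈ equivariant 1)
    (hv : Tendsto (fun n : ℕ => ldVar (G ^ n) / n) atTop (𝓝 0)) (ha : G a = a) :
    deriv G a = 1 := by
  have h : ∀ᶠ n : ℕ in atTop, |ld G a| ≤ 2 * (ldVar (G ^ n) / n) := by
    filter_upwards [eventually_gt_atTop 0] with n hn
    have hn' : (0 : ℝ) < n := Nat.cast_pos.2 hn
    have hGn := (equivariant 1).pow_mem hG n
    obtain ⟨y, hy, hy'⟩ := exists_deriv_eq_slope (G ^ n : 𝓐) (lt_add_one a)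
      hGn.1.1.continuous.continuousOn hGn.1.differentiable.differentiableOn
    rw [hGn.2, add_sub_cancel_left, add_sub_cancel_left, div_one] at hy'
    have h1 : ld (G ^ n) a = n * ld G a := by
      simp only [ld_pow hG.1, coe_pow_orderIso, Function.iterate_fixed ha, Finset.sum_const,
        Finset.card_range, nsmul_eq_mul]
    have h2 := (eVariationOn.edist_le (ld (G ^ n)) (left_mem_Icc.2 (lt_add_one a).le)
      (Ioo_subset_Icc_self hy)).trans (eVariationOn_ld_le hGn ⌊a⌋ (Icc_subset_Icc
        (Int.floor_le a) (by linarith [Int.lt_floor_add_one a])))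
    rw [edist_dist, ENNReal.ofReal_le_ofReal_iff (mul_nonneg zero_le_two (ldVar_nonneg _)),
      dist_eq, h1, show ld (G ^ n) y = 0 by rw [ld, hy', log_one], sub_zero, abs_mul, Nat.abs_cast] at h2
    rw [← mul_div_assoc, le_div_iff₀ hn']
    linarith
  have h0 := ge_of_tendsto (hv.const_mul 2) h
  rw [mul_zero] at h0
  rw [← hG.1.exp_ld, abs_eq_zero.1 (le_antisymm h0 (abs_nonneg _)), exp_zero]

lemma exists_tendsto_ld_pow_sub (hF : F ∈ unifDiffeo)
    (hs : Summable fun m : ℕ => (F ^ m) x' - (F ^ m) x) :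
    ∃ l, Tendsto (fun m : ℕ => ld (F ^ m) x' - ld (F ^ m) x) atTop (𝓝 l) := by
  obtain ⟨C, hC⟩ := exists_ld_lipschitz hF
  have h : Summable fun m : ℕ => ld F ((F ^ m) x') - ld F ((F ^ m) x) :=
    Summable.of_norm_bounded (hs.abs.mul_left (C : ℝ)) fun m => hC.dist_le_mul _ _
  refine ⟨_, h.hasSum.tendsto_sum_nat.congr fun m => ?_⟩
  rw [Finset.sum_sub_distrib, ld_pow hF.1]

lemma transitionEq_of_le (hG : G ∈ equivariant 1)
    (hv : Tendsto (fun n : ℕ => ldVar (G ^ n) / n) atTop (𝓝 0)) (ha : G a = a) (hb : G b = b)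
    (hba : b ≤ a + 1) (hx : x ∈ Ioo a b) (hxx : x ≤ x') (hx' : x' ≤ G x) :
    TransitionEq G x x' := by
  have hu := equivariant_le_unifDiffeo one_pos hG
  have hmem : ∀ m : ℕ, (G ^ m) x ∈ Ioo a b := pow_mem_Ioo ha hb hx
  have hmem' : ∀ m : ℕ, (G⁻¹ ^ m) x ∈ Ioo a b := pow_mem_Ioo (inv_fixed ha) (inv_fixed hb) hx
  have hmem'' : ∀ m : ℕ, (G⁻¹ ^ m) (G x) ∈ Ioo a b :=
    pow_mem_Ioo (inv_fixed ha) (inv_fixed hb) (by simpa using hmem 1)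
  obtain ⟨l, hl⟩ := exists_tendsto_ld_pow_sub hu (x := x) (x' := x')
    (summable_of_sum_range_le (c := b - a) (fun m => sub_nonneg.2 ((G ^ m).monotone hxx))
      fun m => by
        have h := sum_pow_apply_sub G x m 1
        simp only [pow_one, Finset.range_one, Finset.sum_singleton, pow_zero,
          one_orderIso_apply] at h
        have h1 : ∑ i ∈ Finset.range m, ((G ^ i) x' - (G ^ i) x) ≤
          ∑ i ∈ Finset.range m, ((G ^ i) (G x) - (G ^ i) x) :=
          Finset.sum_le_sum fun i _ => sub_le_sub_right ((G ^ i).monotone hx') _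
        linarith [(hmem m).2, hx.1])
  obtain ⟨l', hl'⟩ := exists_tendsto_ld_pow_sub (unifDiffeo.inv_mem hu) (x := x) (x' := x')
    (summable_of_sum_range_le (c := b - a) (fun m => sub_nonneg.2 ((G⁻¹ ^ m).monotone hxx))
      fun m => by
        have h := sum_pow_apply_sub G⁻¹ (G x) m 1
        simp only [pow_one, Finset.range_one, Finset.sum_singleton, pow_zero,
          one_orderIso_apply, inv_apply_self] at h
        have h1 : ∑ i ∈ Finset.range m, ((G⁻¹ ^ i) x' - (G⁻¹ ^ i) x) ≤
          -∑ i ∈ Finset.range m, ((G⁻¹ ^ i) x - (G⁻¹ ^ i) (G x)) := by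
          rw [← Finset.sum_neg_distrib]
          exact Finset.sum_le_sum fun i _ => by linarith [(G⁻¹ ^ i).monotone hx']
        have h2 := (hmem'' m).1
        have h3 : G x < b := by simpa using (hmem 1).2
        linarith)
  have hdiff : ∀ N k : ℕ, k < N → ∀ u, ld (G ^ N) ((G ^ k) ((G⁻¹ ^ N) u)) =
      ld (G ^ k) u - ld (G⁻¹ ^ (N - k)) u := fun N k hk u => by
    have h1 : G ^ k * G⁻¹ ^ N = G⁻¹ ^ (N - k) := by
      rw [← Nat.add_sub_of_le hk.le, pow_add, ← mul_assoc, inv_pow, mul_inv_cancel, one_mul,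
        Nat.add_sub_cancel_left]
    have h2 : G ^ N * G⁻¹ ^ (N - k) = G ^ k := by
      nth_rw 1 [← Nat.add_sub_of_le hk.le]
      rw [pow_add, mul_assoc, inv_pow, mul_inv_cancel, mul_one]
    have h3 := ld_mul (hG.1.pow N) (hG.1.inv.pow (N - k)) u
    rw [h2] at h3
    rw [← mul_apply, h1]
    linarith
  have hle : ∀ᶠ N : ℕ in atTop, |(N : ℝ)⁻¹ * ∑ k ∈ Finset.range N, (ld (G ^ k) x' - ld (G ^ k) x) -
      (N : ℝ)⁻¹ * ∑ k ∈ Finset.range N, (ld (G⁻¹ ^ (k + 1)) x' - ld (G⁻¹ ^ (k + 1)) x)| ≤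
      2 * (ldVar (G ^ N) / N) := by
    filter_upwards [eventually_gt_atTop 0] with N hN
    have hN' : (0 : ℝ) < N := Nat.cast_pos.2 hN
    have h1 : (G ^ N) ((G⁻¹ ^ N) x) = x := by
      rw [inv_pow, apply_inv_self]
    have h := sum_abs_ld_sub_le ((equivariant 1).pow_mem hG N) ⌊a⌋ N (G := G)
      ((Int.floor_le a).trans (hmem' N).1.le) ((G⁻¹ ^ N).monotone hxx)
      (by
        rw [← mul_apply, (Commute.inv_right (Commute.refl G)).pow_right N,
          mul_apply]
        exact (G⁻¹ ^ N).monotone hx') (by linarith [hx.2, Int.lt_floor_add_one a])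
    have h3 : ∑ k ∈ Finset.range N, (ld (G⁻¹ ^ (k + 1)) x' - ld (G⁻¹ ^ (k + 1)) x) =
        ∑ k ∈ Finset.range N, (ld (G⁻¹ ^ (N - k)) x' - ld (G⁻¹ ^ (N - k)) x) := by
      rw [← Finset.sum_range_reflect]
      refine Finset.sum_congr rfl fun k hk => ?_
      rw [show N - 1 - k + 1 = N - k by have := Finset.mem_range.1 hk; omega]
    rw [← mul_sub, h3, ← Finset.sum_sub_distrib, abs_mul, abs_of_pos (inv_pos.2 hN'),
      inv_mul_eq_div, ← mul_div_assoc]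
    refine div_le_div_of_nonneg_right ((Finset.abs_sum_le_sum_abs _ _).trans (le_trans ?_ h)) hN'.le
    refine (Finset.sum_congr rfl fun k hk => ?_).le
    rw [hdiff N k (Finset.mem_range.1 hk), hdiff N k (Finset.mem_range.1 hk)]
    congr 1
    ring
  have hlim := (hl.cesaro.sub ((tendsto_add_atTop_iff_nat 1).2 hl').cesaro).abs
  have h0 := le_of_tendsto_of_tendsto hlim (hv.const_mul 2) hle
  rw [mul_zero] at h0
  have hll : l = l' := sub_eq_zero.1 (abs_eq_zero.1 (le_antisymm h0 (abs_nonneg _)))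
  exact ⟨l, hll ▸ hl', hl⟩

lemma TransitionEq.symm (h : TransitionEq G x x') : TransitionEq G x' x := by
  obtain ⟨l, h1, h2⟩ := h
  exact ⟨-l, by simpa using h1.neg, by simpa using h2.neg⟩

lemma TransitionEq.trans {x'' : ℝ} (h : TransitionEq G x x') (h' : TransitionEq G x' x'') :
    TransitionEq G x x'' := by
  obtain ⟨l, h1, h2⟩ := h
  obtain ⟨l', h1', h2'⟩ := h'
  exact ⟨l + l', by simpa using h1.add h1', by simpa using h2.add h2'⟩

lemma ldVar_inv_le (hF : F ∈ equivariant 1) : ldVar F⁻¹ ≤ 2 * ldVar F := by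
  have h1 : ld F⁻¹ = fun x => -(ld F ∘ (F⁻¹ : 𝓐)) x := funext fun x => ld_inv hF.1 x
  have h2 : eVariationOn (ld F⁻¹) (Icc 0 1) = eVariationOn (ld F ∘ (F⁻¹ : 𝓐)) (Icc 0 1) := by
    simp only [h1, eVariationOn, edist_neg_neg]
  have h3 := ((equivariant 1).inv_mem hF).2 0
  rw [zero_add] at h3
  rw [ldVar, h2, eVariationOn.comp_eq_of_monotoneOn _ _ (F⁻¹.monotone.monotoneOn _),
    OrderIso.image_Icc, h3]
  exact ENNReal.toReal_le_of_le_ofReal (mul_nonneg zero_le_two (ldVar_nonneg F))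
    (eVariationOn_ld_le hF ⌊F⁻¹ 0⌋ (Icc_subset_Icc (Int.floor_le _)
      (by linarith [Int.lt_floor_add_one (F⁻¹ 0)])))

lemma transitionEq_of_lt_map (hG : G ∈ equivariant 1)
    (hv : Tendsto (fun n : ℕ => ldVar (G ^ n) / n) atTop (𝓝 0)) (ha : G a = a) (hb : G b = b)
    (hba : b ≤ a + 1) (hgap : ∀ y ∈ Ioo a b, y < G y) (hx : x ∈ Ioo a b) (hx' : x' ∈ Ioo a b) :
    TransitionEq G x x' := by
  refine isPreconnected_Ioo.induction₂ (TransitionEq G) (fun x hx => ?_)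
    (fun _ _ _ _ _ _ h h' => h.trans h') (fun _ _ _ _ h => h.symm) hx hx'
  filter_upwards [self_mem_nhdsWithin, nhdsWithin_le_nhds (gt_mem_nhds (hgap x hx)),
    nhdsWithin_le_nhds ((continuous_orderIso G).continuousAt.eventually
      (lt_mem_nhds (hgap x hx)))] with y hy h1 h2
  rcases le_total x y with h | h
  · exact transitionEq_of_le hG hv ha hb hba hx h h1.le
  · exact (transitionEq_of_le hG hv ha hb hba hy h h2.le).symm

lemma parabolic_of_ldVar (hG : G ∈ equivariant 1)
    (hv : Tendsto (fun n : ℕ => ldVar (G ^ n) / n) atTop (𝓝 0)) : Parabolic G := by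
  refine ⟨equivariant_le_unifDiffeo one_pos hG, fun x => deriv_eq_one_of_ldVar hG hv,
    fun a b ha hb hgap x hx x' hx' => ?_⟩
  have hba : b ≤ a + 1 := not_lt.1 fun h =>
    hgap (a + 1) ⟨lt_add_one a, h⟩ (by rw [hG.2, ha])
  rcases lt_or_gt_of_gap hgap with h | h
  · exact transitionEq_of_lt_map hG hv ha hb hba h hx hx'
  · rw [← inv_inv G]
    refine TransitionEq.inv (transitionEq_of_lt_map ((equivariant 1).inv_mem hG) ?_ (inv_fixed ha)
      (inv_fixed hb) hba (fun y hy => ?_) hx hx')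
    · refine squeeze_zero (fun n => div_nonneg (ldVar_nonneg _) n.cast_nonneg) (fun n => ?_)
        (by simpa using hv.const_mul 2)
      rw [← mul_div_assoc, inv_pow]
      exact div_le_div_of_nonneg_right (ldVar_inv_le ((equivariant 1).pow_mem hG n))
        n.cast_nonneg
    · have h1 := h _ (mem_Ioo_of_fixed (inv_fixed ha) (inv_fixed hb) hy)
      rwa [apply_inv_self] at h1

end Variation

section Lattice
variable {c ε s η x : ℝ} {r q : ℕ} {p : ℤ} {F Q : 𝓐} {k : ℤ → 𝓐}

lemma exists_mem_cell (c x : ℝ) : ∃ i : ℤ, x ∈ Ico (c + i) (c + i + 1) :=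
  ⟨⌊x - c⌋, by linarith [Int.floor_le (x - c)], by linarith [Int.lt_floor_add_one (x - c)]⟩

/-- Homeomorphisms of the cells of a lattice glue together. -/
lemma exists_glue (hl : ∀ i : ℤ, k i (c + i) = c + i)
    (hr : ∀ i : ℤ, k i (c + i + 1) = c + i + 1) :
    ∃ Q : 𝓐, ∀ i : ℤ, EqOn Q (k i) (Icc (c + i) (c + i + 1)) := by
  have hfl : ∀ (i : ℤ) x, x ∈ Ico (c + i) (c + i + 1) → ⌊x - c⌋ = i := fun i x hx =>
    Int.floor_eq_iff.2 ⟨by linarith [hx.1], by linarith [hx.2]⟩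
  refine ⟨StrictMono.orderIsoOfRightInverse (fun x => k ⌊x - c⌋ x) (fun x y hxy => ?_)
    (fun x => (k ⌊x - c⌋)⁻¹ x) fun x => ?_, fun i x hx => ?_⟩
  · obtain ⟨i, hi⟩ := exists_mem_cell c x
    obtain ⟨j, hj⟩ := exists_mem_cell c y
    simp only [hfl i x hi, hfl j y hj]
    rcases lt_or_ge i j with h | h
    · have h1 : (i : ℝ) + 1 ≤ j := by exact_mod_cast h
      have h2 := (k i).strictMono hi.2
      have h3 := (k j).monotone hj.1
      rw [hr] at h2
      rw [hl] at h3
      linarith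
    · have h1 : (j : ℝ) ≤ i := by exact_mod_cast h
      have h2 : i = j := by
        rw [← hfl i y ⟨hi.1.trans hxy.le, by linarith [hj.2]⟩, hfl j y hj]
      exact h2 ▸ (k i).strictMono hxy
  · obtain ⟨i, hi⟩ := exists_mem_cell c x
    have h1 := (k i)⁻¹.monotone hi.1
    have h2 := (k i)⁻¹.strictMono hi.2
    rw [inv_fixed (hl i)] at h1
    rw [inv_fixed (hr i)] at h2
    simp only [hfl i x hi, hfl i _ ⟨h1, h2⟩, apply_inv_self]
  · change k ⌊x - c⌋ x = k i x
    rcases hx.2.eq_or_lt with rfl | h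
    · have h1 : c + i + 1 = c + ((i + 1 : ℤ) : ℝ) := by push_cast; ring
      rw [hr, h1, hfl (i + 1) _ ⟨le_rfl, lt_add_one _⟩, hl]
    · rw [hfl i x ⟨hx.1, h⟩]

lemma isDiffeo_of_glue (hk : ∀ i : ℤ, k i ∈ supported (c + i) (c + i + 1))
    (hQ : ∀ i : ℤ, EqOn Q (k i) (Icc (c + i) (c + i + 1))) : IsDiffeo Q := by
  have h : ∀ x, ∃ g : 𝓐, IsDiffeo g ∧ (Q : ℝ → ℝ) =ᶠ[𝓝 x] g := fun x => by
    obtain ⟨i, hi⟩ := exists_mem_cell c x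
    have hc : c + ((i - 1 : ℤ) : ℝ) + 1 = c + i := by push_cast; ring
    refine ⟨k (i - 1) * k i, (hk _).1.mul (hk i).1, eventually_of_mem
      (Ioo_mem_nhds (show c + i - 1 < x by linarith [hi.1]) hi.2) fun y hy => ?_⟩
    rw [mul_apply]
    rcases le_total y (c + i) with h | h
    · rw [(hk i).2 y fun h' => h.not_gt h'.1, hQ (i - 1) ⟨by linarith [hy.1], by rwa [hc]⟩]
    · have h1 := (k i).monotone h
      rw [supported_left (hk i)] at h1
      rw [(hk (i - 1)).2 _ fun h' => (hc ▸ h'.2).not_ge h1, hQ i ⟨h, hy.2.le⟩]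
  refine ⟨contDiff_iff_contDiffAt.2 fun x => ?_, fun x => ?_⟩ <;> obtain ⟨g, hg, hgx⟩ := h x
  · exact hg.1.contDiffAt.congr_of_eventuallyEq hgx
  · exact hgx.deriv_eq ▸ hg.2 x

lemma exists_squeezeSystem (c : ℝ) (hη : 0 < η) (hη8 : η ≤ 1 / 8) :
    ∃ H : ℝ → 𝓐, SqueezeSystem (range fun i : ℤ => c + i) η H ∧
      (∀ κ, 0 < κ → H κ ∈ equivariant 1) ∧ ∀ κ x, H κ (x + 1) = H κ x + 1 := by
  have hfar : ∀ κ (i : ℤ) x, 1 / 2 ≤ |x - (c + i)| → pointSqueeze (c + i) η |κ| x = x :=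
    fun κ i x hx => pointSqueeze_far hη (abs_nonneg κ) (by linarith)
  have hends : ∀ i : ℤ, 1 / 2 ≤ |c - 1 / 2 + i - (c + i)| ∧
      1 / 2 ≤ |c - 1 / 2 + i + 1 - (c + i)| := fun i =>
    ⟨le_abs.2 (.inr (by linarith)), le_abs.2 (.inl (by linarith))⟩
  have hg := fun κ => exists_glue (c := c - 1 / 2)
    (k := fun i => pointSqueeze (c + i) η |κ|) (fun i => hfar κ i _ (hends i).1)
    fun i => hfar κ i _ (hends i).2
  choose H hH using hg
  have hadd : ∀ κ x, H κ (x + 1) = H κ x + 1 := fun κ x => by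
    obtain ⟨i, hi⟩ := exists_mem_cell (c - 1 / 2) x
    obtain ⟨y, rfl, -⟩ := exists_eq_affine (c + i) hη x
    rw [hH κ i (Ico_subset_Icc_self hi), hH κ (i + 1) (by
      push_cast
      constructor <;> linarith [hi.1, hi.2]), pointSqueeze_near hη,
      show c + i + η * y + 1 = c + (i + 1 : ℤ) + η * y by push_cast; ring, pointSqueeze_near hη]
    push_cast
    ring
  refine ⟨H, ⟨hη, ?_, fun κ hκ x hx => ?_⟩, fun κ hκ => ⟨isDiffeo_of_glue (fun i => ?_) (hH κ),
    hadd κ⟩, hadd⟩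
  · rintro κ hκ _ ⟨i, rfl⟩ y hy
    have h1 : |η * y| ≤ 1 / 2 := by
      rw [abs_mul, abs_of_pos hη]
      nlinarith
    rw [abs_le] at h1
    rw [hH κ i ⟨by linarith, by linarith⟩, abs_of_nonneg hκ]
    exact pointSqueeze_near hη y
  · obtain ⟨i, hi⟩ := exists_mem_cell (c - 1 / 2) x
    rw [hH κ i (Ico_subset_Icc_self hi)]
    exact pointSqueeze_far hη (abs_nonneg κ) (hx _ ⟨i, rfl⟩)
  · exact pointSqueeze_mem_supported hη (abs_pos.2 hκ.ne') (by linarith) (by linarith)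

end Lattice

section LatticeReduction
variable {a b c ε s t η x : ℝ} {r q : ℕ} {p : ℤ} {F G f : 𝓐}

/-- The translation by `s`. -/
abbrev shift (s : ℝ) : 𝓐 := OrderIso.addRight s

lemma shift_inv_apply (s x : ℝ) : (shift s)⁻¹ x = x - s := (sub_eq_add_neg x s).symm

lemma shift_mem_equivariant (s t : ℝ) : shift s ∈ equivariant t :=
  ⟨isDiffeo_addRight s, fun x => add_right_comm x t s⟩

lemma shift_conj_mem_supported (hf : f ∈ supported a b) :
    shift s * f * (shift s)⁻¹ ∈ supported (a + s) (b + s) := by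
  refine ⟨hf.1.conj (isDiffeo_addRight s), fun x hx => ?_⟩
  rw [mul_apply, mul_apply, shift_inv_apply, hf.2 (x - s) fun h =>
    hx ⟨by linarith [h.1], by linarith [h.2]⟩]
  exact sub_add_cancel x s

lemma map_add_int_mul (hf : ∀ x, f (x + s) = f x + t) (n : ℤ) (x : ℝ) :
    f (x + n * s) = f x + n * t := by
  simpa using AddConstMapClass.map_add_zsmul (⟨f, hf⟩ : AddConstMap ℝ ℝ s t) x n

lemma commute_shift (hf : ∀ x, f (x + 1) = f x + 1) (n : ℤ) : Commute f (shift n) :=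
  DFunLike.ext _ _ fun x => by simpa using map_add_int_mul hf n x

lemma exists_piece (hflat : ∀ i : ℤ, FlatAt (F * (shift p)⁻¹) (c + i))
    (hF : IsDiffeo F) (j : ℕ) (i : ℤ) : ∃ ρ ∈ supported (c + i) (c + i + 1),
      EqOn ρ (shift p ^ j * (F ^ j)⁻¹ : 𝓐) (Icc (c + i) (c + i + 1)) := by
  induction j generalizing i with
  | zero => exact ⟨1, one_mem _, fun x _ => by simp⟩
  | succ j ih =>
    have hi := hflat (i + 1)
    push_cast at hi
    rw [← add_assoc] at hi
    obtain ⟨ρ', h1, h2⟩ := exists_mem_supported_eqOn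
      (hF.mul (isDiffeo_addRight (p : ℝ)).inv) (hflat i) hi (lt_add_one _)
    obtain ⟨ρ, h3, h4⟩ := ih (i - p)
    have h5 := shift_conj_mem_supported (s := p) h3
    push_cast at h4 h5
    rw [show c + ((i : ℝ) - p) + p = c + i by ring,
      show c + ((i : ℝ) - p) + 1 + p = c + i + 1 by ring] at h5
    refine ⟨shift p * ρ * (shift p)⁻¹ * ρ'⁻¹, mul_mem h5 (inv_mem h1), fun x hx => ?_⟩
    have h6 := inv_mem h1
    have h7 : ρ'⁻¹ x ∈ Icc (c + i) (c + i + 1) :=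
      ⟨(supported_left h6).symm.trans_le (ρ'⁻¹.monotone hx.1),
        (ρ'⁻¹.monotone hx.2).trans_eq (supported_right h6)⟩
    have h8 : F⁻¹ x = ρ'⁻¹ x - p := F.injective (by
      rw [apply_inv_self, ← shift_inv_apply, ← mul_apply, ← h2 h7,
        apply_inv_self])
    simp only [pow_succ' _ j, mul_inv_rev, mul_apply, h8, shift_inv_apply]
    rw [h4 ⟨by linarith [h7.1], by linarith [h7.2]⟩]
    rfl

lemma reducible_of_smallOn (hF : IsDiffeo F) {𝓗 : Subgroup 𝓐} {h : 𝓐} (hh : h ∈ 𝓗)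
    (hd : IsDiffeo h) (hε : 0 < ε)
    (hs : ∀ i : ℤ, SmallOn r (ε / 2) (h * F * h⁻¹ * (shift s)⁻¹) (Ioo (c + i) (c + i + 1))) :
    Reducible 𝓗 (fun x => x + s) r ε F := by
  have hN := hF.conj hd
  have hM : IsDiffeo (h * F * h⁻¹ * (shift s)⁻¹) := hN.mul (isDiffeo_addRight s).inv
  refine ⟨h, hh, ε / 2, half_lt_self hε, fun k hk x => ?_⟩
  obtain ⟨i, hi⟩ := exists_mem_cell c (x + s)
  have h1 := (hs i).closure hM k hk (x + s) (by
    rw [closure_Ioo (lt_add_one _).ne]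
    exact Ico_subset_Icc_self hi)
  rw [iteratedDeriv_disp hM.1.contDiffAt, ← congrFun (iteratedDeriv_comp_add_const k _ s) x,
    ← congrFun (iteratedDeriv_comp_add_const k id s) x] at h1
  convert h1 using 4
  · funext y
    rw [mul_apply _ (shift s)⁻¹, shift_inv_apply, add_sub_cancel_right]
  · rfl

end LatticeReduction

section LatticeFlat
variable {a b c ε s t η x : ℝ} {r q : ℕ} {p u v : ℤ} {F G f : 𝓐}

lemma reducible_of_flat (hq : 0 < q) (hF : F ∈ equivariant q) (huv : u * p + v * q = 1)
    (hflat : ∀ i : ℤ, FlatAt (F * (shift p)⁻¹) (c + i))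
    (hG : Parabolic (F ^ q * (shift p ^ q)⁻¹))
    (hGflat : ∀ i : ℤ, FlatAt (F ^ q * (shift p ^ q)⁻¹) (c + i)) (hε : 0 < ε) :
    Reducible (equivariant q) (fun x => x + p) r ε F := by
  have hq' : (0 : ℤ) < q := Int.natCast_pos.2 hq
  set A : ℕ → 𝓐 := fun j => shift p ^ j * (F ^ j)⁻¹ with hA
  have hR : ∀ j, shift p ^ j ∈ equivariant q := pow_mem (shift_mem_equivariant p q)
  have hAm : ∀ j, A j ∈ equivariant q := fun j => mul_mem (hR j) (inv_mem (pow_mem hF j))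
  have hAF : ∀ j y, A (j + 1) (F y) = A j y + p := fun j y => by
    simp only [hA, pow_succ', mul_inv_rev, mul_apply, inv_apply_self]
    rfl
  set G := F ^ q * (shift p ^ q)⁻¹
  have hGm : G ∈ equivariant q := mul_mem (pow_mem hF q) (inv_mem (hR q))
  have hAG : A q = G⁻¹ := by rw [mul_inv_rev, inv_inv]
  have h0 := hGflat 0
  have h1 := hGflat 1
  push_cast at h0 h1
  rw [add_zero] at h0
  obtain ⟨h, hh, hs⟩ := hG.intervalReducible h0 h1 (lt_add_one c) (half_pos hε) (r := r)
  set J : ℤ → ℕ := fun i => (i * u % q).toNat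
  have hJ : ∀ i, (J i : ℤ) = i * u % q := fun i => Int.toNat_of_nonneg (Int.emod_nonneg _ hq'.ne')
  have hhs : ∀ i : ℤ, shift i * h * (shift i)⁻¹ ∈ supported (c + i) (c + i + 1) := fun i => by
    rw [add_right_comm]
    exact shift_conj_mem_supported hh
  have hk : ∀ i : ℤ, ∃ k ∈ supported (c + i) (c + i + 1),
      EqOn k (shift i * h * (shift i)⁻¹ * A (J i) : 𝓐) (Icc (c + i) (c + i + 1)) := fun i => by
    obtain ⟨ρ, h1, h2⟩ := exists_piece hflat hF.1 (J i) i
    exact ⟨_, mul_mem (hhs i) h1, fun x hx => by rw [mul_apply, h2 hx]; rfl⟩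
  choose k hks hkA using hk
  obtain ⟨Q, hQ⟩ := exists_glue (fun i => supported_left (hks i))
    fun i => supported_right (hks i)
  have hQA : ∀ (i : ℤ) x, x ∈ Icc (c + i) (c + i + 1) → Q x = h (A (J i) x - i) + i :=
    fun i x hx => by
      rw [hQ i hx, hkA i hx, mul_apply, mul_apply, mul_apply, shift_inv_apply]
      rfl
  have hQd := isDiffeo_of_glue hks hQ
  have hQm : Q ∈ equivariant q := ⟨hQd, fun x => by
    obtain ⟨i, hi⟩ := exists_mem_cell c x
    have h1 : J (i + q) = J i := by simp only [J, add_mul, mul_comm (q : ℤ), Int.add_mul_emod_self_right]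
    rw [hQA i x (Ico_subset_Icc_self hi), hQA (i + q) (x + q) (by
      push_cast
      constructor <;> linarith [hi.1, hi.2]), h1, (hAm _).2]
    push_cast
    rw [add_sub_add_right_eq_sub, add_assoc]⟩
  refine reducible_of_smallOn (c := c) hF.1 hQm hQd hε fun i => ?_
  have hcell : ∀ x ∈ Ioo (c + i) (c + i + 1), ∃ w, (Q * F * Q⁻¹ * (shift p)⁻¹) x =
      h (A (J i) (F w) - i) + i ∧ h (A (J (i - p)) w + p - i) + i = x := fun x hx => by
    set w := Q⁻¹ ((shift p)⁻¹ x) with hw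
    have h1 : ∀ j : ℤ, Q (c + j) = c + j := fun j => by
      rw [hQ j ⟨le_rfl, (lt_add_one _).le⟩, supported_left (hks j)]
    have h2 : ∀ j : ℤ, F (c + j - p) = c + j := fun j => by
      rw [← shift_inv_apply]
      exact (hflat j).map_self
    have h3 : Q w = x - p := by rw [hw, apply_inv_self, shift_inv_apply]
    have h4 := h1 (i - p)
    have h5 := h1 (i - p + 1)
    have h6 := h2 (i + 1)
    push_cast at h4 h5 h6
    have h7 : c + ((i : ℝ) - p) ≤ w := Q.le_iff_le.1 (by rw [h3, h4]; linarith [hx.1])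
    have h8 : w ≤ c + ((i : ℝ) - p + 1) := Q.le_iff_le.1 (by rw [h3, h5]; linarith [hx.2])
    have h9 := F.monotone (show c + i - p ≤ w by linarith)
    have h10 := F.monotone (show w ≤ c + (i + 1) - p by linarith)
    rw [h2] at h9
    rw [h6] at h10
    refine ⟨w, hQA i (F w) ⟨h9, by linarith⟩, ?_⟩
    rw [hQA (i - p) w (by push_cast; exact ⟨h7, by linarith⟩)] at h3
    push_cast at h3
    rw [show A (J (i - p)) w + p - i = A (J (i - p)) w - (i - p) by ring]
    linarith
  have hJp : (J i : ℤ) = (J (i - p) + 1 : ℤ) % q := by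
    rw [hJ, hJ, Int.emod_add_emod, show (i - p) * u + 1 = i * u + q * v by linear_combination -huv,
      Int.add_mul_emod_self_left]
  have hJq := hJ (i - p) ▸ Int.emod_lt_of_pos ((i - p) * u) hq'
  rcases (show J (i - p) + 1 ≤ q by omega).lt_or_eq with hlt | heq
  · have h1 : J i = J (i - p) + 1 := by
      rw [Int.emod_eq_of_lt (by omega) (by omega)] at hJp
      omega
    refine SmallOn.congr (G := 1) (fun k _ x _ => ?_) isOpen_Ioo fun x hx => ?_
    · rw [flatAt_of_eventuallyEq (.of_forall one_orderIso_apply) k, abs_zero]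
      exact (half_pos hε).le
    · obtain ⟨w, h2, h3⟩ := hcell x hx
      rw [h2, h1, hAF, h3, one_orderIso_apply]
  · have h1 : J i = 0 := by
      have : (J (i - p) : ℤ) + 1 = q := by exact_mod_cast heq
      rw [this, Int.emod_self] at hJp
      omega
    have hdvd : (q : ℤ) ∣ i := by
      have h2 := Int.dvd_of_emod_eq_zero ((hJ i).symm.trans (by rw [h1]; rfl))
      rw [show i = i * u * p + q * (v * i) by linear_combination -i * huv]
      exact dvd_add (h2.mul_right p) (dvd_mul_right _ _)
    obtain ⟨n, hn⟩ := hdvd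
    have hGi : ∀ z, G (z - i) = G z - i := fun z => by
      have := map_add_int_mul hGm.2 n (z - i)
      rw [show (n : ℝ) * q = i by rw [hn, mul_comm]; push_cast; rfl, sub_add_cancel] at this
      linarith
    refine SmallOn.congr (G := shift i * (h * G * h⁻¹) * (shift i)⁻¹) (fun k hk x hx => ?_)
      isOpen_Ioo fun x hx => ?_
    · rw [show disp (shift i * (h * G * h⁻¹) * (shift i)⁻¹) = fun y => disp (h * G * h⁻¹) (y + -i) from
        funext fun y => show (h * G * h⁻¹) (y + -i) + i - y = (h * G * h⁻¹) (y + -i) - (y + -i) by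
          ring, iteratedDeriv_comp_add_const]
      exact hs k hk _ ⟨by linarith [hx.1], by linarith [hx.2]⟩
    · obtain ⟨w, h2, h3⟩ := hcell x hx
      have h4 : F w = G (A (J (i - p)) w + p) := by
        rw [← hAF, heq, hAG, apply_inv_self]
      have h5 : h⁻¹ (x - i) = A (J (i - p)) w + p - i := by
        rw [← h3, add_sub_cancel_right, inv_apply_self]
      rw [h2, h1, show A 0 = 1 by simp [hA], one_orderIso_apply, h4, ← hGi, ← h5]
      rfl

end LatticeFlat

section LatticeParabolic
variable {c ε : ℝ} {r q : ℕ} {p u v : ℤ} {F : 𝓐}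

lemma reducible_of_lattice (hq : 0 < q) (hF : F ∈ equivariant q) (huv : u * p + v * q = 1)
    (hfix : ∀ i : ℤ, F (c + i) = c + i + p) (hd : ∀ i : ℤ, deriv F (c + i) = 1)
    (hG : Parabolic (F ^ q * (shift p ^ q)⁻¹)) (hε : 0 < ε) :
    Reducible (equivariant q) (fun x => x + p) r ε F := by
  have hqu := equivariant_le_unifDiffeo (Nat.cast_pos.2 hq)
  have hRm : ∀ t, shift p ∈ equivariant t := shift_mem_equivariant p
  have hle : equivariant 1 ≤ equivariant q := fun h hh =>
    ⟨hh.1, fun x => by simpa using map_add_int_mul hh.2 q x⟩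
  set Φ := F * (shift p)⁻¹ with hΦ
  set G := F ^ q * (shift p ^ q)⁻¹ with hGdef
  have hΦu : Φ ∈ unifDiffeo := hqu (mul_mem hF (inv_mem (hRm q)))
  have hΦf : ∀ i : ℤ, Φ (c + i) = c + i ∧ deriv Φ (c + i) = 1 := fun i => by
    have h2 : c + i - p = c + (i - p : ℤ) := by push_cast; ring
    change F (c + i - p) = c + i ∧ deriv (fun x => F (x - p)) (c + i) = 1
    rw [deriv_comp_sub_const, h2, hd, hfix]
    exact ⟨by push_cast; ring, rfl⟩
  have hpow : ∀ (n : ℕ) (i : ℤ), (F ^ n * (shift p ^ n)⁻¹) (c + i) = c + i := fun n => by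
    induction n with
    | zero => simp
    | succ n ih =>
      intro i
      have h1 := ih (i - p)
      have h2 := hfix (i - p)
      push_cast at h1 h2
      have h3 : (shift p ^ (n + 1))⁻¹ (c + i) = (shift p ^ n)⁻¹ (c + ((i : ℝ) - p)) := by
        rw [pow_succ', mul_inv_rev, mul_apply, shift_inv_apply, add_sub_assoc]
      rw [mul_apply] at h1
      rw [mul_apply, h3, pow_succ', mul_apply, h1, h2]
      ring
  obtain ⟨η₁, h1, -, hΦη⟩ := exists_flattenableAt hΦu
  obtain ⟨η₂, h2, -, hGη⟩ := exists_flattenableAt hG.mem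
  set η := min (min η₁ η₂) (1 / 8)
  have hη : 0 < η := lt_min (lt_min h1 h2) (by norm_num)
  have hη1 : η ≤ 1 := (min_le_right _ _).trans (by norm_num)
  obtain ⟨H, hS, hHm, hadd⟩ := exists_squeezeSystem c hη (min_le_right _ _)
  have hΦfl : ∀ z ∈ range fun i : ℤ => c + i, FlattenableAt z η Φ := by
    rintro _ ⟨i, rfl⟩
    exact hΦη _ η (hΦf i).1 (hΦf i).2 hη ((min_le_left _ _).trans (min_le_left _ _))
  have hGfl : ∀ z ∈ range fun i : ℤ => c + i, FlattenableAt z η G := by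
    rintro _ ⟨i, rfl⟩
    exact hGη _ η (hpow q i) (hG.deriv_fixed _ (hpow q i)) hη
      ((min_le_left _ _).trans (min_le_right _ _))
  have hHu : ∀ κ, 0 < κ → H κ ∈ unifDiffeo := fun κ hκ =>
    equivariant_le_unifDiffeo one_pos (hHm κ hκ)
  have hdeg := (hS.degenerates hη1 (equivariant_le_unifDiffeo one_pos) hHm hΦfl hΦu).mul_commute
    (equivariant_le_unifDiffeo one_pos) hΦu.1 (hqu (hRm q)) fun h hh => commute_shift hh.2 p
  have hc := commute_shift (hadd 0)
  have e1 : (H 0)⁻¹ * Φ * H 0 = (H 0)⁻¹ * F * H 0 * (shift p)⁻¹ := by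
    rw [hΦ, mul_assoc _ (H 0), (hc p).inv_right.eq]
    group
  have e2 : (H 0)⁻¹ * G * H 0 = ((H 0)⁻¹ * F * H 0) ^ q * (shift p ^ q)⁻¹ := by
    have h3 := conj_pow (a := (H 0)⁻¹) (b := F) (i := q)
    rw [inv_inv] at h3
    rw [hGdef, h3, mul_assoc _ (H 0), ((hc p).pow_right q).inv_right.eq]
    group
  rw [hΦ, inv_mul_cancel_right, ← hΦ, e1, inv_mul_cancel_right] at hdeg
  have hF2 := hdeg.mem_unifDiffeo (equivariant_le_unifDiffeo one_pos) hF.1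
  refine (hdeg.mono hle).reducible hqu hF.1 (reducible_of_flat (c := c) hq ⟨hF2.1, ?_⟩ huv
    (fun i => e1 ▸ hS.flatAt hη1 hHu hΦfl hΦu ⟨i, rfl⟩) (e2 ▸ hS.parabolic hη1 hHu hGfl hG)
    (fun i => e2 ▸ hS.flatAt hη1 hHu hGfl hG.mem ⟨i, rfl⟩) hε)
  have hFc : Commute F (shift q) := DFunLike.ext _ _ hF.2
  have hcq := hc q
  rw [Int.cast_natCast] at hcq
  exact DFunLike.congr_fun ((hcq.inv_left.mul_left hFc).mul_left hcq)

end LatticeParabolic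

section Averaging
variable {ε x₀ : ℝ} {r q : ℕ} {p u v : ℤ} {F S : 𝓐}

lemma exists_average (hF : F ∈ equivariant 1) (n : ℕ) : ∃ S : 𝓐, IsDiffeo S ∧
    (∀ x, S (x + 1) = S x + (n + 1 : ℕ)) ∧ ∀ x, S (F x) = S x + ((F ^ (n + 1)) x - x) := by
  induction n with
  | zero => exact ⟨1, isDiffeo_one, by simp, by simp⟩
  | succ n ih =>
    obtain ⟨S, hS, h1, h2⟩ := ih
    have hn := pow_mem hF (n + 1)
    have hc := fun f : 𝓐 => continuous_orderIso f
    refine ⟨(S.strictMono.add (F ^ (n + 1)).strictMono).orderIsoOfSurjective _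
      (((hc S).add (hc _)).surjective
        (S.tendsto_atTop.atTop_add_atTop (F ^ (n + 1)).tendsto_atTop)
        (S.tendsto_atBot.atBot_add_atBot (F ^ (n + 1)).tendsto_atBot)),
      ⟨hS.1.add hn.1.1, fun x => ?_⟩, fun x => ?_, fun x => ?_⟩
    · change 0 < deriv (fun x => S x + (F ^ (n + 1)) x) x
      rw [deriv_fun_add hS.differentiable.differentiableAt hn.1.differentiable.differentiableAt]
      exact add_pos (hS.2 x) (hn.1.2 x)
    · change S (x + 1) + (F ^ (n + 1)) (x + 1) = S x + (F ^ (n + 1)) x + _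
      rw [h1, hn.2]
      push_cast
      ring
    · change S (F x) + (F ^ (n + 1)) (F x) = S x + (F ^ (n + 1)) x + _
      rw [h2, pow_succ _ (n + 1), mul_apply]
      ring

lemma shift_pow_apply (s x : ℝ) (n : ℕ) : (shift s ^ n) x = x + s * n := by
  rw [coe_pow_orderIso]
  induction n with
  | zero => simp
  | succ n ih =>
    rw [Function.iterate_succ_apply', ih]
    change x + s * n + s = _
    push_cast
    ring

lemma Parabolic.conj {G : 𝓐} (hG : Parabolic G) (hS : S ∈ unifDiffeo) :
    Parabolic (S * G * S⁻¹) := by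
  have hS' := hS.1.inv
  have hu : S * G * S⁻¹ ∈ unifDiffeo := mul_mem (mul_mem hS hG.mem) (inv_mem hS)
  have hc : ∀ w, ContinuousAt (ld S⁻¹) w := fun w => hS'.contDiff_ld.continuous.continuousAt
  have hsc : ∀ u, S⁻¹ ((S * G * S⁻¹) u) = G (S⁻¹ u) := fun u => by
    simp only [mul_apply, inv_apply_self]
  refine hG.of_semiconj hu hsc (fun x hx => ?_) fun a b _ _ _ =>
    ⟨fun u _ => hS'.2 u, .inl (hc a), .inl (hc b)⟩
  have h := ld_semiconj hG.mem.1 hu.1 (.of_forall hsc) (hS'.2 x) (hS'.2 _)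
  have h2 := hsc x
  rw [hx] at h h2
  have h3 : ld G (S⁻¹ x) = 0 := by rw [ld, hG.deriv_fixed _ h2.symm, log_one]
  rw [← hu.1.exp_ld, show ld (S * G * S⁻¹) x = 0 by linarith, exp_zero]

lemma exists_conj_near_shift (hq : 0 < q) (hF : F ∈ equivariant 1) (huv : u * p + v * q = 1)
    (hx₀ : (F ^ q) x₀ = x₀ + p) (hG : Parabolic (F ^ q * (shift p)⁻¹)) (hε : 0 < ε) :
    ∃ K : 𝓐, IsDiffeo K ∧ (∀ x, K (x + 1) = K x + q) ∧
      Reducible ⊥ (fun x => x + p) r ε (K * F * K⁻¹) := by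
  obtain ⟨n, rfl⟩ := Nat.exists_eq_succ_of_ne_zero hq.ne'
  obtain ⟨S, hS, hS1, hSF⟩ := exists_average hF n
  set q := n + 1
  have hSu : S ∈ unifDiffeo := mem_unifDiffeo_of_periodic hS one_pos fun x => by
    rw [ld, ← deriv_comp_add_const, funext hS1, deriv_add_const, ld]
  have hSn := map_add_int_mul hS1
  have hFn := map_add_int_mul (pow_mem hF q).2
  have hSp : S * shift p = shift p ^ q * S := DFunLike.ext _ _ fun x => by
    rw [mul_apply, mul_apply, shift_pow_apply, ← hSn, mul_one]
    rfl
  set F' := S * F * S⁻¹ with hF'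
  have hF'm : F' ∈ equivariant q := by
    have hc : S⁻¹ * shift q * S = shift 1 := DFunLike.ext _ _ fun x =>
      S.injective (by simpa using (hS1 x).symm)
    refine ⟨hF.1.conj hS, DFunLike.congr_fun (f := F' * shift q) (g := shift q * F') ?_⟩
    have h1 : Commute F (shift 1) := by simpa using commute_shift hF.2 1
    rw [← hc] at h1
    have h2 := congrArg (fun g => S * g * S⁻¹) h1.eq
    simpa [hF', mul_assoc] using h2
  have hG' : S * (F ^ q * (shift p)⁻¹) * S⁻¹ = F' ^ q * (shift p ^ q)⁻¹ := by
    rw [hF', conj_pow, ← mul_inv_eq_iff_eq_mul.2 hSp]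
    group
  have hF'S : ∀ z, F' (S z) = S (F z) := fun z => by
    simp only [hF', mul_apply, inv_apply_self]
  have hfix : ∀ z, (F ^ q) z = z + p → F' (S z) = S z + p ∧ deriv F' (S z) = 1 := fun z hz => by
    refine ⟨by rw [hF'S, hSF, hz, add_sub_cancel_left], ?_⟩
    have h1 : (F' : ℝ → ℝ) = fun y => y + ((F ^ q) (S⁻¹ y) - S⁻¹ y) := funext fun y => by
      obtain ⟨z, rfl⟩ := S.surjective y
      rw [hF'S, hSF, inv_apply_self]
    have h2 := hS.inv.differentiable.differentiableAt.hasDerivAt (x := S z)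
    have h3 : HasDerivAt (F ^ q : 𝓐) 1 (S⁻¹ (S z)) := by
      have h4 : ∀ y, (F ^ q) y = (F ^ q * (shift p)⁻¹) (y + p) := fun y => by
        rw [mul_apply, shift_inv_apply, add_sub_cancel_right]
      have h5 := hG.mem.1.differentiable.differentiableAt.hasDerivAt (x := z + p)
      rw [hG.deriv_fixed _ (by rw [← h4, hz])] at h5
      rw [inv_apply_self, funext h4]
      exact h5.comp_add_const z p
    rw [h1]
    exact (((hasDerivAt_id _).add ((h3.comp _ h2).sub h2)).congr_deriv (by ring)).deriv
  have hm : ∀ m : ℕ, (F ^ q) ((F ^ m) x₀) = (F ^ m) x₀ + p ∧ S ((F ^ m) x₀) = S x₀ + m * p := by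
    intro m
    induction m with
    | zero => simpa using hx₀
    | succ m ih =>
      rw [pow_succ' _ m, mul_apply]
      refine ⟨?_, by rw [hSF, ih.1, ih.2]; push_cast; ring⟩
      rw [← mul_apply, ((Commute.refl F).pow_left q).eq, mul_apply, ih.1]
      simpa using map_add_int_mul hF.2 p ((F ^ m) x₀)
  have hi : ∀ i : ℤ, ∃ z, (F ^ q) z = z + p ∧ S z = S x₀ + i := fun i => by
    have h0 : (q : ℤ) ≠ 0 := by positivity
    obtain ⟨m, hm'⟩ := Int.eq_ofNat_of_zero_le (Int.emod_nonneg (i * u) h0)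
    set l := i * u / q * p + i * v
    have h1 : (m : ℤ) * p + l * q = i := by
      linear_combination i * huv - p * hm' + p * Int.emod_add_mul_ediv (i * u) q
    refine ⟨(F ^ m) x₀ + l, ?_, ?_⟩
    · have h2 := hFn l ((F ^ m) x₀)
      rw [mul_one] at h2
      rw [h2, (hm m).1]
      ring
    · have h2 := hSn l ((F ^ m) x₀)
      rw [mul_one] at h2
      rw [h2, (hm m).2, ← h1]
      push_cast
      ring
  have hred := reducible_of_lattice hq hF'm huv (c := S x₀) (fun i => ?_) (fun i => ?_)
    (hG' ▸ hG.conj hSu) hε (r := r)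
  · obtain ⟨h, hh, hb⟩ := hred
    refine ⟨h * S, hh.1.mul hS, fun x => ?_, 1, one_mem _, ?_⟩
    · rw [mul_apply, hS1, hh.2]
      rfl
    · simpa [hF', mul_assoc] using hb
  · obtain ⟨z, h1, h2⟩ := hi i
    exact h2 ▸ (hfix z h1).1
  · obtain ⟨z, h1, h2⟩ := hi i
    exact h2 ▸ (hfix z h1).2

end Averaging

section CircleReduction
variable {ε x₀ : ℝ} {r q : ℕ} {p : ℤ} {F : 𝓐}

lemma exists_coprime_period (hF : F ∈ equivariant 1) (hq : 0 < q)
    (hx₀ : (F ^ q) x₀ = x₀ + p) : ∃ (q : ℕ) (p u v : ℤ), 0 < q ∧ u * p + v * q = 1 ∧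
      (F ^ q) x₀ = x₀ + p := by
  obtain ⟨p', hp'⟩ := Int.gcd_dvd_left p q
  obtain ⟨q', hq'⟩ := Int.natCast_dvd_natCast.1 (Int.gcd_dvd_right p q)
  have hd : 0 < Int.gcd p q := Int.gcd_pos_of_ne_zero_right _ (by positivity)
  have hb := Int.gcd_eq_gcd_ab p q
  set d := Int.gcd p q
  refine ⟨q', p', p.gcdA q, p.gcdB q, pos_of_mul_pos_right (hq' ▸ hq) d.zero_le, ?_, ?_⟩
  · have h1 : (q : ℤ) = d * q' := by exact_mod_cast hq'
    refine mul_left_cancel₀ (Int.natCast_ne_zero.2 hd.ne') ?_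
    linear_combination - hb - p.gcdA q * hp' - p.gcdB q * h1
  · have hc : Function.Commute (F ^ q' : 𝓐) (shift p') := fun x => by
      simpa using map_add_int_mul (pow_mem hF q').2 p' x
    refine (hc.iterate_pos_eq_iff_map_eq (F ^ q').monotone (shift p').strictMono hd).1 ?_
    rw [← coe_pow_orderIso, ← coe_pow_orderIso, ← pow_mul, mul_comm, ← hq', hx₀, shift_pow_apply,
      mul_comm]
    conv_lhs => rw [hp']
    push_cast
    rfl

lemma parabolic_pow_mul_shift (hF : F ∈ equivariant 1) (hq : 0 < q)
    (hv : Tendsto (fun n : ℕ => ldVar (F ^ n) / n) atTop (𝓝 0)) :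
    Parabolic (F ^ q * (shift p)⁻¹) := by
  have hc : Commute (shift (-p)) (F ^ q) :=
    (by simpa using commute_shift (pow_mem hF q).2 (-p) : Commute (F ^ q) (shift (-p))).symm
  have he : F ^ q * (shift p)⁻¹ = shift (-p) * F ^ q := by
    rw [hc.eq]
    exact congrArg _ (DFunLike.ext _ _ fun x => shift_inv_apply p x)
  refine he ▸ parabolic_of_ldVar (mul_mem (shift_mem_equivariant _ _) (pow_mem hF q)) ?_
  have hl : ∀ n, ldVar ((shift (-p) * F ^ q) ^ n) = ldVar (F ^ (q * n)) := fun n => by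
    have h1 : ((shift (-p) * F ^ q) ^ n : 𝓐) = fun x => (F ^ (q * n)) x + -p * n :=
      funext fun x => by rw [hc.mul_pow, mul_apply, shift_pow_apply, ← pow_mul]
    rw [ldVar, ldVar, show ld ((shift (-p) * F ^ q) ^ n) = ld (F ^ (q * n)) from funext fun x => by
      rw [ld, h1, deriv_add_const, ld]]
  have h2 := (hv.comp (tendsto_id.const_mul_atTop' hq)).const_mul (q : ℝ)
  rw [mul_zero] at h2
  refine h2.congr fun n => ?_
  have h3 : (q : ℝ) ≠ 0 := by positivity
  simp only [Function.comp_apply, id, hl]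
  push_cast
  field_simp

lemma exists_isDiffeo_conj (hF : F ∈ equivariant 1) (hq : 0 < q) (hx₀ : (F ^ q) x₀ = x₀ + p)
    (hv : Tendsto (fun n : ℕ => ldVar (F ^ n) / n) atTop (𝓝 0)) (r : ℕ) (hε : 0 < ε) :
    ∃ (K : 𝓐) (q : ℝ) (p : ℤ), IsDiffeo K ∧ 0 < q ∧ (∀ x, K (x + 1) = K x + q) ∧
      ∀ k ≤ r, ∀ x, |iteratedDeriv k (fun y => q⁻¹ * (K * F * K⁻¹ : 𝓐) (q * y)) x -
        iteratedDeriv k (fun y => y + p / q) x| < ε := by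
  obtain ⟨q, p, u, v, hq, huv, hx₀⟩ := exists_coprime_period hF hq hx₀
  have hq' : (0 : ℝ) < q := Nat.cast_pos.2 hq
  obtain ⟨K, hK, hK1, h, h1, ε', hε', hb⟩ := exists_conj_near_shift hq hF huv hx₀
    (parabolic_pow_mul_shift hF hq hv) (r := r) (ε := ε / q ^ r) (by positivity)
  rw [Subgroup.mem_bot] at h1
  rw [h1, one_mul, inv_one, mul_one] at hb
  refine ⟨K, q, p, hK, hq', hK1, fun k hk x => ?_⟩
  have h2 : ∀ f : ℝ → ℝ, ContDiff ℝ ∞ f → iteratedDeriv k (fun y => (q : ℝ)⁻¹ * f (q * y)) x =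
      (q : ℝ)⁻¹ * (q ^ k * iteratedDeriv k f (q * x)) := fun f hf => by
    rw [iteratedDeriv_const_mul_field, iteratedDeriv_comp_const_mul (hf.of_le (natCast_le_infty k))]
  have h3 : (fun y => y + p / q : ℝ → ℝ) = fun y => (q : ℝ)⁻¹ * (q * y + p) := by
    funext y
    field_simp
  rw [h3, h2 _ (hF.1.conj hK).1, h2 (· + (p : ℝ)) (contDiff_id.add contDiff_const), ← mul_sub, ← mul_sub,
    abs_mul, abs_mul, abs_of_pos (inv_pos.2 hq'), abs_of_pos (pow_pos hq' k)]
  have h4 : (1 : ℝ) ≤ q := Nat.one_le_cast.2 hq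
  calc _ ≤ 1 * (q ^ r * ε') := by
        gcongr
        · exact inv_le_one_of_one_le₀ h4
        · exact hb k hk _
    _ < ε := by rwa [one_mul, ← lt_div_iff₀' (by positivity)]

end CircleReduction

/-- Theorem A for the circle: a smooth circle diffeomorphism with a periodic orbit and
vanishing asymptotic variation is almost reducible: it has conjugates arbitrarily close
to rotations. -/
theorem almostReducible_of_periodic_of_asympVar_vanishes (F : CircleLift)
    (hper : ∃ (x₀ : ℝ) (p : ℤ) (q : ℕ), 1 ≤ q ∧ F.toFun^[q] x₀ = x₀ + p)
    (hvar : Tendsto (fun n : ℕ =>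
        (eVariationOn (fun x => Real.log (deriv (F.toFun^[n]) x)) (Set.Icc 0 1)).toReal
          / n)
      atTop (nhds 0)) :
    ∀ r : ℕ, ∀ ε > (0 : ℝ), ∃ (H : CircleLift) (α : ℝ),
      ∀ k ≤ r, ∀ x ∈ Set.Icc (0 : ℝ) 1,
        |iteratedDeriv k (H.toFun ∘ F.toFun ∘ H.invFun) x
          - iteratedDeriv k (fun y => y + α) x| < ε := by
  intro r ε hε
  obtain ⟨x₀, p, q, hq, hx₀⟩ := hper
  let f : ℝ ≃o ℝ := F.mono.orderIsoOfRightInverse F.toFun F.invFun F.right_inv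
  have hf : f ∈ equivariant 1 := by
    refine ⟨⟨F.smooth, fun x => F.mono.monotone.deriv_nonneg.lt_of_ne' fun h => ?_⟩, F.lift⟩
    have h1 := (F.smooth_inv.differentiable (by simp) _).hasDerivAt.comp x
      (F.smooth.differentiable (by simp) x).hasDerivAt
    rw [F.left_inv.comp_eq_id, h, mul_zero] at h1
    exact one_ne_zero ((hasDerivAt_id x).unique h1)
  obtain ⟨K, q, p, hK, hq, hK1, hb⟩ := exists_isDiffeo_conj hf hq
    (by rw [coe_pow_orderIso]; exact hx₀)
    (hvar.congr fun n => by
      rw [ldVar, show ld (f ^ n) = _ from funext fun x => by rw [ld, coe_pow_orderIso]]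
      rfl) r hε
  refine ⟨⟨fun x => q⁻¹ * K x, fun y => K⁻¹ (q * y), contDiff_const.mul hK.1,
    hK.inv.1.comp (contDiff_const.mul contDiff_id), fun x => ?_, fun y => ?_,
    K.strictMono.const_mul (inv_pos.2 hq), fun x => ?_⟩, p / q, fun k hk x _ => hb k hk x⟩
  · beta_reduce
    rw [mul_inv_cancel_left₀ hq.ne', inv_apply_self]
  · beta_reduce
    rw [apply_inv_self, inv_mul_cancel_left₀ hq.ne']
  · rw [hK1, mul_add, inv_mul_cancel₀ hq.ne']
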